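/- Let n ≥ 6, let G be a proper transitive subgroup of S_n contained in the alternating group A_n, and assume that n is not of the form m² or m²+1 for any odd positive integer m. Let d = [S_n : G] be the index of G in S_n. Then for every ε > 0 there is a constant c(n,ε) such that for all X ≥ 2, F_n(X;G) ≤ c(n,ε) · X^{E+ε}, where E = (n+2)/4 − 1 − 1/(2n−2) + √(n/(4(n−1)d)) + n/(4n−4). -/

import Mathlib

open Polynomial

noncomputable section

/-- A fixed algebraic closure of `ℚ`. -/
abbrev Qbar : Type := AlgebraicClosure ℚ

/-- The discriminant of a subfield of `ℚ̄` (zero if it is not a number field). -/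
def fieldDiscr (K : IntermediateField ℚ Qbar) : ℤ := by
  by_cases h : FiniteDimensional ℚ K
  · exact @NumberField.discr K _ ⟨⟩
  · exact 0

/-- The action of `Gal(ℚ̄/ℚ)` on the embeddings of `K` into `ℚ̄`; its image is the
Galois group of the Galois closure of `K`, acting on the embeddings of `K`. -/
def galAct (K : IntermediateField ℚ Qbar) :
    (Qbar ≃ₐ[ℚ] Qbar) →* Equiv.Perm (K →ₐ[ℚ] Qbar) where
  toFun σ :=
    { toFun := fun ι => σ.toAlgHom.comp ι
      invFun := fun ι => σ.symm.toAlgHom.comp ι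
      left_inv := fun ι => by ext x; simp
      right_inv := fun ι => by ext x; simp }
  map_one' := by
    apply Equiv.ext; intro ι; ext x; simp
  map_mul' := fun σ τ => by
    apply Equiv.ext; intro ι; ext x; simp

/-- `K` has Galois group (of its Galois closure, acting on the `n` embeddings of `K` in `ℚ̄`)
equal to `G`, up to conjugacy; this is encoded by an identification of the embeddings
with `Fin n` under which the image of the Galois action is exactly `G`. -/
def HasGalGroup (n : ℕ) (K : IntermediateField ℚ Qbar)
    (G : Subgroup (Equiv.Perm (Fin n))) : Prop :=
  ∃ e : (K →ₐ[ℚ] Qbar) ≃ Fin n, ∀ σ : Equiv.Perm (Fin n),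
    σ ∈ G ↔ ∃ g : Qbar ≃ₐ[ℚ] Qbar, Equiv.permCongr e (galAct K g) = σ

/-- The number of number fields of degree `n`, absolute discriminant at most `X`,
and Galois group (as a permutation group on the embeddings) conjugate to `G`. -/
def FnG (n : ℕ) (X : ℝ) (G : Subgroup (Equiv.Perm (Fin n))) : ℕ :=
  Nat.card {K : IntermediateField ℚ Qbar //
    Module.finrank ℚ K = n ∧ |(fieldDiscr K : ℝ)| ≤ X ∧ HasGalGroup n K G}

/-- The number of number fields of degree `n` and absolute discriminant at most `X`. -/
def FnAll (n : ℕ) (X : ℝ) : ℕ :=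
  Nat.card {K : IntermediateField ℚ Qbar //
    Module.finrank ℚ K = n ∧ |(fieldDiscr K : ℝ)| ≤ X}

/-- A subgroup of the permutations of `β` is transitive. -/
def IsTransitiveSub {β : Type*} (G : Subgroup (Equiv.Perm β)) : Prop :=
  ∀ x y : β, ∃ σ ∈ G, σ x = y

/-- `G` admits a nontrivial block system: a partition of `β` into `k ≥ 2` nonempty parts,
some part having at least two elements, whose parts are permuted by every element of `G`. -/
def HasBlockSystem {β : Type*} (G : Subgroup (Equiv.Perm β)) : Prop :=
  ∃ (k : ℕ) (R : Fin k → Set β), 2 ≤ k ∧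
    (∀ j, (R j).Nonempty) ∧
    (∃ j, 2 ≤ Nat.card (R j)) ∧
    (∀ x : β, ∃! j, x ∈ R j) ∧
    (∀ σ ∈ G, ∀ i, ∃ j, (fun x => σ x) '' R i = R j)

/-- An imprimitive permutation group: transitive with a nontrivial block system. -/
def IsImprimitiveSub {β : Type*} (G : Subgroup (Equiv.Perm β)) : Prop :=
  IsTransitiveSub G ∧ HasBlockSystem G

/-- A primitive permutation group: transitive with no nontrivial block system. -/
def IsPrimitiveSub {β : Type*} (G : Subgroup (Equiv.Perm β)) : Prop :=
  IsTransitiveSub G ∧ ¬ HasBlockSystem G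

end

open Finset (range prod_pow prod_le_prod' card_range prod_mul_distrib card_univ prod_const univ
  mem_coe mem_univ mem_range prod_dvd_of_coprime sum_sub_distrib abs_sum_le_sum_abs sum_le_sum
  sum_add_distrib sum_congr prod_pow_eq_pow_sum univ_unique sum_range_succ' prod_pos sum_mul
  sum_le_card_nsmul card_le_card card_image_of_injOn mem_image card_le_mul_card_image mem_filter
  sum_range_succ sum_const single_le_sum sum_nonneg filter_subset mem_image_of_mem prod_le_pow_card
  image_image card_le_univ Ico mem_Ico card_image_le coe_Ico card_empty mem_biUnion
  card_biUnion_le_card_mul card_union_le card_val prod_congr mul_prod_erase mem_erase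
  prod_eq_zero_iff prod_eq_zero prod_insert mul_sum sum_eq_zero Ioi Iio prod_nonneg sum_ite_eq'
  sum_ite_eq Icc mem_Icc card_le_card_of_injOn card_eq_sum_card_image sum_comm prod_filter)
open Module (finrank finrank_pos finrank_mul_finrank)
open Equiv (Perm swap)
open Real (sqrt_mul sqrt_sq sqrt_nonneg one_le_rpow rpow_natCast rpow_le_rpow_of_exponent_le
  rpow_mul norm_eq_abs rpow_add rpow_one mul_rpow rpow_le_rpow sqrt)
open Set (InjOn)
open Fintype (piFinset ofFinite card_piFinset mem_piFinset sum_sigma card_prod card_fin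
  prod_prod_type sum_prod_type card_coe equivOfCardEq card_sum sum_sum_type)
open Nat (prime_two div_eq_of_lt cast_sub cast_nonneg sub_le le_of_dvd le_ceil ceil_lt_add_one
  cast_zero cast_mul cast_ofNat cast_le cast_sum cast_pos)
open Int (castRingHom one_le_abs ModEq abs_eq_natAbs card_Icc cast_abs)
open Ideal (span isPrime_of_prime dvd_iff_le)
open IntermediateField (fixedField fixingSubgroupEquiv adjoin inclusion extendScalars
  adjoin_simple_le_iff mem_adjoin_simple_self eq_of_le_of_finrank_le)
open Multiset (toFinset_card_le mem_toFinset mem_map card_map length_toList map_const'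
  prod_replicate)
open Matrix (det_apply vandermonde mulVec vandermonde_apply det_permute det_mul det fromBlocks)
open Function (Injective)
open IsAlgClosed (splits)
open FiniteDimensional (of_finrank_pos)
open MvPolynomial (esymm rename rename_rename aeval_rename eval₂Hom_rename isHomogeneous_X psum
  esymm_zero)

/-- Pigeonhole construction of an integral relation: if the reductions of the functions `F j`
modulo `p ^ K` lie in small finite additive groups, some small integral combination vanishes. -/
theorem exists_int_relation {Ω ι : Type*} [Fintype ι] (F : ι → Ω → ℤ) (T : ι → ℕ)
    (hT : ∀ j, 0 < T j) (hF : ∀ j x, |F j x| ≤ T j) (I : Finset ℕ) (hI : ∀ p ∈ I, p.Prime)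
    (K w C : ℕ) (R : ∀ p : ℕ, AddSubgroup (Ω → ZMod (p ^ K)))
    (hRf : ∀ p ∈ I, (R p : Set (Ω → ZMod (p ^ K))).Finite)
    (hR : ∀ p ∈ I, Nat.card (R p) ≤ p ^ w)
    (hFR : ∀ p ∈ I, ∀ j, (fun x => (F j x : ZMod (p ^ K))) ∈ R p)
    (h1 : Fintype.card ι * C < (∏ p ∈ I, p) ^ K)
    (h2 : (∏ p ∈ I, p) ^ w * ∏ j, T j < C ^ Fintype.card ι) :
    ∃ c : ι → ℤ, c ≠ 0 ∧ (∀ j, |c j| ≤ C) ∧ ∀ x, ∑ j, c j * F j x = 0 := by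
  classical
  let B : Finset (ι → ℕ) := piFinset fun j => range (C / T j + 1)
  have hf : ∀ p : I, Finite (R p.1) := fun p => (hRf p.1 p.2).to_subtype
  have : ∀ p : I, Fintype (R p.1) := fun p => ofFinite _
  let φ : (ι → ℕ) → (∀ p : I, R p.1) := fun c p =>
    ⟨∑ j, c j • (fun x => (F j x : ZMod (p.1 ^ K))),
      AddSubgroup.sum_mem _ fun j _ => AddSubgroup.nsmul_mem _ (hFR p.1 p.2 j) _⟩
  have hcard : Fintype.card (∀ p : I, R p.1) ≤ (∏ p ∈ I, p) ^ w := by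
    rw [Fintype.card_pi, ← prod_pow, ← Finset.prod_coe_sort I (fun p => p ^ w)]
    refine prod_le_prod' fun p _ => ?_
    rw [← Nat.card_eq_fintype_card]
    exact hR p.1 p.2
  have hB : (∏ p ∈ I, p) ^ w < B.card := by
    rw [card_piFinset]
    simp only [card_range]
    have h3 : C ^ Fintype.card ι ≤ (∏ j, (C / T j + 1)) * ∏ j, T j := by
      rw [← prod_mul_distrib, ← card_univ, ← prod_const]
      refine prod_le_prod' fun j _ => ?_
      have := Nat.div_add_mod C (T j)
      have := Nat.mod_lt C (hT j)
      nlinarith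
    exact lt_of_mul_lt_mul_right (h2.trans_le h3) (Nat.zero_le _)
  obtain ⟨c, hc, c', hc', hne, heq⟩ := Finset.exists_ne_map_eq_of_card_lt_of_maps_to
    (s := B) (t := (univ : Finset (∀ p : I, R p.1))) (f := φ)
    (by rw [card_univ]; exact hcard.trans_lt hB) (fun _ _ => mem_coe.2 (mem_univ _))
  have hb : ∀ c ∈ B, ∀ j, c j * T j ≤ C := fun c hc j => by
    have := mem_range.1 (mem_piFinset.1 hc j)
    exact (Nat.mul_le_mul_right _ (Nat.lt_succ_iff.1 this)).trans (Nat.div_mul_le_self _ _)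
  have hd : ∀ j, |(c j : ℤ) - c' j| * T j ≤ C := fun j => by
    have e1 : (c j : ℤ) * T j ≤ C := by exact_mod_cast hb c hc j
    have e2 : (c' j : ℤ) * T j ≤ C := by exact_mod_cast hb c' hc' j
    have e3 : (0 : ℤ) ≤ (c j : ℤ) * T j := by positivity
    have e4 : (0 : ℤ) ≤ (c' j : ℤ) * T j := by positivity
    have : |(c j : ℤ) - c' j| * T j = |((c j : ℤ) - c' j) * T j| := by
      rw [abs_mul, Nat.abs_cast]
    rw [this, abs_le]
    constructor <;> nlinarith
  refine ⟨fun j => (c j : ℤ) - c' j, ?_, fun j => ?_, fun x => ?_⟩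
  · intro h
    apply hne
    funext j
    have := congrFun h j
    simp only [Pi.zero_apply] at this
    omega
  · have h1 : (1 : ℤ) ≤ T j := by exact_mod_cast hT j
    nlinarith [hd j, abs_nonneg ((c j : ℤ) - c' j)]
  · have hdvd : ((∏ p ∈ I, p : ℕ) : ℤ) ^ K ∣ ∑ j, ((c j : ℤ) - c' j) * F j x := by
      push_cast
      rw [← prod_pow]
      refine prod_dvd_of_coprime ?_ ?_
      · intro p hp p' hp' hpp
        have : Nat.Coprime p p' := (Nat.coprime_primes (hI p hp) (hI p' hp')).2 hpp
        exact (Nat.isCoprime_iff_coprime.2 this).pow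
      · intro p hp
        have e := congrArg (fun g => (g.1 : Ω → ZMod (p ^ K)) x) (congrFun heq ⟨p, hp⟩)
        simp only [φ, Finset.sum_apply, nsmul_eq_mul, Pi.mul_apply, Pi.natCast_apply] at e
        have : ((∑ j, ((c j : ℤ) - c' j) * F j x : ℤ) : ZMod (p ^ K)) = 0 := by
          push_cast
          simp only [sub_mul, sum_sub_distrib]
          rw [e, sub_self]
        have := (ZMod.intCast_zmod_eq_zero_iff_dvd _ _).1 this
        simpa using this
    refine Int.eq_zero_of_abs_lt_dvd hdvd ?_
    calc |∑ j, ((c j : ℤ) - c' j) * F j x| ≤ ∑ j, |((c j : ℤ) - c' j) * F j x| :=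
          abs_sum_le_sum_abs _ _
      _ ≤ ∑ j : ι, (C : ℤ) := sum_le_sum fun j _ => by
          rw [abs_mul]
          exact (mul_le_mul_of_nonneg_left (hF j x) (abs_nonneg _)).trans (hd j)
      _ = Fintype.card ι * C := by simp
      _ < _ := by exact_mod_cast h1

/-- An additive subgroup generated by finitely many elements of order dividing `m i`. -/
theorem card_closure_range_le {A ι : Type*} [AddCommGroup A] [Fintype ι] (g : ι → A)
    (m : ι → ℕ) (hm : ∀ i, 0 < m i) (hg : ∀ i, m i • g i = 0) :
    (AddSubgroup.closure (Set.range g) : Set A).Finite ∧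
      Nat.card (AddSubgroup.closure (Set.range g)) ≤ ∏ i, m i := by
  classical
  have : ∀ i, NeZero (m i) := fun i => ⟨(hm i).ne'⟩
  let ψ : (∀ i, Fin (m i)) → A := fun c => ∑ i, (c i : ℕ) • g i
  have hsub : (AddSubgroup.closure (Set.range g) : Set A) ⊆ Set.range ψ := by
    intro x hx
    have hx' : ∃ c : ι → ℤ, x = ∑ i, c i • g i := by
      refine AddSubgroup.closure_induction (p := fun x _ => ∃ c : ι → ℤ, x = ∑ i, c i • g i)
        ?_ ?_ ?_ ?_ hx
      · rintro _ ⟨i, rfl⟩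
        exact ⟨Pi.single i 1, by simp [Pi.single_apply, ite_smul]⟩
      · exact ⟨0, by simp⟩
      · rintro _ _ _ _ ⟨c, rfl⟩ ⟨c', rfl⟩
        exact ⟨c + c', by simp [add_smul, sum_add_distrib]⟩
      · rintro _ _ ⟨c, rfl⟩
        exact ⟨-c, by simp⟩
    obtain ⟨c, rfl⟩ := hx'
    refine ⟨fun i => ⟨(c i % m i).toNat, ?_⟩, ?_⟩
    · have h1 := Int.emod_lt_of_pos (c i) (b := m i) (by exact_mod_cast hm i)
      have h2 := Int.emod_nonneg (c i) (b := m i) (by exact_mod_cast (hm i).ne')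
      omega
    · refine sum_congr rfl fun i _ => ?_
      have h2 := Int.emod_nonneg (c i) (b := m i) (by exact_mod_cast (hm i).ne')
      rw [← natCast_zsmul]
      simp only [Int.toNat_of_nonneg h2]
      conv_rhs => rw [← Int.emod_add_mul_ediv (c i) (m i)]
      rw [add_smul, mul_comm, mul_smul, natCast_zsmul, hg, smul_zero, add_zero]
  refine ⟨(Set.finite_range ψ).subset hsub, ?_⟩
  calc Nat.card (AddSubgroup.closure (Set.range g)) ≤ Nat.card (Set.range ψ) :=
        Nat.card_mono (Set.finite_range ψ) hsub
    _ ≤ Nat.card (∀ i, Fin (m i)) := Finite.card_range_le ψ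
    _ = ∏ i, m i := by simp

/-- The ring of functions on `Ω` modulo `p ^ K` generated by the integer functions `u i`. -/
def locRing {Ω ι : Type*} (p K : ℕ) (u : ι → Ω → ℤ) : Subring (Ω → ZMod (p ^ K)) :=
  Subring.closure (Set.range fun i x => (u i x : ZMod (p ^ K)))

theorem locRing_card_aux {Ω ι A : Type*} [Fintype ι] [Fintype A] (p K : ℕ) (hp : p.Prime)
    (u : ι → Ω → ℤ) (hu : ∀ i x y, u i x ≡ u i y [ZMOD p])
    (e : A → ι → ℕ) (he : ∀ α : ι → ℕ, ∑ i, α i < K → ∃ a, e a = α) :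
    ((locRing p K u).toAddSubgroup : Set (Ω → ZMod (p ^ K))).Finite ∧
      Nat.card (locRing p K u).toAddSubgroup ≤ p ^ ∑ a, (K - ∑ i, e a i) := by
  classical
  have hw : ∃ (u0 : ι → ℤ) (w : ι → Ω → ℤ), ∀ i x, u i x = u0 i + p * w i x := by
    rcases isEmpty_or_nonempty Ω with h | ⟨⟨x0⟩⟩
    · exact ⟨0, 0, fun i x => (h.false x).elim⟩
    · refine ⟨fun i => u i x0, fun i x => (u i x - u i x0) / p, fun i x => ?_⟩
      have := Int.emod_emod_of_dvd (u i x - u i x0) (dvd_refl (p : ℤ))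
      rw [Int.mul_ediv_cancel' ((hu i x0 x).dvd)]
      ring
  obtain ⟨u0, w, hw⟩ := hw
  let G : (ι → ℕ) → (Ω → ZMod (p ^ K)) := fun α x => ∏ i, ((p * w i x : ℤ) : ZMod (p ^ K)) ^ α i
  have hGmul : ∀ α β, G α * G β = G (α + β) := fun α β => by
    funext x
    simp [G, pow_add, prod_mul_distrib]
  have hG : ∀ (α : ι → ℕ) (k : ℕ), K ≤ k + ∑ i, α i → p ^ k • G α = 0 := fun α k hk => by
    funext x
    simp only [G, nsmul_eq_mul, Pi.mul_apply, Pi.natCast_apply, Pi.zero_apply]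
    have : ((p ^ k : ℕ) : ZMod (p ^ K)) * ∏ i, ((p * w i x : ℤ) : ZMod (p ^ K)) ^ α i
        = (((p : ℤ) ^ (k + ∑ i, α i) * ∏ i, w i x ^ α i : ℤ) : ZMod (p ^ K)) := by
      push_cast
      rw [pow_add, ← prod_pow_eq_pow_sum, mul_assoc, ← prod_mul_distrib]
      simp only [mul_pow]
    simp only [Nat.cast_pow] at this ⊢
    rw [this, ZMod.intCast_zmod_eq_zero_iff_dvd]
    push_cast
    exact Dvd.dvd.mul_right (pow_dvd_pow _ hk) _
  have hG0 : ∀ α : ι → ℕ, K ≤ ∑ i, α i → G α = 0 := fun α h => by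
    have := hG α 0 (by omega)
    simpa using this
  have hsub : ((locRing p K u).toAddSubgroup : Set (Ω → ZMod (p ^ K))) ⊆
      AddSubgroup.closure (Set.range fun a => G (e a)) := by
    set N := AddSubgroup.closure (Set.range fun a => G (e a)) with hN
    have hGN : ∀ α, G α ∈ N := fun α => by
      by_cases h : ∑ i, α i < K
      · obtain ⟨a, rfl⟩ := he α h
        exact AddSubgroup.subset_closure ⟨a, rfl⟩
      · rw [hG0 α (not_lt.1 h)]
        exact N.zero_mem
    have hmul : ∀ f ∈ N, ∀ g ∈ N, f * g ∈ N := by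
      intro f hf g hg
      refine AddSubgroup.closure_induction (p := fun f _ => f * g ∈ N) ?_ ?_ ?_ ?_ hf
      · rintro _ ⟨a, rfl⟩
        refine AddSubgroup.closure_induction (p := fun g _ => G (e a) * g ∈ N) ?_ ?_ ?_ ?_ hg
        · rintro _ ⟨b, rfl⟩
          simp only [hGmul]
          exact hGN _
        · simp [N.zero_mem]
        · intro x y _ _ hx hy
          rw [mul_add]; exact N.add_mem hx hy
        · intro x _ hx
          rw [mul_neg]; exact N.neg_mem hx
      · simp [N.zero_mem]
      · intro x y _ _ hx hy
        rw [add_mul]; exact N.add_mem hx hy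
      · intro x _ hx
        rw [neg_mul]; exact N.neg_mem hx
    have h1 : (1 : Ω → ZMod (p ^ K)) ∈ N := by
      have : G 0 = 1 := by funext x; simp [G]
      rw [← this]; exact hGN 0
    let S : Subring (Ω → ZMod (p ^ K)) :=
      { carrier := N
        mul_mem' := fun ha hb => hmul _ ha _ hb
        one_mem' := h1
        add_mem' := fun ha hb => N.add_mem ha hb
        zero_mem' := N.zero_mem
        neg_mem' := fun ha => N.neg_mem ha }
    have : locRing p K u ≤ S := by
      refine Subring.closure_le.2 ?_
      rintro _ ⟨i, rfl⟩
      have : (fun x => (u i x : ZMod (p ^ K))) = u0 i • (1 : Ω → ZMod (p ^ K)) + G (Pi.single i 1) := by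
        funext x
        simp only [hw i x, G, Pi.add_apply, Pi.smul_apply, Pi.one_apply]
        rw [Finset.prod_eq_single i]
        · simp
        · intro b _ hb
          simp [hb]
        · simp
      change (fun x => (u i x : ZMod (p ^ K))) ∈ N
      rw [this]
      exact N.add_mem (N.zsmul_mem h1 _) (hGN _)
    exact this
  obtain ⟨hf, hc⟩ := card_closure_range_le (fun a => G (e a)) (fun a => p ^ (K - ∑ i, e a i))
    (fun a => pow_pos hp.pos _) (fun a => hG _ _ (by omega))
  refine ⟨hf.subset hsub, (Nat.card_mono hf hsub).trans (hc.trans_eq ?_)⟩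
  rw [prod_pow_eq_pow_sum]

theorem locRing_card_one {Ω : Type*} (p K : ℕ) (hp : p.Prime)
    (u : Fin 1 → Ω → ℤ) (hu : ∀ i x y, u i x ≡ u i y [ZMOD p]) :
    ((locRing p K u).toAddSubgroup : Set (Ω → ZMod (p ^ K))).Finite ∧
      Nat.card (locRing p K u).toAddSubgroup ≤ p ^ ∑ i ∈ range K, (K - i) := by
  have := locRing_card_aux p K hp u hu (A := Fin K) (fun a _ => a) (fun α h => by
    simp only [univ_unique, Fin.default_eq_zero, Finset.sum_singleton] at h
    refine ⟨⟨α 0, h⟩, ?_⟩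
    funext i
    simp [Subsingleton.elim i 0])
  simp only [univ_unique, Finset.sum_singleton] at this
  rwa [Fin.sum_univ_eq_sum_range (fun i => K - i)] at this

theorem locRing_card_two {Ω : Type*} (p K : ℕ) (hp : p.Prime)
    (u : Fin 2 → Ω → ℤ) (hu : ∀ i x y, u i x ≡ u i y [ZMOD p]) :
    ((locRing p K u).toAddSubgroup : Set (Ω → ZMod (p ^ K))).Finite ∧
      Nat.card (locRing p K u).toAddSubgroup ≤
        p ^ ∑ i ∈ range K, ∑ j ∈ range (K - i), (K - i - j) := by
  have := locRing_card_aux p K hp u hu (A := Σ i : Fin K, Fin (K - i))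
    (fun a => ![a.1, a.2]) (fun α h => by
    simp only [Fin.sum_univ_two] at h
    refine ⟨⟨⟨α 0, by omega⟩, ⟨α 1, by simp; omega⟩⟩, ?_⟩
    funext i
    fin_cases i <;> simp)
  simp only [Fin.sum_univ_two, sum_sigma, Matrix.cons_val_zero, Matrix.cons_val_one] at this
  rw [Fin.sum_univ_eq_sum_range (fun i => ∑ j : Fin (K - i), (K - (i + j)))] at this
  refine ⟨this.1, this.2.trans_eq ?_⟩
  congr 1
  refine sum_congr rfl fun i _ => ?_
  rw [Fin.sum_univ_eq_sum_range (fun j => K - (i + j))]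
  simp only [Nat.sub_sub]

theorem sum_range_sub_self (K : ℕ) : 2 * ∑ i ∈ range K, (K - i) = K * (K + 1) := by
  induction K with
  | zero => simp
  | succ K ih =>
    rw [sum_range_succ']
    simp only [Nat.add_sub_add_right, Nat.sub_zero, mul_add, ih]
    ring

theorem sum_range_sum_range_sub (K : ℕ) :
    6 * ∑ i ∈ range K, ∑ j ∈ range (K - i), (K - i - j)
      = K * (K + 1) * (K + 2) := by
  induction K with
  | zero => simp
  | succ K ih =>
    rw [sum_range_succ']
    simp only [Nat.add_sub_add_right, Nat.sub_zero, mul_add, ih]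
    have := sum_range_sub_self (K + 1)
    linarith

/-- Roots of polynomials over `locRing` that are simple modulo `p` again lie in `locRing`. -/
theorem mem_subring_of_root {Ω : Type*} (p K : ℕ) (hp : p.Prime)
    (R : Subring (Ω → ZMod (p ^ K))) (P : R[X]) (v : Ω → ℤ) (hv : ∀ x y, v x ≡ v y [ZMOD p])
    (hroot : aeval (fun x => (v x : ZMod (p ^ K))) P = 0)
    (a : Ω → ℤ) (ha : aeval (fun x => (v x : ZMod (p ^ K))) (derivative P) =
      fun x => (a x : ZMod (p ^ K))) (ha0 : ∀ x y, a x ≡ a y [ZMOD p]) (ha' : ∀ x, ¬ (p : ℤ) ∣ a x) :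
    (fun x => (v x : ZMod (p ^ K))) ∈ R := by
  rcases isEmpty_or_nonempty Ω with h | ⟨⟨x0⟩⟩
  · have : (fun x => (v x : ZMod (p ^ K))) = 0 := by funext x; exact (h.false x).elim
    rw [this]; exact Subring.zero_mem _
  set V : Ω → ZMod (p ^ K) := fun x => (v x : ZMod (p ^ K)) with hV
  have hnil : ∀ f : Ω → ℤ, (∀ x, (p : ℤ) ∣ f x) → IsNilpotent (fun x => (f x : ZMod (p ^ K)) : (Ω → ZMod (p ^ K))) := by
    intro f hf
    refine ⟨K, ?_⟩
    funext x
    have : ((f x ^ K : ℤ) : ZMod (p ^ K)) = 0 := by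
      rw [ZMod.intCast_zmod_eq_zero_iff_dvd]
      push_cast
      exact pow_dvd_pow_of_dvd (hf x) K
    simpa using this
  have hinj : Injective (algebraMap R (Ω → ZMod (p ^ K))) := Subtype.val_injective
  let r : R := (v x0 : ℤ)
  have hr : (algebraMap R (Ω → ZMod (p ^ K)) r) = fun _ => ((v x0 : ℤ) : ZMod (p ^ K)) := by
    simp only [r, map_intCast]; rfl
  have hrV : IsNilpotent (algebraMap R (Ω → ZMod (p ^ K)) r - V) := by
    rw [hr]
    have := hnil (fun x => v x0 - v x) (fun x => (hv x x0).dvd)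
    convert this using 1
    funext x
    simp only [hV, Pi.sub_apply, Int.cast_sub]
  have h1 : IsNilpotent (aeval r P) := by
    rw [← IsNilpotent.map_iff hinj, ← aeval_algebraMap_apply]
    obtain ⟨z, hz⟩ := Polynomial.sub_dvd_eval_sub (algebraMap R (Ω → ZMod (p ^ K)) r) V (P.map (algebraMap R (Ω → ZMod (p ^ K))))
    rw [eval_map_algebraMap, eval_map_algebraMap, hroot, sub_zero] at hz
    rw [hz]
    exact (Commute.all _ _).isNilpotent_mul_right hrV
  have hunit : ∀ f : R, ∀ c : ℤ, ¬ (p : ℤ) ∣ c → IsNilpotent (algebraMap R (Ω → ZMod (p ^ K)) f - (c : (Ω → ZMod (p ^ K)))) →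
      IsUnit f := by
    intro f c hc hn
    have hcu : IsUnit ((c : R)) := by
      have hcop : IsCoprime c ((p : ℤ) ^ K) :=
        ((Prime.coprime_iff_not_dvd (Nat.prime_iff_prime_int.1 hp)).2 hc).symm.pow_right
      obtain ⟨s, t, hst⟩ := hcop
      refine IsUnit.of_mul_eq_one (s : R) ?_
      have hz : ((p : ℤ) ^ K : ℤ) = ((0 : ℤ) : R) := by
        apply hinj
        rw [map_intCast, map_intCast]
        funext x
        have : (((p : ℤ) ^ K : ℤ) : ZMod (p ^ K)) = 0 := by
          rw [ZMod.intCast_zmod_eq_zero_iff_dvd]; push_cast; exact dvd_refl _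
        simpa only [Pi.intCast_apply, Int.cast_zero] using this
      have := congrArg (Int.cast : ℤ → R) hst
      rw [Int.cast_add, Int.cast_mul, Int.cast_mul, hz, Int.cast_zero, mul_zero, add_zero,
        Int.cast_one, mul_comm] at this
      exact this
    have hn' : IsNilpotent (f - (c : R)) := by
      rw [← IsNilpotent.map_iff hinj, map_sub, map_intCast]
      exact hn
    have := hn'.isUnit_add_left_of_commute hcu (Commute.all _ _)
    simpa using this
  have h2 : IsUnit (aeval r (derivative P)) := by
    refine hunit _ (a x0) (ha' x0) ?_
    rw [← aeval_algebraMap_apply]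
    obtain ⟨z, hz⟩ := Polynomial.sub_dvd_eval_sub (algebraMap R (Ω → ZMod (p ^ K)) r) V
      ((derivative P).map (algebraMap R (Ω → ZMod (p ^ K))))
    rw [eval_map_algebraMap, eval_map_algebraMap, ha] at hz
    have e : (aeval (algebraMap R (Ω → ZMod (p ^ K)) r) (derivative P) - ((a x0 : ℤ) : (Ω → ZMod (p ^ K)))) =
        (algebraMap R (Ω → ZMod (p ^ K)) r - V) * z + (fun x => ((a x - a x0 : ℤ) : ZMod (p ^ K)) : (Ω → ZMod (p ^ K))) := by
      rw [← hz]
      funext x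
      simp
    rw [e]
    exact (Commute.all _ _).isNilpotent_add ((Commute.all _ _).isNilpotent_mul_right hrV)
      (hnil _ fun x => (ha0 x0 x).dvd)
  obtain ⟨s, ⟨hs1, hs2⟩, -⟩ := existsUnique_nilpotent_sub_and_aeval_eq_zero h1 h2
  have h3 : IsNilpotent (aeval (algebraMap R (Ω → ZMod (p ^ K)) r) P) := by
    rw [aeval_algebraMap_apply]; exact h1.map _
  have h4 : IsUnit (aeval (algebraMap R (Ω → ZMod (p ^ K)) r) (derivative P)) := by
    rw [aeval_algebraMap_apply]; exact h2.map _
  have huniq := (existsUnique_nilpotent_sub_and_aeval_eq_zero h3 h4).unique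
    (y₁ := V) (y₂ := algebraMap R (Ω → ZMod (p ^ K)) s) ⟨hrV, hroot⟩ ⟨by
      rw [← map_sub]; exact hs1.map _, by rw [aeval_algebraMap_apply, hs2, map_zero]⟩
  rw [huniq]
  exact s.2

/-- `exists_int_relation` with an optimised choice of the size of the coefficients. -/
theorem exists_int_relation' {Ω ι : Type*} [Fintype ι] [Nonempty ι] (F : ι → Ω → ℤ) (T : ι → ℕ)
    (hT : ∀ j, 0 < T j) (hF : ∀ j x, |F j x| ≤ T j) (I : Finset ℕ) (hI : ∀ p ∈ I, p.Prime)
    (K w : ℕ) (R : ∀ p : ℕ, AddSubgroup (Ω → ZMod (p ^ K)))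
    (hR : ∀ p ∈ I, (R p : Set (Ω → ZMod (p ^ K))).Finite ∧ Nat.card (R p) ≤ p ^ w)
    (hFR : ∀ p ∈ I, ∀ j, (fun x => (F j x : ZMod (p ^ K))) ∈ R p)
    (h : (2 * Fintype.card ι) ^ Fintype.card ι * ((∏ p ∈ I, p) ^ w * ∏ j, T j) <
      ((∏ p ∈ I, p) ^ K) ^ Fintype.card ι) :
    ∃ c : ι → ℤ, c ≠ 0 ∧ (∀ j, |c j| ≤ ((∏ p ∈ I, p) ^ K : ℕ)) ∧ ∀ x, ∑ j, c j * F j x = 0 := by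
  set s := Fintype.card ι with hs
  set q := ∏ p ∈ I, p with hq
  have hs0 : 0 < s := Fintype.card_pos
  have hq0 : 0 < q := prod_pos fun p hp => (hI p hp).pos
  have hP : 0 < q ^ w * ∏ j, T j := Nat.mul_pos (pow_pos hq0 _) (prod_pos fun j _ => hT j)
  have h1 : 2 * s < q ^ K := by
    refine lt_of_pow_lt_pow_left₀ s (Nat.zero_le _) (lt_of_le_of_lt ?_ h)
    exact Nat.le_mul_of_pos_right _ hP
  set C := (q ^ K - 1) / s with hC
  have hC1 : s * C ≤ q ^ K - 1 := Nat.mul_div_le _ _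
  have hC2 : q ^ K - 1 < s * C + s := by
    have := Nat.lt_mul_div_succ (q ^ K - 1) hs0
    rw [Nat.mul_succ] at this
    simpa [hC] using this
  have hC3 : q ^ K ≤ 2 * s * C := by
    have h3 : 1 ≤ C := by
      rw [hC, Nat.le_div_iff_mul_le hs0]; omega
    have : s ≤ s * C := Nat.le_mul_of_pos_right _ h3
    rw [mul_assoc]; omega
  obtain ⟨c, hc, hc1, hc2⟩ := exists_int_relation F T hT hF I hI K w C R (fun p hp => (hR p hp).1)
    (fun p hp => (hR p hp).2) hFR (by rw [← hs, ← hq]; omega) (by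
      rw [← hs, ← hq]
      have h4 : (2 * s) ^ s * (q ^ w * ∏ j, T j) < (2 * s) ^ s * C ^ s := by
        rw [← mul_pow]
        exact h.trans_le (Nat.pow_le_pow_left hC3 _)
      exact lt_of_mul_lt_mul_left h4 (Nat.zero_le _))
  refine ⟨c, hc, fun j => (hc1 j).trans ?_, hc2⟩
  have : C ≤ s * C := Nat.le_mul_of_pos_left _ hs0
  exact_mod_cast (by omega : C ≤ q ^ K)

/-- Two functions that are locally analytic in one parameter satisfy a relation linear in the
second function. -/
theorem exists_curve_relation {Ω : Type*} (u v : Ω → ℤ) (U V M : ℕ) (hU : 0 < U) (hV : 0 < V)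
    (hu : ∀ x, |u x| ≤ U) (hv : ∀ x, |v x| ≤ V) (I : Finset ℕ) (hI : ∀ p ∈ I, p.Prime)
    (hloc : ∀ p ∈ I, ∃ t : Fin 1 → Ω → ℤ, (∀ i x y, t i x ≡ t i y [ZMOD p]) ∧
      ∀ K, (fun x => (u x : ZMod (p ^ K))) ∈ locRing p K t ∧
        (fun x => (v x : ZMod (p ^ K))) ∈ locRing p K t)
    (h : (4 * (M + 1)) ^ (2 * (M + 1)) * (U ^ (M * (M + 1)) * V ^ (M + 1)) <
      (∏ p ∈ I, p) ^ (2 * M ^ 2 + 3 * M)) :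
    ∃ g0 g1 : ℤ[X], (g0 ≠ 0 ∨ g1 ≠ 0) ∧ g0.natDegree ≤ M ∧ g1.natDegree ≤ M ∧
      ∀ x, g0.eval (u x) + g1.eval (u x) * v x = 0 := by
  classical
  have hloc' : ∀ p : ℕ, ∃ t : Fin 1 → Ω → ℤ, p ∈ I → (∀ i x y, t i x ≡ t i y [ZMOD p]) ∧
      ∀ K, (fun x => (u x : ZMod (p ^ K))) ∈ locRing p K t ∧
        (fun x => (v x : ZMod (p ^ K))) ∈ locRing p K t := fun p => by
    by_cases hp : p ∈ I
    · obtain ⟨t, ht⟩ := hloc p hp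
      exact ⟨t, fun _ => ht⟩
    · exact ⟨fun _ _ => 0, fun h => (hp h).elim⟩
  choose t ht using hloc'
  set q := ∏ p ∈ I, p with hq
  have hq0 : 0 < q := prod_pos fun p hp => (hI p hp).pos
  have hw : ∑ i ∈ range (2 * M), (2 * M - i) = M * (2 * M + 1) := by
    have := sum_range_sub_self (2 * M)
    have h2 : 2 * M * (2 * M + 1) = 2 * (M * (2 * M + 1)) := by ring
    omega
  obtain ⟨c, hc, -, hc2⟩ := exists_int_relation' (Ω := Ω) (ι := Fin (M + 1) × Fin 2)
    (fun j x => u x ^ (j.1 : ℕ) * v x ^ (j.2 : ℕ)) (fun j => U ^ (j.1 : ℕ) * V ^ (j.2 : ℕ))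
    (fun j => by positivity) (fun j x => by
      rw [abs_mul, abs_pow, abs_pow]
      push_cast
      exact mul_le_mul (pow_le_pow_left₀ (abs_nonneg _) (hu x) _)
        (pow_le_pow_left₀ (abs_nonneg _) (hv x) _) (by positivity) (by positivity)) I hI
    (2 * M) (M * (2 * M + 1)) (fun p => (locRing p (2 * M) (t p)).toAddSubgroup)
    (fun p hp => by
      have := locRing_card_one p (2 * M) (hI p hp) (t p) (ht p hp).1
      rwa [hw] at this)
    (fun p hp j => by
      have h1 := ((ht p hp).2 (2 * M)).1
      have h2 := ((ht p hp).2 (2 * M)).2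
      have := Subring.mul_mem _ (Subring.pow_mem _ h1 (j.1 : ℕ)) (Subring.pow_mem _ h2 (j.2 : ℕ))
      have e : (fun x => ((u x ^ (j.1 : ℕ) * v x ^ (j.2 : ℕ) : ℤ) : ZMod (p ^ (2 * M)))) =
          (fun x => (u x : ZMod (p ^ (2 * M)))) ^ (j.1 : ℕ) *
            (fun x => (v x : ZMod (p ^ (2 * M)))) ^ (j.2 : ℕ) := by
        funext x
        simp
      rw [e]
      exact this)
    (by
      simp only [card_prod, card_fin, ← hq]
      have e1 : ∏ j : Fin (M + 1) × Fin 2, U ^ (j.1 : ℕ) * V ^ (j.2 : ℕ)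
          = U ^ (M * (M + 1)) * V ^ (M + 1) := by
        rw [prod_mul_distrib, prod_prod_type, prod_prod_type]
        simp only [prod_const, card_univ, card_fin, Fin.prod_univ_two]
        simp only [← pow_mul, Fin.val_zero, Fin.val_one, pow_zero, one_mul, pow_one]
        congr 1
        rw [prod_pow_eq_pow_sum, ← sum_mul, Fin.sum_univ_eq_sum_range (fun i => i),
          Finset.sum_range_id_mul_two]
        simp [mul_comm]
      rw [e1]
      have e2 : (q ^ (2 * M)) ^ ((M + 1) * 2) = q ^ (M * (2 * M + 1)) * q ^ (2 * M ^ 2 + 3 * M) := by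
        rw [← pow_mul, ← pow_add]; congr 1; ring
      rw [e2]
      have e3 : 2 * ((M + 1) * 2) = 4 * (M + 1) := by ring
      have e4 : (M + 1) * 2 = 2 * (M + 1) := by ring
      rw [e3, e4]
      calc _ = q ^ (M * (2 * M + 1)) *
            ((4 * (M + 1)) ^ (2 * (M + 1)) * (U ^ (M * (M + 1)) * V ^ (M + 1))) := by ring
        _ < _ := Nat.mul_lt_mul_of_pos_left h (pow_pos hq0 _))
  have hdeg : ∀ k : Fin 2, (∑ i : Fin (M + 1), C (c (i, k)) * X ^ (i : ℕ) : ℤ[X]).natDegree ≤ M := by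
    intro k
    refine natDegree_sum_le_of_forall_le _ _ fun i _ => ?_
    exact (natDegree_C_mul_X_pow_le _ _).trans (Nat.lt_succ_iff.1 i.2)
  have hcoef : ∀ (k : Fin 2) (i : Fin (M + 1)),
      (∑ i : Fin (M + 1), C (c (i, k)) * X ^ (i : ℕ) : ℤ[X]).coeff i = c (i, k) := by
    intro k i
    simp only [finsetSum_coeff, coeff_C_mul, coeff_X_pow]
    rw [Finset.sum_eq_single i]
    · simp
    · intro b _ hb
      have : (i : ℕ) ≠ b := fun h => hb (Fin.ext h.symm)
      simp [this]
    · simp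
  refine ⟨∑ i : Fin (M + 1), C (c (i, 0)) * X ^ (i : ℕ), ∑ i : Fin (M + 1), C (c (i, 1)) * X ^ (i : ℕ),
    ?_, hdeg 0, hdeg 1, fun x => ?_⟩
  · by_contra hcon
    push Not at hcon
    apply hc
    funext ⟨i, k⟩
    have hk : k = 0 ∨ k = 1 := by omega
    rcases hk with rfl | rfl
    · rw [← hcoef, hcon.1]; simp
    · rw [← hcoef, hcon.2]; simp
  · have := hc2 x
    rw [sum_prod_type] at this
    simp only [Fin.sum_univ_two, Fin.val_zero, Fin.val_one, pow_zero, pow_one, mul_one,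
      sum_add_distrib] at this
    rw [eval_finsetSum, eval_finsetSum, sum_mul]
    simpa [mul_assoc] using this

/-- Both partial degrees of `P` are at most `D`. -/
def Bd (D : ℕ) (P : ℤ[X][X]) : Prop := P.natDegree ≤ D ∧ (Bivariate.swap P).natDegree ≤ D

theorem coeff_coeff_swap' (P : ℤ[X][X]) (i j : ℕ) :
    ((Bivariate.swap P).coeff i).coeff j = (P.coeff j).coeff i := by
  induction P using Polynomial.induction_on' with
  | add p q hp hq => simp [hp, hq]
  | monomial n f =>
    rw [Bivariate.swap_monomial, coeff_mul_C, coeff_map, coeff_C_mul, coeff_monomial, coeff_X_pow]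
    by_cases h : n = j
    · subst h; simp
    · simp [h, Ne.symm h]

theorem natDegree_coeff_le_swap (P : ℤ[X][X]) (i : ℕ) :
    (P.coeff i).natDegree ≤ (Bivariate.swap P).natDegree := by
  refine natDegree_le_iff_coeff_eq_zero.2 fun k hk => ?_
  rw [← coeff_coeff_swap', coeff_eq_zero_of_natDegree_lt hk, coeff_zero]

theorem Bd.mono {D E : ℕ} {P : ℤ[X][X]} (h : Bd D P) (hE : D ≤ E) : Bd E P :=
  ⟨h.1.trans hE, h.2.trans hE⟩

theorem Bd.swap {D : ℕ} {P : ℤ[X][X]} (h : Bd D P) : Bd D (Bivariate.swap P) :=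
  ⟨h.2, by rw [Bivariate.swap_swap_apply]; exact h.1⟩

theorem Bd.mul {D E : ℕ} {P Q : ℤ[X][X]} (hP : Bd D P) (hQ : Bd E Q) : Bd (D + E) (P * Q) :=
  ⟨natDegree_mul_le.trans (add_le_add hP.1 hQ.1), by
    rw [map_mul]; exact natDegree_mul_le.trans (add_le_add hP.2 hQ.2)⟩

theorem Bd.sum {ι : Type*} {D : ℕ} (s : Finset ι) {P : ι → ℤ[X][X]} (hP : ∀ i ∈ s, Bd D (P i)) :
    Bd D (∑ i ∈ s, P i) :=
  ⟨natDegree_sum_le_of_forall_le _ _ fun i hi => (hP i hi).1, by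
    rw [map_sum]; exact natDegree_sum_le_of_forall_le _ _ fun i hi => (hP i hi).2⟩

theorem Bd.prod {ι : Type*} {D : ℕ} (s : Finset ι) {P : ι → ℤ[X][X]} (hP : ∀ i ∈ s, Bd D (P i)) :
    Bd (s.card * D) (∏ i ∈ s, P i) := by
  constructor
  · refine (natDegree_prod_le _ _).trans ?_
    rw [← smul_eq_mul]
    exact sum_le_card_nsmul _ _ _ fun i hi => (hP i hi).1
  · rw [map_prod]
    refine (natDegree_prod_le _ _).trans ?_
    rw [← smul_eq_mul]
    exact sum_le_card_nsmul _ _ _ fun i hi => (hP i hi).2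

theorem Bd.pow {D : ℕ} {P : ℤ[X][X]} (hP : Bd D P) (k : ℕ) : Bd (k * D) (P ^ k) := by
  have := Bd.prod (range k) (P := fun _ => P) fun _ _ => hP
  simpa using this

theorem Bd.zero (D : ℕ) : Bd D 0 := by simp [Bd]

theorem Bd.intCast (D : ℕ) (c : ℤ) : Bd D (c : ℤ[X][X]) := by
  constructor
  · rw [natDegree_intCast]; exact Nat.zero_le _
  · rw [map_intCast, natDegree_intCast]; exact Nat.zero_le _

theorem Bd.det {m D : ℕ} {A : Matrix (Fin m) (Fin m) ℤ[X][X]} (hA : ∀ i j, Bd D (A i j)) :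
    Bd (m * D) A.det := by
  rw [det_apply]
  refine Bd.sum _ fun σ _ => ?_
  have h := Bd.prod (univ) (P := fun i => A (σ i) i) fun i _ => hA _ _
  rw [card_univ, card_fin] at h
  rw [Units.smul_def, zsmul_eq_mul, ← zero_add (m * D)]
  exact (Bd.intCast 0 _).mul h

theorem Bd.resultant {m n D : ℕ} {f g : ℤ[X][X][X]} (hf : ∀ i, Bd D (f.coeff i))
    (hg : ∀ i, Bd D (g.coeff i)) : Bd ((m + n) * D) (resultant f g m n) := by
  refine Bd.det fun i j => ?_
  refine j.addCases (fun k => ?_) (fun k => ?_)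
  · rw [sylvester, Matrix.of_apply, Fin.addCases_left]
    split_ifs
    exacts [hg _, Bd.zero _]
  · rw [sylvester, Matrix.of_apply, Fin.addCases_right]
    split_ifs
    exacts [hf _, Bd.zero _]

theorem natDegree_resultant_le {m n D : ℕ} {f g : ℤ[X][X]} (hf : ∀ i, (f.coeff i).natDegree ≤ D)
    (hg : ∀ i, (g.coeff i).natDegree ≤ D) : (resultant f g m n).natDegree ≤ (m + n) * D := by
  rw [resultant, det_apply]
  refine natDegree_sum_le_of_forall_le _ _ fun σ _ => ?_
  rw [Units.smul_def, zsmul_eq_mul]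
  refine natDegree_mul_le.trans ?_
  rw [natDegree_intCast, zero_add]
  refine (natDegree_prod_le _ _).trans ?_
  refine (sum_le_card_nsmul _ _ D fun i _ => ?_).trans (by simp)
  generalize σ i = k
  refine i.addCases (fun j => ?_) (fun j => ?_)
  · rw [sylvester, Matrix.of_apply, Fin.addCases_left]
    split_ifs
    exacts [hg _, by simp]
  · rw [sylvester, Matrix.of_apply, Fin.addCases_right]
    split_ifs
    exacts [hf _, by simp]

theorem abs_resultant_le {m n : ℕ} {B : ℤ} {f g : ℤ[X]} (hB : 0 ≤ B) (hf : ∀ i, |f.coeff i| ≤ B)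
    (hg : ∀ i, |g.coeff i| ≤ B) : |resultant f g m n| ≤ (m + n).factorial * B ^ (m + n) := by
  have := Matrix.det_le (A := sylvester f g m n) (abv := AbsoluteValue.abs (S := ℤ)) (x := B)
    (fun i j => by
      refine j.addCases (fun k => ?_) (fun k => ?_)
      · rw [sylvester, Matrix.of_apply, Fin.addCases_left]
        split_ifs
        exacts [hg _, by simpa using hB]
      · rw [sylvester, Matrix.of_apply, Fin.addCases_right]
        split_ifs
        exacts [hf _, by simpa using hB])
  simpa [resultant] using this

/-- The resultant of an irreducible polynomial and a polynomial it does not divide is nonzero. -/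
theorem resultant_ne_zero_of_irreducible {R : Type*} [CommRing R] [IsDomain R]
    [UniqueFactorizationMonoid R] {f g : R[X]} (hirr : Irreducible f) (hdeg : f.natDegree ≠ 0)
    (hfg : ¬ f ∣ g) : resultant f g ≠ 0 := by
  let _ : NormalizedGCDMonoid R := Classical.choice inferInstance
  set φ := algebraMap R (FractionRing R) with hφ
  have hinj : Injective φ := IsFractionRing.injective _ _
  have hf : f.IsPrimitive := hirr.isPrimitive hdeg
  have h1 : Irreducible (f.map φ) :=
    (hf.irreducible_iff_irreducible_map_fraction_map).1 hirr
  have h2 : IsCoprime (f.map φ) (g.map φ) := (h1.coprime_iff_not_dvd).2 fun h =>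
    hfg (hf.dvd_of_fraction_map_dvd_fraction_map h)
  have h3 := resultant_ne_zero _ _ h2
  rw [natDegree_map_eq_of_injective hinj, natDegree_map_eq_of_injective hinj, resultant_map_map] at h3
  exact fun h => h3 (by rw [h, map_zero])

theorem map_resultant_eq_zero {R S : Type*} [CommRing R] [CommRing S] {f g : R[X]}
    (hdeg : f.natDegree ≠ 0) (φ : R →+* S) (z : S) (hf : (f.map φ).eval z = 0)
    (hg : (g.map φ).eval z = 0) : φ (resultant f g) = 0 := by
  obtain ⟨p, q, -, -, h⟩ := exists_mul_add_mul_eq_C_resultant f g le_rfl le_rfl (Or.inl hdeg)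
  have := congrArg (fun P => (P.map φ).eval z) h
  simpa [hf, hg] using this.symm

theorem card_le_natDegree_of_eval_eq_zero {P : ℤ[X]} (hP : P ≠ 0) (S : Finset ℤ)
    (hS : ∀ x ∈ S, P.eval x = 0) : S.card ≤ P.natDegree := by
  refine (card_le_card ?_).trans ((toFinset_card_le P.roots).trans (card_roots' P))
  intro x hx
  rw [mem_toFinset, mem_roots hP]
  exact hS x hx

theorem evalEval_eq_eval_map (P : ℤ[X][X]) (a b : ℤ) :
    P.evalEval a b = (P.map (evalRingHom a)).eval b := by
  rw [← map_evalRingHom_eval]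

theorem evalEval_swap (P : ℤ[X][X]) (a b : ℤ) :
    (Bivariate.swap P).evalEval b a = P.evalEval a b := by
  have := Bivariate.aevalAeval_swap (R := ℤ) b a P
  simpa only [coe_aevalAeval_eq_evalEval] using this

/-- If `P(a, ·)` vanishes identically, then `X - a` divides `P`. -/
theorem C_X_sub_C_dvd {P : ℤ[X][X]} {a : ℤ} (h : P.map (evalRingHom a) = 0) :
    (C (X - C a) : ℤ[X][X]) ∣ P := by
  rw [C_dvd_iff_dvd_coeff]
  intro i
  rw [dvd_iff_isRoot, IsRoot.def]
  simpa using congrArg (fun Q => Q.coeff i) h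

theorem irreducible_C_X_sub_C (a : ℤ) : Irreducible (C (X - C a) : ℤ[X][X]) :=
  (Polynomial.prime_C_iff.2 (prime_X_sub_C a)).irreducible

/-- An irreducible polynomial divisible by `X - a` does not depend on `Y`. -/
theorem map_evalRingHom_ne_zero {Γ : ℤ[X][X]} (hΓ : Irreducible Γ) (hdeg : Γ.natDegree ≠ 0) (a : ℤ) :
    Γ.map (evalRingHom a) ≠ 0 := by
  intro h
  have h1 := (irreducible_C_X_sub_C a).dvd_symm hΓ (C_X_sub_C_dvd h)
  have := natDegree_le_of_dvd h1 (by rw [Ne, C_eq_zero]; exact X_sub_C_ne_zero a)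
  rw [natDegree_C] at this
  omega

theorem associated_of_natDegree_eq_zero {Γ : ℤ[X][X]} (hΓ : Irreducible Γ) (hdeg : Γ.natDegree = 0)
    {a b : ℤ} (h : Γ.evalEval a b = 0) : Associated (C (X - C a)) Γ := by
  refine (irreducible_C_X_sub_C a).associated_of_dvd hΓ (C_X_sub_C_dvd ?_)
  rw [eq_C_of_natDegree_eq_zero hdeg] at h ⊢
  rw [evalEval_C] at h
  simp [h]

/-- Bounded number of common zeros of two coprime polynomials. -/
theorem card_common_zeros_le {D E : ℕ} {Γ N : ℤ[X][X]} (hΓ : Irreducible Γ) (hΓN : ¬ Γ ∣ N)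
    (hD : Bd D Γ) (hE : Bd E N) (S : Finset (ℤ × ℤ))
    (hS : ∀ x ∈ S, Γ.evalEval x.1 x.2 = 0 ∧ N.evalEval x.1 x.2 = 0) :
    S.card ≤ (D + E) * (D + E) * D + E := by
  classical
  by_cases hdeg : Γ.natDegree = 0
  · rcases S.eq_empty_or_nonempty with rfl | ⟨x0, hx0⟩
    · simp
    have hx : ∀ x ∈ S, Associated (C (X - C x.1)) Γ := fun x hx =>
      associated_of_natDegree_eq_zero hΓ hdeg (hS x hx).1
    have hN0 : N.map (evalRingHom x0.1) ≠ 0 := fun h =>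
      hΓN ((hx x0 hx0).dvd_iff_dvd_left.1 (C_X_sub_C_dvd h))
    have ha : ∀ x ∈ S, x.1 = x0.1 := by
      intro x hxS
      have := ((hx x hxS).trans (hx x0 hx0).symm).dvd
      rw [C_dvd_iff_dvd_coeff] at this
      have := this 0
      rw [coeff_C_zero, dvd_iff_isRoot, IsRoot.def] at this
      simp only [eval_sub, eval_X, eval_C] at this
      omega
    have h1 : S.card = (S.image Prod.snd).card := by
      rw [card_image_of_injOn]
      intro x hx y hy hxy
      exact Prod.ext ((ha x hx).trans (ha y hy).symm) hxy
    have h2 := card_le_natDegree_of_eval_eq_zero hN0 (S.image Prod.snd) (by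
      intro b hb
      obtain ⟨x, hx, rfl⟩ := mem_image.1 hb
      rw [← evalEval_eq_eval_map, ← ha x hx]
      exact (hS x hx).2)
    have h3 := (natDegree_map_le (p := N) (f := evalRingHom x0.1)).trans hE.1
    omega
  · have hR := resultant_ne_zero_of_irreducible hΓ hdeg hΓN
    have hRdeg : (resultant Γ N).natDegree ≤ (D + E) * (D + E) := by
      refine (natDegree_resultant_le (D := D + E) (fun i => ?_) (fun i => ?_)).trans ?_
      · exact (natDegree_coeff_le_swap _ _).trans (hD.2.trans (Nat.le_add_right _ _))
      · exact (natDegree_coeff_le_swap _ _).trans (hE.2.trans (Nat.le_add_left _ _))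
      · exact Nat.mul_le_mul_right _ (add_le_add hD.1 hE.1)
    have h1 : (S.image Prod.fst).card ≤ (D + E) * (D + E) := by
      refine (card_le_natDegree_of_eval_eq_zero hR _ ?_).trans hRdeg
      intro a ha
      obtain ⟨x, hx, rfl⟩ := mem_image.1 ha
      refine map_resultant_eq_zero (φ := evalRingHom x.1) hdeg x.2 ?_ ?_
      · rw [← evalEval_eq_eval_map]; exact (hS x hx).1
      · rw [← evalEval_eq_eval_map]; exact (hS x hx).2
    have h2 := card_le_mul_card_image (s := S) (f := Prod.fst) D (by
      intro a _
      have hinj : InjOn Prod.snd ((S.filter fun x => x.1 = a : Finset (ℤ × ℤ)) : Set (ℤ × ℤ)) := by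
        intro x hx y hy hxy
        have hx := (mem_filter.1 hx).2
        have hy := (mem_filter.1 hy).2
        exact Prod.ext (hx.trans hy.symm) hxy
      rw [← card_image_of_injOn hinj]
      refine (card_le_natDegree_of_eval_eq_zero (map_evalRingHom_ne_zero hΓ hdeg a) _ ?_).trans
        (natDegree_map_le.trans hD.1)
      intro b hb
      obtain ⟨x, hx, rfl⟩ := mem_image.1 hb
      obtain ⟨hxS, hxa⟩ := mem_filter.1 hx
      rw [← hxa, ← evalEval_eq_eval_map]
      exact (hS x hxS).1)
    calc S.card ≤ D * (S.image Prod.fst).card := h2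
      _ ≤ D * ((D + E) * (D + E)) := Nat.mul_le_mul_left _ h1
      _ ≤ _ := by rw [mul_comm]; exact Nat.le_add_right _ _

/-- A finite set of representatives of the nonconstant irreducible factors. -/
theorem exists_factor_finset {D : ℕ} {N : ℤ[X][X]} (hN : N ≠ 0) (hD : Bd D N) :
    ∃ F : Finset ℤ[X][X], F.card ≤ 2 * D ∧ (∀ Γ ∈ F, Irreducible Γ ∧ Γ ∣ N ∧ Bd D Γ) ∧
      (∀ x y : ℤ, N.evalEval x y = 0 → ∃ Γ ∈ F, Γ.evalEval x y = 0) ∧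
      ∀ Γ, Irreducible Γ → Γ ∣ N → Γ.natDegree ≠ 0 → ∃ Γ' ∈ F, Associated Γ Γ' := by
  classical
  open UniqueFactorizationMonoid in
  set M := factors N with hM
  have hirr : ∀ Γ ∈ M, Irreducible Γ := fun Γ h => irreducible_of_factor Γ h
  have hdvd : ∀ Γ ∈ M, Γ ∣ N := fun Γ h => dvd_of_mem_factors h
  obtain ⟨u, hu⟩ := UniqueFactorizationMonoid.factors_prod hN
  have h0 : (0 : ℤ[X][X]) ∉ M := fun h => (hirr 0 h).ne_zero rfl
  have hu1 : (u : ℤ[X][X]).natDegree = 0 := natDegree_eq_zero_of_isUnit u.isUnit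
  have hu2 : (Bivariate.swap (u : ℤ[X][X])).natDegree = 0 :=
    natDegree_eq_zero_of_isUnit (u.isUnit.map Bivariate.swap)
  have hMp : M.prod ≠ 0 := Multiset.prod_ne_zero h0
  have hinj : Injective (Bivariate.swap (R := ℤ)) := AlgEquiv.injective _
  have hd1 : (M.map natDegree).sum = N.natDegree := by
    rw [← hu, natDegree_mul hMp u.ne_zero, hu1, add_zero, natDegree_multiset_prod _ h0]
  have hd2 : (M.map fun Γ => (Bivariate.swap Γ).natDegree).sum = (Bivariate.swap N).natDegree := by
    rw [← hu, map_mul, natDegree_mul ((map_ne_zero_iff _ hinj).2 hMp)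
      ((map_ne_zero_iff _ hinj).2 u.ne_zero), hu2, add_zero, map_multiset_prod,
      natDegree_multiset_prod _ (by
        simp only [mem_map, not_exists, not_and]
        intro Γ hΓ h
        exact h0 (((map_eq_zero_iff _ hinj).1 h) ▸ hΓ)), Multiset.map_map]
    rfl
  set deg : ℤ[X][X] → ℕ := fun Γ => Γ.natDegree + (Bivariate.swap Γ).natDegree with hdeg
  have hconst : ∀ Γ, deg Γ = 0 → ∀ x y : ℤ, Γ.evalEval x y = 0 → Γ = 0 := by
    intro Γ h x y hxy
    have h1 : Γ.natDegree = 0 := by simp only [hdeg] at h; omega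
    have h2 := natDegree_coeff_le_swap Γ 0
    have h3 : (Γ.coeff 0).natDegree = 0 := by simp only [hdeg] at h; omega
    rw [eq_C_of_natDegree_eq_zero h1, eq_C_of_natDegree_eq_zero h3] at hxy ⊢
    rw [evalEval_CC] at hxy
    simp only [hxy, C_0]
  have hsum : (M.map deg).sum = N.natDegree + (Bivariate.swap N).natDegree := by
    rw [← hd1, ← hd2, ← Multiset.sum_map_add]
  refine ⟨(M.filter fun Γ => deg Γ ≠ 0).toFinset, ?_, ?_, ?_, ?_⟩
  · refine (toFinset_card_le _).trans ?_
    have h1 : (M.filter fun Γ => deg Γ ≠ 0).card ≤ ((M.filter fun Γ => deg Γ ≠ 0).map deg).sum := by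
      have := Multiset.card_nsmul_le_sum (s := (M.filter fun Γ => deg Γ ≠ 0).map deg) (a := 1) (by
        intro x hx
        obtain ⟨Γ, hΓ, rfl⟩ := mem_map.1 hx
        exact Nat.one_le_iff_ne_zero.2 (Multiset.mem_filter.1 hΓ).2)
      simpa using this
    have h2 : ((M.filter fun Γ => deg Γ ≠ 0).map deg).sum ≤ (M.map deg).sum := by
      conv_rhs => rw [← Multiset.filter_add_not (fun Γ => deg Γ ≠ 0) M, Multiset.map_add, Multiset.sum_add]
      exact Nat.le_add_right _ _
    have := hD.1
    have := hD.2
    omega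
  · intro Γ hΓ
    have hΓ := (Multiset.mem_filter.1 (mem_toFinset.1 hΓ)).1
    refine ⟨hirr Γ hΓ, hdvd Γ hΓ, (natDegree_le_of_dvd (hdvd Γ hΓ) hN).trans hD.1, ?_⟩
    exact (natDegree_le_of_dvd (_root_.map_dvd _ (hdvd Γ hΓ)) ((map_ne_zero_iff _ hinj).2 hN)).trans hD.2
  · intro x y hxy
    have h1 : (M.map (evalEval x y)).prod = 0 := by
      rw [← hu, evalEval_mul] at hxy
      rw [← evalEval_multiset_prod]
      refine (mul_eq_zero.1 hxy).resolve_right fun h => ?_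
      have : IsUnit (evalEval x y (u : ℤ[X][X])) := u.isUnit.map (evalEvalRingHom x y)
      rw [h] at this
      exact not_isUnit_zero this
    rw [Multiset.prod_eq_zero_iff, mem_map] at h1
    obtain ⟨Γ, hΓ, h⟩ := h1
    refine ⟨Γ, mem_toFinset.2 (Multiset.mem_filter.2 ⟨hΓ, fun hd => ?_⟩), h⟩
    exact h0 (hconst Γ hd x y h ▸ hΓ)
  · intro Γ hΓ hΓN hdeg0
    obtain ⟨Γ', hΓ', has⟩ := UniqueFactorizationMonoid.exists_mem_factors_of_dvd hN hΓ hΓN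
    refine ⟨Γ', mem_toFinset.2 (Multiset.mem_filter.2 ⟨hΓ', ?_⟩), has⟩
    have := natDegree_le_of_dvd has.dvd (hirr Γ' hΓ').ne_zero
    simp only [hdeg]
    omega

theorem eval_map_intCast_eq {Λ : Type*} [CommRing Λ] {S : Type*} [CommRing S] (Q : Λ[X]) (e : Λ →+* ℤ) (v : ℤ) :
    (((Q.map e).eval v : ℤ) : S) = eval₂ ((castRingHom S).comp e) (v : S) Q := by
  rw [eval_map]
  exact hom_eval₂ Q e (castRingHom S) v

theorem mem_subring_of_root_eval {Ω Λ : Type*} [CommRing Λ] (p K : ℕ) (hp : p.Prime)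
    (R : Subring (Ω → ZMod (p ^ K))) (e : Ω → Λ →+* ℤ)
    (he : ∀ l, (fun x => (e x l : ZMod (p ^ K))) ∈ R)
    (hc : ∀ l x y, e x l ≡ e y l [ZMOD p]) (P : Λ[X]) (v : Ω → ℤ)
    (hv : ∀ x y, v x ≡ v y [ZMOD p]) (hroot : ∀ x, (P.map (e x)).eval (v x) = 0)
    (hne : ∀ x, ¬ (p : ℤ) ∣ ((derivative P).map (e x)).eval (v x)) :
    (fun x => (v x : ZMod (p ^ K))) ∈ R := by
  let φ : Λ →+* R := (RingHom.pi fun x => (castRingHom (ZMod (p ^ K))).comp (e x)).codRestrict R he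
  have key : ∀ Q : Λ[X], aeval (fun x => (v x : ZMod (p ^ K))) (Q.map φ) =
      fun x => (((Q.map (e x)).eval (v x) : ℤ) : ZMod (p ^ K)) := by
    intro Q
    funext x
    rw [aeval_def, eval₂_map, eval_map_intCast_eq]
    change Pi.evalRingHom (fun _ => ZMod (p ^ K)) x _ = _
    rw [hom_eval₂]
    rfl
  refine mem_subring_of_root p K hp R (P.map φ) v hv ?_
    (fun x => ((derivative P).map (e x)).eval (v x)) ?_ ?_ hne
  · rw [key]; funext x; simp [hroot x]
  · rw [derivative_map, key]
  · intro x y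
    rw [← ZMod.intCast_eq_intCast_iff, eval_map_intCast_eq, eval_map_intCast_eq,
      (ZMod.intCast_eq_intCast_iff _ _ _).2 (hv x y)]
    congr 1
    ext l
    exact (ZMod.intCast_eq_intCast_iff _ _ _).2 (hc l x y)

theorem eval_mem_subring {Ω : Type*} {m : ℕ} {R : Subring (Ω → ZMod m)} {u : Ω → ℤ}
    (hu : (fun x => (u x : ZMod m)) ∈ R) (P : ℤ[X]) :
    (fun x => ((evalRingHom (u x) P : ℤ) : ZMod m)) ∈ R := by
  induction P using Polynomial.induction_on' with
  | add p q hp hq =>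
    have := R.add_mem hp hq
    convert this using 1
    funext x; simp
  | monomial n c =>
    have := R.mul_mem (intCast_mem R c) (R.pow_mem hu n)
    convert this using 1
    funext x; simp

theorem evalEval_mem_subring {Ω : Type*} {m : ℕ} {R : Subring (Ω → ZMod m)} {u v : Ω → ℤ}
    (hu : (fun x => (u x : ZMod m)) ∈ R) (hv : (fun x => (v x : ZMod m)) ∈ R) (P : ℤ[X][X]) :
    (fun x => ((evalEvalRingHom (u x) (v x) P : ℤ) : ZMod m)) ∈ R := by
  induction P using Polynomial.induction_on' with
  | add p q hp hq =>
    have := R.add_mem hp hq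
    convert this using 1
    funext x; simp
  | monomial n c =>
    have := R.mul_mem (eval_mem_subring hu c) (R.pow_mem hv n)
    convert this using 1
    funext x
    simp [← C_mul_X_pow_eq_monomial]

theorem evalEval_modEq {p : ℕ} {a b a' b' : ℤ} (ha : a ≡ a' [ZMOD p]) (hb : b ≡ b' [ZMOD p])
    (P : ℤ[X][X]) : P.evalEval a b ≡ P.evalEval a' b' [ZMOD p] := by
  have h : ∀ a b : ℤ, ((P.evalEval a b : ℤ) : ZMod p) =
      eval₂ (eval₂RingHom (castRingHom (ZMod p)) (a : ZMod p)) (b : ZMod p) P := by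
    intro a b
    rw [evalEval_eq_eval_map, eval_map_intCast_eq]
    congr 1
    ext <;> simp
  rw [← ZMod.intCast_eq_intCast_iff, h, h, (ZMod.intCast_eq_intCast_iff _ _ _).2 ha,
    (ZMod.intCast_eq_intCast_iff _ _ _).2 hb]

theorem eval_modEq {p : ℕ} {a a' : ℤ} (ha : a ≡ a' [ZMOD p]) (P : ℤ[X]) :
    P.eval a ≡ P.eval a' [ZMOD p] :=
  (Int.modEq_iff_dvd).2 (((Int.modEq_iff_dvd).1 ha).trans (sub_dvd_eval_sub _ _ _))

/-- Points on an irreducible curve of degree at least two in `Y`, in one cell. -/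
theorem card_le_of_curve_relation {D U V M : ℕ} (hU : 0 < U) (hV : 0 < V) {Γ : ℤ[X][X]}
    (hΓ : Irreducible Γ) (hdeg : 2 ≤ Γ.natDegree) (hD : Bd D Γ) (S : Finset (ℤ × ℤ))
    (f : ℤ × ℤ → ℤ × ℤ) (hf : InjOn f S) (hS : ∀ x ∈ S, Γ.evalEval (f x).1 (f x).2 = 0)
    (hSU : ∀ x ∈ S, |(f x).1| ≤ U) (hSV : ∀ x ∈ S, |(f x).2| ≤ V)
    (I : Finset ℕ) (hI : ∀ p ∈ I, p.Prime)
    (hloc : ∀ p ∈ I, ∃ t : Fin 1 → S → ℤ, (∀ i x y, t i x ≡ t i y [ZMOD p]) ∧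
      ∀ K, (fun x : S => ((f x.1).1 : ZMod (p ^ K))) ∈ locRing p K t ∧
        (fun x : S => ((f x.1).2 : ZMod (p ^ K))) ∈ locRing p K t)
    (h : (4 * (M + 1)) ^ (2 * (M + 1)) * (U ^ (M * (M + 1)) * V ^ (M + 1)) <
      (∏ p ∈ I, p) ^ (2 * M ^ 2 + 3 * M)) :
    S.card ≤ (D + M + 1) ^ 3 := by
  obtain ⟨g0, g1, hg, hg0, hg1, hrel⟩ := exists_curve_relation (Ω := S) (fun x => (f x.1).1)
    (fun x => (f x.1).2) U V M hU hV (fun x => hSU _ x.2) (fun x => hSV _ x.2) I hI hloc h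
  set N : ℤ[X][X] := C g0 + C g1 * X with hN
  have hN1 : N.natDegree ≤ 1 := by
    refine natDegree_add_le_of_degree_le (by simp) ((natDegree_C_mul_le _ _).trans natDegree_X_le)
  have hN2 : (Bivariate.swap N).natDegree ≤ M := by
    rw [hN, map_add, map_mul, Bivariate.swap_C, Bivariate.swap_C, Bivariate.swap_Y]
    refine natDegree_add_le_of_degree_le (natDegree_map_le.trans hg0) ?_
    exact (natDegree_mul_C_le _ _).trans (natDegree_map_le.trans hg1)
  have hN0 : N ≠ 0 := by
    intro h0
    have e0 : N.coeff 0 = g0 := by simp [hN]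
    have e1 : N.coeff 1 = g1 := by simp [hN, coeff_C]
    rw [h0, coeff_zero] at e0 e1
    rcases hg with h | h
    exacts [h e0.symm, h e1.symm]
  have hM : Bd (M + 1) N := ⟨hN1.trans (Nat.le_add_left _ _), hN2.trans (Nat.le_succ _)⟩
  classical
  rw [← card_image_of_injOn hf]
  refine (card_common_zeros_le hΓ (fun hd => ?_) hD hM (S.image f) fun x' hx' => ?_).trans ?_
  · have := natDegree_le_of_dvd hd hN0
    omega
  · obtain ⟨x, hx, rfl⟩ := mem_image.1 hx'
    refine ⟨hS x hx, ?_⟩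
    have := hrel ⟨x, hx⟩
    simpa [hN, evalEval_add, evalEval_mul, evalEval_C, evalEval_X] using this
  · have h1 : D + (M + 1) = D + M + 1 := by ring
    rw [h1]
    have h2 : 1 ≤ (D + M + 1) * (D + M + 1) := Nat.mul_pos (by omega) (by omega)
    nlinarith

/-- The polynomial `P(X, m X + c)` over `ℚ`. -/
noncomputable def restrictLine (P : ℤ[X][X]) (m c : ℚ) : ℚ[X] :=
  (P.map (mapRingHom (castRingHom ℚ))).eval (C m * X + C c)

theorem eval_restrictLine (P : ℤ[X][X]) (m c : ℚ) (a b : ℤ) (h : m * a + c = b) :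
    (restrictLine P m c).eval (a : ℚ) = (P.evalEval a b : ℤ) := by
  have h1 : (C m * X + C c : ℚ[X]).eval (a : ℚ) = b := by simp [h]
  have h2 := map_mapRingHom_evalEval (castRingHom ℚ) P a b
  rw [evalEval] at h2
  simp only [eq_intCast] at h2
  rw [← h2, restrictLine, eval_map, eval_map, ← coe_evalRingHom, hom_eval₂, coe_evalRingHom, h1,
    ← coe_evalRingHom, hom_eval₂, coe_evalRingHom, eval_C]

theorem natDegree_restrictLine_le {D : ℕ} {P : ℤ[X][X]} (hP : Bd D P) (m c : ℚ) :
    (restrictLine P m c).natDegree ≤ D + D := by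
  rw [restrictLine, eval_map, eval₂_eq_sum_range]
  refine natDegree_sum_le_of_forall_le _ _ fun i hi => ?_
  have hi := Finset.mem_range_succ_iff.1 hi
  refine natDegree_mul_le.trans (add_le_add ?_ ?_)
  · rw [coe_mapRingHom]
    exact natDegree_map_le.trans ((natDegree_coeff_le_swap _ _).trans hP.2)
  · refine natDegree_pow_le.trans ?_
    have : (C m * X + C c : ℚ[X]).natDegree ≤ 1 := natDegree_linear_le
    calc i * _ ≤ i * 1 := Nat.mul_le_mul_left _ this
      _ ≤ D := by rw [mul_one]; exact hi.trans hP.1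

theorem not_isSquare_imp_ne {F : Type*} [Field F] {E g0 g1 : F[X]} (hE : ¬ IsSquare E)
    (hg : g0 ≠ 0 ∨ g1 ≠ 0) : g1 ^ 2 * E - g0 ^ 2 ≠ 0 := by
  intro h
  have h1 : g1 ^ 2 ∣ g0 ^ 2 := ⟨E, by linear_combination -h⟩
  by_cases h0 : g1 = 0
  · simp only [h0, ne_eq, not_true_eq_false, or_false] at hg
    rw [h0] at h
    apply hg
    simpa using h
  · obtain ⟨k, rfl⟩ := (IsIntegrallyClosed.pow_dvd_pow_iff (n := 2) (by norm_num)).1 h1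
    refine hE ⟨k, ?_⟩
    have h2 : g1 ^ 2 * (E - k * k) = 0 := by linear_combination h
    exact sub_eq_zero.1 ((mul_eq_zero.1 h2).resolve_left (pow_ne_zero _ h0))

theorem card_le_natDegree_of_eval_cast {P : ℚ[X]} (hP : P ≠ 0) (S : Finset ℤ)
    (hS : ∀ x ∈ S, P.eval (x : ℚ) = 0) : S.card ≤ P.natDegree := by
  classical
  rw [← Finset.card_image_of_injective S (Int.cast_injective (α := ℚ))]
  refine (card_le_card ?_).trans ((toFinset_card_le P.roots).trans (card_roots' P))
  intro x hx
  obtain ⟨y, hy, rfl⟩ := mem_image.1 hx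
  rw [mem_toFinset, mem_roots hP]
  exact hS y hy

/-- Points `(t, y)` with `y ^ 2 = E(t)` in one cell, where `E` is not a square. -/
theorem card_le_of_square_relation {U V M D : ℕ} (hU : 0 < U) (hV : 0 < V) {E : ℚ[X]}
    (hE : ¬ IsSquare E) (hD : E.natDegree ≤ D) (S : Finset (ℤ × ℤ)) (f y : ℤ × ℤ → ℤ)
    (hf : InjOn f S) (hSU : ∀ x ∈ S, |f x| ≤ U) (hSV : ∀ x ∈ S, |y x| ≤ V)
    (hy : ∀ x ∈ S, E.eval (f x : ℚ) = (y x : ℚ) ^ 2)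
    (I : Finset ℕ) (hI : ∀ p ∈ I, p.Prime)
    (hloc : ∀ p ∈ I, ∃ t : Fin 1 → S → ℤ, (∀ i x y, t i x ≡ t i y [ZMOD p]) ∧
      ∀ K, (fun x : S => (f x.1 : ZMod (p ^ K))) ∈ locRing p K t ∧
        (fun x : S => (y x.1 : ZMod (p ^ K))) ∈ locRing p K t)
    (h : (4 * (M + 1)) ^ (2 * (M + 1)) * (U ^ (M * (M + 1)) * V ^ (M + 1)) <
      (∏ p ∈ I, p) ^ (2 * M ^ 2 + 3 * M)) :
    S.card ≤ 2 * M + D := by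
  classical
  obtain ⟨g0, g1, hg, hg0, hg1, hrel⟩ := exists_curve_relation (Ω := S) (fun x => f x.1)
    (fun x => y x.1) U V M hU hV (fun x => hSU _ x.2) (fun x => hSV _ x.2) I hI hloc h
  set ψ := castRingHom ℚ
  have hinj : Injective ψ := Int.cast_injective
  have hQ := not_isSquare_imp_ne (g0 := g0.map ψ) (g1 := g1.map ψ) hE (by
    rwa [Ne, Polynomial.map_eq_zero_iff hinj, Ne, Polynomial.map_eq_zero_iff hinj])
  rw [← card_image_of_injOn hf]
  refine (card_le_natDegree_of_eval_cast hQ _ ?_).trans ?_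
  · intro a ha
    obtain ⟨x, hx, rfl⟩ := mem_image.1 ha
    have h1 := congrArg (Int.cast : ℤ → ℚ) (hrel ⟨x, hx⟩)
    have e : ∀ g : ℤ[X], (g.map ψ).eval ((f x : ℤ) : ℚ) = (g.eval (f x) : ℤ) := by
      intro g
      have := eval_intCast_map ψ g (f x)
      simpa [ψ] using this
    simp only [Int.cast_add, Int.cast_mul, Int.cast_zero] at h1
    rw [eval_sub, eval_mul, eval_pow, eval_pow, e, e, hy x hx]
    linear_combination (((g1.eval (f x) : ℤ) : ℚ) * y x - ((g0.eval (f x) : ℤ) : ℚ)) * h1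
  · refine natDegree_sub_le_of_le (m := 2 * M + D) (n := 2 * M + D) ?_ ?_ |>.trans (by simp)
    · refine natDegree_mul_le.trans (add_le_add (natDegree_pow_le.trans ?_) hD)
      exact Nat.mul_le_mul_left _ (natDegree_map_le.trans hg1)
    · refine natDegree_pow_le.trans ?_
      have := natDegree_map_le (p := g0) (f := ψ)
      omega

/-- The congruence conditions on a cell modulo `p`. -/
structure GoodCell (p : ℕ) (S : Finset (ℤ × ℤ)) (y : ℤ × ℤ → ℤ) : Prop where
  prime : p.Prime
  ne_two : p ≠ 2
  fst : ∀ x ∈ S, ∀ x' ∈ S, x.1 ≡ x'.1 [ZMOD p]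
  snd : ∀ x ∈ S, ∀ x' ∈ S, x.2 ≡ x'.2 [ZMOD p]
  sq : ∀ x ∈ S, ∀ x' ∈ S, y x ≡ y x' [ZMOD p]
  not_dvd : ∀ x ∈ S, ¬ (p : ℤ) ∣ y x

theorem GoodCell.sq_mem {p : ℕ} {S : Finset (ℤ × ℤ)} {y : ℤ × ℤ → ℤ} (h : GoodCell p S y)
    {Δ : ℤ[X][X]} (hy : ∀ x ∈ S, Δ.evalEval x.1 x.2 = y x ^ 2) (K : ℕ) {R : Subring (S → ZMod (p ^ K))}
    (h1 : (fun x : S => (x.1.1 : ZMod (p ^ K))) ∈ R) (h2 : (fun x : S => (x.1.2 : ZMod (p ^ K))) ∈ R) :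
    (fun x : S => (y x.1 : ZMod (p ^ K))) ∈ R := by
  refine mem_subring_of_root_eval p K h.prime R (fun x => evalEvalRingHom x.1.1 x.1.2)
    (evalEval_mem_subring h1 h2) (fun l x x' => ?_) (X ^ 2 - C Δ) (fun x => y x.1)
    (fun x x' => h.sq _ x.2 _ x'.2) (fun x => ?_) (fun x => ?_)
  · exact evalEval_modEq (h.fst _ x.2 _ x'.2) (h.snd _ x.2 _ x'.2) l
  · have := hy x.1 x.2
    rw [evalEval] at this
    simp only [Polynomial.map_sub, Polynomial.map_pow, map_X, map_C, eval_sub, eval_pow, eval_X, eval_C,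
      coe_evalEvalRingHom, evalEval]
    rw [this, sub_self]
  · have : ((derivative (X ^ 2 - C Δ)).map (evalEvalRingHom x.1.1 x.1.2)).eval (y x.1) = 2 * y x.1 := by
      simp
    rw [this]
    intro hd
    have hp := Nat.prime_iff_prime_int.1 h.prime
    rcases hp.dvd_or_dvd hd with h' | h'
    · have := (Nat.prime_dvd_prime_iff_eq h.prime prime_two).1 (by exact_mod_cast h')
      exact h.ne_two this
    · exact h.not_dvd _ x.2 h'

theorem GoodCell.curve_mem {p : ℕ} {S : Finset (ℤ × ℤ)} {y : ℤ × ℤ → ℤ} (h : GoodCell p S y)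
    {Γ : ℤ[X][X]} (hΓ : ∀ x ∈ S, Γ.evalEval x.1 x.2 = 0)
    (hd : ∀ x ∈ S, ¬ (p : ℤ) ∣ (derivative Γ).evalEval x.1 x.2) (K : ℕ)
    {R : Subring (S → ZMod (p ^ K))} (h1 : (fun x : S => (x.1.1 : ZMod (p ^ K))) ∈ R) :
    (fun x : S => (x.1.2 : ZMod (p ^ K))) ∈ R := by
  refine mem_subring_of_root_eval p K h.prime R (fun x => evalRingHom x.1.1)
    (eval_mem_subring h1) (fun l x x' => eval_modEq (h.fst _ x.2 _ x'.2) l) Γ (fun x => x.1.2)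
    (fun x x' => h.snd _ x.2 _ x'.2) (fun x => ?_) (fun x => ?_)
  · rw [← evalEval_eq_eval_map]; exact hΓ _ x.2
  · rw [← evalEval_eq_eval_map]; exact hd _ x.2

theorem card_cell_vertical {U V M D : ℕ} (hU : 0 < U) (hV : 0 < V) (a : ℤ) {Δ : ℤ[X][X]}
    (hΔ : Bd D Δ) (hsq : ¬ IsSquare ((Δ.map (evalRingHom a)).map (castRingHom ℚ)))
    (S : Finset (ℤ × ℤ)) (y : ℤ × ℤ → ℤ) (ha : ∀ x ∈ S, x.1 = a) (hSU : ∀ x ∈ S, |x.2| ≤ U)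
    (hSV : ∀ x ∈ S, |y x| ≤ V) (hy : ∀ x ∈ S, Δ.evalEval x.1 x.2 = y x ^ 2)
    (I : Finset ℕ) (hI : ∀ p ∈ I, GoodCell p S y)
    (h : (4 * (M + 1)) ^ (2 * (M + 1)) * (U ^ (M * (M + 1)) * V ^ (M + 1)) <
      (∏ p ∈ I, p) ^ (2 * M ^ 2 + 3 * M)) :
    S.card ≤ 2 * M + D := by
  refine card_le_of_square_relation hU hV hsq (natDegree_map_le.trans (natDegree_map_le.trans hΔ.1))
    S Prod.snd y (fun x hx x' hx' hxx => Prod.ext ((ha x hx).trans (ha x' hx').symm) hxx) hSU hSV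
    (fun x hx => ?_) I (fun p hp => (hI p hp).prime) (fun p hp => ⟨fun _ x => x.1.2, fun _ x x' =>
      (hI p hp).snd _ x.2 _ x'.2, fun K => ?_⟩) h
  · have := eval_intCast_map (castRingHom ℚ) (Δ.map (evalRingHom a)) x.2
    rw [Int.cast_id] at this
    simp only [eq_intCast] at this
    rw [this, ← evalEval_eq_eval_map, ← ha x hx, hy x hx]
    simp
  · have h2 : (fun x : S => (x.1.2 : ZMod (p ^ K))) ∈ locRing p K (fun (_ : Fin 1) (x : S) => x.1.2) :=
      Subring.subset_closure ⟨0, rfl⟩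
    refine ⟨h2, (hI p hp).sq_mem hy K ?_ h2⟩
    have := intCast_mem (locRing p K (fun (_ : Fin 1) (x : S) => x.1.2)) a
    convert this using 1
    funext x
    simp [ha x.1 x.2]

theorem card_cell_curve {W V M D E : ℕ} (hW : 0 < W) (hV : 0 < V) (hWV : W ≤ V) {Δ Γ : ℤ[X][X]}
    (hΔ : Bd E Δ) (hsq : ∀ m c : ℚ, ¬ IsSquare (restrictLine Δ m c))
    (hΓ : Irreducible Γ) (hdeg : Γ.natDegree ≠ 0) (hD : Bd D Γ)
    (S : Finset (ℤ × ℤ)) (y : ℤ × ℤ → ℤ) (hS : ∀ x ∈ S, Γ.evalEval x.1 x.2 = 0)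
    (hS1 : ∀ x ∈ S, |x.1| ≤ W) (hS2 : ∀ x ∈ S, |x.2| ≤ W)
    (hSV : ∀ x ∈ S, |y x| ≤ V) (hy : ∀ x ∈ S, Δ.evalEval x.1 x.2 = y x ^ 2)
    (I : Finset ℕ) (hI : ∀ p ∈ I, GoodCell p S y)
    (hd : ∀ p ∈ I, ∀ x ∈ S, ¬ (p : ℤ) ∣ (derivative Γ).evalEval x.1 x.2)
    (h : (4 * (M + 1)) ^ (2 * (M + 1)) * ((2 * W) ^ (M * (M + 1)) * V ^ (M + 1)) <
      (∏ p ∈ I, p) ^ (2 * M ^ 2 + 3 * M)) :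
    S.card ≤ (D + M + 3) ^ 3 + 2 * E := by
  classical
  have hmem : ∀ p ∈ I, ∀ K, (fun x : S => (x.1.1 : ZMod (p ^ K))) ∈
      locRing p K (fun (_ : Fin 1) (x : S) => x.1.1) ∧ (fun x : S => (x.1.2 : ZMod (p ^ K))) ∈
      locRing p K (fun (_ : Fin 1) (x : S) => x.1.1) := by
    intro p hp K
    have h1 : (fun x : S => (x.1.1 : ZMod (p ^ K))) ∈
      locRing p K (fun (_ : Fin 1) (x : S) => x.1.1) := Subring.subset_closure ⟨0, rfl⟩
    exact ⟨h1, (hI p hp).curve_mem hS (hd p hp) K h1⟩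
  have hmod : ∀ p ∈ I, ∀ (i : Fin 1) (x x' : S), (fun (_ : Fin 1) (x : S) => x.1.1) i x ≡
      (fun (_ : Fin 1) (x : S) => x.1.1) i x' [ZMOD p] :=
    fun p hp i x x' => (hI p hp).fst _ x.2 _ x'.2
  have h1W : 1 ≤ 2 * W := by omega
  have hlt : ∀ {U : ℕ}, U ≤ 2 * W → (4 * (M + 1)) ^ (2 * (M + 1)) * (U ^ (M * (M + 1)) * V ^ (M + 1)) <
      (∏ p ∈ I, p) ^ (2 * M ^ 2 + 3 * M) := fun {U} hU => lt_of_le_of_lt (by gcongr) h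
  have hS2V : ∀ x ∈ S, |x.2| ≤ V := fun x hx => (hS2 x hx).trans (by exact_mod_cast hWV)
  have hS1V : ∀ x ∈ S, |x.1| ≤ V := fun x hx => (hS1 x hx).trans (by exact_mod_cast hWV)
  by_cases hd2 : 2 ≤ Γ.natDegree
  · have := card_le_of_curve_relation (U := W) hW hV hΓ hd2 hD S id (Set.injOn_id _) hS hS1 hS2V I
      (fun p hp => (hI p hp).prime) (fun p hp => ⟨_, hmod p hp, hmem p hp⟩) (hlt (by omega))
    refine (this.trans ?_).trans (Nat.le_add_right _ _)
    gcongr; omega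
  by_cases hs2 : 2 ≤ (Bivariate.swap Γ).natDegree
  · have := card_le_of_curve_relation (U := W) hW hV
      ((MulEquiv.irreducible_iff (Bivariate.swap (R := ℤ))).2 hΓ) hs2 hD.swap S Prod.swap
      Prod.swap_injective.injOn
      (fun x hx => by rw [Prod.fst_swap, Prod.snd_swap, evalEval_swap]; exact hS x hx)
      hS2 hS1V I (fun p hp => (hI p hp).prime)
      (fun p hp => ⟨_, hmod p hp, fun K => ⟨(hmem p hp K).2, (hmem p hp K).1⟩⟩) (hlt (by omega))
    refine (this.trans ?_).trans (Nat.le_add_right _ _)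
    gcongr; omega
  obtain ⟨g0, g1, hg⟩ : ∃ g0 g1 : ℤ[X], Γ = C g1 * X + C g0 :=
    by
    obtain ⟨g1, g0, h⟩ := exists_eq_X_add_C_of_natDegree_le_one (show Γ.natDegree ≤ 1 by omega)
    exact ⟨g0, g1, h⟩
  have hc0 : Γ.coeff 0 = g0 := by simp [hg]
  have hc1 : Γ.coeff 1 = g1 := by simp [hg, coeff_C]
  obtain ⟨s, r, hg0⟩ : ∃ s r : ℤ, g0 = C s * X + C r :=
    exists_eq_X_add_C_of_natDegree_le_one (by
      have := natDegree_coeff_le_swap Γ 0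
      rw [hc0] at this; omega)
  obtain ⟨γ, β, hg1⟩ : ∃ γ β : ℤ, g1 = C γ * X + C β :=
    exists_eq_X_add_C_of_natDegree_le_one (by
      have := natDegree_coeff_le_swap Γ 1
      rw [hc1] at this; omega)
  have hval : ∀ a b : ℤ, Γ.evalEval a b = (γ * a + β) * b + (s * a + r) := by
    intro a b
    simp [hg, hg0, hg1, evalEval_add, evalEval_mul, evalEval_C, evalEval_X]
  by_cases hγ : γ = 0
  · have hβ : β ≠ 0 := by
      rintro rfl
      apply hdeg
      simp [hg, hg1, hγ]
    have hβ' : (β : ℚ) ≠ 0 := by exact_mod_cast hβ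
    have hline : ∀ x ∈ S, (-s / β : ℚ) * x.1 + (-r / β) = x.2 := by
      intro x hx
      have h1 := hS x hx
      rw [hval, hγ] at h1
      have h2 : (β : ℚ) * x.2 + (s * x.1 + r) = 0 := by exact_mod_cast (by linarith)
      field_simp
      linarith
    have hinj : InjOn Prod.fst (S : Set (ℤ × ℤ)) := by
      intro x hx x' hx' hxx
      refine Prod.ext hxx ?_
      have h1 := hline x hx
      have h2 := hline x' hx'
      rw [hxx, h2] at h1
      exact_mod_cast h1.symm
    have := card_le_of_square_relation (U := W) hW hV (hsq (-s / β) (-r / β))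
      (natDegree_restrictLine_le hΔ _ _) S Prod.fst y hinj hS1 hSV (fun x hx => by
        rw [eval_restrictLine Δ _ _ _ _ (hline x hx), hy x hx]; push_cast; rfl) I
      (fun p hp => (hI p hp).prime) (fun p hp => ⟨_, hmod p hp, fun K => ⟨(hmem p hp K).1,
        (hI p hp).sq_mem hy K (hmem p hp K).1 (hmem p hp K).2⟩⟩) (hlt (by omega))
    have h3 : 2 * M ≤ (D + M + 3) ^ 3 := by calc 2 * M ≤ 3 * (D + M + 3) := by omega
        _ ≤ (D + M + 3) ^ 2 * (D + M + 3) := by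
          gcongr
          nlinarith [show 3 ≤ D + M + 3 by omega]
        _ = _ := by ring
    omega
  · set Γ' : ℤ[X][X] := Bivariate.swap (taylorEquiv (-X) Γ) with hΓ'
    have hform : Γ' = C (C (-γ)) * X ^ 2 + C (C γ * X + C (s - β)) * X + C (C β * X + C r) := by
      rw [hΓ', hg, hg0, hg1]
      change Bivariate.swap (taylor (-X) _) = _
      simp only [map_add, taylor_mul, taylor_C, taylor_X, map_mul, Bivariate.swap_C, Bivariate.swap_Y,
        Polynomial.map_add, Polynomial.map_mul, map_C, map_X, map_neg, Polynomial.map_neg, map_sub]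
      ring
    have hval' : ∀ u v : ℤ, Γ'.evalEval u v = Γ.evalEval v (u - v) := by
      intro u v
      rw [hval, hform]
      simp only [evalEval_add, evalEval_mul, evalEval_C, evalEval_X, evalEval_pow, eval_C, eval_add,
        eval_mul, eval_X]
      ring
    have hdeg2 : Γ'.natDegree = 2 := by
      rw [hform]
      exact natDegree_quadratic (by simpa using hγ)
    have hB : Bd 2 Γ' := by
      refine ⟨hdeg2.le, ?_⟩
      rw [hΓ', Bivariate.swap_swap_apply]
      change (taylor (-X) Γ).natDegree ≤ 2
      rw [natDegree_taylor]
      omega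
    have hirr : Irreducible Γ' :=
      (MulEquiv.irreducible_iff (Bivariate.swap (R := ℤ))).2
        ((MulEquiv.irreducible_iff (taylorEquiv (-X : ℤ[X]))).2 hΓ)
    have := card_le_of_curve_relation (U := 2 * W) (by omega) hV hirr hdeg2.ge hB S
      (fun x => (x.1 + x.2, x.1)) (fun x hx x' hx' hxx => by
        simp only [Prod.mk.injEq] at hxx
        exact Prod.ext hxx.2 (by linarith [hxx.1, hxx.2]))
      (fun x hx => by simp only [hval', add_sub_cancel_left]; exact hS x hx)
      (fun x hx => (abs_add_le _ _).trans (by push_cast; linarith [hS1 x hx, hS2 x hx]))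
      hS1V I (fun p hp => (hI p hp).prime)
      (fun p hp => ⟨_, hmod p hp, fun K => ⟨by
        convert add_mem (hmem p hp K).1 (hmem p hp K).2 using 1
        funext x
        simp, (hmem p hp K).1⟩⟩) (hlt le_rfl)
    refine (this.trans ?_).trans (Nat.le_add_right _ _)
    exact Nat.pow_le_pow_left (by omega) 3

/-- Exponents of the monomials used for the surface relation: `(t, i), ι, ι', k`. -/
abbrev SurfIndex (n d M : ℕ) : Type := ((Σ t : Fin M, Fin (t + 1)) × Fin n × Fin (n - 1)) × Fin d

namespace SurfIndex

variable {n d M : ℕ}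

/-- The exponent of the first variable. -/
def fstExp (j : SurfIndex n d M) : ℕ := n * j.1.1.2 + j.1.2.1

/-- The exponent of the second variable. -/
def sndExp (j : SurfIndex n d M) : ℕ := (n - 1) * (j.1.1.1 - j.1.1.2) + j.1.2.2

/-- The size of the monomial. -/
def size (κ : ℕ) (j : SurfIndex n d M) : ℕ := n * (n - 1) * (j.1.1.1 + 2) + κ * d

theorem fstExp_lt (j : SurfIndex n d M) : j.fstExp < n * M := by
  have h1 := j.1.1.2.2
  have h2 := j.1.1.1.2
  have h3 := j.1.2.1.2
  calc j.fstExp < n * j.1.1.2 + n := Nat.add_lt_add_left h3 _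
    _ = n * (j.1.1.2 + 1) := by ring
    _ ≤ n * M := Nat.mul_le_mul_left _ (by omega)

theorem sndExp_lt (j : SurfIndex n d M) : j.sndExp < n * M := by
  have h1 := j.1.1.2.2
  have h2 := j.1.1.1.2
  have h3 := j.1.2.2.2
  calc j.sndExp < (n - 1) * (j.1.1.1 - j.1.1.2) + (n - 1) := Nat.add_lt_add_left h3 _
    _ = (n - 1) * (j.1.1.1 - j.1.1.2 + 1) := by ring
    _ ≤ n * M := Nat.mul_le_mul (by omega) (by omega)

theorem ext_exp {j j' : SurfIndex n d M} (h1 : j.fstExp = j'.fstExp) (h2 : j.sndExp = j'.sndExp)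
    (h3 : j.2 = j'.2) : j = j' := by
  obtain ⟨⟨⟨⟨t, ht⟩, ⟨i, hi⟩⟩, ⟨a, ha⟩, ⟨b, hb⟩⟩, k⟩ := j
  obtain ⟨⟨⟨⟨t', ht'⟩, ⟨i', hi'⟩⟩, ⟨a', ha'⟩, ⟨b', hb'⟩⟩, k'⟩ := j'
  simp only [fstExp, sndExp] at h1 h2 h3
  have hi2 : i = i' := by
    have := congrArg (· / n) h1
    simpa [Nat.mul_add_div (by omega : 0 < n), div_eq_of_lt ha, div_eq_of_lt ha'] using this
  have ht2 : t - i = t' - i' := by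
    have := congrArg (· / (n - 1)) h2
    simpa [Nat.mul_add_div (by omega : 0 < n - 1), div_eq_of_lt hb, div_eq_of_lt hb'] using this
  simp only at hi hi'
  have ht3 : t = t' := by omega
  subst hi2 ht3 h3
  have : a = a' := by omega
  have : b = b' := by omega
  subst a' b'
  rfl

theorem card_eq : 2 * Fintype.card (SurfIndex n d M) = n * (n - 1) * d * (M * (M + 1)) := by
  have h : 2 * ∑ t ∈ range M, (t + 1) = M * (M + 1) := by
    induction M with
    | zero => simp
    | succ M ih => rw [sum_range_succ, mul_add, ih]; ring
  simp only [card_prod, Fintype.card_sigma, card_fin]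
  rw [Fin.sum_univ_eq_sum_range (fun t => t + 1)]
  linear_combination (n * (n - 1) * d) * h

theorem sum_size (κ : ℕ) : 6 * ∑ j : SurfIndex n d M, j.size κ =
    n * (n - 1) * d * (2 * (n * (n - 1)) * (M * (M + 1) * (M + 2)) + 3 * (κ * d) * (M * (M + 1))) := by
  simp only [size]
  rw [sum_prod_type, sum_prod_type, sum_sigma]
  simp only [sum_const, card_univ, card_fin, card_prod, smul_eq_mul]
  rw [Fin.sum_univ_eq_sum_range
    (fun t => (t + 1) * (n * (n - 1) * (d * (n * (n - 1) * (t + 2) + κ * d))))]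
  induction M with
  | zero => simp
  | succ M ih => rw [sum_range_succ, mul_add, ih]; ring

end SurfIndex

/-- The auxiliary polynomial vanishing on all points of one cell of the surface. -/
theorem exists_surface_relation {Ω : Type*} (n d M κ H K : ℕ) (hH : 0 < H) (hn : 2 ≤ n) (hd : 0 < d)
    (hM : 0 < M) (a b z : Ω → ℤ) (ha : ∀ x, |a x| ≤ (H : ℤ) ^ (n - 1)) (hb : ∀ x, |b x| ≤ (H : ℤ) ^ n)
    (hz : ∀ x, |z x| ≤ (H : ℤ) ^ κ) (I : Finset ℕ) (hI : ∀ p ∈ I, p.Prime)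
    (hab : ∀ p ∈ I, ∀ i x y, (![a, b] : Fin 2 → Ω → ℤ) i x ≡ (![a, b] : Fin 2 → Ω → ℤ) i y [ZMOD p])
    (hloc : ∀ p ∈ I, (fun x => (z x : ZMod (p ^ K))) ∈ locRing p K (![a, b] : Fin 2 → Ω → ℤ))
    (w s W : ℕ) (hw : 6 * w = K * (K + 1) * (K + 2)) (hs : 2 * s = n * (n - 1) * d * (M * (M + 1)))
    (hW : 6 * W = n * (n - 1) * d *
      (2 * (n * (n - 1)) * (M * (M + 1) * (M + 2)) + 3 * (κ * d) * (M * (M + 1))))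
    (h : (2 * s) ^ s * ((∏ p ∈ I, p) ^ w * H ^ W) < ((∏ p ∈ I, p) ^ K) ^ s) :
    ∃ A : ℤ[X][X][X], A ≠ 0 ∧ A.natDegree < d ∧ (∀ k, Bd (n * M) (A.coeff k)) ∧
      (∀ x, (A.map (evalEvalRingHom (a x) (b x))).eval (z x) = 0) ∧
      ∀ k, ∀ a' b' Y : ℤ, 1 ≤ Y → |a'| ≤ Y → |b'| ≤ Y →
        |(A.coeff k).evalEval a' b'| ≤ s * (∏ p ∈ I, p : ℕ) ^ K * Y ^ (2 * (n * M)) := by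
  classical
  have hs' : Fintype.card (SurfIndex n d M) = s := by
    have := SurfIndex.card_eq (n := n) (d := d) (M := M); omega
  have hW' : ∑ j : SurfIndex n d M, j.size κ = W := by
    have := SurfIndex.sum_size (n := n) (d := d) (M := M) κ; omega
  have hw' : ∑ i ∈ range K, ∑ j ∈ range (K - i), (K - i - j) = w := by
    have := sum_range_sum_range_sub K; omega
  let _ : Nonempty (SurfIndex n d M) :=
    ⟨((⟨⟨0, hM⟩, ⟨0, by simp⟩⟩, ⟨0, by omega⟩, ⟨0, by omega⟩), ⟨0, hd⟩)⟩
  obtain ⟨c, hc, hcb, hrel⟩ := exists_int_relation' (Ω := Ω) (ι := SurfIndex n d M)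
    (fun j x => a x ^ j.fstExp * b x ^ j.sndExp * z x ^ (j.2 : ℕ)) (fun j => H ^ j.size κ)
    (fun j => by positivity) (fun j x => by
      have h1 : |a x| ^ j.fstExp ≤ ((H : ℤ) ^ (n - 1)) ^ j.fstExp :=
        pow_le_pow_left₀ (abs_nonneg _) (ha x) _
      have h2 : |b x| ^ j.sndExp ≤ ((H : ℤ) ^ n) ^ j.sndExp :=
        pow_le_pow_left₀ (abs_nonneg _) (hb x) _
      have h3 : |z x| ^ (j.2 : ℕ) ≤ ((H : ℤ) ^ κ) ^ (j.2 : ℕ) :=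
        pow_le_pow_left₀ (abs_nonneg _) (hz x) _
      rw [abs_mul, abs_mul, abs_pow, abs_pow, abs_pow]
      push_cast
      refine (mul_le_mul (mul_le_mul h1 h2 (by positivity) (by positivity)) h3 (by positivity)
        (by positivity)).trans ?_
      rw [← pow_mul, ← pow_mul, ← pow_mul, ← pow_add, ← pow_add]
      refine pow_le_pow_right₀ (by exact_mod_cast hH) ?_
      obtain ⟨⟨⟨⟨t, ht⟩, ⟨i, hi⟩⟩, ⟨u, hu⟩, ⟨v, hv⟩⟩, ⟨k, hk⟩⟩ := j
      simp only [SurfIndex.fstExp, SurfIndex.sndExp, SurfIndex.size] at *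
      obtain ⟨r, rfl⟩ := Nat.exists_eq_add_of_le (Nat.lt_succ_iff.1 hi)
      obtain ⟨m, rfl⟩ := Nat.exists_eq_add_of_le' hn
      simp only [Nat.add_sub_cancel_left, show m + 2 - 1 = m + 1 by omega] at *
      have e1 : (m + 1) * u ≤ (m + 1) * (m + 2) := Nat.mul_le_mul_left _ hu.le
      have e2 : (m + 2) * v ≤ (m + 2) * (m + 1) := Nat.mul_le_mul_left _ hv.le
      have e3 : κ * k ≤ κ * d := Nat.mul_le_mul_left _ hk.le
      nlinarith) I hI K w
    (fun p => (locRing p K (![a, b] : Fin 2 → Ω → ℤ)).toAddSubgroup)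
    (fun p hp => by
      have := locRing_card_two p K (hI p hp) (![a, b]) (hab p hp)
      rwa [hw'] at this)
    (fun p hp j => by
      have h1 : (fun x => (a x : ZMod (p ^ K))) ∈ locRing p K (![a, b] : Fin 2 → Ω → ℤ) :=
        Subring.subset_closure ⟨0, rfl⟩
      have h2 : (fun x => (b x : ZMod (p ^ K))) ∈ locRing p K (![a, b] : Fin 2 → Ω → ℤ) :=
        Subring.subset_closure ⟨1, rfl⟩
      have := Subring.mul_mem _ (Subring.mul_mem _ (Subring.pow_mem _ h1 j.fstExp)
        (Subring.pow_mem _ h2 j.sndExp)) (Subring.pow_mem _ (hloc p hp) (j.2 : ℕ))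
      change _ ∈ locRing p K _
      convert this using 1
      funext x
      simp)
    (by rwa [hs', prod_pow_eq_pow_sum, hW'])
  refine ⟨∑ j, monomial (j.2 : ℕ) (monomial j.sndExp (monomial j.fstExp (c j))), ?_, ?_, ?_, ?_, ?_⟩
  · intro h0
    apply hc
    funext j
    have := congrArg (fun A : ℤ[X][X][X] => ((A.coeff (j.2 : ℕ)).coeff j.sndExp).coeff j.fstExp) h0
    simp only [finsetSum_coeff, coeff_zero] at this
    rw [Finset.sum_eq_single j] at this
    · simpa using this
    · intro j' _ hj'
      by_cases e3 : j'.2 = j.2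
      · rw [e3, coeff_monomial_same]
        by_cases e2 : j'.sndExp = j.sndExp
        · rw [e2, coeff_monomial_same]
          refine coeff_monomial_of_ne _ fun e1 => hj' (SurfIndex.ext_exp e1.symm e2 e3)
        · rw [coeff_monomial_of_ne _ (Ne.symm e2), coeff_zero]
      · rw [coeff_monomial_of_ne _ (fun h => e3 (Fin.ext h.symm)), coeff_zero, coeff_zero]
    · simp
  · refine lt_of_le_of_lt (b := d - 1) (natDegree_sum_le_of_forall_le _ _ fun j _ => ?_) (by omega)
    refine (natDegree_monomial_le _).trans ?_
    have := j.2.2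
    omega
  · intro k
    rw [finsetSum_coeff]
    refine Bd.sum _ fun j _ => ?_
    rw [coeff_monomial]
    split_ifs with hk
    · refine ⟨(natDegree_monomial_le _).trans j.sndExp_lt.le, ?_⟩
      rw [Bivariate.swap_monomial_monomial]
      exact (natDegree_monomial_le _).trans j.fstExp_lt.le
    · exact Bd.zero _
  · intro x
    rw [← hrel x, Polynomial.map_sum, eval_finsetSum]
    refine sum_congr rfl fun j _ => ?_
    rw [map_monomial, eval_monomial, coe_evalEvalRingHom, evalEval, eval_monomial, eval_mul,
      eval_monomial, eval_pow, eval_C]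
    ring
  · intro k a' b' Y hY ha' hb'
    have hq0 : (0 : ℤ) ≤ (∏ p ∈ I, p : ℕ) := Int.natCast_nonneg _
    have hterm : ∀ j : SurfIndex n d M,
        |((monomial (j.2 : ℕ) (monomial j.sndExp (monomial j.fstExp (c j)))).coeff k).evalEval a' b'| ≤
          (∏ p ∈ I, p : ℕ) ^ K * Y ^ (2 * (n * M)) := by
      intro j
      rw [coeff_monomial]
      split_ifs with hk
      · rw [evalEval, eval_monomial, eval_mul, eval_monomial, eval_pow, eval_C, abs_mul, abs_mul, mul_assoc]
        refine mul_le_mul (by exact_mod_cast hcb j) ?_ (by positivity) (by positivity)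
        rw [abs_pow, abs_pow]
        refine (mul_le_mul (pow_le_pow_left₀ (abs_nonneg _) ha' _)
          (pow_le_pow_left₀ (abs_nonneg _) hb' _) (by positivity) (by positivity)).trans ?_
        rw [← pow_add]
        refine pow_le_pow_right₀ hY ?_
        have := j.fstExp_lt
        have := j.sndExp_lt
        omega
      · simp only [evalEval_zero, abs_zero]
        positivity
    rw [finsetSum_coeff, evalEval_finsetSum]
    refine (abs_sum_le_sum_abs _ _).trans ((sum_le_sum fun j _ => hterm j).trans ?_)
    rw [sum_const, card_univ, hs', nsmul_eq_mul, mul_assoc]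

set_option maxHeartbeats 1000000 in
theorem exists_surface_exponents (n d κ : ℕ) (hn : 2 ≤ n) (hd : 0 < d) (ε : ℝ) (hε : 0 < ε) :
    ∃ M K w s W H₀ : ℕ, 0 < M ∧ 6 * w = K * (K + 1) * (K + 2) ∧
      2 * s = n * (n - 1) * d * (M * (M + 1)) ∧
      6 * W = n * (n - 1) * d *
        (2 * (n * (n - 1)) * (M * (M + 1) * (M + 2)) + 3 * (κ * d) * (M * (M + 1))) ∧
      ∀ H q : ℕ, H₀ ≤ H → (H : ℝ) ^ (√((n : ℝ) * (n - 1) / d) + ε) ≤ q →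
        (2 * s) ^ s * (q ^ w * H ^ W) < (q ^ K) ^ s := by
  obtain ⟨ν, hν⟩ : ∃ ν, ν = n * (n - 1) := ⟨_, rfl⟩
  have hν0 : 0 < ν := hν ▸ Nat.mul_pos (by omega) (by omega)
  have hνr : (n : ℝ) * (n - 1) = ν := by
    rw [hν]; push_cast [cast_sub (by omega : 1 ≤ n)]; ring
  rw [hνr, ← hν]
  set ρ := √((d : ℝ) * ν) with hρ
  set π := √((ν : ℝ) / d) with hπ
  have hdr : (0 : ℝ) < d := by exact_mod_cast hd
  have hνr0 : (0 : ℝ) < ν := by exact_mod_cast hν0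
  have hρ2 : ρ ^ 2 = d * ν := Real.sq_sqrt (by positivity)
  have hπρ : π * ρ = ν := by
    rw [hπ, hρ, ← sqrt_mul (by positivity)]
    rw [show (ν : ℝ) / d * (d * ν) = ν ^ 2 by field_simp]
    exact sqrt_sq hνr0.le
  have hρ1 : 1 ≤ ρ := by
    rw [hρ]
    refine Real.one_le_sqrt.2 ?_
    exact_mod_cast Nat.mul_pos hd hν0
  have hπ0 : 0 ≤ π := sqrt_nonneg _
  obtain ⟨M, hM⟩ := exists_nat_ge
    ((8 * (π + ε) * ρ ^ 2 + ρ ^ 2 * (10 * ν + 6 * (κ * d)) + 6) / (2 * ε * ρ ^ 3))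
  have hM0 : 0 < M := by
    have : (0 : ℝ) < M := lt_of_lt_of_le (by positivity) hM
    exact_mod_cast this
  have hM1 : (1 : ℝ) ≤ M := by exact_mod_cast hM0
  rw [div_le_iff₀ (by positivity)] at hM
  set K := ⌊ρ * M⌋₊ with hK
  have hK1 : (K : ℝ) ≤ ρ * M := Nat.floor_le (by positivity)
  have hK2 : ρ * M - 1 < K := by have := Nat.lt_floor_add_one (ρ * M); linarith
  have hw := sum_range_sum_range_sub K
  set w := ∑ i ∈ range K, ∑ j ∈ range (K - i), (K - i - j)
  have hs := SurfIndex.card_eq (n := n) (d := d) (M := M)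
  set s := Fintype.card (SurfIndex n d M)
  have hW := SurfIndex.sum_size (n := n) (d := d) (M := M) κ
  set W := ∑ j : SurfIndex n d M, j.size κ
  rw [← hν] at hs hW
  have hwr : 6 * (w : ℝ) = K * (K + 1) * (K + 2) := by exact_mod_cast hw
  have hsr : 2 * (s : ℝ) = ν * d * (M * (M + 1)) := by exact_mod_cast hs
  have hWr : 6 * (W : ℝ) = ν * d * (2 * ν * (M * (M + 1) * (M + 2)) + 3 * (κ * d) * (M * (M + 1))) := by
    exact_mod_cast hW
  have hmain1 : 2 * ρ ^ 3 * M ^ 3 - 8 * ρ ^ 2 * M ^ 2 ≤ 6 * ((K : ℝ) * s - w) := by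
    have e1 : 6 * ((K : ℝ) * s - w) = 3 * K * (ρ ^ 2 * (M * (M + 1))) - K * (K + 1) * (K + 2) := by
      rw [hρ2]; linear_combination 3 * (K : ℝ) * hsr - hwr
    have e2 : (K : ℝ) * (K + 1) * (K + 2) ≤ ρ * M * (ρ * M + 1) * (ρ * M + 2) := by gcongr
    have e3 : 3 * (ρ * M - 1) * (ρ ^ 2 * (M * M)) ≤ 3 * K * (ρ ^ 2 * (M * (M + 1))) := by
      have : (0 : ℝ) ≤ K := cast_nonneg _
      have h1 : 3 * (ρ * M - 1) ≤ 3 * K := by linarith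
      calc _ ≤ 3 * (K : ℝ) * (ρ ^ 2 * (M * M)) := by gcongr
        _ ≤ _ := by gcongr; linarith
    have e4 : ρ * M ≤ (ρ * M) ^ 2 := by nlinarith [mul_le_mul hρ1 hM1 (by norm_num) (by linarith)]
    linarith
  have hmain2 : 6 * (W : ℝ) ≤ 2 * ρ ^ 2 * ν * M ^ 3 + ρ ^ 2 * (10 * ν + 6 * (κ * d)) * M ^ 2 := by
    have h2 : (M : ℝ) ≤ M ^ 2 := by nlinarith
    have e1 : (M : ℝ) * (M + 1) ≤ 2 * M ^ 2 := by linarith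
    have e2 : (M : ℝ) * (M + 1) * (M + 2) ≤ M ^ 3 + 5 * M ^ 2 := by linarith
    rw [hWr, hρ2]
    have : (ν : ℝ) * d * (2 * ν * (M * (M + 1) * (M + 2)) + 3 * (κ * d) * (M * (M + 1))) ≤
      ν * d * (2 * ν * (M ^ 3 + 5 * M ^ 2) + 3 * (κ * d) * (2 * M ^ 2)) := by gcongr
    refine this.trans (le_of_eq ?_)
    ring
  have hmain : (W : ℝ) + 1 ≤ (π + ε) * (K * s - w) := by
    have h1 : (π + ε) * (2 * ρ ^ 3 * M ^ 3 - 8 * ρ ^ 2 * M ^ 2) ≤ (π + ε) * (6 * ((K : ℝ) * s - w)) :=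
      mul_le_mul_of_nonneg_left hmain1 (by positivity)
    have h2 : (π + ε) * (2 * ρ ^ 3 * M ^ 3 - 8 * ρ ^ 2 * M ^ 2) = 2 * ρ ^ 2 * ν * M ^ 3 +
        (M * (2 * ε * ρ ^ 3)) * M ^ 2 - 8 * (π + ε) * ρ ^ 2 * M ^ 2 := by
      rw [← hπρ]; ring
    have h3 := mul_le_mul_of_nonneg_right hM (sq_nonneg (M : ℝ))
    have h4 : (1 : ℝ) ≤ M ^ 2 := by nlinarith
    linarith
  refine ⟨M, K, w, s, W, (2 * s) ^ s + 1, hM0, hw, hs, hW, fun H q hH hq => ?_⟩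
  have hH1 : (1 : ℝ) ≤ H := by
    have : 1 ≤ H := by omega
    exact_mod_cast this
  have hq1 : (1 : ℝ) ≤ q := (one_le_rpow hH1 (by positivity)).trans hq
  have hKs : w ≤ K * s := by
    have h0 : (0 : ℝ) < (π + ε) * (K * s - w) := lt_of_lt_of_le (by positivity) hmain
    have := (pos_iff_pos_of_mul_pos h0).1 (by positivity)
    have : (w : ℝ) ≤ K * s := by linarith
    exact_mod_cast this
  obtain ⟨e, he⟩ := Nat.exists_eq_add_of_le hKs
  have her : (K : ℝ) * s - w = e := by
    have : (K : ℝ) * s = w + e := by exact_mod_cast he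
    linarith
  rw [her] at hmain
  have hqe : (H : ℝ) ^ (W + 1) ≤ (q : ℝ) ^ e := by
    calc (H : ℝ) ^ (W + 1) = (H : ℝ) ^ ((W : ℝ) + 1) := by
          rw [← rpow_natCast]; push_cast; rfl
      _ ≤ (H : ℝ) ^ ((π + ε) * e) := rpow_le_rpow_of_exponent_le hH1 hmain
      _ = ((H : ℝ) ^ (π + ε)) ^ e := by rw [rpow_mul (by positivity), rpow_natCast]
      _ ≤ _ := by gcongr
  have hqe' : H ^ (W + 1) ≤ q ^ e := by exact_mod_cast hqe
  have hq0 : 0 < q := by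
    have : (0 : ℝ) < q := by linarith
    exact_mod_cast this
  rw [← pow_mul, he, pow_add]
  calc (2 * s) ^ s * (q ^ w * H ^ W) < H * (q ^ w * H ^ W) := by
        refine Nat.mul_lt_mul_of_pos_right (by omega) ?_
        have : 0 < H := by omega
        positivity
    _ = q ^ w * H ^ (W + 1) := by ring
    _ ≤ _ := Nat.mul_le_mul_left _ hqe'

/-- The congruence conditions on a cell of the surface modulo `p`. -/
structure GoodSurfaceCell (p : ℕ) (Φ : ℤ[X][X][X]) (S : Finset (ℤ × ℤ)) (z : ℤ × ℤ → ℤ) : Prop where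
  prime : p.Prime
  fst : ∀ x ∈ S, ∀ x' ∈ S, x.1 ≡ x'.1 [ZMOD p]
  snd : ∀ x ∈ S, ∀ x' ∈ S, x.2 ≡ x'.2 [ZMOD p]
  root : ∀ x ∈ S, ∀ x' ∈ S, z x ≡ z x' [ZMOD p]
  not_dvd : ∀ x ∈ S, ¬ (p : ℤ) ∣ ((derivative Φ).map (evalEvalRingHom x.1 x.2)).eval (z x)

theorem GoodSurfaceCell.mem {p : ℕ} {Φ : ℤ[X][X][X]} {S : Finset (ℤ × ℤ)} {z : ℤ × ℤ → ℤ}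
    (h : GoodSurfaceCell p Φ S z)
    (hz : ∀ x ∈ S, (Φ.map (evalEvalRingHom x.1 x.2)).eval (z x) = 0) (K : ℕ)
    {R : Subring (S → ZMod (p ^ K))}
    (h1 : (fun x : S => (x.1.1 : ZMod (p ^ K))) ∈ R) (h2 : (fun x : S => (x.1.2 : ZMod (p ^ K))) ∈ R) :
    (fun x : S => (z x.1 : ZMod (p ^ K))) ∈ R :=
  mem_subring_of_root_eval p K h.prime R (fun x => evalEvalRingHom x.1.1 x.1.2)
    (evalEval_mem_subring h1 h2)
    (fun l x x' => evalEval_modEq (h.fst _ x.2 _ x'.2) (h.snd _ x.2 _ x'.2) l) Φ (fun x => z x.1)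
    (fun x x' => h.root _ x.2 _ x'.2) (fun x => hz _ x.2) (fun x => h.not_dvd _ x.2)

theorem exists_cell_norm (n d κ D : ℕ) (hn : 2 ≤ n) (hd : 0 < d) (ε : ℝ) (hε : 0 < ε) :
    ∃ D' κ' H₀ : ℕ, ∀ H : ℕ, H₀ ≤ H → ∀ Φ : ℤ[X][X][X], Irreducible Φ → Φ.natDegree = d →
      (∀ k, Bd D (Φ.coeff k)) →
      (∀ k, ∀ a b : ℤ, |a| ≤ 2 * (H : ℤ) ^ n → |b| ≤ 2 * (H : ℤ) ^ n →
        |(Φ.coeff k).evalEval a b| ≤ (H : ℤ) ^ κ) →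
      ∀ (S : Finset (ℤ × ℤ)) (z : ℤ × ℤ → ℤ), (∀ x ∈ S, |x.1| ≤ (H : ℤ) ^ (n - 1)) →
      (∀ x ∈ S, |x.2| ≤ (H : ℤ) ^ n) → (∀ x ∈ S, |z x| ≤ (H : ℤ) ^ κ) →
      (∀ x ∈ S, (Φ.map (evalEvalRingHom x.1 x.2)).eval (z x) = 0) →
      ∀ I : Finset ℕ, (∀ p ∈ I, GoodSurfaceCell p Φ S z) →
      (H : ℝ) ^ (√((n : ℝ) * (n - 1) / d) + ε) ≤ (∏ p ∈ I, p : ℕ) → ∏ p ∈ I, p ≤ H ^ κ →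
      ∃ N : ℤ[X][X], N ≠ 0 ∧ Bd D' N ∧ (∀ x ∈ S, N.evalEval x.1 x.2 = 0) ∧
        ∀ a b : ℤ, |a| ≤ 2 * (H : ℤ) ^ n → |b| ≤ 2 * (H : ℤ) ^ n →
          |N.evalEval a b| ≤ (H : ℤ) ^ κ' := by
  obtain ⟨M, K, w, s, W, H₀, hM, hw, hs, hW, hineq⟩ := exists_surface_exponents n d κ hn hd ε hε
  refine ⟨(d + d) * (D + n * M), 1 + (κ + (1 + κ * K + (n + 1) * (2 * (n * M)))) * (d + d),
    H₀ + s + 2 + (d + d).factorial, ?_⟩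
  intro H hH Φ hΦ hΦd hΦD hΦH S z hS1 hS2 hS3 hSz I hI hq1 hq2
  have hH2 : 2 ≤ H := by omega
  have hHs : s ≤ H := by omega
  have hHf : (d + d).factorial ≤ H := by omega
  obtain ⟨A, hA0, hAd, hAD, hAz, hAH⟩ := exists_surface_relation (Ω := S) n d M κ H K (by omega) hn hd hM
    (fun x => x.1.1) (fun x => x.1.2) (fun x => z x.1) (fun x => hS1 _ x.2) (fun x => hS2 _ x.2)
    (fun x => hS3 _ x.2) I (fun p hp => (hI p hp).prime) (fun p hp i x y => by
      fin_cases i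
      · exact (hI p hp).fst _ x.2 _ y.2
      · exact (hI p hp).snd _ x.2 _ y.2)
    (fun p hp => (hI p hp).mem hSz K (Subring.subset_closure ⟨0, rfl⟩)
      (Subring.subset_closure ⟨1, rfl⟩)) w s W hw hs hW
    (hineq H _ (by omega) hq1)
  have hΦA : ¬ Φ ∣ A := fun h => by
    have := natDegree_le_of_dvd h hA0
    omega
  have hΦd0 : Φ.natDegree ≠ 0 := by omega
  refine ⟨resultant Φ A, resultant_ne_zero_of_irreducible hΦ hΦd0 hΦA, ?_, fun x hx => ?_, ?_⟩
  · refine (Bd.resultant (D := D + n * M) (fun i => (hΦD i).mono (by omega))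
      (fun i => (hAD i).mono (by omega))).mono ?_
    gcongr
    omega
  · exact map_resultant_eq_zero hΦd0 (evalEvalRingHom x.1 x.2) (z x) (hSz x hx) (hAz ⟨x, hx⟩)
  · intro a b ha hb
    have hH1 : (1 : ℤ) ≤ H := by exact_mod_cast (by omega : 1 ≤ H)
    have e : (resultant Φ A).evalEval a b = resultant (Φ.map (evalEvalRingHom a b))
        (A.map (evalEvalRingHom a b)) Φ.natDegree A.natDegree := by
      rw [resultant_map_map]; rfl
    have hB1 : (H : ℤ) ^ κ ≤ (H : ℤ) ^ (κ + (1 + κ * K + (n + 1) * (2 * (n * M)))) :=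
      pow_le_pow_right₀ hH1 (by omega)
    have h2n : 2 * (H : ℤ) ^ n ≤ (H : ℤ) ^ (n + 1) := by
      rw [pow_succ']
      gcongr
      exact_mod_cast hH2
    have hB2 : (s : ℤ) * (∏ p ∈ I, p : ℕ) ^ K * (2 * (H : ℤ) ^ n) ^ (2 * (n * M)) ≤
        (H : ℤ) ^ (κ + (1 + κ * K + (n + 1) * (2 * (n * M)))) := by
      calc (s : ℤ) * (∏ p ∈ I, p : ℕ) ^ K * (2 * (H : ℤ) ^ n) ^ (2 * (n * M))
          ≤ (H : ℤ) * ((H : ℤ) ^ κ) ^ K * ((H : ℤ) ^ (n + 1)) ^ (2 * (n * M)) := by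
            gcongr
            exact_mod_cast hq2
        _ = (H : ℤ) ^ (1 + κ * K + (n + 1) * (2 * (n * M))) := by
            rw [← pow_mul, ← pow_mul, pow_add, pow_add, pow_one]
        _ ≤ _ := pow_le_pow_right₀ hH1 (by omega)
    have hY : (1 : ℤ) ≤ 2 * (H : ℤ) ^ n := by
      have := one_le_pow₀ (n := n) hH1
      linarith
    rw [e]
    refine (abs_resultant_le (B := (H : ℤ) ^ (κ + (1 + κ * K + (n + 1) * (2 * (n * M))))) (by positivity)
      (fun i => ?_) (fun i => ?_)).trans ?_
    · rw [coeff_map]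
      exact (hΦH i a b ha hb).trans hB1
    · rw [coeff_map]
      exact (hAH i a b _ hY ha hb).trans hB2
    · rw [pow_add (H : ℤ) 1, pow_one, pow_mul]
      have h1 : (1 : ℤ) ≤ (H : ℤ) ^ (κ + (1 + κ * K + (n + 1) * (2 * (n * M)))) := one_le_pow₀ hH1
      refine mul_le_mul ?_ (pow_le_pow_right₀ h1 (by omega)) (by positivity) (by positivity)
      have : (Φ.natDegree + A.natDegree).factorial ≤ H :=
        (Nat.factorial_le (by omega)).trans hHf
      exact_mod_cast this

/-- The coefficients of a polynomial of bounded degree are bounded by its values. -/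
theorem exists_coeff_bound (D : ℕ) : ∃ c : ℕ, 0 < c ∧ ∀ P : ℤ[X], P.natDegree ≤ D → ∀ B : ℤ,
    (∀ j : ℕ, j ≤ D → |P.eval (j : ℤ)| ≤ B) → ∀ k, |P.coeff k| ≤ c * B := by
  classical
  set V : Matrix (Fin (D + 1)) (Fin (D + 1)) ℤ := vandermonde fun i => ((i : ℕ) : ℤ) with hV
  have hdet : V.det ≠ 0 := Matrix.det_vandermonde_ne_zero_iff.2 fun i j h => by
    ext; exact_mod_cast h
  refine ⟨1 + ∑ i, ∑ j, (V.adjugate i j).natAbs, by omega, fun P hP B hB k => ?_⟩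
  have hB0 : 0 ≤ B := (abs_nonneg _).trans (hB 0 (Nat.zero_le _))
  by_cases hk : k ≤ D
  swap
  · rw [coeff_eq_zero_of_natDegree_lt (by omega), abs_zero]
    positivity
  set v : Fin (D + 1) → ℤ := fun i => P.coeff i with hv
  have h1 : V.mulVec v = fun i : Fin (D + 1) => P.eval ((i : ℕ) : ℤ) := by
    funext i
    rw [eval_eq_sum_range' (Nat.lt_succ_of_le hP), ← Fin.sum_univ_eq_sum_range (fun e => P.coeff e * ((i : ℕ) : ℤ) ^ e)]
    simp only [mulVec, dotProduct, hV, vandermonde_apply, hv]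
    exact sum_congr rfl fun j _ => mul_comm _ _
  have h2 : V.adjugate.mulVec (fun i : Fin (D + 1) => P.eval ((i : ℕ) : ℤ)) = V.det • v := by
    rw [← h1, Matrix.mulVec_mulVec, Matrix.adjugate_mul, Matrix.smul_mulVec, Matrix.one_mulVec]
  set i0 : Fin (D + 1) := ⟨k, by omega⟩
  have h3 := congrFun h2 i0
  simp only [mulVec, dotProduct, Pi.smul_apply, smul_eq_mul] at h3
  have hvk : v i0 = P.coeff k := rfl
  rw [hvk] at h3
  calc |P.coeff k| ≤ |V.det| * |P.coeff k| :=
        le_mul_of_one_le_left (abs_nonneg _) (one_le_abs hdet)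
    _ = |∑ j, V.adjugate i0 j * P.eval ((j : ℕ) : ℤ)| := by rw [h3, abs_mul]
    _ ≤ ∑ j, |V.adjugate i0 j| * B := (abs_sum_le_sum_abs _ _).trans
        (sum_le_sum fun j _ => by
          rw [abs_mul]
          exact mul_le_mul_of_nonneg_left (hB j (by omega)) (abs_nonneg _))
    _ = (∑ j, |V.adjugate i0 j|) * B := by rw [sum_mul]
    _ ≤ _ := by
        refine mul_le_mul_of_nonneg_right ?_ hB0
        push_cast
        have : ∑ j, |V.adjugate i0 j| ≤ ∑ i, ∑ j, |V.adjugate i j| :=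
          single_le_sum (f := fun i => ∑ j, |V.adjugate i j|)
            (fun i _ => sum_nonneg fun j _ => abs_nonneg _) (mem_univ i0)
        linarith

/-- The trailing coefficient of `N(a, Y + b)`. -/
noncomputable def shiftTrail (N : ℤ[X][X]) (x : ℤ × ℤ) : ℤ :=
  (taylor x.2 (N.map (evalRingHom x.1))).trailingCoeff

theorem shiftTrail_ne_zero {N : ℤ[X][X]} {x : ℤ × ℤ} (h : N.map (evalRingHom x.1) ≠ 0) :
    shiftTrail N x ≠ 0 := by
  rw [shiftTrail, Ne, trailingCoeff_eq_zero]
  exact fun h' => h ((map_eq_zero_iff _ (taylor_injective _)).1 h')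

theorem derivative_evalEval_dvd_shiftTrail {N Γ : ℤ[X][X]} {x : ℤ × ℤ} (hΓ : Γ ∣ N)
    (h0 : Γ.evalEval x.1 x.2 = 0) (h1 : (derivative Γ).evalEval x.1 x.2 ≠ 0) :
    (derivative Γ).evalEval x.1 x.2 ∣ shiftTrail N x := by
  obtain ⟨Q, rfl⟩ := hΓ
  rw [evalEval_eq_eval_map] at h0 h1 ⊢
  rw [← derivative_map] at h1 ⊢
  set g := Γ.map (evalRingHom x.1)
  have e0 : (taylor x.2 g).coeff 0 = 0 := by rw [taylor_coeff_zero, h0]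
  have e1 : (taylor x.2 g).coeff 1 = (derivative g).eval x.2 := taylor_coeff_one _ _
  have hd : (taylor x.2 g).natTrailingDegree = 1 := by
    apply le_antisymm
    · exact natTrailingDegree_le_of_ne_zero (by rwa [e1])
    · refine le_natTrailingDegree (fun h => h1 ?_) fun i hi => ?_
      · rw [← e1, h, coeff_zero]
      · obtain rfl : i = 0 := by omega
        exact e0
  rw [shiftTrail, Polynomial.map_mul, taylor_mul, trailingCoeff_mul]
  refine Dvd.dvd.mul_right ?_ _
  rw [trailingCoeff, hd, e1]

theorem abs_shiftTrail_le {D c : ℕ} {N : ℤ[X][X]} {x : ℤ × ℤ} (hN : N.natDegree ≤ D) {B : ℤ}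
    (hc : ∀ P : ℤ[X], P.natDegree ≤ D → ∀ B : ℤ,
      (∀ j : ℕ, j ≤ D → |P.eval (j : ℤ)| ≤ B) → ∀ k, |P.coeff k| ≤ c * B)
    (hB : ∀ j : ℕ, j ≤ D → |N.evalEval x.1 (x.2 + j)| ≤ B) : |shiftTrail N x| ≤ c * B := by
  refine hc (taylor x.2 (N.map (evalRingHom x.1))) ?_ B (fun j hj => ?_) _
  · rw [natDegree_taylor]
    exact natDegree_map_le.trans hN
  · rw [taylor_eval, ← evalEval_eq_eval_map, add_comm]
    exact hB j hj

/-- The numerical condition needed for the determinant method on curves. -/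
theorem exists_curve_exponent (n κ : ℕ) (ε : ℝ) (hε : 0 < ε) :
    ∃ M H₀ : ℕ, ∀ H q : ℕ, H₀ ≤ H → (H : ℝ) ^ ((n : ℝ) / 2 + ε) ≤ q →
      (4 * (M + 1)) ^ (2 * (M + 1)) * ((2 * H ^ n) ^ (M * (M + 1)) * (H ^ κ) ^ (M + 1)) <
        q ^ (2 * M ^ 2 + 3 * M) := by
  obtain ⟨M, hM⟩ := exists_nat_gt ((κ + 1 : ℝ) / ε)
  have hM0 : (0 : ℝ) < M := lt_of_le_of_lt (by positivity) hM
  rw [div_lt_iff₀ hε] at hM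
  set A : ℕ := (4 * (M + 1)) ^ (2 * (M + 1)) * 2 ^ (M * (M + 1)) with hA
  refine ⟨M, A + 1, fun H q hH hq => ?_⟩
  have hH1 : (1 : ℝ) ≤ H := by exact_mod_cast (show 1 ≤ H by omega)
  have hM1 : (1 : ℝ) ≤ M := by
    have : 0 < M := by exact_mod_cast hM0
    exact_mod_cast this
  have key : ((M * (M + 1) * n + κ * (M + 1) + 1 : ℕ) : ℝ) ≤
      ((n : ℝ) / 2 + ε) * ((2 * M ^ 2 + 3 * M : ℕ) : ℝ) := by
    push_cast
    have hn : (0 : ℝ) ≤ n := cast_nonneg n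
    have hk : (0 : ℝ) ≤ κ := cast_nonneg κ
    have h1 : (κ + 1 : ℝ) * (M + 1) ≤ M * ε * (M + M) := by
      refine mul_le_mul hM.le (by linarith) (by positivity) (by positivity)
    nlinarith [mul_nonneg hn hM0.le, mul_nonneg hε.le hM0.le]
  have h2 : ((H : ℝ) ^ (M * (M + 1) * n + κ * (M + 1) + 1)) ≤ (q : ℝ) ^ (2 * M ^ 2 + 3 * M) := by
    rw [← rpow_natCast]
    refine (rpow_le_rpow_of_exponent_le hH1 key).trans ?_
    rw [rpow_mul (by linarith), rpow_natCast]
    exact pow_le_pow_left₀ (by positivity) hq _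
  have h3 : H ^ (M * (M + 1) * n + κ * (M + 1) + 1) ≤ q ^ (2 * M ^ 2 + 3 * M) := by exact_mod_cast h2
  refine lt_of_lt_of_le ?_ h3
  calc _ = A * H ^ (M * (M + 1) * n + κ * (M + 1)) := by rw [hA]; ring
    _ < H * H ^ (M * (M + 1) * n + κ * (M + 1)) :=
        Nat.mul_lt_mul_of_pos_right (by omega) (pow_pos (by omega) _)
    _ = _ := by ring

theorem card_le_of_cells {Ω : Type*} {β : ℕ → Type*} (S : Finset Ω) (I : Finset ℕ)
    [∀ p, DecidableEq (β p)] (r : ∀ p, Ω → β p) (m b : ℕ)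
    (hm : ∀ p ∈ I, (S.image (r p)).card ≤ m)
    (hb : ∀ S' ⊆ S, (∀ p ∈ I, ∀ x ∈ S', ∀ x' ∈ S', r p x = r p x') → S'.card ≤ b) :
    S.card ≤ b * m ^ I.card := by
  classical
  set f : Ω → ∀ p : I, β p := fun x p => r p x with hf
  have h1 : S.card ≤ b * (S.image f).card := card_le_mul_card_image S b fun c hc => by
    refine hb _ (filter_subset _ _) fun p hp x hx x' hx' => ?_
    exact (congrFun (mem_filter.1 hx).2 ⟨p, hp⟩).trans
      (congrFun (mem_filter.1 hx').2 ⟨p, hp⟩).symm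
  refine h1.trans (Nat.mul_le_mul_left _ ?_)
  have h2 : S.image f ⊆ piFinset fun p : I => S.image (r p) := by
    intro c hc
    obtain ⟨x, hx, rfl⟩ := mem_image.1 hc
    exact mem_piFinset.2 fun p => mem_image_of_mem _ hx
  refine (card_le_card h2).trans ?_
  rw [card_piFinset]
  refine (prod_le_pow_card (univ : Finset I) (fun p => (S.image (r p)).card) m
    fun p _ => hm p.1 p.2).trans ?_
  simp

/-- The residue class of a point modulo `p`. -/
def resClass (z y : ℤ × ℤ → ℤ) (p : ℕ) (x : ℤ × ℤ) : (ZMod p × ZMod p) × (ZMod p × ZMod p) :=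
  ((x.1, x.2), (z x, y x))

theorem resClass_eq {z y : ℤ × ℤ → ℤ} {p : ℕ} {x x' : ℤ × ℤ} (h : resClass z y p x = resClass z y p x') :
    x.1 ≡ x'.1 [ZMOD p] ∧ x.2 ≡ x'.2 [ZMOD p] ∧ z x ≡ z x' [ZMOD p] ∧ y x ≡ y x' [ZMOD p] := by
  simp only [resClass, Prod.mk.injEq] at h
  exact ⟨(ZMod.intCast_eq_intCast_iff _ _ _).1 h.1.1, (ZMod.intCast_eq_intCast_iff _ _ _).1 h.1.2,
    (ZMod.intCast_eq_intCast_iff _ _ _).1 h.2.1, (ZMod.intCast_eq_intCast_iff _ _ _).1 h.2.2⟩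

theorem card_roots_filter_le {F : Type*} [Field F] [DecidableEq F] {P : F[X]} (hP : P ≠ 0) (S : Finset F)
    (hS : ∀ x ∈ S, P.eval x = 0) : S.card ≤ P.natDegree := by
  refine (card_le_card (t := P.roots.toFinset) fun x hx => ?_).trans
    ((toFinset_card_le P.roots).trans (card_roots' P))
  rw [mem_toFinset, mem_roots hP]
  exact hS x hx

theorem eval_map_evalEval_cast {R : Type*} [CommRing R] (Φ : ℤ[X][X][X]) (a b z : ℤ) :
    (((Φ.map (evalEvalRingHom a b)).eval z : ℤ) : R) =
      (Φ.map ((castRingHom R).comp (evalEvalRingHom a b))).eval (z : R) := by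
  rw [← eq_intCast (castRingHom R), ← eq_intCast (castRingHom R) z,
    ← Polynomial.map_map (evalEvalRingHom a b) (castRingHom R)]
  exact (eval_map_apply (castRingHom R) (p := Φ.map (evalEvalRingHom a b)) z).symm

theorem evalEval_cast_congr {p : ℕ} {x x' : ℤ × ℤ} (h1 : (x.1 : ZMod p) = x'.1)
    (h2 : (x.2 : ZMod p) = x'.2) :
    (castRingHom (ZMod p)).comp (evalEvalRingHom x.1 x.2) =
      (castRingHom (ZMod p)).comp (evalEvalRingHom x'.1 x'.2) := by
  refine RingHom.ext fun l => ?_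
  exact (ZMod.intCast_eq_intCast_iff _ _ _).2 (evalEval_modEq ((ZMod.intCast_eq_intCast_iff _ _ _).1 h1)
    ((ZMod.intCast_eq_intCast_iff _ _ _).1 h2) l)

theorem card_image_resClass_le {d p : ℕ} (hp : p.Prime) {Φ : ℤ[X][X][X]} {Δ : ℤ[X][X]} (hΦ : Φ.Monic)
    (hd : Φ.natDegree = d) (S : Finset (ℤ × ℤ)) (z y : ℤ × ℤ → ℤ)
    (hz : ∀ x ∈ S, (Φ.map (evalEvalRingHom x.1 x.2)).eval (z x) = 0)
    (hy : ∀ x ∈ S, Δ.evalEval x.1 x.2 = y x ^ 2) :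
    (S.image (resClass z y p)).card ≤
      d * 2 * (S.image fun x => ((x.1 : ZMod p), (x.2 : ZMod p))).card := by
  classical
  have := Fact.mk hp
  have e : (S.image fun x => ((x.1 : ZMod p), (x.2 : ZMod p))) =
      (S.image (resClass z y p)).image Prod.fst := by
    rw [image_image]; rfl
  rw [e]
  refine card_le_mul_card_image _ _ fun c hc => ?_
  rw [image_image] at hc
  obtain ⟨x₀, hx₀, rfl⟩ := mem_image.1 hc
  set P : (ZMod p)[X] := Φ.map ((castRingHom (ZMod p)).comp (evalEvalRingHom x₀.1 x₀.2)) with hP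
  set Q : (ZMod p)[X] := X ^ 2 - C ((Δ.evalEval x₀.1 x₀.2 : ℤ) : ZMod p) with hQ
  have hP1 : P.Monic := hΦ.map _
  have hQ1 : Q ≠ 0 := X_pow_sub_C_ne_zero (by norm_num) _
  have hQ2 : Q.natDegree = 2 := natDegree_X_pow_sub_C
  have hP2 : P.natDegree = d := (hΦ.natDegree_map _).trans hd
  set T := {a ∈ S.image (resClass z y p) | a.1 = (resClass z y p x₀).1} with hT
  have hTP : ∀ a ∈ T, ∃ x ∈ S, a.1 = (resClass z y p x₀).1 ∧ a = resClass z y p x := by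
    intro a ha
    obtain ⟨h1, h2⟩ := mem_filter.1 ha
    obtain ⟨x, hx, rfl⟩ := mem_image.1 h1
    exact ⟨x, hx, h2, rfl⟩
  have hc1 : ((T.image fun a => a.2.1)).card ≤ d := by
    rw [← hP2]
    refine card_roots_filter_le hP1.ne_zero _ fun t ht => ?_
    obtain ⟨a, ha, rfl⟩ := mem_image.1 ht
    obtain ⟨x, hx, h, rfl⟩ := hTP a ha
    simp only [resClass, Prod.mk.injEq] at h ⊢
    rw [hP, ← evalEval_cast_congr h.1 h.2, ← eval_map_evalEval_cast, hz x hx, Int.cast_zero]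
  have hc2 : ((T.image fun a => a.2.2)).card ≤ 2 := by
    rw [← hQ2]
    refine card_roots_filter_le hQ1 _ fun t ht => ?_
    obtain ⟨a, ha, rfl⟩ := mem_image.1 ht
    obtain ⟨x, hx, h, rfl⟩ := hTP a ha
    simp only [resClass, Prod.mk.injEq] at h ⊢
    have h3 : ((Δ.evalEval x.1 x.2 : ℤ) : ZMod p) = (Δ.evalEval x₀.1 x₀.2 : ℤ) :=
      DFunLike.congr_fun (evalEval_cast_congr h.1 h.2) Δ
    rw [hQ, eval_sub, eval_pow, eval_X, eval_C, ← h3, hy x hx]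
    push_cast
    ring
  have hsub : (T.image Prod.snd) ⊆ (T.image fun a => a.2.1) ×ˢ (T.image fun a => a.2.2) := by
    intro t ht
    obtain ⟨a, ha, rfl⟩ := mem_image.1 ht
    exact Finset.mem_product.2 ⟨mem_image.2 ⟨a, ha, rfl⟩, mem_image.2 ⟨a, ha, rfl⟩⟩
  have hinj : InjOn Prod.snd (T : Set ((ZMod p × ZMod p) × (ZMod p × ZMod p))) := by
    intro a ha b hb hab
    exact Prod.ext ((mem_filter.1 ha).2.trans (mem_filter.1 hb).2.symm) hab
  change T.card ≤ d * 2
  rw [← card_image_of_injOn hinj]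
  refine (card_le_card hsub).trans ?_
  rw [Finset.card_product]
  exact Nat.mul_le_mul hc1 hc2

theorem card_image_cast_le {p : ℕ} (hp : p.Prime) (S : Finset (ℤ × ℤ)) :
    (S.image fun x => ((x.1 : ZMod p), (x.2 : ZMod p))).card ≤ p ^ 2 := by
  have := Fact.mk hp
  refine (card_le_univ _).trans ?_
  rw [card_prod, ZMod.card, sq]

theorem card_image_cast_vertical_le {p : ℕ} (hp : p.Prime) (a : ℤ) (S : Finset (ℤ × ℤ))
    (hS : ∀ x ∈ S, x.1 = a) :
    (S.image fun x => ((x.1 : ZMod p), (x.2 : ZMod p))).card ≤ p := by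
  classical
  have := Fact.mk hp
  rw [← card_image_of_injOn (f := Prod.snd)]
  · refine (card_le_univ _).trans ?_
    rw [ZMod.card]
  · intro u hu v hv huv
    obtain ⟨x, hx, rfl⟩ := mem_image.1 hu
    obtain ⟨x', hx', rfl⟩ := mem_image.1 hv
    exact Prod.ext (by simp only [hS x hx, hS x' hx']) huv

theorem card_image_cast_curve_le {p D : ℕ} (hp : p.Prime) {Γ : ℤ[X][X]} (hD : Γ.natDegree ≤ D)
    (S : Finset (ℤ × ℤ)) (hS : ∀ x ∈ S, Γ.evalEval x.1 x.2 = 0)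
    (hS' : ∀ x ∈ S, ¬ (p : ℤ) ∣ (derivative Γ).evalEval x.1 x.2) :
    (S.image fun x => ((x.1 : ZMod p), (x.2 : ZMod p))).card ≤ D * p := by
  classical
  have := Fact.mk hp
  set T := S.image fun x => ((x.1 : ZMod p), (x.2 : ZMod p)) with hT
  have h1 : T.card ≤ D * (T.image Prod.fst).card := card_le_mul_card_image _ _ fun c hc => by
    obtain ⟨u, hu, rfl⟩ := mem_image.1 hc
    obtain ⟨x₀, hx₀, rfl⟩ := mem_image.1 hu
    set P : (ZMod p)[X] := (Γ.map (evalRingHom x₀.1)).map (castRingHom (ZMod p)) with hP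
    have hev : ∀ (Γ : ℤ[X][X]) (x : ℤ × ℤ), (x.1 : ZMod p) = x₀.1 →
        ((Γ.map (evalRingHom x₀.1)).map (castRingHom (ZMod p))).eval (x.2 : ZMod p) =
          (Γ.evalEval x.1 x.2 : ℤ) := by
      intro Γ x hx
      rw [← eq_intCast (castRingHom (ZMod p)), eval_map_apply, ← evalEval_eq_eval_map]
      exact (ZMod.intCast_eq_intCast_iff _ _ _).2 (evalEval_modEq
        ((ZMod.intCast_eq_intCast_iff _ _ _).1 hx.symm) (ModEq.refl _) Γ)
    have hP0 : P ≠ 0 := by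
      intro h
      have h2 := hev (derivative Γ) x₀ rfl
      rw [← derivative_map, ← derivative_map, ← hP, h, derivative_zero, eval_zero] at h2
      exact hS' x₀ hx₀ ((ZMod.intCast_zmod_eq_zero_iff_dvd _ _).1 h2.symm)
    have hPD : P.natDegree ≤ D := natDegree_map_le.trans (natDegree_map_le.trans hD)
    rw [← card_image_of_injOn (f := Prod.snd)]
    · refine (card_roots_filter_le hP0 _ fun t ht => ?_).trans hPD
      obtain ⟨v, hv, rfl⟩ := mem_image.1 ht
      obtain ⟨hv1, hv2⟩ := mem_filter.1 hv
      obtain ⟨x, hx, rfl⟩ := mem_image.1 hv1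
      rw [hP, hev Γ x hv2, hS x hx, Int.cast_zero]
    · intro u hu v hv huv
      exact Prod.ext ((mem_filter.1 hu).2.trans (mem_filter.1 hv).2.symm) huv
  refine h1.trans (Nat.mul_le_mul_left _ ((card_le_univ _).trans ?_))
  rw [ZMod.card]

theorem Bd.derivative {D : ℕ} {P : ℤ[X][X]} (h : Bd D P) : Bd D (derivative P) := by
  refine ⟨(natDegree_derivative_le P).trans ((sub_le _ _).trans h.1), ?_⟩
  refine natDegree_le_iff_coeff_eq_zero.2 fun k hk => ?_
  ext j
  rw [coeff_coeff_swap', coeff_derivative, show ((j : ℤ[X]) + 1) = C ((j : ℤ) + 1) by simp,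
    coeff_mul_C, ← coeff_coeff_swap', coeff_eq_zero_of_natDegree_lt (h.2.trans_lt hk), coeff_zero, zero_mul,
    coeff_zero]

/-- Points on a surface together with consecutive primes such that each window of `r` primes
determines a curve through every point. -/
structure WindowSystem (d D E M r t L P Q W V B₀ : ℕ) (Φ : ℤ[X][X][X]) (Δ : ℤ[X][X])
    (S : Finset (ℤ × ℤ)) (z y : ℤ × ℤ → ℤ) (p : ℕ → ℕ) (N : ℕ → ℤ × ℤ → ℤ[X][X]) : Prop where
  prime : ∀ i < L, (p i).Prime
  ne_two : ∀ i < L, p i ≠ 2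
  inj : ∀ i < L, ∀ j < L, p i = p j → i = j
  lower : ∀ i < L, P ≤ p i
  upper : ∀ i < L, p i ≤ Q
  monic : Φ.Monic
  natDegree : Φ.natDegree = d
  root : ∀ x ∈ S, (Φ.map (evalEvalRingHom x.1 x.2)).eval (z x) = 0
  sq : ∀ x ∈ S, Δ.evalEval x.1 x.2 = y x ^ 2
  bd : Bd D Δ
  line : ∀ m c, ¬ IsSquare (restrictLine Δ m c)
  vert : ∀ a : ℤ, ¬ IsSquare ((Δ.map (evalRingHom a)).map (castRingHom ℚ))
  not_dvd : ∀ i < L, ∀ x ∈ S, ¬ (p i : ℤ) ∣ y x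
  fst_le : ∀ x ∈ S, |x.1| ≤ W
  snd_le : ∀ x ∈ S, |x.2| ≤ W
  y_le : ∀ x ∈ S, |y x| ≤ V
  W_pos : 0 < W
  V_pos : 0 < V
  W_le : W ≤ V
  curve : (4 * (M + 1)) ^ (2 * (M + 1)) * ((2 * W) ^ (M * (M + 1)) * V ^ (M + 1)) <
    (P ^ (r + t)) ^ (2 * M ^ 2 + 3 * M)
  N_ne : ∀ k, k + r ≤ L → ∀ x ∈ S, N k x ≠ 0
  N_bd : ∀ k, k + r ≤ L → ∀ x ∈ S, Bd E (N k x)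
  N_zero : ∀ k, k + r ≤ L → ∀ x ∈ S, (N k x).evalEval x.1 x.2 = 0
  N_congr : ∀ k, k + r ≤ L → ∀ x ∈ S, ∀ x' ∈ S,
    (∀ i, k ≤ i → i < k + r → resClass z y (p i) x = resClass z y (p i) x') → N k x = N k x'
  N_trail : ∀ x ∈ S, |shiftTrail (N 0 x) x| < (P : ℤ) ^ (B₀ + 1)
  L_ge : (B₀ + 1) * (r + t) + 1 ≤ L

/-- The primes `p k, …, p (k + m - 1)`. -/
def primeBlock (p : ℕ → ℕ) (k m : ℕ) : Finset ℕ := (Ico k (k + m)).image p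

namespace WindowSystem

variable {d D E M r t L P Q W V B₀ : ℕ} {Φ : ℤ[X][X][X]} {Δ : ℤ[X][X]}
    {S : Finset (ℤ × ℤ)} {z y : ℤ × ℤ → ℤ} {p : ℕ → ℕ} {N : ℕ → ℤ × ℤ → ℤ[X][X]}

theorem mem_block {k m q : ℕ}
    (hk : k + m ≤ L) (hq : q ∈ primeBlock p k m) : ∃ i < L, k ≤ i ∧ i < k + m ∧ p i = q := by
  obtain ⟨i, hi, rfl⟩ := mem_image.1 hq
  rw [mem_Ico] at hi
  exact ⟨i, by omega, hi.1, hi.2, rfl⟩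

theorem card_block (p : ℕ → ℕ) (k m : ℕ) : (primeBlock p k m).card ≤ m :=
  card_image_le.trans (by simp)

theorem exists_factor {D : ℕ} {N : ℤ[X][X]} (hN : Bd D N) (hN0 : N ≠ 0) :
    ∃ F : Finset ℤ[X][X], F.card ≤ 2 * D ∧ (∀ Γ ∈ F, Irreducible Γ ∧ Γ.natDegree ≠ 0 ∧ Bd D Γ) ∧
      ∀ Γ, Irreducible Γ → Γ ∣ N → Γ.natDegree ≠ 0 → ∃ Γ' ∈ F, ∃ u : ℤ, IsUnit u ∧ Γ = C (C u) * Γ' := by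
  classical
  obtain ⟨F, h1, h2, -, h4⟩ := exists_factor_finset hN0 hN
  refine ⟨F.filter fun Γ => Γ.natDegree ≠ 0, (Finset.card_filter_le _ _).trans h1, fun Γ hΓ => ?_,
    fun Γ hΓ hΓN hdeg => ?_⟩
  · obtain ⟨h, h'⟩ := mem_filter.1 hΓ
    exact ⟨(h2 Γ h).1, h', (h2 Γ h).2.2⟩
  · obtain ⟨Γ', hΓ', u, hu⟩ := h4 Γ hΓ hΓN hdeg
    obtain ⟨v, hv, hv'⟩ := Polynomial.isUnit_iff.1 (u⁻¹).isUnit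
    obtain ⟨w, hw, rfl⟩ := Polynomial.isUnit_iff.1 hv
    have h5 : Γ = C (C w) * Γ' := by
      rw [hv', ← hu, mul_comm, mul_assoc, Units.mul_inv, mul_one]
    refine ⟨Γ', mem_filter.2 ⟨hΓ', fun h => hdeg ?_⟩, w, hw, h5⟩
    rw [h5]
    exact Nat.le_zero.1 (natDegree_C_mul_le _ _ |>.trans h.le)

/-- The irreducible component chosen at a point. -/
structure IsComponent (N Γ : ℤ[X][X]) (x : ℤ × ℤ) : Prop where
  irr : Irreducible Γ
  dvd : Γ ∣ N
  deg : Γ.natDegree ≠ 0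
  zero : Γ.evalEval x.1 x.2 = 0

variable (ws : WindowSystem d D E M r t L P Q W V B₀ Φ Δ S z y p N)
include ws

theorem le_prod_block {k m : ℕ}
    (hk : k + m ≤ L) : P ^ m ≤ ∏ q ∈ primeBlock p k m, q := by
  rw [primeBlock, Finset.prod_image]
  · calc P ^ m = ∏ i ∈ Ico k (k + m), P := by simp
      _ ≤ _ := prod_le_prod' fun i hi => ws.lower i (by
          rw [mem_Ico] at hi; omega)
  · intro i hi j hj hij
    rw [coe_Ico, Set.mem_Ico] at hi hj
    exact ws.inj i (by omega) j (by omega) hij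

theorem goodCell {i : ℕ} (hi : i < L)
    {S' : Finset (ℤ × ℤ)} (hS : S' ⊆ S)
    (h : ∀ x ∈ S', ∀ x' ∈ S', resClass z y (p i) x = resClass z y (p i) x') : GoodCell (p i) S' y where
  prime := ws.prime i hi
  ne_two := ws.ne_two i hi
  fst x hx x' hx' := (resClass_eq (h x hx x' hx')).1
  snd x hx x' hx' := (resClass_eq (h x hx x' hx')).2.1
  sq x hx x' hx' := (resClass_eq (h x hx x' hx')).2.2.2
  not_dvd x hx := ws.not_dvd i hi x (hS hx)

theorem card_le_of_res {k m c b : ℕ}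
    (hk : k + m ≤ L) (hc : 0 < c) {T : Finset (ℤ × ℤ)} (hT : T ⊆ S)
    (hcard : ∀ i, k ≤ i → i < k + m → (T.image fun x => ((x.1 : ZMod (p i)), (x.2 : ZMod (p i)))).card ≤ c)
    (h : ∀ T' ⊆ T, (∀ i, k ≤ i → i < k + m → ∀ x ∈ T', ∀ x' ∈ T',
      resClass z y (p i) x = resClass z y (p i) x') → T'.card ≤ b) :
    T.card ≤ b * (2 * d * c) ^ m := by
  classical
  by_cases hd : d = 0
  · have h0 := ws.natDegree
    rw [hd] at h0
    have h1 : Φ = 1 := ws.monic.natDegree_eq_zero.1 h0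
    have : T = ∅ := Finset.eq_empty_of_forall_notMem fun x hx => by
      have := ws.root x (hT hx)
      rw [h1, Polynomial.map_one, eval_one] at this
      exact one_ne_zero this
    rw [this, card_empty]
    exact Nat.zero_le _
  have h1 := card_le_of_cells T (primeBlock p k m) (fun q => resClass z y q) (2 * d * c) b
    (fun q hq => by
      obtain ⟨i, hi, h1, h2, rfl⟩ := mem_block hk hq
      refine (card_image_resClass_le (ws.prime i hi) ws.monic ws.natDegree T z y
        (fun x hx => ws.root x (hT hx)) (fun x hx => ws.sq x (hT hx))).trans ?_
      rw [mul_comm d 2]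
      exact Nat.mul_le_mul_left _ (hcard i h1 h2))
    (fun S' hS' hS => h S' hS' fun i h1 h2 x hx x' hx' => hS (p i) (mem_image_of_mem _
      (mem_Ico.2 ⟨h1, h2⟩)) x hx x' hx')
  refine h1.trans (Nat.mul_le_mul_left _ (Nat.pow_le_pow_right ?_ (card_block p k m)))
  exact Nat.mul_pos (by omega) hc

theorem Q_pos : 0 < Q :=
  (ws.prime 0 (by have := ws.L_ge; omega)).pos.trans_le (ws.upper 0 (by have := ws.L_ge; omega))

theorem card_le_of_cell {k m b : ℕ}
    (hk : k + m ≤ L) {T : Finset (ℤ × ℤ)} (hT : T ⊆ S)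
    (h : ∀ T' ⊆ T, (∀ i, k ≤ i → i < k + m → ∀ x ∈ T', ∀ x' ∈ T',
      resClass z y (p i) x = resClass z y (p i) x') → T'.card ≤ b) :
    T.card ≤ b * (2 * d * Q ^ 2) ^ m := by
  refine ws.card_le_of_res hk (pow_pos ws.Q_pos 2) hT (fun i h1 h2 => ?_) h
  exact (card_image_cast_le (ws.prime i (by omega)) T).trans (Nat.pow_le_pow_left (ws.upper i (by omega)) 2)

theorem le_L {j : ℕ} (hj : j ≤ B₀) :
    j * (r + t) + (r + t) + 1 ≤ L := by
  have h1 := ws.L_ge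
  have : (j + 1) * (r + t) ≤ (B₀ + 1) * (r + t) := Nat.mul_le_mul_right _ (by omega)
  rw [add_mul, one_mul] at this
  omega

theorem curve_block {k : ℕ}
    (hk : k + (r + t) ≤ L) : (4 * (M + 1)) ^ (2 * (M + 1)) * ((2 * W) ^ (M * (M + 1)) * V ^ (M + 1)) <
      (∏ q ∈ primeBlock p k (r + t), q) ^ (2 * M ^ 2 + 3 * M) :=
  ws.curve.trans_le (Nat.pow_le_pow_left (ws.le_prod_block hk) _)

theorem card_vertical
    (T : Finset (ℤ × ℤ)) (hT : T ⊆ S) (hv : ∀ x ∈ T, (N 0 x).map (evalRingHom x.1) = 0) :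
    T.card ≤ (2 * M + D) * (2 * d * Q) ^ t * E * (2 * d * Q ^ 2) ^ r := by
  classical
  have hL := ws.le_L (Nat.zero_le B₀)
  refine ws.card_le_of_cell (k := 0) (by omega) hT fun T' hT' hcell => ?_
  rcases T'.eq_empty_or_nonempty with rfl | ⟨x₀, hx₀⟩
  · simp
  have hx₀S := hT (hT' hx₀)
  have hN : ∀ x ∈ T', N 0 x = N 0 x₀ := fun x hx => ws.N_congr 0 (by omega) x (hT (hT' hx)) x₀ hx₀S
    fun i h1 h2 => hcell i h1 h2 x hx x₀ hx₀
  obtain ⟨k, hk⟩ : ∃ k, (N 0 x₀).coeff k ≠ 0 := by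
    by_contra! h
    exact ws.N_ne 0 (by omega) x₀ hx₀S (Polynomial.ext fun k => by rw [h k, coeff_zero])
  have h1 : (T'.image Prod.fst).card ≤ E := by
    refine (card_le_natDegree_of_eval_eq_zero hk _ fun a ha => ?_).trans
      ((natDegree_coeff_le_swap _ _).trans (ws.N_bd 0 (by omega) x₀ hx₀S).2)
    obtain ⟨x, hx, rfl⟩ := mem_image.1 ha
    have := congrArg (fun P => P.coeff k) (hv x (hT' hx))
    rwa [hN x hx, coeff_map, coeff_zero] at this
  refine (card_le_mul_card_image T' ((2 * M + D) * (2 * d * Q) ^ t) fun a ha => ?_).trans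
    (Nat.mul_le_mul_left _ h1)
  have hs : {x ∈ T' | x.1 = a} ⊆ S := (filter_subset _ _).trans (hT'.trans hT)
  have ha' : ∀ x ∈ {x ∈ T' | x.1 = a}, x.1 = a := fun x hx => (mem_filter.1 hx).2
  refine ws.card_le_of_res (k := r) (m := t) (c := Q) (by omega) ws.Q_pos hs (fun i h1 h2 => ?_) ?_
  · exact (card_image_cast_vertical_le (ws.prime i (by omega)) a _ ha').trans (ws.upper i (by omega))
  · intro T'' hT'' hcell'
    have hs' := hT''.trans hs
    refine card_cell_vertical (U := 2 * W) (V := V) (by have := ws.W_pos; omega) ws.V_pos a ws.bd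
      (ws.vert a) T'' y (fun x hx => ha' x (hT'' hx)) (fun x hx => ?_) (fun x hx => ws.y_le x (hs' hx))
      (fun x hx => ws.sq x (hs' hx)) (primeBlock p 0 (r + t)) (fun q hq => ?_) (ws.curve_block (by omega))
    · have := ws.snd_le x (hs' hx)
      push_cast
      linarith [abs_nonneg x.2]
    · obtain ⟨i, hi, h1, h2, rfl⟩ := mem_block (L := L) (by omega) hq
      refine ws.goodCell hi hs' fun x hx x' hx' => ?_
      by_cases hir : i < r
      · exact hcell i h1 (by omega) x (mem_filter.1 (hT'' hx)).1 x' (mem_filter.1 (hT'' hx')).1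
      · exact hcell' i (by omega) (by omega) x hx x' hx'

theorem exists_component {x : ℤ × ℤ}
    (hx : x ∈ S) (hv : (N 0 x).map (evalRingHom x.1) ≠ 0) : ∃ Γ, IsComponent (N 0 x) Γ x := by
  have hL := ws.le_L (Nat.zero_le B₀)
  obtain ⟨F, -, h2, h3, -⟩ := exists_factor_finset (ws.N_ne 0 (by omega) x hx) (ws.N_bd 0 (by omega) x hx)
  obtain ⟨Γ, hΓ, h0⟩ := h3 _ _ (ws.N_zero 0 (by omega) x hx)
  obtain ⟨hi, hd, -⟩ := h2 Γ hΓ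
  refine ⟨Γ, hi, hd, fun h => hv ?_, h0⟩
  obtain ⟨R, hR⟩ := hd
  rw [eq_C_of_natDegree_eq_zero h] at h0
  rw [hR, eq_C_of_natDegree_eq_zero h, Polynomial.map_mul, map_C, coe_evalRingHom]
  rw [evalEval, eval_C] at h0
  rw [h0, C_0, zero_mul]

theorem card_le_of_components {k m c : ℕ} (hk : k + m ≤ L) (hr : r ≤ m) {Γ : ℤ × ℤ → ℤ[X][X]}
    {T : Finset (ℤ × ℤ)} (hT : T ⊆ S) (hΓ : ∀ x ∈ T, IsComponent (N k x) (Γ x) x)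
    (R : ℤ[X][X] → ℤ × ℤ → Prop)
    (hR : ∀ x ∈ T, ∀ G u, IsUnit u → Γ x = C (C u) * G → R G x)
    (hc : ∀ T' ⊆ T, ∀ x₀ ∈ T', (∀ i, k ≤ i → i < k + m → ∀ x ∈ T', ∀ x' ∈ T',
      resClass z y (p i) x = resClass z y (p i) x') → ∀ G, Irreducible G → G.natDegree ≠ 0 → Bd E G →
      (∀ x ∈ T', G.evalEval x.1 x.2 = 0 ∧ R G x) → T'.card ≤ c) :
    T.card ≤ 2 * E * c * (2 * d * Q ^ 2) ^ m := by
  classical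
  refine ws.card_le_of_cell hk hT fun T' hT' hcell => ?_
  rcases T'.eq_empty_or_nonempty with rfl | ⟨x₀, hx₀⟩
  · simp
  have hx₀S := hT (hT' hx₀)
  obtain ⟨F, h1, h2, h3⟩ := exists_factor (ws.N_bd k (by omega) x₀ hx₀S) (ws.N_ne k (by omega) x₀ hx₀S)
  have hsub : T' ⊆ F.biUnion fun G => T'.filter fun x => G.evalEval x.1 x.2 = 0 ∧ R G x := by
    intro x hx
    have hc := hΓ x (hT' hx)
    rw [ws.N_congr k (by omega) x (hT (hT' hx)) x₀ hx₀S
      fun i h1 h2 => hcell i h1 (by omega) x hx x₀ hx₀] at hc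
    obtain ⟨G, hG, u, hu, he⟩ := h3 _ hc.irr hc.dvd hc.deg
    refine mem_biUnion.2 ⟨G, hG, mem_filter.2 ⟨hx, ?_, hR x (hT' hx) G u hu he⟩⟩
    have := hc.zero
    rw [he, evalEval_mul, evalEval_CC] at this
    exact (mul_eq_zero.1 this).resolve_left hu.ne_zero
  refine (card_le_card hsub).trans ((card_biUnion_le_card_mul _ _ _ fun G hG => ?_).trans
    (Nat.mul_le_mul_right _ h1))
  rcases Finset.eq_empty_or_nonempty (T'.filter fun x => G.evalEval x.1 x.2 = 0 ∧ R G x) with h | ⟨x₁, hx₁⟩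
  · simp [h]
  obtain ⟨hG1, hG2, hG3⟩ := h2 G hG
  exact hc _ ((filter_subset _ _).trans hT') x₁ hx₁ (fun i hi hi' x hx x' hx' =>
    hcell i hi hi' x (mem_filter.1 hx).1 x' (mem_filter.1 hx').1) G hG1 hG2 hG3 fun x hx => (mem_filter.1 hx).2

theorem card_break {k : ℕ}
    (hk : k + r + 1 ≤ L) (Γ : ℤ × ℤ → ℤ[X][X]) (T : Finset (ℤ × ℤ)) (hT : T ⊆ S)
    (hΓ : ∀ x ∈ T, IsComponent (N k x) (Γ x) x) (hb : ∀ x ∈ T, ¬ Γ x ∣ N (k + 1) x) :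
    T.card ≤ 2 * E * ((E + E) * (E + E) * E + E) * (2 * d * Q ^ 2) ^ (r + 1) := by
  refine ws.card_le_of_components (m := r + 1) hk (by omega) hT hΓ (fun G x => ¬ G ∣ N (k + 1) x)
    (fun x hx G u hu he h => hb x hx ?_) fun T' hT' x₀ hx₀ hcell G hG _ hGE h => ?_
  · rw [he]
    exact (IsUnit.mul_left_dvd ((hu.map C).map C)).2 h
  · refine card_common_zeros_le hG (h x₀ hx₀).2 hGE (ws.N_bd (k + 1) (by omega) x₀ (hT (hT' hx₀))) _
      fun x hx => ⟨(h x hx).1, ?_⟩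
    rw [← ws.N_congr (k + 1) (by omega) x (hT (hT' hx)) x₀ (hT (hT' hx₀))
      fun i h1 h2 => hcell i (by omega) (by omega) x hx x₀ hx₀]
    exact ws.N_zero (k + 1) (by omega) x (hT (hT' hx))

theorem card_singular (Γ : ℤ × ℤ → ℤ[X][X]) (T : Finset (ℤ × ℤ)) (hT : T ⊆ S)
    (hΓ : ∀ x ∈ T, IsComponent (N 0 x) (Γ x) x)
    (hb : ∀ x ∈ T, (derivative (Γ x)).evalEval x.1 x.2 = 0) :
    T.card ≤ 2 * E * ((E + E) * (E + E) * E + E) * (2 * d * Q ^ 2) ^ r := by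
  have hL := ws.le_L (Nat.zero_le B₀)
  refine ws.card_le_of_components (by omega) le_rfl hT hΓ
    (fun G x => (derivative G).evalEval x.1 x.2 = 0) (fun x hx G u hu he => ?_)
    fun T' _ _ _ _ G hG hG0 hGE h => card_common_zeros_le hG (fun h => hG0 ?_) hGE hGE.derivative _ h
  · have := hb x hx
    rw [he, derivative_C_mul, evalEval_mul, evalEval_CC] at this
    exact (mul_eq_zero.1 this).resolve_left hu.ne_zero
  · exact derivative_eq_zero.1 (eq_zero_of_dvd_of_natDegree_lt h (natDegree_derivative_lt hG0))

theorem card_smooth {k : ℕ}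
    (hk : k + (r + t) ≤ L) (Γ : ℤ × ℤ → ℤ[X][X]) (T : Finset (ℤ × ℤ)) (hT : T ⊆ S)
    (hΓ : ∀ x ∈ T, IsComponent (N k x) (Γ x) x)
    (hb : ∀ x ∈ T, ∀ i, k ≤ i → i < k + (r + t) → ¬ (p i : ℤ) ∣ (derivative (Γ x)).evalEval x.1 x.2) :
    T.card ≤ 2 * E * (((E + M + 3) ^ 3 + 2 * D) * (2 * d * (E * Q)) ^ t) * (2 * d * Q ^ 2) ^ r := by
  classical
  refine ws.card_le_of_components (by omega) le_rfl hT hΓ (fun G x => ∀ i, k ≤ i → i < k + (r + t) →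
    ¬ (p i : ℤ) ∣ (derivative G).evalEval x.1 x.2) (fun x hx G u _ he i hi hi' hd => hb x hx i hi hi' ?_)
    fun T₁ hT₁ _ _ hcell G hG1 hG2 hG3 h => ?_
  · rw [he, derivative_C_mul, evalEval_mul, evalEval_CC]
    exact hd.mul_left _
  have hs : T₁ ⊆ S := hT₁.trans hT
  have hE : 0 < E := by have := hG3.1; omega
  refine ws.card_le_of_res (k := k + r) (m := t) (c := E * Q) (by omega) (Nat.mul_pos hE ws.Q_pos) hs
    (fun i h1 h2 => ?_) fun T'' hT'' hcell' => ?_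
  · refine (card_image_cast_curve_le (ws.prime i (by omega)) hG3.1 T₁ (fun x hx => (h x hx).1)
      (fun x hx => (h x hx).2 i (by omega) (by omega))).trans ?_
    exact Nat.mul_le_mul_left _ (ws.upper i (by omega))
  · have hs' := hT''.trans hs
    refine card_cell_curve (W := W) (V := V) ws.W_pos ws.V_pos ws.W_le ws.bd ws.line hG1 hG2 hG3 T'' y
      (fun x hx => (h x (hT'' hx)).1) (fun x hx => ws.fst_le x (hs' hx))
      (fun x hx => ws.snd_le x (hs' hx)) (fun x hx => ws.y_le x (hs' hx)) (fun x hx => ws.sq x (hs' hx))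
      (primeBlock p k (r + t)) (fun q hq => ?_) (fun q hq x hx => ?_) (ws.curve_block hk)
    · obtain ⟨i, hi, h1, h2, rfl⟩ := mem_block hk hq
      refine ws.goodCell hi hs' fun x hx x' hx' => ?_
      by_cases hir : i < k + r
      · exact hcell i h1 hir x (hT'' hx) x' (hT'' hx')
      · exact hcell' i (by omega) (by omega) x hx x' hx'
    · obtain ⟨i, hi, h1, h2, rfl⟩ := mem_block hk hq
      exact (h x (hT'' hx)).2 i h1 h2

/-- Some block of primes avoids the divisors of the derivative. -/
theorem exists_block {x : ℤ × ℤ}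
    (hx : x ∈ S) (hv : (N 0 x).map (evalRingHom x.1) ≠ 0) {Γ : ℤ[X][X]} (hΓ : IsComponent (N 0 x) Γ x)
    (h1 : (derivative Γ).evalEval x.1 x.2 ≠ 0) : ∃ j ≤ B₀, ∀ i, j * (r + t) ≤ i →
      i < j * (r + t) + (r + t) → ¬ (p i : ℤ) ∣ (derivative Γ).evalEval x.1 x.2 := by
  classical
  by_contra! h
  choose! f hf1 hf2 hf3 using h
  have hfL : ∀ j ≤ B₀, f j < L := fun j hj => by
    have := ws.le_L hj
    have := hf2 j hj
    omega
  have hinj : ∀ j ≤ B₀, ∀ j' ≤ B₀, f j = f j' → j = j' := by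
    intro j hj j' hj' hjj
    have a1 := hf1 j hj
    have a2 := hf2 j hj
    have a3 := hf1 j' hj'
    have a4 := hf2 j' hj'
    rw [← hjj] at a3 a4
    have e1 : j * (r + t) < (j' + 1) * (r + t) := by rw [add_mul, one_mul]; omega
    have e2 : j' * (r + t) < (j + 1) * (r + t) := by rw [add_mul, one_mul]; omega
    have := Nat.lt_of_mul_lt_mul_right e1
    have := Nat.lt_of_mul_lt_mul_right e2
    omega
  have hT0 := shiftTrail_ne_zero hv
  have hdvd : ∀ j ≤ B₀, (p (f j) : ℤ) ∣ shiftTrail (N 0 x) x := fun j hj =>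
    (hf3 j hj).trans (derivative_evalEval_dvd_shiftTrail hΓ.dvd hΓ.zero h1)
  have hprod : ∏ j ∈ range (B₀ + 1), p (f j) ∣ (shiftTrail (N 0 x) x).natAbs := by
    refine Finset.prod_dvd_of_isRelPrime (fun j hj j' hj' hjj => ?_) fun j hj => ?_
    rotate_left
    · exact Int.natCast_dvd.1 (hdvd j (Nat.lt_succ_iff.1 (mem_range.1 hj)))
    · have hj := Nat.lt_succ_iff.1 (mem_range.1 (mem_coe.1 hj))
      have hj' := Nat.lt_succ_iff.1 (mem_range.1 (mem_coe.1 hj'))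
      refine Nat.coprime_iff_isRelPrime.1 ((Nat.coprime_primes (ws.prime _ (hfL j hj)) (ws.prime _ (hfL j' hj'))).2 ?_)
      exact fun he => hjj (hinj j hj j' hj' (ws.inj _ (hfL j hj) _ (hfL j' hj') he))
  have h2 := le_of_dvd (Int.natAbs_pos.2 hT0) hprod
  have h3 : P ^ (B₀ + 1) ≤ ∏ j ∈ range (B₀ + 1), p (f j) := by
    calc P ^ (B₀ + 1) = ∏ j ∈ range (B₀ + 1), P := by simp
      _ ≤ _ := prod_le_prod' fun j hj =>
        ws.lower _ (hfL j (Nat.lt_succ_iff.1 (mem_range.1 hj)))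
  have h4 := ws.N_trail x hx
  rw [abs_eq_natAbs] at h4
  have h5 : (shiftTrail (N 0 x) x).natAbs < P ^ (B₀ + 1) := by exact_mod_cast h4
  omega

/-- The constant in `card_le`. -/
def windowConst (d D E M r t L B₀ : ℕ) : ℕ :=
  (2 * M + D) * (2 * d) ^ t * E * (2 * d) ^ r +
    L * (2 * E * ((E + E) * (E + E) * E + E) * (2 * d) ^ (r + 1)) +
    2 * E * ((E + E) * (E + E) * E + E) * (2 * d) ^ r +
    (B₀ + 1) * (2 * E * (((E + M + 3) ^ 3 + 2 * D) * (2 * d * E) ^ t) * (2 * d) ^ r)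

theorem card_le : S.card ≤ windowConst d D E M r t L B₀ * Q ^ (2 * r + max 2 t) := by
  classical
  have hL := ws.le_L (Nat.zero_le B₀)
  have hex : ∀ x ∈ S, (N 0 x).map (evalRingHom x.1) ≠ 0 → ∃ Γ, IsComponent (N 0 x) Γ x :=
    fun x hx hv => ws.exists_component hx hv
  choose! Γ hΓ using hex
  set TV := S.filter fun x => (N 0 x).map (evalRingHom x.1) = 0 with hTV
  set TA : ℕ → Finset (ℤ × ℤ) := fun k => S.filter fun x => k + r + 1 ≤ L ∧
    IsComponent (N k x) (Γ x) x ∧ ¬ Γ x ∣ N (k + 1) x with hTA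
  set TB := S.filter fun x => IsComponent (N 0 x) (Γ x) x ∧
    (derivative (Γ x)).evalEval x.1 x.2 = 0 with hTB
  set TC : ℕ → Finset (ℤ × ℤ) := fun j => S.filter fun x => IsComponent (N (j * (r + t)) x) (Γ x) x ∧
    ∀ i, j * (r + t) ≤ i → i < j * (r + t) + (r + t) →
      ¬ (p i : ℤ) ∣ (derivative (Γ x)).evalEval x.1 x.2 with hTC
  have hcover : S ⊆ TV ∪ (range L).biUnion TA ∪ TB ∪ (range (B₀ + 1)).biUnion TC := by
    intro x hx
    simp only [Finset.mem_union, mem_biUnion, mem_range]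
    by_cases hv : (N 0 x).map (evalRingHom x.1) = 0
    · exact Or.inl (Or.inl (Or.inl (mem_filter.2 ⟨hx, hv⟩)))
    have hc := hΓ x hx hv
    by_cases hbreak : ∃ k, k + r + 1 ≤ L ∧ Γ x ∣ N k x ∧ ¬ Γ x ∣ N (k + 1) x
    · obtain ⟨k, hk, h1, h2⟩ := hbreak
      exact Or.inl (Or.inl (Or.inr ⟨k, by omega, mem_filter.2
        ⟨hx, hk, ⟨hc.irr, h1, hc.deg, hc.zero⟩, h2⟩⟩))
    push Not at hbreak
    have hall : ∀ k, k + r ≤ L → Γ x ∣ N k x := by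
      intro k
      induction k with
      | zero => exact fun _ => hc.dvd
      | succ k ih => exact fun hk => hbreak k (by omega) (ih (by omega))
    by_cases hd : (derivative (Γ x)).evalEval x.1 x.2 = 0
    · exact Or.inl (Or.inr (mem_filter.2 ⟨hx, hc, hd⟩))
    · obtain ⟨j, hj, h⟩ := ws.exists_block hx hv hc hd
      have := ws.le_L hj
      exact Or.inr ⟨j, by omega, mem_filter.2
        ⟨hx, ⟨hc.irr, hall _ (by omega), hc.deg, hc.zero⟩, h⟩⟩
  have hQ := ws.Q_pos
  have hpow : ∀ {a b : ℕ}, a ≤ b → Q ^ a ≤ Q ^ b := fun h => Nat.pow_le_pow_right hQ h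
  have cV : TV.card ≤ (2 * M + D) * (2 * d) ^ t * E * (2 * d) ^ r * Q ^ (2 * r + max 2 t) := by
    refine (ws.card_vertical TV (filter_subset _ _) fun x hx => (mem_filter.1 hx).2).trans ?_
    calc _ = (2 * M + D) * (2 * d) ^ t * E * (2 * d) ^ r * Q ^ (2 * r + t) := by ring
      _ ≤ _ := Nat.mul_le_mul_left _ (hpow (by omega))
  have cA : ∀ k, (TA k).card ≤ 2 * E * ((E + E) * (E + E) * E + E) * (2 * d) ^ (r + 1) *
      Q ^ (2 * r + max 2 t) := by
    intro k
    by_cases hk : k + r + 1 ≤ L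
    · refine (ws.card_break hk Γ (TA k) (filter_subset _ _)
        (fun x hx => (mem_filter.1 hx).2.2.1) fun x hx => (mem_filter.1 hx).2.2.2).trans ?_
      calc _ = 2 * E * ((E + E) * (E + E) * E + E) * (2 * d) ^ (r + 1) * Q ^ (2 * r + 2) := by ring
        _ ≤ _ := Nat.mul_le_mul_left _ (hpow (by omega))
    · have : TA k = ∅ := Finset.eq_empty_of_forall_notMem fun x hx => hk (mem_filter.1 hx).2.1
      rw [this, card_empty]
      exact Nat.zero_le _
  have cB : TB.card ≤ 2 * E * ((E + E) * (E + E) * E + E) * (2 * d) ^ r * Q ^ (2 * r + max 2 t) := by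
    refine (ws.card_singular Γ TB (filter_subset _ _)
        (fun x hx => (mem_filter.1 hx).2.1) fun x hx => (mem_filter.1 hx).2.2).trans ?_
    calc _ = 2 * E * ((E + E) * (E + E) * E + E) * (2 * d) ^ r * Q ^ (2 * r) := by ring
      _ ≤ _ := Nat.mul_le_mul_left _ (hpow (by omega))
  have cC : ∀ j ∈ range (B₀ + 1), (TC j).card ≤
      2 * E * (((E + M + 3) ^ 3 + 2 * D) * (2 * d * E) ^ t) * (2 * d) ^ r * Q ^ (2 * r + max 2 t) := by
    intro j hj
    have := ws.le_L (Nat.lt_succ_iff.1 (mem_range.1 hj))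
    refine (ws.card_smooth (k := j * (r + t)) (by omega) Γ (TC j) (filter_subset _ _)
        (fun x hx => (mem_filter.1 hx).2.1) fun x hx => (mem_filter.1 hx).2.2).trans ?_
    calc _ = 2 * E * (((E + M + 3) ^ 3 + 2 * D) * (2 * d * E) ^ t) * (2 * d) ^ r * Q ^ (2 * r + t) := by ring
      _ ≤ _ := Nat.mul_le_mul_left _ (hpow (by omega))
  refine (card_le_card hcover).trans ?_
  refine (card_union_le _ _).trans ?_
  refine (Nat.add_le_add_right (card_union_le _ _) _).trans ?_
  refine (Nat.add_le_add_right (Nat.add_le_add_right (card_union_le _ _) _) _).trans ?_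
  have dA := card_biUnion_le_card_mul (range L) TA _ fun k _ => cA k
  have dC := card_biUnion_le_card_mul (range (B₀ + 1)) TC _ cC
  rw [card_range] at dA dC
  refine (add_le_add (add_le_add (add_le_add cV dA) cB) dC).trans (le_of_eq ?_)
  rw [windowConst]
  ring

end WindowSystem

theorem exists_prime_pool (P m : ℕ) (hP : 2 ≤ P) : ∃ T : Finset ℕ, T.card = m ∧
    ∀ p ∈ T, p.Prime ∧ p ≠ 2 ∧ P ≤ p ∧ p ≤ 2 ^ m * P := by
  suffices h : ∃ T : Finset ℕ, ∃ q, T.card = m ∧ P ≤ q ∧ q ≤ 2 ^ m * P ∧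
      ∀ p ∈ T, p.Prime ∧ p ≠ 2 ∧ P ≤ p ∧ p ≤ q by
    obtain ⟨T, q, h1, -, h2, h3⟩ := h
    exact ⟨T, h1, fun p hp => ⟨(h3 p hp).1, (h3 p hp).2.1, (h3 p hp).2.2.1, (h3 p hp).2.2.2.trans h2⟩⟩
  induction m with
  | zero => exact ⟨∅, P, by simp, le_rfl, by simp, by simp⟩
  | succ m ih =>
    obtain ⟨T, q, h1, h0, h2, h3⟩ := ih
    obtain ⟨p, hp, hqp, hp2⟩ := Nat.exists_prime_lt_and_le_two_mul q (by omega)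
    refine ⟨insert p T, p, ?_, by omega, ?_, ?_⟩
    · rw [Finset.card_insert_of_notMem fun h => ?_, h1]
      have := (h3 p h).2.2.2
      omega
    · calc p ≤ 2 * q := hp2
        _ ≤ 2 * (2 ^ m * P) := Nat.mul_le_mul_left _ h2
        _ = _ := by ring
    · intro p' hp'
      rcases Finset.mem_insert.1 hp' with rfl | hp'
      · exact ⟨hp, by omega, by omega, le_rfl⟩
      · obtain ⟨a, b, c, d⟩ := h3 p' hp'
        exact ⟨a, b, c, by omega⟩

theorem card_prime_divisors_le {P B : ℕ} {w : ℤ} (hw : w ≠ 0) (T : Finset ℕ)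
    (hT : ∀ p ∈ T, p.Prime ∧ P ≤ p ∧ (p : ℤ) ∣ w) (hP : |w| < (P : ℤ) ^ (B + 1)) (hP1 : 1 ≤ P) : T.card ≤ B := by
  have h1 : ∏ p ∈ T, p ∣ w.natAbs := Finset.prod_primes_dvd _ (fun p hp => (hT p hp).1.prime)
    fun p hp => Int.natCast_dvd.1 (hT p hp).2.2
  have h2 := le_of_dvd (Int.natAbs_pos.2 hw) h1
  have h3 : P ^ T.card ≤ ∏ p ∈ T, p := by
    calc P ^ T.card = ∏ p ∈ T, P := by simp
      _ ≤ _ := prod_le_prod' fun p hp => (hT p hp).2.1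
  rw [abs_eq_natAbs] at hP
  have h4 : w.natAbs < P ^ (B + 1) := by exact_mod_cast hP
  by_contra! h
  have := Nat.pow_le_pow_right hP1 (show B + 1 ≤ T.card by omega)
  omega

theorem pow_lt_ceil_pow {δ : ℝ} (hδ : 0 < δ) (κ H B c : ℕ) (hH : 1 ≤ H) (hB : (κ + 1 : ℝ) / δ ≤ B)
    (hc : c < H) : c * H ^ κ < ⌈(H : ℝ) ^ δ⌉₊ ^ (B + 1) := by
  have hH' : (1 : ℝ) ≤ H := by exact_mod_cast hH
  have h1 : (H : ℝ) ^ (κ + 1) ≤ (⌈(H : ℝ) ^ δ⌉₊ : ℝ) ^ (B + 1) := by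
    calc (H : ℝ) ^ (κ + 1) = (H : ℝ) ^ ((κ + 1 : ℕ) : ℝ) := (rpow_natCast _ _).symm
      _ ≤ (H : ℝ) ^ (δ * ((B + 1 : ℕ) : ℝ)) := by
          refine rpow_le_rpow_of_exponent_le hH' ?_
          rw [div_le_iff₀ hδ] at hB
          push_cast
          nlinarith
      _ = ((H : ℝ) ^ δ) ^ (B + 1) := by rw [rpow_mul (by linarith), rpow_natCast]
      _ ≤ _ := pow_le_pow_left₀ (by positivity) (le_ceil _) _
  have h2 : H ^ (κ + 1) ≤ ⌈(H : ℝ) ^ δ⌉₊ ^ (B + 1) := by exact_mod_cast h1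
  refine lt_of_lt_of_le ?_ h2
  rw [pow_succ']
  exact Nat.mul_lt_mul_of_pos_right hc (pow_pos (by omega) _)

theorem exists_window_count (n d D E κ r t : ℕ) (δ ε : ℝ) (hδ : 0 < δ) (hε : 0 < ε) (hn : n ≠ 0) (hκ : n ≤ κ)
    (hrt : (n : ℝ) / 2 + ε ≤ δ * (r + t : ℕ)) : ∃ C₀ C H₀ : ℕ, ∀ H : ℕ, H₀ ≤ H →
      ∀ (Φ : ℤ[X][X][X]) (Δ : ℤ[X][X]) (S : Finset (ℤ × ℤ)) (z y w : ℤ × ℤ → ℤ),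
      Φ.Monic → Φ.natDegree = d → (∀ x ∈ S, (Φ.map (evalEvalRingHom x.1 x.2)).eval (z x) = 0) →
      (∀ x ∈ S, Δ.evalEval x.1 x.2 = y x ^ 2) → Bd D Δ →
      (∀ m c, ¬ IsSquare (restrictLine Δ m c)) →
      (∀ a : ℤ, ¬ IsSquare ((Δ.map (evalRingHom a)).map (castRingHom ℚ))) →
      (∀ x ∈ S, |x.1| ≤ (H : ℤ) ^ n) → (∀ x ∈ S, |x.2| ≤ (H : ℤ) ^ n) →
      (∀ x ∈ S, |y x| ≤ (H : ℤ) ^ κ) → (∀ x ∈ S, w x ≠ 0) → (∀ x ∈ S, |w x| ≤ (H : ℤ) ^ κ) →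
      (∀ x ∈ S, y x ∣ w x) →
      (∀ I : Finset ℕ, I.card = r → (∀ p ∈ I, p.Prime ∧ p ≠ 2 ∧ ⌈(H : ℝ) ^ δ⌉₊ ≤ p ∧
        p ≤ C₀ * ⌈(H : ℝ) ^ δ⌉₊) → ∀ S' ⊆ S, (∀ p ∈ I, ∀ x ∈ S', ¬ (p : ℤ) ∣ w x) →
        (∀ p ∈ I, ∀ x ∈ S', ∀ x' ∈ S', resClass z y p x = resClass z y p x') →
        ∃ N : ℤ[X][X], N ≠ 0 ∧ Bd E N ∧ (∀ x ∈ S', N.evalEval x.1 x.2 = 0) ∧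
          ∀ a b : ℤ, |a| ≤ 2 * (H : ℤ) ^ n → |b| ≤ 2 * (H : ℤ) ^ n → |N.evalEval a b| ≤ (H : ℤ) ^ κ) →
      S.card ≤ C * ⌈(H : ℝ) ^ δ⌉₊ ^ (2 * r + max 2 t) := by
  classical
  obtain ⟨M, H₁, hM⟩ := exists_curve_exponent n κ ε hε
  obtain ⟨c, hc0, hc⟩ := exists_coeff_bound E
  obtain ⟨B₀, hB₀⟩ := exists_nat_ge ((κ + 1 : ℝ) / δ)
  set L := (B₀ + 1) * (r + t) + 1 with hL
  set m := L + B₀ with hm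
  refine ⟨2 ^ m, WindowSystem.windowConst d D E M r t L B₀ * (2 ^ m) ^ (2 * r + max 2 t) * 2 ^ m, H₁ + c + E + 2, ?_⟩
  intro H hH Φ Δ S z y w hΦ hd hz hy hΔ hline hvert hS1 hS2 hyV hw0 hwV hyw hsup
  set P := ⌈(H : ℝ) ^ δ⌉₊ with hP
  have hH1 : (1 : ℝ) < H := by exact_mod_cast (show 1 < H by omega)
  have hHn : (H : ℤ) ^ n ≤ (H : ℤ) ^ κ := pow_le_pow_right₀ (by omega) hκ
  have hP2 : 2 ≤ P := by
    have : 1 < P := Nat.lt_ceil.2 (by simpa using Real.one_lt_rpow hH1 hδ)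
    omega
  obtain ⟨T, hTm, hT⟩ := exists_prime_pool P m hP2
  have hbad : ∀ x ∈ S, ∃ J ⊆ T, J.card = L ∧ ∀ p ∈ J, ¬ (p : ℤ) ∣ w x := by
    intro x hx
    have h1 : (T.filter fun p : ℕ => (p : ℤ) ∣ w x).card ≤ B₀ := by
      refine card_prime_divisors_le (P := P) (hw0 x hx) _ (fun p hp => ?_) ?_ (by omega)
      · obtain ⟨h, h'⟩ := mem_filter.1 hp
        exact ⟨(hT p h).1, (hT p h).2.2.1, h'⟩
      · refine (hwV x hx).trans_lt ?_
        have := pow_lt_ceil_pow hδ κ H B₀ 1 (by omega) hB₀ (by omega)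
        rw [one_mul] at this
        exact_mod_cast this
    have h2 := Finset.card_filter_add_card_filter_not (s := T) (fun p : ℕ => (p : ℤ) ∣ w x)
    obtain ⟨J, hJ, hJL⟩ := Finset.exists_subset_card_eq
      (show L ≤ (T.filter fun p : ℕ => ¬ (p : ℤ) ∣ w x).card by omega)
    exact ⟨J, hJ.trans (filter_subset _ _), hJL, fun p hp => (mem_filter.1 (hJ hp)).2⟩
  choose! f hfT hfL hfw using hbad
  have himg : (S.image f).card ≤ 2 ^ m := by
    rw [← hTm, ← Finset.card_powerset]
    refine card_le_card fun J hJ => ?_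
    obtain ⟨x, hx, rfl⟩ := mem_image.1 hJ
    exact Finset.mem_powerset.2 (hfT x hx)
  have hmain : ∀ J ∈ S.image f, {x ∈ S | f x = J}.card ≤
      WindowSystem.windowConst d D E M r t L B₀ * (2 ^ m * P) ^ (2 * r + max 2 t) := by
    intro J hJ
    obtain ⟨x₀, hx₀, rfl⟩ := mem_image.1 hJ
    set S₁ := {x ∈ S | f x = f x₀} with hS₁
    have hS₁S : S₁ ⊆ S := filter_subset _ _
    have hJL := hfL x₀ hx₀
    have hJT := hfT x₀ hx₀
    have hJw : ∀ p ∈ f x₀, ∀ x ∈ S₁, ¬ (p : ℤ) ∣ w x := fun p hp x hx => by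
      obtain ⟨h, h'⟩ := mem_filter.1 hx
      exact hfw x h p (h' ▸ hp)
    set e := (f x₀).orderEmbOfFin hJL with he
    set p : ℕ → ℕ := fun i => if h : i < L then e ⟨i, h⟩ else 0 with hp
    have hpi : ∀ i (h : i < L), p i = e ⟨i, h⟩ := fun i h => dif_pos h
    have hpJ : ∀ i < L, p i ∈ f x₀ := fun i h => by
      rw [hpi i h]; exact Finset.orderEmbOfFin_mem _ _ _
    have hinj : ∀ i < L, ∀ j < L, p i = p j → i = j := fun i hi j hj h => by
      rw [hpi i hi, hpi j hj] at h
      simpa using e.injective h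
    have hex : ∀ k S', ∃ N : ℤ[X][X], k + r ≤ L → S' ⊆ S₁ → (∀ i, k ≤ i → i < k + r → ∀ x ∈ S', ∀ x' ∈ S',
        resClass z y (p i) x = resClass z y (p i) x') → N ≠ 0 ∧ Bd E N ∧
        (∀ x ∈ S', N.evalEval x.1 x.2 = 0) ∧
          ∀ a b : ℤ, |a| ≤ 2 * (H : ℤ) ^ n → |b| ≤ 2 * (H : ℤ) ^ n → |N.evalEval a b| ≤ (H : ℤ) ^ κ := by
      intro k S'
      by_cases h : k + r ≤ L ∧ S' ⊆ S₁ ∧ (∀ i, k ≤ i → i < k + r → ∀ x ∈ S', ∀ x' ∈ S',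
        resClass z y (p i) x = resClass z y (p i) x')
      · obtain ⟨h1, h2, h3⟩ := h
        have hmem : ∀ q ∈ primeBlock p k r, ∃ i, k ≤ i ∧ i < k + r ∧ p i = q := fun q hq => by
          obtain ⟨i, hi, a, b, e⟩ := WindowSystem.mem_block h1 hq
          exact ⟨i, a, b, e⟩
        obtain ⟨N, hN⟩ := hsup (primeBlock p k r) (by
            rw [primeBlock, card_image_of_injOn]
            · simp
            · intro i hi j hj hij
              rw [coe_Ico, Set.mem_Ico] at hi hj
              exact hinj i (by omega) j (by omega) hij)
          (fun q hq => by
            obtain ⟨i, a, b, rfl⟩ := hmem q hq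
            exact hT _ (hJT (hpJ i (by omega)))) S' (h2.trans hS₁S)
          (fun q hq x hx => by
            obtain ⟨i, a, b, rfl⟩ := hmem q hq
            exact hJw _ (hpJ i (by omega)) x (h2 hx))
          (fun q hq x hx x' hx' => by
            obtain ⟨i, a, b, rfl⟩ := hmem q hq
            exact h3 i a b x hx x' hx')
        exact ⟨N, fun _ _ _ => hN⟩
      · exact ⟨0, fun h1 h2 h3 => absurd ⟨h1, h2, h3⟩ h⟩
    choose Nf hNf using hex
    set cell : ℕ → ℤ × ℤ → Finset (ℤ × ℤ) := fun k x => {x' ∈ S₁ | ∀ i, k ≤ i → i < k + r →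
      resClass z y (p i) x = resClass z y (p i) x'} with hcell
    have hN : ∀ k, k + r ≤ L → ∀ x, _ := fun k hk x => hNf k (cell k x) hk (filter_subset _ _)
      fun i h1 h2 x' hx' x'' hx'' => ((mem_filter.1 hx').2 i h1 h2).symm.trans
        ((mem_filter.1 hx'').2 i h1 h2)
    have hself : ∀ k, ∀ x ∈ S₁, x ∈ cell k x := fun k x hx =>
      mem_filter.2 ⟨hx, fun _ _ _ => rfl⟩
    refine WindowSystem.card_le (P := P) (W := H ^ n) (V := H ^ κ) (p := p) (Φ := Φ) (Δ := Δ) (z := z)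
      (y := y) (N := fun k x => Nf k (cell k x)) ?_
    refine
      { prime := fun i hi => (hT _ (hJT (hpJ i hi))).1
        ne_two := fun i hi => (hT _ (hJT (hpJ i hi))).2.1
        inj := hinj
        lower := fun i hi => (hT _ (hJT (hpJ i hi))).2.2.1
        upper := fun i hi => (hT _ (hJT (hpJ i hi))).2.2.2
        monic := hΦ
        natDegree := hd
        root := fun x hx => hz x (hS₁S hx)
        sq := fun x hx => hy x (hS₁S hx)
        bd := hΔ
        line := hline
        vert := hvert
        not_dvd := fun i hi x hx h => hJw _ (hpJ i hi) x hx (h.trans (hyw x (hS₁S hx)))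
        fst_le := fun x hx => by push_cast; exact hS1 x (hS₁S hx)
        snd_le := fun x hx => by push_cast; exact hS2 x (hS₁S hx)
        y_le := fun x hx => by push_cast; exact hyV x (hS₁S hx)
        W_pos := pow_pos (by omega) _
        V_pos := pow_pos (by omega) _
        W_le := Nat.pow_le_pow_right (by omega) hκ
        curve := hM H _ (by omega) ?_
        N_ne := fun k hk x _ => (hN k hk x).1
        N_bd := fun k hk x _ => (hN k hk x).2.1
        N_zero := fun k hk x hx => (hN k hk x).2.2.1 x (hself k x hx)
        N_congr := fun k hk x hx x' hx' h => ?_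
        N_trail := fun x hx => ?_
        L_ge := le_rfl }
    · have e1 : (n : ℝ) / 2 + ε ≤ δ * ((r + t : ℕ) : ℝ) := hrt
      push_cast
      calc (H : ℝ) ^ ((n : ℝ) / 2 + ε) ≤ (H : ℝ) ^ (δ * ((r + t : ℕ) : ℝ)) :=
            rpow_le_rpow_of_exponent_le hH1.le e1
        _ = ((H : ℝ) ^ δ) ^ (r + t) := by rw [rpow_mul (by linarith), rpow_natCast]
        _ ≤ _ := pow_le_pow_left₀ (by positivity) (le_ceil _) _
    · have : cell k x = cell k x' := by
        ext x''
        simp only [hcell, mem_filter]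
        refine and_congr_right fun _ => forall_congr' fun i => ?_
        refine forall_congr' fun h1 => forall_congr' fun h2 => ?_
        rw [h i h1 h2]
      simp only [this]
    · have h0 : 0 + r ≤ L := by rw [hL, add_mul, one_mul]; omega
      obtain ⟨a1, a2, a3, a4⟩ := hN 0 h0 x
      refine (abs_shiftTrail_le a2.1 hc (B := (H : ℤ) ^ κ) fun j hj => a4 _ _ ?_ ?_).trans_lt ?_
      · have := hS1 x (hS₁S hx)
        have h3 : (0 : ℤ) ≤ (H : ℤ) ^ n := by positivity
        linarith
      · have := hS2 x (hS₁S hx)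
        refine (abs_add_le _ _).trans ?_
        have h4 : |(j : ℤ)| ≤ (H : ℤ) ^ n := by
          rw [Nat.abs_cast]
          have : (H : ℤ) ≤ (H : ℤ) ^ n := le_self_pow₀ (by omega) hn
          have : (j : ℤ) ≤ H := by exact_mod_cast (by omega)
          linarith
        linarith
      · have := pow_lt_ceil_pow hδ κ H B₀ c (by omega) hB₀ (by omega)
        exact_mod_cast this
  refine (card_le_mul_card_image S _ hmain).trans ((Nat.mul_le_mul_left _ himg).trans (le_of_eq ?_))
  rw [mul_pow]
  ring

/-- A monic irreducible family of polynomials of degree `d` over the plane, of size bounded by a power of `H`,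
together with a polynomial that is not a square on any line. -/
structure SurfaceData (n d D κ H : ℕ) (Φ : ℤ[X][X][X]) (Δ : ℤ[X][X]) : Prop where
  irreducible : Irreducible Φ
  monic : Φ.Monic
  natDegree : Φ.natDegree = d
  bd : ∀ k, Bd D (Φ.coeff k)
  size : ∀ k, ∀ a b : ℤ, |a| ≤ 2 * (H : ℤ) ^ n → |b| ≤ 2 * (H : ℤ) ^ n →
    |(Φ.coeff k).evalEval a b| ≤ (H : ℤ) ^ κ
  bd_disc : Bd D Δ
  line : ∀ m c, ¬ IsSquare (restrictLine Δ m c)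
  vert : ∀ a : ℤ, ¬ IsSquare ((Δ.map (evalRingHom a)).map (castRingHom ℚ))

theorem SurfaceData.abs_coeff_derivative_le {n d D κ H : ℕ} {Φ : ℤ[X][X][X]} {Δ : ℤ[X][X]}
    (h : SurfaceData n d D κ H Φ Δ) {a b : ℤ} (ha : |a| ≤ 2 * (H : ℤ) ^ n) (hb : |b| ≤ 2 * (H : ℤ) ^ n) (k : ℕ) :
    |((derivative Φ).map (evalEvalRingHom a b)).coeff k| ≤ d * (H : ℤ) ^ κ := by
  rw [← derivative_map, coeff_derivative, coeff_map]
  by_cases hk : d < k + 1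
  · rw [coeff_eq_zero_of_natDegree_lt (h.natDegree ▸ hk)]
    simp
    positivity
  · have h1 := h.size (k + 1) a b ha hb
    have h2 : |(k : ℤ) + 1| ≤ d := by
      rw [abs_of_nonneg (by positivity)]
      exact_mod_cast not_lt.1 hk
    rw [abs_mul, mul_comm]
    exact mul_le_mul h2 h1 (abs_nonneg _) (by positivity)

theorem SurfaceData.abs_derivative_le {n d D κ H : ℕ} {Φ : ℤ[X][X][X]} {Δ : ℤ[X][X]}
    (h : SurfaceData n d D κ H Φ Δ) (hH : 1 ≤ H) {a b z : ℤ} (ha : |a| ≤ 2 * (H : ℤ) ^ n)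
    (hb : |b| ≤ 2 * (H : ℤ) ^ n) (hz : |z| ≤ (H : ℤ) ^ κ) :
    |((derivative Φ).map (evalEvalRingHom a b)).eval z| ≤ (d * (d + 1) : ℕ) * (H : ℤ) ^ (κ + κ * d) := by
  have hdeg : ((derivative Φ).map (evalEvalRingHom a b)).natDegree < d + 1 :=
    (natDegree_map_le.trans ((natDegree_derivative_le Φ).trans (sub_le _ _))).trans_lt
      (by rw [h.natDegree]; omega)
  rw [eval_eq_sum_range' hdeg]
  refine (abs_sum_le_sum_abs _ _).trans ?_
  refine (sum_le_card_nsmul _ _ (d * (H : ℤ) ^ (κ + κ * d)) fun k hk => ?_).trans ?_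
  · rw [abs_mul, abs_pow, pow_add, ← mul_assoc]
    refine mul_le_mul (h.abs_coeff_derivative_le ha hb k) ?_ (by positivity) (by positivity)
    calc |z| ^ k ≤ ((H : ℤ) ^ κ) ^ k := pow_le_pow_left₀ (abs_nonneg _) hz _
      _ ≤ ((H : ℤ) ^ κ) ^ d := pow_le_pow_right₀ (one_le_pow₀ (by exact_mod_cast hH))
          (by simpa [Nat.lt_succ_iff] using hk)
      _ = _ := (pow_mul _ _ _).symm
  · rw [card_range, nsmul_eq_mul]
    push_cast
    apply le_of_eq; ring

theorem SurfaceData.exists_disc {n d D κ : ℕ} (hd : d ≠ 0) :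
    ∃ E κ' H₀ : ℕ, ∀ H : ℕ, H₀ ≤ H → ∀ (Φ : ℤ[X][X][X]) (Δ : ℤ[X][X]), SurfaceData n d D κ H Φ Δ →
      ∃ N : ℤ[X][X], N ≠ 0 ∧ Bd E N ∧
        (∀ x : ℤ × ℤ, ∀ z : ℤ, (Φ.map (evalEvalRingHom x.1 x.2)).eval z = 0 →
          ((derivative Φ).map (evalEvalRingHom x.1 x.2)).eval z = 0 → N.evalEval x.1 x.2 = 0) ∧
        ∀ a b : ℤ, |a| ≤ 2 * (H : ℤ) ^ n → |b| ≤ 2 * (H : ℤ) ^ n → |N.evalEval a b| ≤ (H : ℤ) ^ κ' := by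
  refine ⟨(d + d) * D, (κ + 1) * (d + d) + 1, d + 1 + (d + d).factorial, fun H hH Φ Δ h => ?_⟩
  have hdeg : Φ.natDegree ≠ 0 := by rw [h.natDegree]; exact hd
  have hlt : (derivative Φ).natDegree < Φ.natDegree := natDegree_derivative_lt hdeg
  have hder0 : derivative Φ ≠ 0 := fun h0 => hdeg (Polynomial.derivative_eq_zero.1 h0)
  have hnd : ¬ Φ ∣ derivative Φ := fun hdvd =>
    hder0 (eq_zero_of_dvd_of_natDegree_lt hdvd hlt)
  have hR := resultant_ne_zero_of_irreducible h.irreducible hdeg hnd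
  have hH1 : (1 : ℤ) ≤ H := by exact_mod_cast (show 1 ≤ H by omega)
  refine ⟨_, hR, ?_, fun x z hz hz' => ?_, fun a b ha hb => ?_⟩
  · refine (Bd.resultant h.bd fun i => ?_).mono (Nat.mul_le_mul_right _ (by rw [h.natDegree] at *; omega))
    rw [coeff_derivative]
    have : Bd 0 ((i : ℤ[X][X]) + 1) := by
      have := Bd.intCast (D := 0) ((i : ℤ) + 1)
      push_cast at this; exact this
    simpa using (h.bd (i + 1)).mul this
  · exact map_resultant_eq_zero hdeg (evalEvalRingHom x.1 x.2) z hz hz'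
  · change |evalEvalRingHom a b _| ≤ _
    rw [← resultant_map_map]
    have hHd : (1 : ℤ) ≤ d := by exact_mod_cast Nat.one_le_iff_ne_zero.2 hd
    have hdH : (d : ℤ) ≤ H := by exact_mod_cast (show d ≤ H by omega)
    have hB : (d : ℤ) * (H : ℤ) ^ κ ≤ (H : ℤ) ^ (κ + 1) := by
      rw [pow_succ, mul_comm]; gcongr
    refine (abs_resultant_le (B := (H : ℤ) ^ (κ + 1)) (by positivity) (fun i => ?_) fun i =>
      (h.abs_coeff_derivative_le ha hb i).trans hB).trans ?_
    · rw [coeff_map]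
      exact (h.size i a b ha hb).trans (pow_le_pow_right₀ hH1 (by omega))
    · have h1 : Φ.natDegree + (derivative Φ).natDegree ≤ d + d := by rw [h.natDegree] at *; omega
      have h2 : (((Φ.natDegree + (derivative Φ).natDegree).factorial : ℕ) : ℤ) ≤ H := by
        exact_mod_cast (Nat.factorial_le h1).trans (by omega)
      calc _ ≤ (H : ℤ) * ((H : ℤ) ^ (κ + 1)) ^ (d + d) := by
            gcongr
            exact one_le_pow₀ hH1
        _ = _ := by rw [← pow_mul, mul_comm, pow_succ]

theorem card_surface_points_le (n d D κ : ℕ) (hn : 2 ≤ n) (hd : 0 < d) (hκ : n ≤ κ)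
    (hπ : √((n : ℝ) * (n - 1) / d) ≤ n / 2) (ε : ℝ) (hε : 0 < ε) :
    ∃ C H₀ : ℕ, ∀ H : ℕ, H₀ ≤ H → ∀ (Φ : ℤ[X][X][X]) (Δ : ℤ[X][X]), SurfaceData n d D κ H Φ Δ →
      ∀ (S : Finset (ℤ × ℤ)) (z y : ℤ × ℤ → ℤ),
      (∀ x ∈ S, (Φ.map (evalEvalRingHom x.1 x.2)).eval (z x) = 0) →
      (∀ x ∈ S, Δ.evalEval x.1 x.2 = y x ^ 2) → (∀ x ∈ S, y x ≠ 0) →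
      (∀ x ∈ S, |x.1| ≤ (H : ℤ) ^ (n - 1)) → (∀ x ∈ S, |x.2| ≤ (H : ℤ) ^ n) →
      (∀ x ∈ S, |z x| ≤ (H : ℤ) ^ κ) → (∀ x ∈ S, |y x| ≤ (H : ℤ) ^ κ) →
      (S.card : ℝ) ≤ C * (H : ℝ) ^ (√((n : ℝ) * (n - 1) / d) + n / 2 + ε) := by
  classical
  set π := √((n : ℝ) * (n - 1) / d) with hπdef
  have hπ0 : 0 ≤ π := sqrt_nonneg _
  set δ := ε / 8 with hδdef
  have hδ : 0 < δ := by positivity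
  set r := ⌈(π + δ) / δ⌉₊ with hr
  set u := ⌈((n : ℝ) / 2 + δ) / δ⌉₊ with hu
  have hru : r ≤ u := Nat.ceil_le_ceil (by gcongr)
  have hr1 : π + δ ≤ δ * r := by
    have := le_ceil ((π + δ) / δ)
    rw [div_le_iff₀ hδ] at this; linarith
  have hr2 : δ * r ≤ π + 2 * δ := by
    have := (ceil_lt_add_one (show 0 ≤ (π + δ) / δ by positivity)).le
    have h2 : δ * r ≤ δ * ((π + δ) / δ + 1) := mul_le_mul_of_nonneg_left this hδ.le
    rw [mul_add, mul_div_cancel₀ _ hδ.ne'] at h2; linarith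
  have hu1 : (n : ℝ) / 2 + δ ≤ δ * u := by
    have := le_ceil (((n : ℝ) / 2 + δ) / δ)
    rw [div_le_iff₀ hδ] at this; linarith
  have hu2 : δ * u ≤ (n : ℝ) / 2 + 2 * δ := by
    have := (ceil_lt_add_one (show 0 ≤ ((n : ℝ) / 2 + δ) / δ by positivity)).le
    have h2 : δ * u ≤ δ * (((n : ℝ) / 2 + δ) / δ + 1) := mul_le_mul_of_nonneg_left this hδ.le
    rw [mul_add, mul_div_cancel₀ _ hδ.ne'] at h2; linarith
  set κ₁ := κ + ⌈δ * r⌉₊ + 1 with hκ₁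
  obtain ⟨D', κ', H₁, hcell⟩ := exists_cell_norm n d κ₁ D hn hd δ hδ
  obtain ⟨E, κ₂, H₂, hdisc⟩ := SurfaceData.exists_disc (n := n) (d := d) (D := D) (κ := κ) hd.ne'
  set κ₃ := κ' + κ₂ + (κ + (κ + κ * d)) + 1 + n with hκ₃
  obtain ⟨C₀, C, H₃, hwin⟩ := exists_window_count n d D D' κ₃ r (u - r) δ δ hδ hδ (by omega)
    (by omega) (by rw [Nat.add_sub_cancel' hru]; exact hu1)
  obtain ⟨C₀', C', H₄, hwin'⟩ := exists_window_count n d D E κ₃ 0 u δ δ hδ hδ (by omega)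
    (by omega) (by rw [zero_add]; exact hu1)
  refine ⟨(C + C') * 2 ^ (2 * r + 2 * u + 2), H₁ + H₂ + H₃ + H₄ + (C₀ * 2) ^ r + d * (d + 1) + 1, ?_⟩
  intro H hH Φ Δ h S z y hz hy hy0 hS1 hS2 hzκ hyκ
  have hH1 : 1 ≤ H := by omega
  have hHZ : (1 : ℤ) ≤ H := by exact_mod_cast hH1
  have hHR : (1 : ℝ) ≤ H := by exact_mod_cast hH1
  have hup : ∀ {a b : ℕ}, a ≤ b → (H : ℤ) ^ a ≤ (H : ℤ) ^ b := fun hab => pow_le_pow_right₀ hHZ hab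
  have hHδ : (1 : ℝ) ≤ (H : ℝ) ^ δ := one_le_rpow hHR hδ.le
  have hceil : (⌈(H : ℝ) ^ δ⌉₊ : ℝ) ≤ 2 * (H : ℝ) ^ δ := by
    have := (ceil_lt_add_one (zero_le_one.trans hHδ)).le
    linarith
  have hpowbound : ∀ k : ℕ, k ≤ 2 * r + 2 * u + 2 → δ * k ≤ π + n / 2 + ε →
      (⌈(H : ℝ) ^ δ⌉₊ : ℝ) ^ k ≤ 2 ^ (2 * r + 2 * u + 2) * (H : ℝ) ^ (π + n / 2 + ε) := fun k hk hk' => by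
    calc (⌈(H : ℝ) ^ δ⌉₊ : ℝ) ^ k ≤ (2 * (H : ℝ) ^ δ) ^ k := by gcongr
      _ = 2 ^ k * (H : ℝ) ^ (δ * k) := by rw [mul_pow, ← rpow_natCast, ← rpow_natCast, ← rpow_mul (by positivity)]
      _ ≤ _ := by
        gcongr
        norm_num
  set v : ℤ × ℤ → ℤ := fun x => ((derivative Φ).map (evalEvalRingHom x.1 x.2)).eval (z x) with hv
  have hbox1 : ∀ x ∈ S, |x.1| ≤ (H : ℤ) ^ n := fun x hx => (hS1 x hx).trans (hup (by omega))
  have hpos : (0 : ℤ) ≤ (H : ℤ) ^ n := by positivity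
  have hvb : ∀ x ∈ S, |v x| ≤ (H : ℤ) ^ (1 + (κ + κ * d)) := fun x hx => by
    refine (h.abs_derivative_le hH1 (by linarith [hbox1 x hx]) (by linarith [hS2 x hx]) (hzκ x hx)).trans ?_
    rw [pow_add _ 1, pow_one]
    gcongr
    exact_mod_cast (show d * (d + 1) ≤ H by omega)
  set S₁ := S.filter fun x => v x ≠ 0 with hS₁
  set S₂ := S.filter fun x => v x = 0 with hS₂
  have hs₁ : S₁ ⊆ S := filter_subset _ _
  have hs₂ : S₂ ⊆ S := filter_subset _ _
  have hcard : S.card = S₁.card + S₂.card := by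
    rw [add_comm]; exact (Finset.card_filter_add_card_filter_not (s := S) fun x => v x = 0).symm
  have hb1 : S₁.card ≤ C * ⌈(H : ℝ) ^ δ⌉₊ ^ (2 * r + max 2 (u - r)) := by
    refine hwin H (by omega) Φ Δ S₁ z y (fun x => y x * v x) h.monic h.natDegree (fun x hx => hz x (hs₁ hx))
      (fun x hx => hy x (hs₁ hx)) h.bd_disc h.line h.vert (fun x hx => hbox1 x (hs₁ hx))
      (fun x hx => hS2 x (hs₁ hx)) (fun x hx => (hyκ x (hs₁ hx)).trans (hup (by omega)))
      (fun x hx => mul_ne_zero (hy0 x (hs₁ hx)) (mem_filter.1 hx).2) (fun x hx => ?_)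
      (fun x hx => dvd_mul_right _ _) ?_
    · rw [abs_mul]
      calc _ ≤ (H : ℤ) ^ κ * (H : ℤ) ^ (1 + (κ + κ * d)) :=
            mul_le_mul (hyκ x (hs₁ hx)) (hvb x (hs₁ hx)) (abs_nonneg _) (by positivity)
        _ = (H : ℤ) ^ (κ + (1 + (κ + κ * d))) := (pow_add _ _ _).symm
        _ ≤ _ := hup (by omega)
    · intro I hIr hI S' hS' hIw hcl
      have hS'S : S' ⊆ S := hS'.trans hs₁
      have hprod1 : ((⌈(H : ℝ) ^ δ⌉₊ : ℕ) : ℝ) ^ r ≤ ((∏ p ∈ I, p : ℕ) : ℝ) := by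
        rw [← hIr]
        exact_mod_cast Finset.pow_card_le_prod I (fun p => p) _ fun p hp => (hI p hp).2.2.1
      have hprod2 : ((∏ p ∈ I, p : ℕ) : ℝ) ≤ ((C₀ * ⌈(H : ℝ) ^ δ⌉₊ : ℕ) : ℝ) ^ r := by
        rw [← hIr]
        exact_mod_cast prod_le_pow_card I (fun p => p) _ fun p hp => (hI p hp).2.2.2
      obtain ⟨N, hN0, hND, hNS, hNH⟩ := hcell H (by omega) Φ h.irreducible h.natDegree h.bd
        (fun k a b ha hb => (h.size k a b ha hb).trans (hup (by omega))) S' z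
        (fun x hx => hS1 x (hS'S hx)) (fun x hx => hS2 x (hS'S hx))
        (fun x hx => (hzκ x (hS'S hx)).trans (hup (by omega))) (fun x hx => hz x (hS'S hx)) I
        (fun p hp => ⟨(hI p hp).1, fun x hx x' hx' => (resClass_eq (hcl p hp x hx x' hx')).1,
          fun x hx x' hx' => (resClass_eq (hcl p hp x hx x' hx')).2.1,
          fun x hx x' hx' => (resClass_eq (hcl p hp x hx x' hx')).2.2.1,
          fun x hx hdvd => hIw p hp x hx (hdvd.mul_left _)⟩) (by
          calc (H : ℝ) ^ (π + δ) ≤ (H : ℝ) ^ (δ * r) := by gcongr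
            _ = ((H : ℝ) ^ δ) ^ r := by rw [rpow_mul (by positivity), rpow_natCast]
            _ ≤ (⌈(H : ℝ) ^ δ⌉₊ : ℝ) ^ r := by gcongr; exact le_ceil _
            _ ≤ _ := hprod1) (by
          have h3 : ((∏ p ∈ I, p : ℕ) : ℝ) ≤ ((H ^ κ₁ : ℕ) : ℝ) := by
            calc ((∏ p ∈ I, p : ℕ) : ℝ) ≤ ((C₀ * ⌈(H : ℝ) ^ δ⌉₊ : ℕ) : ℝ) ^ r := hprod2
              _ ≤ (C₀ * (2 * (H : ℝ) ^ δ)) ^ r := by push_cast; gcongr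
              _ = (((C₀ * 2) ^ r : ℕ) : ℝ) * (H : ℝ) ^ (δ * r) := by
                rw [rpow_mul (by positivity), rpow_natCast]; push_cast; ring
              _ ≤ (H : ℝ) * (H : ℝ) ^ ((⌈δ * r⌉₊ : ℕ) : ℝ) := by
                gcongr
                · exact_mod_cast (show (C₀ * 2) ^ r ≤ H by omega)
                · exact le_ceil _
              _ = (H : ℝ) ^ (⌈δ * r⌉₊ + 1) := by rw [rpow_natCast, pow_succ, mul_comm]
              _ ≤ (H : ℝ) ^ κ₁ := pow_le_pow_right₀ hHR (by omega)
              _ = _ := by push_cast; rfl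
          exact_mod_cast h3)
      exact ⟨N, hN0, hND, hNS, fun a b ha hb => (hNH a b ha hb).trans (hup (by omega))⟩
  have hb2 : S₂.card ≤ C' * ⌈(H : ℝ) ^ δ⌉₊ ^ (2 * 0 + max 2 u) := by
    obtain ⟨N, hN0, hND, hNS, hNH⟩ := hdisc H (by omega) Φ Δ h
    exact hwin' H (by omega) Φ Δ S₂ z y y h.monic h.natDegree (fun x hx => hz x (hs₂ hx))
      (fun x hx => hy x (hs₂ hx)) h.bd_disc h.line h.vert (fun x hx => hbox1 x (hs₂ hx))
      (fun x hx => hS2 x (hs₂ hx)) (fun x hx => (hyκ x (hs₂ hx)).trans (hup (by omega)))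
      (fun x hx => hy0 x (hs₂ hx)) (fun x hx => (hyκ x (hs₂ hx)).trans (hup (by omega)))
      (fun x hx => dvd_rfl) fun I _ _ S' hS' _ _ => ⟨N, hN0, hND, fun x hx =>
        hNS x (z x) (hz x (hs₂ (hS' hx))) (mem_filter.1 (hS' hx)).2,
        fun a b ha hb => (hNH a b ha hb).trans (hup (by omega))⟩
  have hn2 : (0 : ℝ) ≤ n := by positivity
  have e1 : δ * ((2 * r + max 2 (u - r) : ℕ) : ℝ) ≤ π + n / 2 + ε := by
    have : ((2 * r + max 2 (u - r) : ℕ) : ℝ) ≤ r + u + 2 := by exact_mod_cast (by omega)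
    calc δ * ((2 * r + max 2 (u - r) : ℕ) : ℝ) ≤ δ * (r + u + 2) := by gcongr
      _ ≤ _ := by nlinarith
  have e2 : δ * ((2 * 0 + max 2 u : ℕ) : ℝ) ≤ π + n / 2 + ε := by
    have : ((2 * 0 + max 2 u : ℕ) : ℝ) ≤ u + 2 := by exact_mod_cast (by omega)
    calc δ * ((2 * 0 + max 2 u : ℕ) : ℝ) ≤ δ * (u + 2) := by gcongr
      _ ≤ _ := by nlinarith
  have f1 := hpowbound _ (by omega) e1
  have f2 := hpowbound _ (by omega) e2
  calc (S.card : ℝ) = S₁.card + S₂.card := by rw [hcard]; push_cast; rfl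
    _ ≤ C * (⌈(H : ℝ) ^ δ⌉₊ : ℝ) ^ (2 * r + max 2 (u - r)) + C' * (⌈(H : ℝ) ^ δ⌉₊ : ℝ) ^ (2 * 0 + max 2 u) :=
      add_le_add (by exact_mod_cast hb1) (by exact_mod_cast hb2)
    _ ≤ C * (2 ^ (2 * r + 2 * u + 2) * (H : ℝ) ^ (π + n / 2 + ε)) +
        C' * (2 ^ (2 * r + 2 * u + 2) * (H : ℝ) ^ (π + n / 2 + ε)) := by gcongr
    _ = _ := by push_cast; ring

/-- The lower coefficients of a polynomial. -/
def coeffVec (n : ℕ) {S : Type*} [Semiring S] (f : S[X]) : Fin n → S := fun i => f.coeff i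

theorem prod_X_sub_C_coeff_fin {n : ℕ} {S : Type*} [CommRing S] (r : Fin n → S) {k : ℕ} (hk : k ≤ n) :
    (∏ j, (X - C (r j))).coeff k = (-1) ^ (n - k) * (univ.val.map r).esymm (n - k) := by
  have h := Multiset.prod_X_sub_C_coeff (univ.val.map r) (k := k) (by simpa using hk)
  rw [Multiset.map_map, card_map, card_val, card_univ, card_fin] at h
  exact h

/-- A symmetric polynomial of the roots is a polynomial of the coefficients. -/
theorem exists_coeffVec_of_isSymmetric {n : ℕ} {p : MvPolynomial (Fin n) ℤ} (hp : p.IsSymmetric) :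
    ∃ q : MvPolynomial (Fin n) ℤ, ∀ {S : Type} [CommRing S] (r : Fin n → S),
      MvPolynomial.aeval (coeffVec n (∏ j, (X - C (r j)))) q = MvPolynomial.aeval r p := by
  obtain ⟨q₀, hq₀⟩ := (MvPolynomial.esymmAlgEquiv (Fin n) ℤ (card_fin n)).surjective ⟨p, hp⟩
  have hq : MvPolynomial.aeval (fun i : Fin n => esymm (Fin n) ℤ (i + 1)) q₀ = p := by
    rw [← MvPolynomial.esymmAlgHom_apply, ← show _ = p from congrArg Subtype.val hq₀]
    rfl
  refine ⟨MvPolynomial.aeval (fun i : Fin n => (-1) ^ ((i : ℕ) + 1) * MvPolynomial.X i.rev) q₀, ?_⟩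
  intro S _ r
  rw [← hq, ← AlgHom.comp_apply, ← AlgHom.comp_apply]
  congr 1
  refine MvPolynomial.algHom_ext fun i => ?_
  have hi : n - (i.rev : ℕ) = i + 1 := by rw [Fin.val_rev]; omega
  rw [AlgHom.comp_apply, AlgHom.comp_apply, MvPolynomial.aeval_X, MvPolynomial.aeval_X,
    MvPolynomial.aeval_esymm_eq_multiset_esymm, map_mul, map_pow, map_neg, map_one, MvPolynomial.aeval_X,
    coeffVec, prod_X_sub_C_coeff_fin r i.rev.2.le, hi, ← mul_assoc, ← mul_pow, neg_one_mul, neg_neg, one_pow,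
    one_mul]

section Resolvent

variable {n : ℕ} {G : Subgroup (Perm (Fin n))} {θ : MvPolynomial (Fin n) ℤ}

theorem rename_eq_of_inv_mul_mem (hθ : ∀ σ ∈ G, rename σ θ = θ) {σ τ : Perm (Fin n)}
    (h : σ⁻¹ * τ ∈ G) : rename σ θ = rename τ θ := by
  conv_lhs => rw [← hθ _ h]
  rw [rename_rename, ← Perm.coe_mul, mul_inv_cancel_left]

theorem rename_out_smul (hθ : ∀ σ ∈ G, rename σ θ = θ) (τ : Perm (Fin n))
    (q : Perm (Fin n) ⧸ G) :
    rename τ (rename q.out θ) = rename (τ • q).out θ := by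
  rw [rename_rename, ← Perm.coe_mul]
  refine rename_eq_of_inv_mul_mem hθ (QuotientGroup.eq.1 ?_)
  rw [QuotientGroup.out_eq']
  conv_rhs => rw [← QuotientGroup.out_eq' q]
  rfl

theorem exists_resolvent [Fintype (Perm (Fin n) ⧸ G)] (hθ : ∀ σ ∈ G, rename σ θ = θ) :
    ∃ U : (MvPolynomial (Fin n) ℤ)[X], U.Monic ∧ U.natDegree = G.index ∧
      ∀ {S : Type} [CommRing S] (r : Fin n → S),
        U.map (MvPolynomial.aeval (coeffVec n (∏ j, (X - C (r j))))).toRingHom =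
          ∏ q : Perm (Fin n) ⧸ G, (X - C (MvPolynomial.aeval (r ∘ q.out) θ)) := by
  classical
  set P : (MvPolynomial (Fin n) ℤ)[X] :=
    ∏ q : Perm (Fin n) ⧸ G, (X - C (rename q.out θ)) with hP
  have hcard : Fintype.card (Perm (Fin n) ⧸ G) = G.index := by
    rw [Subgroup.index, Nat.card_eq_fintype_card]
  have hPm : P.Monic := monic_prod_of_monic _ _ fun q _ => monic_X_sub_C _
  have hPd : P.natDegree = G.index := by
    nontriviality
    rw [hP, natDegree_prod_of_monic _ _ fun q _ => monic_X_sub_C _]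
    simp [hcard]
  have hsymm : ∀ k, (P.coeff k).IsSymmetric := by
    intro k τ
    have h1 : P.map (rename τ : _ →ₐ[ℤ] _).toRingHom = P := by
      rw [hP, Polynomial.map_prod]
      conv_rhs => rw [← Equiv.prod_comp (MulAction.toPerm τ : Perm (Perm (Fin n) ⧸ G))]
      refine prod_congr rfl fun q _ => ?_
      rw [Polynomial.map_sub, map_X, map_C]
      congr 2
      exact rename_out_smul hθ τ q
    conv_rhs => rw [← h1]
    rw [coeff_map]
    rfl
  choose Q hQ using fun k => exists_coeffVec_of_isSymmetric (hsymm k)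
  have hlt : (∑ k ∈ range G.index, C (Q k) * X ^ k).degree < (G.index : WithBot ℕ) :=
    (degree_sum_le _ _).trans_lt ((Finset.sup_lt_iff (WithBot.bot_lt_coe _)).2 fun k hk =>
      (degree_C_mul_X_pow_le _ _).trans_lt (by exact_mod_cast mem_range.1 hk))
  refine ⟨X ^ G.index + ∑ k ∈ range G.index, C (Q k) * X ^ k, monic_X_pow_add hlt,
    natDegree_eq_of_degree_eq_some ?_, ?_⟩
  · rw [degree_add_eq_left_of_degree_lt (by rwa [degree_X_pow]), degree_X_pow]
  · intro S _ r
    have h2 : P.map (MvPolynomial.aeval r).toRingHom =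
        ∏ q : Perm (Fin n) ⧸ G, (X - C (MvPolynomial.aeval (r ∘ q.out) θ)) := by
      rw [hP, Polynomial.map_prod]
      refine prod_congr rfl fun q _ => ?_
      rw [Polynomial.map_sub, map_X, map_C]
      congr 2
      exact aeval_rename _ _ _
    rw [← h2, hPm.as_sum, hPd]
    simp only [Polynomial.map_add, Polynomial.map_pow, map_X, Polynomial.map_sum, Polynomial.map_mul, map_C]
    congr 1
    exact sum_congr rfl fun k _ => by congr 2; exact hQ k r

end Resolvent

section
open NumberField

theorem iSup_inertia_eq_top (L : Type) [Field L] [NumberField L] [IsGalois ℚ L] :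
    ⨆ m : MaximalSpectrum (𝓞 L), m.asIdeal.inertia (L ≃ₐ[ℚ] L) = ⊤ := by
  set H := ⨆ m : MaximalSpectrum (𝓞 L), m.asIdeal.inertia (L ≃ₐ[ℚ] L) with hH
  set E := fixedField H with hE
  have hfix : E.fixingSubgroup = H := IntermediateField.fixingSubgroup_fixedField H
  by_contra hne
  have hE1 : finrank ℚ E ≠ 1 := fun h => by
    rw [IntermediateField.finrank_eq_one_iff] at h
    rw [h, IntermediateField.fixingSubgroup_bot] at hfix
    exact hne hfix.symm
  obtain ⟨P, hPm, hP⟩ := NumberField.exists_not_isUnramifiedAt_int (𝒪 := 𝓞 E) hE1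
  obtain ⟨Q, hQm, hQP⟩ := Ideal.exists_maximal_ideal_liesOver_of_isIntegral (S := 𝓞 L) P
  refine hP (Ideal.ramificationIdx_eq_one_iff.1 ?_)
  have hQZ : Q.LiesOver (P.under ℤ) := Ideal.LiesOver.trans Q P (P.under ℤ)
  have htower := Ideal.ramificationIdx_tower (R := ℤ) P Q
  have hP0 : P ≠ ⊥ := by
    rintro rfl
    exact hP Algebra.isUnramifiedAt_bot
  have : PerfectField P.ResidueField := by
    have : Finite (𝓞 E ⧸ P) := Ring.HasFiniteQuotients.finiteQuotient hP0
    have : Finite P.ResidueField := inferInstance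
    infer_instance
  have : PerfectField (P.under ℤ).ResidueField := by
    have : Finite (ℤ ⧸ (P.under ℤ)) :=
      Ring.HasFiniteQuotients.finiteQuotient (mt Ideal.eq_bot_of_comap_eq_bot hP0)
    have : Finite (P.under ℤ).ResidueField := inferInstance
    infer_instance
  have h1 := Ideal.card_inertia_eq_ramificationIdxIn (G := L ≃ₐ[ℚ] L) (P.under ℤ) Q
  have h2 := Ideal.card_inertia_eq_ramificationIdxIn (G := L ≃ₐ[E] L) P Q
  rw [Ideal.ramificationIdxIn_eq_ramificationIdx (P.under ℤ) Q (L ≃ₐ[ℚ] L)] at h1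
  rw [Ideal.ramificationIdxIn_eq_ramificationIdx P Q (L ≃ₐ[E] L)] at h2
  have hcard : Nat.card (Q.inertia (L ≃ₐ[ℚ] L)) ≤ Nat.card (Q.inertia (L ≃ₐ[E] L)) := by
    have hle : Q.inertia (L ≃ₐ[ℚ] L) ≤ E.fixingSubgroup := by
      rw [hfix]; exact le_iSup (fun m : MaximalSpectrum (𝓞 L) => m.asIdeal.inertia (L ≃ₐ[ℚ] L)) ⟨Q, hQm⟩
    refine Nat.card_le_card_of_injective (fun g => ⟨fixingSubgroupEquiv E ⟨g.1, hle g.2⟩, ?_⟩) ?_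
    · exact g.2
    · intro g g' h
      have := congrArg Subtype.val h
      have := (fixingSubgroupEquiv E).injective this
      exact Subtype.ext (Subtype.mk.inj this)
  have hpos : 0 < Nat.card (Q.inertia (L ≃ₐ[E] L)) := Nat.card_pos
  rw [h1, h2, htower] at hcard
  rw [h2] at hpos
  have h0 : 0 < Nat.card (Q.inertia (L ≃ₐ[ℚ] L)) := Nat.card_pos
  rw [h1, htower] at h0
  have h3 := Nat.le_of_mul_le_mul_right (hcard.trans (one_mul _).ge) hpos
  exact le_antisymm h3 (Nat.pos_of_mul_pos_right h0)

theorem card_roots_selmer_le {F : Type*} [Field F] {n : ℕ} (hn : 2 ≤ n) (r : Fin n → F)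
    (hr : ∏ j, (X - C (r j)) = X ^ n - X - 1) : n ≤ (Set.range r).ncard + 1 := by
  classical
  have key : ∀ i j, i ≠ j → r i = r j → (n : F) * r i ^ (n - 1) = 1 ∧ r i ^ n = r i + 1 := by
    intro i j hij h
    have hd : (X - C (r i)) ^ 2 ∣ (X ^ n - X - 1 : F[X]) := by
      rw [← hr, ← mul_prod_erase _ _ (mem_univ i),
        ← mul_prod_erase _ _ (mem_erase.2 ⟨hij.symm, mem_univ j⟩), ← h,
        ← mul_assoc, ← sq]
      exact dvd_mul_right _ _
    obtain ⟨g, hg⟩ := hd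
    have h0 := congrArg (eval (r i)) hg
    have h1 := congrArg (fun p => eval (r i) (derivative p)) hg
    simp [derivative_pow] at h0 h1
    constructor
    · linear_combination h1
    · linear_combination h0
  have hne : ∀ i j, i ≠ j → r i = r j → (n : F) ≠ 0 ∧ r i ≠ 0 ∧ (n : F) - 1 ≠ 0 ∧
      ((n : F) - 1) * r i = - n := by
    intro i j hij h
    obtain ⟨h1, h2⟩ := key i j hij h
    have hn0 : (n : F) ≠ 0 := fun h => by simp [h] at h1
    have hr0 : r i ≠ 0 := fun h => by
      rw [h, zero_pow (by omega)] at h1; simp at h1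
    have h3 : ((n : F) - 1) * r i = - n := by
      have : r i ^ n = r i ^ (n - 1) * r i := by rw [← pow_succ]; congr 1; omega
      rw [this] at h2
      linear_combination (r i) * h1 - (n : F) * h2
    refine ⟨hn0, hr0, fun h => ?_, h3⟩
    rw [h, zero_mul] at h3
    exact hn0 (neg_eq_zero.1 h3.symm)
  have htriple : ∀ i j k, i ≠ j → i ≠ k → j ≠ k → r i = r j → r i ≠ r k := by
    intro i j k hij hik hjk h h'
    obtain ⟨h0, h1, h2, -⟩ := hne i j hij h
    have hd : (X - C (r i)) ^ 3 ∣ (X ^ n - X - 1 : F[X]) := by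
      rw [← hr, ← mul_prod_erase _ _ (mem_univ i),
        ← mul_prod_erase _ _ (mem_erase.2 ⟨hij.symm, mem_univ j⟩),
        ← mul_prod_erase _ _ (mem_erase.2 ⟨hjk.symm, mem_erase.2
          ⟨hik.symm, mem_univ k⟩⟩), ← h, ← h',
        ← mul_assoc, ← mul_assoc, ← pow_two, ← pow_succ]
      exact dvd_mul_right _ _
    obtain ⟨g, hg⟩ := hd
    have h3 := congrArg (fun p => eval (r i) (derivative (derivative p))) hg
    simp [derivative_pow] at h3
    rw [cast_sub (by omega)] at h3
    rcases h3 with h3 | h3 | h3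
    · exact h0 h3
    · exact h2 (by simpa using h3)
    · exact h1 h3.1
  by_cases hinj : Injective r
  · rw [← Set.image_univ, Set.ncard_image_of_injective _ hinj]
    simp
  · simp only [Injective] at hinj
    push Not at hinj
    obtain ⟨i, j, hij, hne'⟩ := hinj
    have : InjOn r {i}ᶜ := by
      intro k hk l hl hkl
      by_contra hkl'
      have h1 := hne i j hne' hij
      have h2 := hne k l hkl' hkl
      have h3 : r i = r k := mul_left_cancel₀ h1.2.2.1 (h1.2.2.2.trans h2.2.2.2.symm)
      exact htriple k l i hkl' hk hl hkl h3.symm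
    have h1 := this.ncard_image
    have h2 : ({i}ᶜ : Set (Fin n)).ncard = n - 1 := by
      rw [Set.ncard_compl]; simp
    have h3 : (r '' {i}ᶜ).ncard ≤ (Set.range r).ncard :=
      Set.ncard_le_ncard (Set.image_subset_range _ _) (Set.finite_range r)
    omega

theorem rootSet_eq_range_of_map_eq_prod {R S ι : Type*} [CommRing R] [CommRing S] [IsDomain S]
    [Algebra R S] [Fintype ι] {F : R[X]} {s : ι → S}
    (h : F.map (algebraMap R S) = ∏ j, (X - C (s j))) : F.rootSet S = Set.range s := by
  ext x
  rw [mem_rootSet', ← eval_map_algebraMap, h, eval_prod, prod_eq_zero_iff]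
  constructor
  · rintro ⟨-, j, -, hj⟩
    exact ⟨j, by simpa [sub_eq_zero, eq_comm] using hj⟩
  · rintro ⟨j, rfl⟩
    exact ⟨(monic_prod_of_monic _ _ fun j _ => monic_X_sub_C _).ne_zero, j, mem_univ j,
      by simp⟩

theorem exists_selmer_full_galois (n : ℕ) (hn : 2 ≤ n) :
    ∃ (L : Type) (_ : Field L) (_ : NumberField L) (r : Fin n → L), Injective r ∧
      ∏ j, (X - C (r j)) = (X ^ n - X - 1 : L[X]) ∧
      ∀ σ : Perm (Fin n), ∃ g : L ≃ₐ[ℚ] L, ∀ i, g (r i) = r (σ i) := by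
  classical
  set f : ℚ[X] := X ^ n - X - 1 with hf
  have hirr : Irreducible f := X_pow_sub_X_sub_one_irreducible_rat (by omega)
  have hdf : (X + 1 : ℚ[X]).natDegree < n := by
    rw [show (X + 1 : ℚ[X]) = X + C 1 by simp, natDegree_X_add_C]; omega
  have hf' : f = X ^ n - (X + 1) := by rw [hf]; ring
  have hmon : f.Monic := by
    rw [hf']; exact monic_X_pow_sub (lt_of_le_of_lt degree_le_natDegree (by exact_mod_cast hdf))
  have hdeg : f.natDegree = n := by
    rw [hf', natDegree_sub_eq_left_of_natDegree_lt] <;> simp [hdf]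
  have hsf : IsSplittingField ℚ f.SplittingField f := by
    convert IsSplittingField.splittingField f
    exact Subsingleton.elim _ _
  let L := f.SplittingField
  have hGal : IsGalois ℚ L := IsGalois.of_separable_splitting_field (p := f) hirr.separable
  have hNF : NumberField L := ⟨⟩
  have hspl : (f.map (algebraMap ℚ L)).Splits := SplittingField.splits f
  obtain ⟨r, hrinj, hr⟩ : ∃ r : Fin n → L, Injective r ∧
      ∏ j, (X - C (r j)) = (X ^ n - X - 1 : L[X]) := by
    have hnd : (f.map (algebraMap ℚ L)).roots.Nodup :=
      nodup_roots (hirr.separable.map)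
    have hcard : Fintype.card (Fin n) = Fintype.card ((f.map (algebraMap ℚ L)).roots.toFinset) := by
      rw [card_coe, Multiset.toFinset_card_of_nodup hnd, ← hspl.natDegree_eq_card_roots,
        natDegree_map, hdeg, card_fin]
    let e := equivOfCardEq hcard
    refine ⟨fun j => (e j).1, Subtype.val_injective.comp e.injective, ?_⟩
    rw [Equiv.prod_comp e (fun x => X - C (x : L)), Finset.prod_coe_sort _ (fun x => X - C x),
      Finset.prod_eq_multiset_prod, Multiset.toFinset_val, hnd.dedup,
      ← hspl.eq_prod_roots_of_monic (hmon.map _)]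
    simp [hf]
  refine ⟨L, inferInstance, hNF, r, hrinj, hr, fun σ => ?_⟩
  have hroot : ∀ j, r j ^ n - r j - 1 = 0 := fun j => by
    have := congrArg (eval (r j)) hr
    rw [eval_prod, prod_eq_zero (mem_univ j) (by simp)] at this
    simpa using this.symm
  have hint : ∀ j, IsIntegral ℤ (r j) := fun j =>
    ⟨X ^ n - (X + 1), monic_X_pow_sub (lt_of_le_of_lt degree_le_natDegree (by
      rw [show (X + 1 : ℤ[X]) = X + C 1 by simp, natDegree_X_add_C]; exact_mod_cast hn)), by
      simpa [sub_sub] using hroot j⟩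
  let s : Fin n → 𝓞 L := fun j => ⟨r j, hint j⟩
  have hs : ∏ j, (X - C (s j)) = (X ^ n - X - 1 : (𝓞 L)[X]) := by
    apply map_injective (algebraMap (𝓞 L) L) NumberField.RingOfIntegers.coe_injective
    rw [Polynomial.map_prod]
    simpa using! hr
  set F : ℤ[X] := X ^ n - X - 1 with hF
  have hFs : F.map (algebraMap ℤ (𝓞 L)) = ∏ j, (X - C (s j)) := by rw [hs]; simp [hF]
  have hrs : F.rootSet (𝓞 L) = Set.range s := rootSet_eq_range_of_map_eq_prod hFs
  have hsplit : (F.map (algebraMap ℤ (𝓞 L))).Splits := by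
    rw [hFs]; exact Splits.prod fun j _ => Splits.X_sub_C _
  have : MulAction.IsPretransitive (L ≃ₐ[ℚ] L) (F.rootSet (𝓞 L)) := by
    refine ⟨fun x y => ?_⟩
    obtain ⟨i, hi⟩ := hrs.subset x.2
    obtain ⟨j, hj⟩ := hrs.subset y.2
    have hmin : minpoly ℚ (r i) = f :=
      (minpoly.eq_of_irreducible_of_monic hirr (by simpa [hf] using hroot i) hmon).symm
    obtain ⟨g, hg⟩ := minpoly.exists_algEquiv_of_root' (K := ℚ) (x := r j) (y := r i)
      (Algebra.IsAlgebraic.isAlgebraic _) (by rw [hmin]; simpa [hf] using hroot j)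
    refine ⟨g, Subtype.ext (NumberField.RingOfIntegers.coe_injective ?_)⟩
    rw [rootSet.coe_smul, ← hi, ← hj]
    exact hg
  have hsinj : Injective s := fun i j h => hrinj (congrArg Subtype.val h)
  have hsurj := hsplit.surjective_toPermHom_of_iSup_inertia_eq_top (G := L ≃ₐ[ℚ] L) (fun m => ?_)
    (iSup_inertia_eq_top L)
  · let e : Fin n ≃ F.rootSet (𝓞 L) := (Equiv.ofInjective s hsinj).trans (Equiv.setCongr hrs.symm)
    obtain ⟨g, hg⟩ := hsurj (e.permCongr σ)
    refine ⟨g, fun i => ?_⟩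
    have h2 := congrArg (fun p => ((p (e i) : 𝓞 L) : L)) hg
    have h3 : (MulAction.toPermHom (L ≃ₐ[ℚ] L) (F.rootSet (𝓞 L)) g (e i) : 𝓞 L) = g • s i := rfl
    have h4 : ((e.permCongr σ) (e i) : 𝓞 L) = s (σ i) := by simp [e]
    simp only [h3, h4] at h2
    exact h2
  · let _ : Field (𝓞 L ⧸ m.asIdeal) := Ideal.Quotient.field m.asIdeal
    have h1 := card_roots_selmer_le hn (fun j => Ideal.Quotient.mk m.asIdeal (s j)) (by
      have := congrArg (Polynomial.map (Ideal.Quotient.mk m.asIdeal)) hs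
      rw [Polynomial.map_prod] at this
      simpa using this)
    rw [hrs, ← Set.image_univ, Set.ncard_image_of_injective _ hsinj,
      rootSet_eq_range_of_map_eq_prod (S := 𝓞 L ⧸ m.asIdeal)
        (s := fun j => Ideal.Quotient.mk m.asIdeal (s j)) (by
          rw [IsScalarTower.algebraMap_eq ℤ (𝓞 L), ← Polynomial.map_map, hFs, Polynomial.map_prod]
          simp)]
    simpa using h1

end

theorem exists_coeffVec_prod_eq {n : ℕ} {K : Type*} [Field K] [IsAlgClosed K] (v : Fin n → K) :
    ∃ r : Fin n → K, coeffVec n (∏ j, (X - C (r j))) = v := by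
  set g : K[X] := ∑ i : Fin n, C (v i) * X ^ (i : ℕ) with hg
  have hgc : ∀ k : Fin n, g.coeff k = v k := fun k => by
    simp [hg, coeff_X_pow, Fin.val_inj]
  have hgd : g.degree < n := by
    rw [hg]
    refine (degree_sum_le _ _).trans_lt ((Finset.sup_lt_iff (by simp [bot_lt_iff_ne_bot])).2 fun i _ => ?_)
    exact (degree_C_mul_X_pow_le _ _).trans_lt (by exact_mod_cast i.2)
  set f : K[X] := X ^ n + g with hf
  have hmon : f.Monic := monic_X_pow_add hgd
  have hdeg : f.natDegree = n := by
    rw [hf, natDegree_eq_of_degree_eq_some (n := n)]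
    rw [degree_add_eq_left_of_degree_lt] <;> simp [hgd]
  have hspl := splits f
  have hcard : f.roots.card = n := by rw [← hspl.natDegree_eq_card_roots, hdeg]
  refine ⟨fun j => f.roots.toList.get (j.cast (by rw [length_toList, hcard])), ?_⟩
  have : ∏ j : Fin n, (X - C (f.roots.toList.get (j.cast (by rw [length_toList, hcard])))) = f := by
    conv_rhs => rw [hspl.eq_prod_roots_of_monic hmon, ← Multiset.coe_toList f.roots]
    rw [Multiset.map_coe, Multiset.prod_coe, ← List.prod_ofFn]
    congr 1
    refine List.ext_get (by simp [hcard]) fun i h1 h2 => by simp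
  rw [this]
  ext i
  simp only [coeffVec, hf, coeff_add, hgc, coeff_X_pow]
  simp [i.2.ne]

theorem coeffVec_mul_roots {n : ℕ} {K : Type*} [Field K] (s : K) (r : Fin n → K) (i : Fin n) :
    coeffVec n (∏ j, (X - C (s * r j))) i =
      coeffVec n (∏ j, (X - C (r j))) i * s ^ (n - (i : ℕ)) := by
  have h : ∀ t : Finset (Fin n), ∏ j ∈ t, (X - C (s * r j)) = (∏ j ∈ t, (X - C (r j))).scaleRoots s := by
    intro t
    induction t using Finset.induction_on with
    | empty => simp
    | insert a t ha ih =>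
      rw [prod_insert ha, prod_insert ha, mul_scaleRoots_of_noZeroDivisors, ih,
        X_sub_C_scaleRoots, mul_comm s]
  simp only [coeffVec, h, coeff_scaleRoots, natDegree_finsetProd_X_sub_C_eq_card, card_univ,
    card_fin]

/-- Invariant products used to build resolvents. -/
noncomputable def resolventSeed (n : ℕ) (G : Subgroup (Perm (Fin n))) [Fintype G] (W : ℤ) :
    MvPolynomial (Fin n) ℤ :=
  ∏ σ : G, (MvPolynomial.C W * ∏ j, MvPolynomial.X j -
    ∑ i : Fin n, MvPolynomial.C ((i : ℕ) : ℤ) * MvPolynomial.X ((σ : Perm (Fin n)) i) ^ n)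

section
variable {n : ℕ} {G : Subgroup (Perm (Fin n))} [Fintype G] (W : ℤ)

theorem aeval_resolventSeed {S : Type*} [CommRing S] (r : Fin n → S) :
    MvPolynomial.aeval r (resolventSeed n G W) =
      ∏ σ : G, ((W : S) * ∏ j, r j - ∑ i : Fin n, ((i : ℕ) : S) * r ((σ : Perm (Fin n)) i) ^ n) := by
  simp [resolventSeed]

theorem rename_resolventSeed (τ : Perm (Fin n)) (hτ : τ ∈ G) :
    rename τ (resolventSeed n G W) = resolventSeed n G W := by
  rw [resolventSeed, map_prod, ← Equiv.prod_comp (Equiv.mulLeft (⟨τ, hτ⟩ : G)) (fun σ : G => (MvPolynomial.C W * ∏ j, MvPolynomial.X j -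
    ∑ i : Fin n, MvPolynomial.C ((i : ℕ) : ℤ) * MvPolynomial.X ((σ : Perm (Fin n)) i) ^ n))]
  refine prod_congr rfl fun σ _ => ?_
  simp [Equiv.prod_comp τ (fun j => (MvPolynomial.X j : MvPolynomial (Fin n) ℤ))]

theorem aeval_mul_resolventSeed {S : Type*} [CommRing S] (s : S) (r : Fin n → S) :
    MvPolynomial.aeval (fun j => s * r j) (resolventSeed n G W) =
      s ^ (n * Fintype.card G) * MvPolynomial.aeval r (resolventSeed n G W) := by
  simp only [aeval_resolventSeed]
  rw [pow_mul, ← card_univ (α := G), ← prod_const, ← prod_mul_distrib]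
  refine prod_congr rfl fun σ _ => ?_
  rw [mul_sub, mul_sum]
  congr 1
  · rw [prod_mul_distrib, prod_const, card_univ, card_fin]; ring
  · exact sum_congr rfl fun i _ => by ring

end

theorem injective_linear_form_of_full_galois {L : Type} [Field L] [NumberField L] {n : ℕ}
    (r : Fin n → L) (hr : Injective r)
    (hgal : ∀ σ : Perm (Fin n), ∃ g : L ≃ₐ[ℚ] L, ∀ i, g (r i) = r (σ i)) :
    Injective fun ρ : Perm (Fin n) => ∑ i : Fin n, ((i : ℕ) : L) * (r (ρ i) + 1) := by
  intro ρ ρ' h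
  simp only [mul_add, mul_one, sum_add_distrib, add_left_inj] at h
  set e : Fin n → L := fun j => ((ρ⁻¹ j : Fin n) : ℕ) - ((ρ'⁻¹ j : Fin n) : ℕ) with he
  have hsum : ∑ j, e j * r j = 0 := by
    have h1 : ∀ τ : Perm (Fin n),
        ∑ j, (((τ⁻¹ j : Fin n) : ℕ) : L) * r j = ∑ i : Fin n, ((i : ℕ) : L) * r (τ i) := by
      intro τ
      rw [← Equiv.sum_comp τ]
      simp
    simp only [he, sub_mul, sum_sub_distrib, h1, h, sub_self]
  have hg : ∀ (g : L ≃ₐ[ℚ] L) j, g (e j) = e j := fun g j => by simp [he]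
  have hsum0 : ∑ j, e j = 0 := by
    have h1 : ∀ τ : Perm (Fin n),
        ∑ j, (((τ⁻¹ j : Fin n) : ℕ) : L) = ∑ i : Fin n, ((i : ℕ) : L) := fun τ =>
      Equiv.sum_comp τ⁻¹ (fun i : Fin n => ((i : ℕ) : L))
    simp only [he, sum_sub_distrib, h1, sub_self]
  have heq : ∀ j k, e j = e k := by
    intro j k
    by_contra hjk
    have hne : j ≠ k := fun h => hjk (h ▸ rfl)
    obtain ⟨g, hgs⟩ := hgal (swap j k)
    have h1 := congrArg g hsum
    simp only [map_sum, map_mul, hg, hgs, map_zero] at h1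
    have h2 : ∑ i, e i * (r i - r (swap j k i)) = 0 := by
      simp only [mul_sub, sum_sub_distrib, hsum, h1, sub_self]
    rw [← Finset.add_sum_erase _ _ (mem_univ j),
      ← Finset.add_sum_erase _ _ (mem_erase.2 ⟨hne.symm, mem_univ k⟩),
      sum_eq_zero (s := (univ.erase j).erase k)] at h2
    · simp only [Equiv.swap_apply_left, Equiv.swap_apply_right] at h2
      have h3 : (e j - e k) * (r j - r k) = 0 := by linear_combination h2
      rcases mul_eq_zero.1 h3 with h3 | h3
      · exact hjk (sub_eq_zero.1 h3)
      · exact hne (hr (sub_eq_zero.1 h3))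
    · intro i hi
      simp only [mem_erase, mem_univ, and_true] at hi
      rw [Equiv.swap_apply_of_ne_of_ne hi.2 hi.1, sub_self, mul_zero]
  have hzero : ∀ j, e j = 0 := by
    intro j
    have h1 : ∑ k : Fin n, e k = (n : L) * e j := by
      rw [sum_congr rfl fun k _ => heq k j]; simp
    rw [hsum0] at h1
    have : (n : L) ≠ 0 := by have := j.2; exact_mod_cast (by omega)
    exact (mul_eq_zero.1 h1.symm).resolve_left this
  have : ρ⁻¹ = ρ'⁻¹ := by
    ext j
    have := hzero j
    simp only [he, sub_eq_zero] at this
    exact_mod_cast this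
  exact inv_injective this

/-- Evaluation of an integral multivariate polynomial in a ring. -/
noncomputable def intEval {n : ℕ} {S : Type*} [CommRing S] (v : Fin n → S) :
    MvPolynomial (Fin n) ℤ →+* S := MvPolynomial.eval₂Hom (castRingHom S) v

theorem intEval_eq_aeval {n : ℕ} {S : Type*} [CommRing S] (v : Fin n → S) :
    intEval v = (MvPolynomial.aeval v).toRingHom :=
  MvPolynomial.ringHom_ext (fun i => by simp) fun i => by simp [intEval]

theorem comp_intEval {n : ℕ} {R S : Type*} [CommRing R] [CommRing S] (φ : R →+* S)
    (v : Fin n → R) : φ.comp (intEval v) =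
      intEval fun i => φ (v i) :=
  MvPolynomial.ringHom_ext (fun i => by simp [intEval]) fun i => by simp [intEval]

theorem coeffVec_map {n : ℕ} {R S : Type*} [CommRing R] [CommRing S] (φ : R →+* S) (f : R[X]) :
    (fun i => φ (coeffVec n f i)) = coeffVec n (f.map φ) := by
  ext i; simp [coeffVec]

theorem exists_irreducible_selmer_resolvent (n : ℕ) (hn : 2 ≤ n)
    (G : Subgroup (Perm (Fin n))) [Fintype G] [Fintype (Perm (Fin n) ⧸ G)] :
    ∃ W : ℤ, ∀ U : (MvPolynomial (Fin n) ℤ)[X], U.Monic → U.natDegree = G.index →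
      (∀ {S : Type} [CommRing S] (r : Fin n → S),
        U.map (intEval (coeffVec n (∏ j, (X - C (r j))))) =
          ∏ q : Perm (Fin n) ⧸ G, (X - C (MvPolynomial.aeval (r ∘ q.out) (resolventSeed n G W)))) →
      Irreducible (U.map (intEval (coeffVec n (X ^ n - X - 1 : ℤ[X])))) := by
  classical
  obtain ⟨L, hL, hNF, r, hrinj, hr, hgal⟩ := exists_selmer_full_galois n hn
  have hroot : ∀ j, r j ^ n = r j + 1 := fun j => by
    have := congrArg (eval (r j)) hr
    rw [eval_prod, prod_eq_zero (mem_univ j) (by simp)] at this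
    simp at this
    linear_combination -this
  have hP : ∏ j, r j ≠ 0 := by
    rw [Finset.prod_ne_zero_iff]
    intro j _ h
    have := hroot j
    rw [h, zero_pow (by omega)] at this
    simp at this
  set P := ∏ j, r j
  set ℓ : Perm (Fin n) → L := fun ρ => ∑ i : Fin n, ((i : ℕ) : L) * (r (ρ i) + 1) with hℓ
  have hℓinj : Injective ℓ := injective_linear_form_of_full_galois r hrinj hgal
  let p : Perm (Fin n) ⧸ G → L[X] := fun q => ∏ σ : G, (X * C P - C (ℓ (q.out * σ)))
  have hval : ∀ (W : ℤ) q, MvPolynomial.aeval (r ∘ q.out) (resolventSeed n G W) = (p q).eval (W : L) := by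
    intro W q
    have : ∏ j, r (q.out j) = P := Equiv.prod_comp q.out r
    simp only [aeval_resolventSeed, p, eval_prod, hℓ, hroot, this, Function.comp_apply, eval_sub,
      eval_mul, eval_X, eval_C, Perm.mul_apply]
  have hpne : ∀ q q', q ≠ q' → p q - p q' ≠ 0 := by
    intro q q' hqq h
    have h1 := congrArg (eval (ℓ q.out / P)) h
    simp only [p, eval_sub, eval_prod, eval_mul, eval_X, eval_C, eval_zero, div_mul_cancel₀ _ hP] at h1
    rw [prod_eq_zero (mem_univ (1 : G)) (by simp), zero_sub, neg_eq_zero,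
      prod_eq_zero_iff] at h1
    obtain ⟨σ, -, hσ⟩ := h1
    have h2 := hℓinj (sub_eq_zero.1 hσ)
    apply hqq
    rw [← QuotientGroup.out_eq' q, ← QuotientGroup.out_eq' q', eq_comm, QuotientGroup.eq, h2,
      inv_mul_cancel_left]
    exact σ.2
  obtain ⟨W, hW⟩ : ∃ W : ℤ, Injective fun q => (p q).eval (W : L) := by
    have hD : ∏ x ∈ (univ : Finset (Perm (Fin n) ⧸ G)).offDiag, (p x.1 - p x.2) ≠ 0 :=
      Finset.prod_ne_zero_iff.2 fun x hx => hpne _ _ (Finset.mem_offDiag.1 hx).2.2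
    by_contra hcon
    push Not at hcon
    refine hD (eq_zero_of_infinite_isRoot _ ((Set.infinite_range_of_injective
      (Int.cast_injective (α := L))).mono ?_))
    rintro _ ⟨W, rfl⟩
    have h1 := hcon W
    simp only [Injective] at h1
    push Not at h1
    obtain ⟨q, q', h2, h3⟩ := h1
    simp only [Set.mem_ofPred_eq, IsRoot, eval_prod]
    exact prod_eq_zero (i := (q, q')) (by simpa using h3) (by simp [h2])
  refine ⟨W, fun U hU hUd hUr => ?_⟩
  set V := U.map (intEval (coeffVec n (X ^ n - X - 1 : ℤ[X]))) with hV
  have hVm : V.Monic := hU.map _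
  have hVL : V.map (castRingHom L) = ∏ q : Perm (Fin n) ⧸ G, (X - C ((p q).eval (W : L))) := by
    simp only [← hval]
    rw [← hUr r, hV, Polynomial.map_map, hr]
    rw [comp_intEval, coeffVec_map]
    simp only [Polynomial.map_sub, Polynomial.map_pow, map_X, Polynomial.map_one]
  rw [hVm.irreducible_iff_irreducible_map_fraction_map (K := ℚ)]
  set VQ := V.map (algebraMap ℤ ℚ)
  have hVQ : VQ.Monic := hVm.map _
  have hVQL : VQ.map (algebraMap ℚ L) = ∏ q : Perm (Fin n) ⧸ G, (X - C ((p q).eval (W : L))) := by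
    rw [← hVL, Polynomial.map_map]; congr 1; exact RingHom.ext_int _ _
  set q₀ : Perm (Fin n) ⧸ G := QuotientGroup.mk 1
  set α := (p q₀).eval (W : L)
  have hαint : IsIntegral ℚ α := Algebra.IsIntegral.isIntegral α
  have hroots : ∀ q, aeval ((p q).eval (W : L)) (minpoly ℚ α) = 0 := by
    intro q
    obtain ⟨g, hg⟩ := hgal q.out
    have : (p q).eval (W : L) = g α := by
      have h1 := rename_out_smul (fun σ hσ => rename_resolventSeed W σ hσ) q.out q₀
      have h2 : q.out • q₀ = q := by
        conv_rhs => rw [← QuotientGroup.out_eq' q]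
        exact congrArg QuotientGroup.mk (mul_one _)
      rw [h2] at h1
      have h3 := congrArg (MvPolynomial.aeval r) h1
      rw [aeval_rename, aeval_rename, aeval_rename, hval] at h3
      rw [← h3, show α = _ from (hval W q₀).symm, aeval_resolventSeed, aeval_resolventSeed]
      simp [hg]
    rw [this, aeval_algHom_apply, minpoly.aeval, map_zero]
  have hdvd : minpoly ℚ α ∣ VQ := minpoly.dvd _ _ (by
    rw [← eval_map_algebraMap, hVQL, eval_prod]
    exact prod_eq_zero (mem_univ q₀) (by simp [α]))
  have hdeg : VQ.natDegree ≤ (minpoly ℚ α).natDegree := by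
    rw [hVm.natDegree_map, hU.natDegree_map, hUd, Subgroup.index_eq_card, Nat.card_eq_fintype_card,
      ← card_univ, ← Finset.card_image_of_injective _ hW,
      ← (minpoly.monic hαint).natDegree_map (algebraMap ℚ L)]
    refine card_le_degree_of_subset_roots fun x hx => ?_
    obtain ⟨q, -, rfl⟩ := mem_image.1 hx
    rw [mem_roots ((minpoly.monic hαint).map _).ne_zero, IsRoot, eval_map_algebraMap]
    exact hroots q
  rw [eq_of_monic_of_dvd_of_natDegree_le (minpoly.monic hαint) hVQ hdvd hdeg]
  exact minpoly.irreducible hαint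

/-- The coefficients of the family `x ^ n + ∑ A i x ^ i + a x + b` in two parameters. -/
noncomputable def coeffFamily (n : ℕ) (A : Fin n → ℤ) : Fin n → ℤ[X][X] := fun i =>
  if (i : ℕ) = 0 then X else if (i : ℕ) = 1 then C X else C (C (A i))

theorem irreducible_of_irreducible_scaleRoots {K : Type*} [Field K] {p : K[X]} (hp : p.Monic) {s : K}
    (h : Irreducible (p.scaleRoots s)) : Irreducible p := by
  rw [hp.irreducible_iff_natDegree']
  have h' := (((monic_scaleRoots_iff s).2 hp).irreducible_iff_natDegree').1 h
  refine ⟨fun h1 => h'.1 (by simp [h1]), fun f g hf hg hfg => ?_⟩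
  have := h'.2 (f.scaleRoots s) (g.scaleRoots s) ((monic_scaleRoots_iff s).2 hf)
    ((monic_scaleRoots_iff s).2 hg) (by rw [← mul_scaleRoots_of_noZeroDivisors, hfg])
  simpa using this

section
variable {n : ℕ} {G : Subgroup (Perm (Fin n))} [Fintype G]
  [Fintype (Perm (Fin n) ⧸ G)] {W : ℤ} {U : (MvPolynomial (Fin n) ℤ)[X]}

theorem resolvent_scaleRoots_of_isAlgClosed
    (hUr : ∀ {S : Type} [CommRing S] (r : Fin n → S),
      U.map (intEval (coeffVec n (∏ j, (X - C (r j))))) =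
        ∏ q : Perm (Fin n) ⧸ G, (X - C (MvPolynomial.aeval (r ∘ q.out) (resolventSeed n G W))))
    {K : Type} [Field K] [IsAlgClosed K] (v : Fin n → K) (s : K) :
    U.map (intEval (fun i => v i * s ^ (n - (i : ℕ)))) =
      (U.map (intEval v)).scaleRoots (s ^ (n * Fintype.card G)) := by
  classical
  obtain ⟨r, rfl⟩ := exists_coeffVec_prod_eq v
  rw [hUr r]
  have : (fun i => coeffVec n (∏ j, (X - C (r j))) i * s ^ (n - (i : ℕ))) =
      coeffVec n (∏ j, (X - C (s * r j))) := funext fun i => (coeffVec_mul_roots s r i).symm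
  rw [this, hUr fun j => s * r j]
  have h : ∀ t : Finset (Perm (Fin n) ⧸ G), ∏ q ∈ t, (X - C (MvPolynomial.aeval ((fun j => s * r j) ∘ q.out)
      (resolventSeed n G W))) = (∏ q ∈ t, (X - C (MvPolynomial.aeval (r ∘ q.out)
      (resolventSeed n G W)))).scaleRoots (s ^ (n * Fintype.card G)) := by
    intro t
    induction t using Finset.induction_on with
    | empty => simp
    | insert a t ha ih =>
      rw [prod_insert ha, prod_insert ha, mul_scaleRoots_of_noZeroDivisors, ih,
        X_sub_C_scaleRoots, mul_comm _ (s ^ _)]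
      congr 3
      exact aeval_mul_resolventSeed (G := G) W s (r ∘ a.out)
  exact h _

theorem resolvent_scaleRoots
    (hUr : ∀ {S : Type} [CommRing S] (r : Fin n → S),
      U.map (intEval (coeffVec n (∏ j, (X - C (r j))))) =
        ∏ q : Perm (Fin n) ⧸ G, (X - C (MvPolynomial.aeval (r ∘ q.out) (resolventSeed n G W))))
    (hU : U.Monic) {K : Type} [Field K] (v : Fin n → K) (s : K) :
    U.map (intEval (fun i => v i * s ^ (n - (i : ℕ)))) =
      (U.map (intEval v)).scaleRoots (s ^ (n * Fintype.card G)) := by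
  set φ := algebraMap K (AlgebraicClosure K)
  apply map_injective φ φ.injective
  rw [map_scaleRoots _ _ _ (by rw [(hU.map _).leadingCoeff]; simp), Polynomial.map_map,
    Polynomial.map_map, comp_intEval, comp_intEval, map_pow,
    ← resolvent_scaleRoots_of_isAlgClosed hUr]
  simp

theorem irreducible_resolvent_coeffFamily (hn : 2 ≤ n)
    (hUr : ∀ {S : Type} [CommRing S] (r : Fin n → S),
      U.map (intEval (coeffVec n (∏ j, (X - C (r j))))) =
        ∏ q : Perm (Fin n) ⧸ G, (X - C (MvPolynomial.aeval (r ∘ q.out) (resolventSeed n G W))))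
    (hU : U.Monic)
    (hirr : Irreducible (U.map (intEval (coeffVec n (X ^ n - X - 1 : ℤ[X])))))
    (A : Fin n → ℤ) :
    Irreducible (U.map (intEval (coeffFamily n A))) := by
  set K := FractionRing ℤ[X]
  set ℓ : K := algebraMap ℤ[X] K X
  have hℓ : ℓ ≠ 0 := by
    simp [ℓ]
  let ψ : ℤ[X][X] →+* K := eval₂RingHom (eval₂RingHom (castRingHom K) (-(ℓ ^ (n - 1))⁻¹)) (-(ℓ ^ n)⁻¹)
  let w : Fin n → ℤ[X] := fun i =>
    if (i : ℕ) = 0 then -1 else if (i : ℕ) = 1 then -1 else C (A i) * X ^ (n - (i : ℕ))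
  have hw0 : (fun i => evalRingHom 0 (w i)) = coeffVec n (X ^ n - X - 1 : ℤ[X]) := by
    ext i
    have := i.2
    simp only [w, coeffVec, coeff_sub, coeff_X_pow, coeff_X, coeff_one]
    split_ifs <;> simp <;> omega
  have hwψ : (fun i => ψ (coeffFamily n A i) * ℓ ^ (n - (i : ℕ))) = fun i => algebraMap ℤ[X] K (w i) := by
    ext i
    have := i.2
    simp only [w, coeffFamily]
    split_ifs with h0 h1
    · simp only [ψ, h0, coe_eval₂RingHom, eval₂_X, Nat.sub_zero, map_neg, map_one]
      exact (neg_mul _ _).trans (congrArg Neg.neg (inv_mul_cancel₀ (pow_ne_zero n hℓ)))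
    · simp only [ψ, h1, coe_eval₂RingHom, eval₂_C, eval₂_X, map_neg, map_one]
      exact (neg_mul _ _).trans (congrArg Neg.neg (inv_mul_cancel₀ (pow_ne_zero (n - 1) hℓ)))
    · simp [ψ, ℓ]
  have hΨm : (U.map (intEval w)).Monic := hU.map _
  have hΨ : Irreducible (U.map (intEval w)) := by
    refine hΨm.irreducible_of_irreducible_map (evalRingHom 0) _ ?_
    rwa [Polynomial.map_map, comp_intEval, hw0]
  rw [hΨm.irreducible_iff_irreducible_map_fraction_map (K := K), Polynomial.map_map,
    comp_intEval, ← hwψ, resolvent_scaleRoots hUr hU] at hΨ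
  have h := irreducible_of_irreducible_scaleRoots (hU.map _) hΨ
  refine (hU.map _).irreducible_of_irreducible_map ψ _ ?_
  rwa [Polynomial.map_map, comp_intEval]

end

theorem exists_coeff_disc (n : ℕ) : ∃ q : MvPolynomial (Fin n) ℤ, ∀ {S : Type} [CommRing S] (r : Fin n → S),
    intEval (coeffVec n (∏ j, (X - C (r j)))) q = (vandermonde r).det ^ 2 := by
  have hmap : ∀ {S : Type} [CommRing S] (r : Fin n → S), MvPolynomial.aeval r
      ((vandermonde (MvPolynomial.X : Fin n → MvPolynomial (Fin n) ℤ)).det ^ 2) =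
      (vandermonde r).det ^ 2 := by
    intro S _ r
    rw [map_pow, AlgHom.map_det]
    congr 2
    ext i j
    simp [vandermonde_apply]
  have hp : ((vandermonde (MvPolynomial.X : Fin n → MvPolynomial (Fin n) ℤ)).det ^ 2).IsSymmetric := by
    intro σ
    have h0 : rename σ ((vandermonde (MvPolynomial.X : Fin n → MvPolynomial (Fin n) ℤ)).det ^ 2) =
        (vandermonde (MvPolynomial.X ∘ σ : Fin n → MvPolynomial (Fin n) ℤ)).det ^ 2 := by
      rw [map_pow, AlgHom.map_det]
      congr 2
      ext i j
      simp [vandermonde_apply]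
    rw [h0]
    have : vandermonde (MvPolynomial.X ∘ σ : Fin n → MvPolynomial (Fin n) ℤ) =
        (vandermonde MvPolynomial.X).submatrix σ id := by
      ext i j; simp [vandermonde_apply]
    rw [this, det_permute, mul_pow, ← Int.cast_pow, ← Units.val_pow_eq_pow_val,
      Int.units_sq]
    simp
  obtain ⟨q, hq⟩ := exists_coeffVec_of_isSymmetric hp
  refine ⟨q, fun r => ?_⟩
  rw [intEval_eq_aeval, ← hmap r]
  exact hq r

section
variable {n : ℕ} {q : MvPolynomial (Fin n) ℤ} (hq : ∀ {S : Type} [CommRing S] (r : Fin n → S),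
    intEval (coeffVec n (∏ j, (X - C (r j)))) q = (vandermonde r).det ^ 2)

include hq in
theorem disc_scale {K : Type} [Field K] (v : Fin n → K) (s : K) :
    intEval (fun i => v i * s ^ (n - (i : ℕ))) q = s ^ (n * (n - 1)) * intEval v q := by
  set φ := algebraMap K (AlgebraicClosure K)
  apply φ.injective
  rw [← RingHom.comp_apply, comp_intEval, map_mul, ← RingHom.comp_apply φ (intEval v), comp_intEval]
  obtain ⟨r, hr⟩ := exists_coeffVec_prod_eq fun i => φ (v i)
  rw [← hr, hq]
  have h2 : (fun i : Fin n => φ (v i * s ^ (n - (i : ℕ)))) = coeffVec n (∏ j, (X - C (φ s * r j))) := by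
    ext i
    rw [coeffVec_mul_roots, hr]; simp
  have h3 : vandermonde (fun j => φ s * r j) =
      vandermonde r * Matrix.diagonal fun j : Fin n => φ s ^ (j : ℕ) := by
    ext i j
    simp [vandermonde_apply, mul_pow, mul_comm]
  rw [h2, hq, h3, det_mul, Matrix.det_diagonal, prod_pow_eq_pow_sum, mul_pow, ← pow_mul,
    Fin.sum_univ_eq_sum_range (fun i => i), Finset.sum_range_id_mul_two, map_pow, mul_comm]

include hq in
theorem norm_disc (r : Fin n → ℂ) : ‖intEval (coeffVec n (∏ j, (X - C (r j)))) q‖ =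
    ∏ i, ‖(derivative (∏ j, (X - C (r j)))).eval (r i)‖ := by
  classical
  have h1 : ∀ i, ‖(derivative (∏ j, (X - C (r j)))).eval (r i)‖ =
      (∏ j ∈ Ioi i, ‖r j - r i‖) * ∏ j ∈ Iio i, ‖r j - r i‖ := by
    intro i
    have h := Lagrange.eval_nodal_derivative_eval_node_eq (s := univ) (v := r) (mem_univ i)
    rw [Lagrange.nodal_eq, Lagrange.nodal_eq] at h
    rw [h, eval_prod, norm_prod, ← Finset.prod_union]
    · refine prod_congr ?_ fun j _ => by simp [norm_sub_rev]
      ext j; simp [lt_or_lt_iff_ne, eq_comm]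
    · rw [Finset.disjoint_left]; intro j hj hj'; simp at hj hj'; exact lt_asymm hj hj'
  rw [prod_congr rfl fun i _ => h1 i, prod_mul_distrib, hq, norm_pow, Matrix.det_vandermonde,
    norm_prod, sq]
  simp_rw [norm_prod]
  congr 1
  rw [Finset.prod_comm' (t' := univ) (s' := fun j => Iio j) (by simp)]
  simp_rw [norm_sub_rev]

include hq in
theorem abs_disc_of_roots {v : Fin n → ℚ} {f : ℂ[X]} (hf : f.Monic) (hfn : f.natDegree = n)
    (hv : (fun i => (v i : ℂ)) = coeffVec n f) :
    (|intEval v q| : ℝ) = (f.roots.map fun x => ‖(derivative f).eval x‖).prod := by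
  obtain ⟨r, hr⟩ := exists_coeffVec_prod_eq (coeffVec n f)
  have hfr : f = ∏ j, (X - C (r j)) := by
    have hm : (∏ j, (X - C (r j))).Monic := monic_prod_of_monic _ _ fun _ _ => monic_X_sub_C _
    have hd : (∏ j, (X - C (r j))).natDegree = n := by simp
    ext k
    rcases lt_trichotomy k n with hk | rfl | hk
    · exact (congrFun hr ⟨k, hk⟩).symm
    · have h1 := hf.coeff_natDegree
      have h2 := hm.coeff_natDegree
      rw [hfn] at h1; rw [hd] at h2; rw [h1, h2]
    · rw [coeff_eq_zero_of_natDegree_lt (hfn ▸ hk), coeff_eq_zero_of_natDegree_lt (by rw [hd]; exact hk)]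
  have hroots : f.roots = univ.val.map r := by
    rw [hfr]
    refine Eq.trans ?_ (roots_multiset_prod_X_sub_C (univ.val.map r))
    rw [Multiset.map_map]
    rfl
  have h := norm_disc hq r
  rw [← hfr, ← hv] at h
  have h2 : intEval (fun i => (v i : ℂ)) q = ((intEval v q : ℚ) : ℂ) := by
    have := comp_intEval (Rat.castHom ℂ) v
    exact (RingHom.congr_fun this q).symm
  rw [hroots, Multiset.map_map]
  rw [h2] at h
  have h3 : ‖((intEval v q : ℚ) : ℂ)‖ = |((intEval v q : ℚ) : ℝ)| := by
    rw [← Complex.ofReal_ratCast, Complex.norm_real, norm_eq_abs]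
  rw [h3] at h
  rw [h]
  rfl

end

section
variable {n : ℕ} {q : MvPolynomial (Fin n) ℤ} (hq : ∀ {S : Type} [CommRing S] (r : Fin n → S),
    intEval (coeffVec n (∏ j, (X - C (r j)))) q = (vandermonde r).det ^ 2)

include hq in
theorem abs_disc_X_pow_add_C (hn : 2 ≤ n) {u : ℚ} :
    |intEval (coeffVec n (X ^ n + C u : ℚ[X])) q| = n ^ n * |u| ^ (n - 1) := by
  have hf : (X ^ n + C (u : ℂ)).Monic := monic_X_pow_add_C _ (by omega)
  have hfn : (X ^ n + C (u : ℂ)).natDegree = n := natDegree_X_pow_add_C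
  have h := abs_disc_of_roots hq (v := coeffVec n (X ^ n + C u : ℚ[X])) hf hfn (by
    ext i; simp [coeffVec, coeff_X_pow, coeff_C]; split_ifs <;> simp)
  have hc : (X ^ n + C (u : ℂ)).roots.card = n := by
    rw [IsAlgClosed.card_roots_eq_natDegree, hfn]
  rw [Multiset.map_congr (g := fun x => (n : ℝ) * ‖x‖ ^ (n - 1)) rfl (fun x _ => by simp [derivative_X_pow])] at h
  rw [Multiset.prod_map_mul, map_const', prod_replicate, hc, Multiset.prod_map_pow] at h
  have h2 : ((X ^ n + C (u : ℂ)).roots.map fun x => ‖x‖).prod = |(u : ℝ)| := by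
    have h3 := (splits (X ^ n + C (u : ℂ))).coeff_zero_eq_prod_roots_of_monic hf
    have h4 := congrArg norm h3
    rw [norm_mul, show ∀ s : Multiset ℂ, ‖s.prod‖ = (s.map (‖·‖)).prod from fun s => map_multiset_prod (normHom : ℂ →*₀ ℝ) s] at h4
    simpa [hfn, show n ≠ 0 by omega, coeff_X_pow, ← Complex.ofReal_ratCast, ← Rat.norm_cast_real, eq_comm] using h4
  rw [h2] at h
  exact_mod_cast h

include hq in
theorem abs_disc_X_pow_add_C_mul_X (hn : 3 ≤ n) {u : ℚ} :
    |intEval (coeffVec n (X ^ n + C u * X : ℚ[X])) q| = (n - 1 : ℕ) ^ (n - 1) * |u| ^ n := by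
  set g : ℂ[X] := X ^ (n - 1) + C (u : ℂ) with hg
  have hgm : g.Monic := monic_X_pow_add_C _ (by omega)
  have hgn : g.natDegree = n - 1 := natDegree_X_pow_add_C
  have hf : (X * g).Monic := monic_X.mul hgm
  have hfn : (X * g).natDegree = n := by
    rw [natDegree_X_mul hgm.ne_zero, hgn]; omega
  have hXg : X * g = X ^ n + C (u : ℂ) * X := by
    rw [hg, mul_add, ← pow_succ', show n - 1 + 1 = n by omega, mul_comm X]
  have h := abs_disc_of_roots hq (v := coeffVec n (X ^ n + C u * X : ℚ[X])) hf hfn (by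
    rw [hXg]
    ext i; simp [coeffVec, coeff_X_pow, coeff_X]; split_ifs <;> simp)
  have hc : g.roots.card = n - 1 := by
    rw [IsAlgClosed.card_roots_eq_natDegree, hgn]
  have hr : (X * g).roots = 0 ::ₘ g.roots := by
    rw [roots_mul (hf.ne_zero), roots_X]; rfl
  rw [hr, Multiset.map_cons, Multiset.prod_cons,
    Multiset.map_congr (g := fun _ => ((n - 1 : ℕ) : ℝ) * |(u : ℝ)|) rfl (fun x hx => ?_),
    map_const', prod_replicate, hc] at h
  · have h0 : ‖eval 0 (derivative (X * g))‖ = |(u : ℝ)| := by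
      rw [hXg]
      simp [derivative_X_pow, show n - 1 ≠ 0 by omega, ← Rat.norm_cast_real]
    rw [h0, mul_pow] at h
    have h' : (|(u : ℝ)|) * (((n - 1 : ℕ) : ℝ) ^ (n - 1) * |(u : ℝ)| ^ (n - 1)) =
        ((n - 1 : ℕ) : ℝ) ^ (n - 1) * |(u : ℝ)| ^ n := by
      obtain ⟨m, rfl⟩ : ∃ m, n = m + 1 := ⟨n - 1, by omega⟩
      simp only [Nat.add_sub_cancel]; ring
    rw [h'] at h
    exact_mod_cast h
  · have hx' : x ^ (n - 1) = -(u : ℂ) := by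
      have := (mem_roots'.1 hx).2
      simp only [hg, IsRoot, eval_add, eval_pow, eval_X, eval_C] at this
      exact eq_neg_of_add_eq_zero_left this
    rw [hXg]
    have : eval x (derivative (X ^ n + C (u : ℂ) * X)) = -((n - 1 : ℕ) * u) := by
      simp only [derivative_add, derivative_X_pow, derivative_C_mul, derivative_X, eval_add, eval_mul, eval_C,
        eval_pow, eval_X, mul_one, hx']
      push_cast [show 1 ≤ n by omega]
      ring
    rw [this, norm_neg, norm_mul, Complex.norm_natCast]
    simp [← Rat.norm_cast_real]

end

theorem isSquare_eval_zero {E P : ℚ[X]} {φ : ℚ[X] →+* FractionRing ℚ[X]} {N : ℕ}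
    (h : algebraMap ℚ[X] (FractionRing ℚ[X]) P = (algebraMap ℚ[X] (FractionRing ℚ[X]) X) ^ (N + N) * φ E)
    (hE : IsSquare E) : IsSquare (P.eval 0) := by
  obtain ⟨F, rfl⟩ := hE
  set y := (algebraMap ℚ[X] (FractionRing ℚ[X]) X) ^ N * φ F with hy
  have hy2 : y ^ 2 = algebraMap ℚ[X] (FractionRing ℚ[X]) P := by
    rw [h, hy, map_mul]; ring
  obtain ⟨R, hR⟩ := IsIntegrallyClosed.exists_algebraMap_eq_of_isIntegral_pow (R := ℚ[X]) (x := y) two_pos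
    (by rw [hy2]; exact isIntegral_algebraMap)
  have : P = R * R := by
    apply IsFractionRing.injective ℚ[X] (FractionRing ℚ[X])
    rw [← hy2, ← hR]; simp [sq]
  exact ⟨R.eval 0, by rw [this, eval_mul]⟩

theorem isSquare_of_sq_mul_odd_pow {a k : ℕ} {b y : ℚ} (hk : Odd k) (hb : b ≠ 0)
    (hy : |y| = b ^ 2 * (a : ℚ) ^ k) (h : IsSquare y) : IsSquare a := by
  obtain ⟨j, rfl⟩ := hk
  rcases eq_or_ne a 0 with rfl | ha
  · simp
  obtain ⟨z, rfl⟩ := h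
  have ha' : (a : ℚ) ≠ 0 := by exact_mod_cast ha
  rw [← Rat.isSquare_natCast_iff]
  refine ⟨z / (b * (a : ℚ) ^ j), ?_⟩
  rw [abs_mul_self] at hy
  rw [div_mul_div_comm, hy, eq_div_iff (by positivity)]
  ring

section
variable {n : ℕ} {q : MvPolynomial (Fin n) ℤ} (hq : ∀ {S : Type} [CommRing S] (r : Fin n → S),
    intEval (coeffVec n (∏ j, (X - C (r j)))) q = (vandermonde r).det ^ 2)

include hq in
theorem isSquare_disc_of_scale {k : ℕ} (u : ℚ) (v w : Fin n → ℚ[X])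
    (h : ∀ i, algebraMap ℚ[X] (FractionRing ℚ[X]) (w i) =
      eval₂RingHom (algebraMap ℚ (FractionRing ℚ[X]))
        (algebraMap ℚ (FractionRing ℚ[X]) u * ((algebraMap ℚ[X] (FractionRing ℚ[X]) X) ^ k)⁻¹) (v i) *
      (algebraMap ℚ[X] (FractionRing ℚ[X]) X) ^ (n - (i : ℕ)))
    (hs : IsSquare (intEval v q)) : IsSquare (intEval (fun i => (w i).eval 0) q) := by
  obtain ⟨N, hN⟩ := Nat.even_mul_pred_self n
  have h1 := isSquare_eval_zero (P := intEval w q) (N := N) (E := intEval v q)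
    (φ := eval₂RingHom (algebraMap ℚ (FractionRing ℚ[X]))
        (algebraMap ℚ (FractionRing ℚ[X]) u * ((algebraMap ℚ[X] (FractionRing ℚ[X]) X) ^ k)⁻¹)) (by
      rw [← hN, ← RingHom.comp_apply, ← RingHom.comp_apply, comp_intEval, comp_intEval, ← disc_scale hq]
      congr 2
      ext i
      exact h i) hs
  have h2 := RingHom.congr_fun (comp_intEval (evalRingHom (0 : ℚ)) w) q
  rw [RingHom.comp_apply] at h2
  exact h2 ▸ h1

include hq in
theorem not_isSquare_restrictLine_disc (hn : 3 ≤ n)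
    (hshape : ∀ m : ℕ, Odd m → 0 < m → n ≠ m ^ 2 ∧ n ≠ m ^ 2 + 1) (A : Fin n → ℤ) (m c : ℚ) :
    ¬ IsSquare (restrictLine (intEval (coeffFamily n A) q) m c) := by
  intro hsq
  have h1 : restrictLine (intEval (coeffFamily n A) q) m c =
      intEval (fun i => restrictLine (coeffFamily n A i) m c) q :=
    RingHom.congr_fun (comp_intEval ((evalRingHom (C m * X + C c)).comp
      (mapRingHom (mapRingHom (castRingHom ℚ)))) (coeffFamily n A)) q
  rw [h1] at hsq
  have key : ∀ u : ℚ, IsSquare (intEval (coeffVec n (X ^ n + C u * X : ℚ[X])) q) := by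
    intro u
    have h := isSquare_disc_of_scale hq (k := n - 1) u _
      (fun i => if (i : ℕ) = 0 then C (m * u) * X + C c * X ^ n else if (i : ℕ) = 1 then C u else
        C (A i : ℚ) * X ^ (n - (i : ℕ))) (fun i => ?_) hsq
    · convert h using 3
      ext i
      have := i.2
      simp only [coeffVec, coeff_add, coeff_X_pow, coeff_C_mul, coeff_X]
      split_ifs <;> first | omega | skip
      · simp
      · simp; exact Or.inr (by omega)
      · simp; omega
    · have hℓ : algebraMap ℚ[X] (FractionRing ℚ[X]) X ≠ 0 := by simp
      set ℓ := algebraMap ℚ[X] (FractionRing ℚ[X]) X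
      have hC : ∀ x : ℚ, algebraMap ℚ[X] (FractionRing ℚ[X]) (C x) = algebraMap ℚ (FractionRing ℚ[X]) x :=
        fun x => (IsScalarTower.algebraMap_apply ℚ ℚ[X] (FractionRing ℚ[X]) x).symm
      have hpow : ℓ ^ n = ℓ ^ (n - 1) * ℓ := by rw [← pow_succ, show n - 1 + 1 = n by omega]
      have hi := i.2
      simp only [restrictLine, coeffFamily]
      split_ifs with h0 h1
      · rw [h0]
        simp only [map_add, map_mul, map_pow, hC, Polynomial.map_X, eval_X, coe_eval₂RingHom, eval₂_add,
          eval₂_mul, eval₂_C, eval₂_X, Nat.sub_zero]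
        change _ * ℓ + _ * ℓ ^ n = _
        rw [hpow]
        field_simp
      · rw [h1]
        simp only [Polynomial.map_C, coe_mapRingHom, Polynomial.map_X, eval_C, hC, coe_eval₂RingHom, eval₂_X]
        field_simp
      · simp [ℓ]
  rcases Nat.even_or_odd n with he | ho
  · have h2 := isSquare_of_sq_mul_odd_pow (a := n - 1) (k := n - 1) (b := 1)
      (Nat.Even.sub_odd (by omega) he odd_one) one_ne_zero
      (by rw [abs_disc_X_pow_add_C_mul_X hq hn]; simp) (key 1)
    obtain ⟨r, hr⟩ := h2
    have hodd : Odd (r * r) := hr ▸ Nat.Even.sub_odd (by omega) he odd_one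
    have hr' := (Nat.odd_mul.1 hodd).1
    refine (hshape r hr' hr'.pos).2 ?_
    rw [sq, ← hr]; omega
  · have hne : ((n - 1 : ℕ) : ℚ) ≠ 0 := by exact_mod_cast (by omega : n - 1 ≠ 0)
    obtain ⟨j, hj⟩ := ho
    have h2 := isSquare_of_sq_mul_odd_pow (a := 2) (k := n) (b := ((n - 1 : ℕ) : ℚ) ^ j)
      ⟨j, hj⟩ (pow_ne_zero _ hne)
      (by rw [abs_disc_X_pow_add_C_mul_X hq hn, ← pow_mul, show j * 2 = n - 1 by omega]; simp) (key 2)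
    exact prime_two.prime.not_isSquare h2

include hq in
theorem not_isSquare_disc_vertical (hn : 3 ≤ n)
    (hshape : ∀ m : ℕ, Odd m → 0 < m → n ≠ m ^ 2 ∧ n ≠ m ^ 2 + 1) (A : Fin n → ℤ) (a : ℤ) :
    ¬ IsSquare (((intEval (coeffFamily n A) q).map (evalRingHom a)).map (castRingHom ℚ)) := by
  intro hsq
  have h1 : ((intEval (coeffFamily n A) q).map (evalRingHom a)).map (castRingHom ℚ) =
      intEval (fun i => ((coeffFamily n A i).map (evalRingHom a)).map (castRingHom ℚ)) q :=
    RingHom.congr_fun (comp_intEval ((mapRingHom (castRingHom ℚ)).comp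
      (mapRingHom (evalRingHom a))) (coeffFamily n A)) q
  rw [h1] at hsq
  have key : ∀ u : ℚ, IsSquare (intEval (coeffVec n (X ^ n + C u : ℚ[X])) q) := by
    intro u
    have h := isSquare_disc_of_scale hq (k := n) u _
      (fun i => if (i : ℕ) = 0 then C u else if (i : ℕ) = 1 then C (a : ℚ) * X ^ (n - 1) else
        C (A i : ℚ) * X ^ (n - (i : ℕ))) (fun i => ?_) hsq
    · convert h using 3
      ext i
      have := i.2
      simp only [coeffVec, coeff_add, coeff_X_pow, coeff_C]
      split_ifs <;> first | omega | skip
      · simp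
      · simp; omega
      · simp; omega
    · have hℓ : algebraMap ℚ[X] (FractionRing ℚ[X]) X ≠ 0 := by simp
      set ℓ := algebraMap ℚ[X] (FractionRing ℚ[X]) X
      have hC : ∀ x : ℚ, algebraMap ℚ[X] (FractionRing ℚ[X]) (C x) = algebraMap ℚ (FractionRing ℚ[X]) x :=
        fun x => (IsScalarTower.algebraMap_apply ℚ ℚ[X] (FractionRing ℚ[X]) x).symm
      have hi := i.2
      simp only [coeffFamily]
      split_ifs with h0 h1
      · rw [h0]
        simp only [Polynomial.map_X, hC, coe_eval₂RingHom, eval₂_X, Nat.sub_zero]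
        field_simp
      · rw [h1]
        simp [ℓ]
      · simp [ℓ]
  rcases Nat.even_or_odd n with he | ho
  · have hne : (n : ℚ) ≠ 0 := by exact_mod_cast (by omega : n ≠ 0)
    have ho := Nat.Even.sub_odd (by omega) he odd_one
    obtain ⟨j, hj⟩ := he
    have h2 := isSquare_of_sq_mul_odd_pow (a := 2) (k := n - 1) (b := (n : ℚ) ^ j)
      ho (pow_ne_zero _ hne)
      (by rw [abs_disc_X_pow_add_C hq (by omega), ← pow_mul, show j * 2 = n by omega]; simp) (key 2)
    exact prime_two.prime.not_isSquare h2
  · have h2 := isSquare_of_sq_mul_odd_pow (a := n) (k := n) (b := 1)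
      ho one_ne_zero (by rw [abs_disc_X_pow_add_C hq (by omega)]; simp) (key 1)
    obtain ⟨r, hr⟩ := h2
    have hr' := (Nat.odd_mul.1 (hr ▸ ho)).1
    exact (hshape r hr' hr'.pos).1 (by rw [sq, ← hr])

end

theorem exists_bd_intEval {n : ℕ} (q : MvPolynomial (Fin n) ℤ) :
    ∃ D, ∀ v : Fin n → ℤ[X][X], (∀ i, Bd 1 (v i)) → Bd D (intEval v q) := by
  induction q using MvPolynomial.induction_on with
  | C a => exact ⟨0, fun v _ => by simpa [intEval] using Bd.intCast 0 a⟩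
  | add p q hp hq =>
    obtain ⟨D, hD⟩ := hp
    obtain ⟨E, hE⟩ := hq
    refine ⟨D + E, fun v hv => ?_⟩
    have := Bd.sum (D := D + E) univ (P := ![intEval v p, intEval v q]) (by
      intro i _
      fin_cases i
      · exact (hD v hv).mono (by omega)
      · exact (hE v hv).mono (by omega))
    simpa using this
  | mul_X p i hp =>
    obtain ⟨D, hD⟩ := hp
    refine ⟨D + 1, fun v hv => ?_⟩
    rw [map_mul]
    exact (hD v hv).mul (by simpa [intEval] using hv i)

theorem exists_abs_intEval_le {n : ℕ} (q : MvPolynomial (Fin n) ℤ) :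
    ∃ κ H₀ : ℕ, ∀ H : ℕ, H₀ ≤ H → ∀ v : Fin n → ℤ, (∀ i, |v i| ≤ 2 * (H : ℤ) ^ n) →
      |intEval v q| ≤ (H : ℤ) ^ κ := by
  induction q using MvPolynomial.induction_on with
  | C a =>
    refine ⟨1, a.natAbs, fun H hH v _ => ?_⟩
    have h : intEval v (MvPolynomial.C a) = a := by simp [intEval]
    rw [h, pow_one, abs_eq_natAbs]
    exact_mod_cast hH
  | add p q hp hq =>
    obtain ⟨k, A, hA⟩ := hp
    obtain ⟨l, B, hB⟩ := hq
    refine ⟨k + l + 1, A + B + 2, fun H hH v hv => ?_⟩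
    have h1 := hA H (by omega) v hv
    have h2 := hB H (by omega) v hv
    have hH2 : (2 : ℤ) ≤ H := by omega
    have h3 : (H : ℤ) ^ k ≤ (H : ℤ) ^ (k + l) := pow_le_pow_right₀ (by omega) (by omega)
    have h4 : (H : ℤ) ^ l ≤ (H : ℤ) ^ (k + l) := pow_le_pow_right₀ (by omega) (by omega)
    rw [map_add]
    refine (abs_add_le _ _).trans ?_
    rw [pow_succ]
    nlinarith [pow_pos (show (0 : ℤ) < H by omega) (k + l)]
  | mul_X p i hp =>
    obtain ⟨k, A, hA⟩ := hp
    refine ⟨k + (n + 1), A + 2, fun H hH v hv => ?_⟩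
    rw [map_mul, abs_mul, pow_add]
    have h2 := hv i
    have hH2 : (2 : ℤ) ≤ H := by omega
    refine mul_le_mul (hA H (by omega) v hv) ?_ (abs_nonneg _) (by positivity)
    simp only [intEval, MvPolynomial.coe_eval₂Hom, MvPolynomial.eval₂_X]
    refine h2.trans ?_
    rw [pow_succ']
    gcongr

theorem bd_coeffFamily {n : ℕ} (A : Fin n → ℤ) (i : Fin n) : Bd 1 (coeffFamily n A i) := by
  unfold coeffFamily
  split_ifs
  · exact ⟨natDegree_X_le, by rw [Bivariate.swap_Y]; simp⟩
  · exact ⟨by simp, by rw [Bivariate.swap_X]; exact natDegree_X_le⟩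
  · simpa using Bd.intCast 1 (A i)

theorem evalEval_intEval_coeffFamily {n : ℕ} (A : Fin n → ℤ) (a b : ℤ) (q : MvPolynomial (Fin n) ℤ) :
    (intEval (coeffFamily n A) q).evalEval a b =
      intEval (fun i : Fin n => if (i : ℕ) = 0 then b else if (i : ℕ) = 1 then a else A i) q := by
  have h := RingHom.congr_fun (comp_intEval (evalEvalRingHom a b) (coeffFamily n A)) q
  have h2 : (fun i => evalEvalRingHom a b (coeffFamily n A i)) =
      fun i : Fin n => if (i : ℕ) = 0 then b else if (i : ℕ) = 1 then a else A i := by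
    ext i
    unfold coeffFamily
    split_ifs <;> simp
  rw [h2] at h
  exact h

theorem abs_root_le {p : ℤ[X]} (hp : p.Monic) {z B : ℤ} (hB : ∀ k, |p.coeff k| ≤ B)
    (hz : p.eval z = 0) : |z| ≤ B + 1 := by
  have hB0 : 0 ≤ B := (abs_nonneg _).trans (hB 0)
  have h1 : (p.map (castRingHom ℝ)).IsRoot (z : ℝ) := by
    rw [IsRoot, eval_map, eval₂_at_intCast, Int.cast_id, hz]; simp
  have h2 := h1.norm_lt_cauchyBound ((hp.map _).ne_zero)
  have h3 : cauchyBound (p.map (castRingHom ℝ)) ≤ Real.toNNReal B + 1 := by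
    unfold cauchyBound
    rw [(hp.map _).leadingCoeff]
    simp only [nnnorm_one, div_one]
    refine add_le_add_left (Finset.sup_le fun k _ => ?_) _
    rw [← NNReal.coe_le_coe, coe_nnnorm, coeff_map, Real.coe_toNNReal _ (by exact_mod_cast hB0)]
    simp only [eq_intCast, norm_eq_abs]
    exact_mod_cast hB k
  have h4 : ‖(z : ℝ)‖ < B + 1 := by
    have h5 := NNReal.coe_lt_coe.2 (h2.trans_le h3)
    rwa [NNReal.coe_add, Real.coe_toNNReal _ (by exact_mod_cast hB0), coe_nnnorm, NNReal.coe_one] at h5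
  rw [norm_eq_abs] at h4
  exact_mod_cast h4.le

theorem card_family_le (n : ℕ) (hn : 3 ≤ n) (G : Subgroup (Perm (Fin n))) [Fintype G]
    (hshape : ∀ m : ℕ, Odd m → 0 < m → n ≠ m ^ 2 ∧ n ≠ m ^ 2 + 1)
    (hπ : √((n : ℝ) * (n - 1) / G.index) ≤ n / 2) :
    ∃ W : ℤ, ∀ ε : ℝ, 0 < ε → ∃ c H₀ : ℕ, ∀ H : ℕ, H₀ ≤ H → ∀ A : Fin n → ℤ,
      (∀ i, |A i| ≤ 2 * (H : ℤ) ^ n) → ∀ S : Finset (ℤ × ℤ),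
      (∀ x ∈ S, |x.1| ≤ (H : ℤ) ^ (n - 1) ∧ |x.2| ≤ (H : ℤ) ^ n ∧
        ∃ r : Fin n → AlgebraicClosure ℚ, Injective r ∧
          (coeffVec n (∏ j, (X - C (r j))) = fun i : Fin n =>
            ((if (i : ℕ) = 0 then x.2 else if (i : ℕ) = 1 then x.1 else A i : ℤ) : AlgebraicClosure ℚ)) ∧
          (∃ z : ℤ, intEval r (resolventSeed n G W) = z) ∧
          ∃ y : ℤ, (vandermonde r).det = y) →
      (S.card : ℝ) ≤ c * (H : ℝ) ^ (√((n : ℝ) * (n - 1) / G.index) + n / 2 + ε) := by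
  classical
  obtain ⟨W, hW⟩ := exists_irreducible_selmer_resolvent n (by omega) G
  refine ⟨W, fun ε hε => ?_⟩
  obtain ⟨U, hUm, hUd, hUr'⟩ := exists_resolvent (θ := resolventSeed n G W) (G := G)
    (rename_resolventSeed W)
  have hUr : ∀ {S : Type} [CommRing S] (r : Fin n → S),
      U.map (intEval (coeffVec n (∏ j, (X - C (r j))))) =
        ∏ q : Perm (Fin n) ⧸ G, (X - C (MvPolynomial.aeval (r ∘ q.out) (resolventSeed n G W))) := by
    intro S _ r
    rw [intEval_eq_aeval]
    exact hUr' r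
  have hirr := hW U hUm hUd hUr
  obtain ⟨q, hq⟩ := exists_coeff_disc n
  choose D hD using fun k => exists_bd_intEval (U.coeff k)
  choose κ H₁ hκ using fun k => exists_abs_intEval_le (U.coeff k)
  obtain ⟨D', hD'⟩ := exists_bd_intEval q
  obtain ⟨κ', H₂, hκ'⟩ := exists_abs_intEval_le q
  set d := G.index with hd
  set D₀ := D' + ∑ k ∈ range (d + 1), D k with hD₀
  set κ₀ := n + κ' + 1 + ∑ k ∈ range (d + 1), κ k with hκ₀
  set H₃ := ∑ k ∈ range (d + 1), H₁ k with hH₃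
  have hd0 : 0 < d := Nat.pos_of_ne_zero Subgroup.index_ne_zero_of_finite
  obtain ⟨C₁, H₄, hmain⟩ := card_surface_points_le n d D₀ κ₀ (by omega) hd0 (by omega) hπ ε hε
  refine ⟨C₁, H₄ + H₃ + H₂ + 2, fun H hH A hA S hS => ?_⟩
  have hle : ∀ f : ℕ → ℕ, ∀ k ∈ range (d + 1), f k ≤ ∑ k ∈ range (d + 1), f k :=
    fun f k hk => single_le_sum (f := f) (fun _ _ => Nat.zero_le _) hk
  have hH2 : (2 : ℤ) ≤ H := by omega
  have hvbd : ∀ a b : ℤ, |a| ≤ 2 * (H : ℤ) ^ n → |b| ≤ 2 * (H : ℤ) ^ n → ∀ i : Fin n,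
      |if (i : ℕ) = 0 then b else if (i : ℕ) = 1 then a else A i| ≤ 2 * (H : ℤ) ^ n := by
    intro a b ha hb i
    split_ifs
    exacts [hb, ha, hA i]
  have hcoeff : ∀ v : Fin n → ℤ, (∀ i, |v i| ≤ 2 * (H : ℤ) ^ n) → ∀ k,
      |intEval v (U.coeff k)| ≤ (H : ℤ) ^ (κ₀ - 1) := by
    intro v hv k
    by_cases hk : k ∈ range (d + 1)
    · refine (hκ k H ((hle H₁ k hk).trans (by omega)) v hv).trans ?_
      refine pow_le_pow_right₀ (by omega) ?_
      have := hle κ k hk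
      omega
    · rw [coeff_eq_zero_of_natDegree_lt (by rw [hUd]; simpa using hk)]
      simp
  have hdata : SurfaceData n d D₀ κ₀ H (U.map (intEval (coeffFamily n A))) (intEval (coeffFamily n A) q) :=
    { irreducible := irreducible_resolvent_coeffFamily (by omega) hUr hUm hirr A
      monic := hUm.map _
      natDegree := by rw [hUm.natDegree_map, hUd]
      bd := fun k => by
        rw [coeff_map]
        by_cases hk : k ∈ range (d + 1)
        · refine (hD k _ (bd_coeffFamily A)).mono ?_
          have := hle D k hk
          omega
        · rw [coeff_eq_zero_of_natDegree_lt (by rw [hUd]; simpa using hk), map_zero]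
          exact Bd.zero _
      size := fun k a b ha hb => by
        rw [coeff_map, evalEval_intEval_coeffFamily]
        exact (hcoeff _ (hvbd a b ha hb) k).trans (pow_le_pow_right₀ (by omega) (by omega))
      bd_disc := (hD' _ (bd_coeffFamily A)).mono (by omega)
      line := not_isSquare_restrictLine_disc hq hn hshape A
      vert := not_isSquare_disc_vertical hq hn hshape A }
  have hS' : ∀ x ∈ S, ∃ (r : Fin n → AlgebraicClosure ℚ) (z y : ℤ), Injective r ∧
      (coeffVec n (∏ j, (X - C (r j))) = fun i : Fin n =>
        ((if (i : ℕ) = 0 then x.2 else if (i : ℕ) = 1 then x.1 else A i : ℤ) : AlgebraicClosure ℚ)) ∧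
      intEval r (resolventSeed n G W) = z ∧ (vandermonde r).det = y := by
    intro x hx
    obtain ⟨-, -, r, h1, h2, ⟨z, hz⟩, y, hy⟩ := hS x hx
    exact ⟨r, z, y, h1, h2, hz, hy⟩
  have h1 : ∀ x ∈ S, |x.1| ≤ (H : ℤ) ^ (n - 1) := fun x hx => (hS x hx).1
  have h2 : ∀ x ∈ S, |x.2| ≤ (H : ℤ) ^ n := fun x hx => (hS x hx).2.1
  choose! r z y hr hrv hz hy using hS'
  have hbig : ∀ x ∈ S, |x.1| ≤ 2 * (H : ℤ) ^ n ∧ |x.2| ≤ 2 * (H : ℤ) ^ n := by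
    intro x hx
    have h3 : (H : ℤ) ^ (n - 1) ≤ (H : ℤ) ^ n := pow_le_pow_right₀ (by omega) (by omega)
    have h4 : 0 ≤ (H : ℤ) ^ n := by positivity
    exact ⟨by linarith [h1 x hx], by linarith [h2 x hx]⟩
  have hΔ : ∀ x ∈ S, (intEval (coeffFamily n A) q).evalEval x.1 x.2 = y x ^ 2 := by
    intro x hx
    rw [evalEval_intEval_coeffFamily]
    have h3 := hq (r x)
    rw [hrv x hx, hy x hx] at h3
    have h4 := RingHom.congr_fun (comp_intEval (castRingHom (AlgebraicClosure ℚ))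
      (fun i : Fin n => if (i : ℕ) = 0 then x.2 else if (i : ℕ) = 1 then x.1 else A i)) q
    simp only [RingHom.comp_apply, eq_intCast] at h4
    rw [h3] at h4
    exact_mod_cast h4
  have hΦ : ∀ x ∈ S, (((U.map (intEval (coeffFamily n A))).map (evalEvalRingHom x.1 x.2)).eval (z x)) = 0 := by
    intro x hx
    have h3 := hUr (r x)
    rw [hrv x hx] at h3
    have h4 := comp_intEval (castRingHom (AlgebraicClosure ℚ))
      (fun i : Fin n => if (i : ℕ) = 0 then x.2 else if (i : ℕ) = 1 then x.1 else A i)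
    simp only [eq_intCast] at h4
    have h5 : (evalEvalRingHom x.1 x.2).comp (intEval (coeffFamily n A)) =
        intEval (fun i : Fin n => if (i : ℕ) = 0 then x.2 else if (i : ℕ) = 1 then x.1 else A i) :=
      RingHom.ext fun p => evalEval_intEval_coeffFamily A x.1 x.2 p
    rw [Polynomial.map_map, h5]
    have hz0 : intEval (r x ∘ ((1 : Perm (Fin n)) : Perm (Fin n) ⧸ G).out)
        (resolventSeed n G W) = z x := by
      rw [← hz x hx, intEval, ← eval₂Hom_rename, rename_resolventSeed W]
      · rfl
      have := QuotientGroup.mk_out_eq_mul G (1 : Perm (Fin n))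
      obtain ⟨g, hg⟩ := this
      rw [hg, one_mul]
      exact g.2
    have h6 : ((U.map (intEval fun i : Fin n => if (i : ℕ) = 0 then x.2 else if (i : ℕ) = 1 then x.1 else A i)).map
        (castRingHom (AlgebraicClosure ℚ))).eval ((z x : ℤ) : AlgebraicClosure ℚ) = 0 := by
      rw [Polynomial.map_map, h4, h3, eval_prod]
      refine prod_eq_zero (mem_univ ((1 : Perm (Fin n)) : Perm (Fin n) ⧸ G)) ?_
      have h7 := RingHom.congr_fun (intEval_eq_aeval (r x ∘ ((1 : Perm (Fin n)) : Perm (Fin n) ⧸ G).out)) (resolventSeed n G W)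
      rw [hz0] at h7
      rw [eval_sub, eval_X, eval_C, sub_eq_zero]
      exact h7
    rw [eval_map, eval₂_at_intCast] at h6
    simpa using h6
  refine hmain H (by omega) _ _ hdata S z y hΦ hΔ ?_ h1 h2 ?_ ?_
  · intro x hx h0
    have h3 := hy x hx
    rw [h0, Int.cast_zero] at h3
    exact Matrix.det_vandermonde_ne_zero_iff.2 (hr x hx) h3
  · intro x hx
    have h5 : (evalEvalRingHom x.1 x.2).comp (intEval (coeffFamily n A)) =
        intEval (fun i : Fin n => if (i : ℕ) = 0 then x.2 else if (i : ℕ) = 1 then x.1 else A i) :=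
      RingHom.ext fun p => evalEval_intEval_coeffFamily A x.1 x.2 p
    have h6 := hΦ x hx
    rw [Polynomial.map_map, h5] at h6
    refine (abs_root_le (B := (H : ℤ) ^ (κ₀ - 1)) (hUm.map _) (fun k => ?_) h6).trans ?_
    · rw [coeff_map]
      exact hcoeff _ (hvbd _ _ (hbig x hx).1 (hbig x hx).2) k
    · have hpow : (H : ℤ) ^ κ₀ = (H : ℤ) ^ (κ₀ - 1) * H := by
        rw [← pow_succ]; congr 1; omega
      rw [hpow]
      have := one_le_pow₀ (show (1 : ℤ) ≤ H by omega) (n := κ₀ - 1)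
      nlinarith
  · intro x hx
    have h3 := hΔ x hx
    rw [evalEval_intEval_coeffFamily] at h3
    have h4 := hκ' H (by omega) _ (hvbd _ _ (hbig x hx).1 (hbig x hx).2)
    rw [h3, abs_pow] at h4
    refine le_trans ?_ (h4.trans (pow_le_pow_right₀ (by omega) (by omega)))
    rcases eq_or_ne (y x) 0 with h0 | h0
    · simp [h0]
    · have := one_le_abs h0
      nlinarith

/-- **Minkowski's theorem on linear forms.** -/
theorem exists_int_vec_forms_lt {ι : Type*} [Fintype ι] [DecidableEq ι] (N : Matrix ι ι ℝ)
    (hN : N.det ≠ 0) (t : ι → ℝ) (ht : ∀ i, 0 < t i) (h : |N.det| < ∏ i, t i) :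
    ∃ x : ι → ℤ, x ≠ 0 ∧ ∀ i, |N.mulVec (fun j => (x j : ℝ)) i| < t i := by
  classical
  have hu : IsUnit N.transpose.det := by simpa using hN
  obtain ⟨hli, hsp⟩ := (Module.Basis.is_basis_iff_det (Pi.basisFun ℝ ι)).2
    (show IsUnit ((Pi.basisFun ℝ ι).det N.transpose) by
      rw [Pi.basisFun_det]; exact hu)
  let b : Module.Basis ι ℝ (ι → ℝ) := Module.Basis.mk hli hsp.ge
  have hb : ∀ j, b j = N.transpose j := fun j => Module.Basis.mk_apply hli hsp.ge j
  have hvol := ZSpan.volume_fundamentalDomain b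
  have hmat : (Matrix.of b).det = N.det := by
    rw [← Matrix.det_transpose N]; congr 1; ext i j; simp [hb]
  have : Countable (Submodule.span ℤ (Set.range b)).toAddSubgroup := by
    change Countable (Submodule.span ℤ (Set.range b))
    infer_instance
  obtain ⟨x, hx0, hx⟩ := MeasureTheory.exists_ne_zero_mem_lattice_of_measure_mul_two_pow_lt_measure
    (s := Set.pi Set.univ fun i => Set.Ioo (-t i) (t i))
    (ZSpan.isAddFundamentalDomain' b MeasureTheory.volume)
    (by
      intro x hx i hi
      have := hx i hi
      simp only [Set.mem_Ioo, Pi.neg_apply] at this ⊢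
      constructor <;> linarith [this.1, this.2])
    (convex_pi fun i _ => convex_Ioo _ _)
    (by
      rw [hvol, hmat, Real.volume_pi_Ioo, Module.finrank_pi,
        ← ENNReal.ofReal_prod_of_nonneg (fun i _ => by linarith [ht i])]
      have : ∏ i, (t i - -t i) = (∏ i, t i) * 2 ^ Fintype.card ι := by
        rw [Fintype.card, ← prod_const, ← prod_mul_distrib]
        exact prod_congr rfl fun i _ => by ring
      rw [this, ENNReal.ofReal_mul (prod_nonneg fun i _ => (ht i).le),
        ENNReal.ofReal_pow two_pos.le, ENNReal.ofReal_ofNat]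
      refine ENNReal.mul_lt_mul_left (by simp) (by simp) ?_
      exact (ENNReal.ofReal_lt_ofReal_iff_of_nonneg (abs_nonneg _)).2 h)
  have hmem : (x : ι → ℝ) ∈ Submodule.span ℤ (Set.range b) := x.2
  obtain ⟨c, hc⟩ := (Submodule.mem_span_range_iff_exists_fun ℤ).1 hmem
  refine ⟨c, ?_, fun i => ?_⟩
  · rintro rfl
    apply hx0
    ext1
    rw [← hc]; simp
  · have := hx i (Set.mem_univ i)
    have hval : N.mulVec (fun j => (c j : ℝ)) i = (x : ι → ℝ) i := by
      rw [← hc]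
      simp [mulVec, dotProduct, hb, Finset.sum_apply, mul_comm]
    rw [hval, abs_lt]
    exact this

/-- The real matrix `Re E + Im E` has the same absolute determinant as `E`, when complex
conjugation permutes the rows of `E`. -/
theorem abs_det_re_add_im {ι : Type*} [Fintype ι] [DecidableEq ι] (E : Matrix ι ι ℂ)
    (c : Perm ι) (hc : ∀ i j, E (c i) j = (starRingEnd ℂ) (E i j)) (hcc : ∀ i, c (c i) = i) :
    |(Matrix.of fun i j => (E i j).re + (E i j).im : Matrix ι ι ℝ).det| = ‖E.det‖ := by
  classical
  set U : Matrix ι ι ℝ := Matrix.of fun i j => (E i j).re + (E i j).im with hU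
  set M : Matrix ι ι ℂ := ((1 - Complex.I) / 2) • (1 : Matrix ι ι ℂ) +
    ((1 + Complex.I) / 2) • (Matrix.of fun i j => if j = c i then 1 else 0) with hM
  have hME : M * E = U.map (algebraMap ℝ ℂ) := by
    ext i j
    have hE : E i j = ((E i j).re : ℂ) + (E i j).im * Complex.I := (Complex.re_add_im _).symm
    rw [hM, Matrix.add_mul, Matrix.smul_mul, Matrix.one_mul, Matrix.smul_mul]
    simp only [Matrix.add_apply,
      Matrix.smul_apply, Matrix.mul_apply, Matrix.of_apply, ite_mul, one_mul, zero_mul,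
      sum_ite_eq', sum_ite_eq, mem_univ, if_true, hc, smul_eq_mul, hU, Matrix.map_apply]
    apply Complex.ext <;> simp <;> ring
  have hMM : M * M.conjTranspose = 1 := by
    have hP : (Matrix.of fun i j => if j = c i then (1 : ℂ) else 0 : Matrix ι ι ℂ).conjTranspose =
        Matrix.of fun i j => if j = c i then (1 : ℂ) else 0 := by
      ext i j
      simp only [Matrix.conjTranspose_apply, Matrix.of_apply]
      have : (i = c j) ↔ (j = c i) := by
        constructor <;> rintro rfl <;> rw [hcc]
      by_cases h : j = c i
      · rw [if_pos h, if_pos (this.2 h), star_one]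
      · rw [if_neg h, if_neg (fun h' => h (this.1 h')), star_zero]
    have hPP : (Matrix.of fun i j => if j = c i then (1 : ℂ) else 0 : Matrix ι ι ℂ) *
        (Matrix.of fun i j => if j = c i then (1 : ℂ) else 0) = 1 := by
      ext i j
      simp only [Matrix.mul_apply, Matrix.of_apply, ite_mul, one_mul, zero_mul,
        sum_ite_eq', sum_ite_eq, mem_univ, if_true, hcc, Matrix.one_apply, eq_comm]
    rw [hM, Matrix.conjTranspose_add, Matrix.conjTranspose_smul, Matrix.conjTranspose_smul, hP,
      Matrix.conjTranspose_one]
    simp only [Matrix.add_mul, Matrix.mul_add, Matrix.smul_mul, Matrix.mul_smul, hPP, Matrix.one_mul,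
      Matrix.mul_one, smul_smul]
    have e1 : (1 - Complex.I) / 2 * star ((1 - Complex.I) / 2) = 1 / 2 := by
      apply Complex.ext <;> simp <;> norm_num
    have e2 : (1 + Complex.I) / 2 * star ((1 + Complex.I) / 2) = 1 / 2 := by
      apply Complex.ext <;> simp <;> norm_num
    have e3 : (1 - Complex.I) / 2 * star ((1 + Complex.I) / 2) +
        (1 + Complex.I) / 2 * star ((1 - Complex.I) / 2) = 0 := by
      apply Complex.ext <;> simp <;> norm_num
    ext i j
    simp only [Matrix.add_apply, Matrix.smul_apply, smul_eq_mul]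
    linear_combination (Matrix.of fun i j => if j = c i then (1 : ℂ) else 0) i j * e3 +
      (1 : Matrix ι ι ℂ) i j * (e1 + e2)
  have hnM : ‖M.det‖ = 1 := by
    have := congrArg (fun A => ‖det A‖) hMM
    simp only [det_mul, Matrix.det_conjTranspose, norm_mul, norm_star, Matrix.det_one,
      norm_one] at this
    nlinarith [norm_nonneg M.det]
  have h := congrArg (fun A => ‖det A‖) hME
  simp only [det_mul, norm_mul, hnM, one_mul] at h
  rw [h, ← RingHom.mapMatrix_apply, ← RingHom.map_det]
  simp

section HartleyForms
open NumberField

/-- The real part plus the imaginary part of the image of an element under an embedding. -/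
noncomputable def hartley {K : Type*} [Field K] [NumberField K] (σ : K →ₐ[ℚ] ℂ) : K →+ ℝ where
  toFun x := (σ x).re + (σ x).im
  map_zero' := by simp
  map_add' x y := by simp only [map_add, Complex.add_re, Complex.add_im]; ring

theorem hartley_apply {K : Type*} [Field K] [NumberField K] (σ : K →ₐ[ℚ] ℂ) (x : K) :
    hartley σ x = (σ x).re + (σ x).im := rfl

/-- Complex conjugation on the embeddings of a number field. -/
noncomputable def conjEmb {K : Type*} [Field K] [NumberField K] (σ : K →ₐ[ℚ] ℂ) : K →ₐ[ℚ] ℂ :=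
  (Complex.conjAe.toAlgHom.restrictScalars ℚ).comp σ

theorem conjEmb_apply {K : Type*} [Field K] [NumberField K] (σ : K →ₐ[ℚ] ℂ) (x : K) :
    conjEmb σ x = (starRingEnd ℂ) (σ x) := rfl

theorem conjEmb_conjEmb {K : Type*} [Field K] [NumberField K] (σ : K →ₐ[ℚ] ℂ) :
    conjEmb (conjEmb σ) = σ := by
  ext x; simp [conjEmb_apply]

theorem norm_le_of_abs_hartley_le {K : Type*} [Field K] [NumberField K] {B : ℝ} {x : K}
    (h : ∀ σ : K →ₐ[ℚ] ℂ, |hartley σ x| ≤ B) (σ : K →ₐ[ℚ] ℂ) : ‖σ x‖ ≤ 2 * B := by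
  have h1 := h σ
  have h2 := h (conjEmb σ)
  rw [hartley_apply, abs_le] at h1 h2
  simp only [conjEmb_apply, Complex.conj_re, Complex.conj_im] at h2
  have hre : |(σ x).re| ≤ B := abs_le.2 ⟨by linarith [h1.1, h2.1], by linarith [h1.2, h2.2]⟩
  have him : |(σ x).im| ≤ B := abs_le.2 ⟨by linarith [h1.1, h2.2], by linarith [h1.2, h2.1]⟩
  linarith [Complex.norm_le_abs_re_add_abs_im (σ x)]

theorem norm_le_one_of_abs_hartley_lt {K : Type*} [Field K] [NumberField K] {x : K}
    (h : ∀ σ : K →ₐ[ℚ] ℂ, |hartley σ x| < 1) (σ : K →ₐ[ℚ] ℂ) : ‖σ x‖ < 1 := by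
  have h1 := sq_lt_sq' (by linarith [(abs_lt.1 (h σ)).1]) (abs_lt.1 (h σ)).2
  have h2 := sq_lt_sq' (by linarith [(abs_lt.1 (h (conjEmb σ))).1]) (abs_lt.1 (h (conjEmb σ))).2
  rw [hartley_apply] at h1 h2
  simp only [conjEmb_apply, Complex.conj_re, Complex.conj_im] at h2
  have h3 : ‖σ x‖ ^ 2 < 1 := by
    rw [Complex.sq_norm, Complex.normSq_apply]
    nlinarith
  nlinarith [norm_nonneg (σ x)]

theorem discr_eq_det_sq {K : Type*} [Field K] [NumberField K] {ι : Type*} [Fintype ι]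
    [DecidableEq ι] (ω : Module.Basis ι ℤ (𝓞 K)) (e : ι ≃ (K →ₐ[ℚ] ℂ)) :
    ((discr K : ℤ) : ℂ) = (Matrix.of fun i j => e i (ω j : K) : Matrix ι ι ℂ).det ^ 2 := by
  have h1 := Algebra.discr_localizationLocalization (Rₘ := ℚ) ℤ (nonZeroDivisors ℤ) K ω
  rw [discr_eq_discr] at h1
  have h2 := Algebra.discr_eq_det_embeddingsMatrixReindex_pow_two ℚ ℂ
    (ω.localizationLocalization ℚ (nonZeroDivisors ℤ) K) e
  rw [h1] at h2
  have : (Matrix.of fun i j => e i (ω j : K) : Matrix ι ι ℂ) =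
      (Algebra.embeddingsMatrixReindex ℚ ℂ (ω.localizationLocalization ℚ (nonZeroDivisors ℤ) K)
        e).transpose := by
    ext i j
    simp [Algebra.embeddingsMatrixReindex, Module.Basis.localizationLocalization_apply]
  rw [this, Matrix.det_transpose, ← h2]
  simp

theorem abs_discr_eq_det_hartley_sq {K : Type*} [Field K] [NumberField K] {ι : Type*} [Fintype ι]
    [DecidableEq ι] (ω : Module.Basis ι ℤ (𝓞 K)) (e : ι ≃ (K →ₐ[ℚ] ℂ)) :
    |(discr K : ℝ)| = (Matrix.of fun i j => hartley (e i) (ω j : K) : Matrix ι ι ℝ).det ^ 2 := by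
  have h1 := abs_det_re_add_im (Matrix.of fun i j => e i (ω j : K))
    ⟨fun i => e.symm (conjEmb (e i)), fun i => e.symm (conjEmb (e i)),
      fun i => by simp [conjEmb_conjEmb], fun i => by simp [conjEmb_conjEmb]⟩
    (fun i j => by simp [conjEmb_apply]) (fun i => by simp [conjEmb_conjEmb])
  have h2 := congrArg norm (discr_eq_det_sq ω e)
  rw [norm_pow, ← h1, sq_abs, Complex.norm_intCast] at h2
  exact h2

open Classical in
theorem sum_embeddings_over {k K : Type*} [Field k] [NumberField k] [Field K] [NumberField K]
    [Algebra k K] (τ : k →ₐ[ℚ] ℂ) (x : K) :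
    τ (Algebra.trace k K x) =
      ∑ σ : K →ₐ[ℚ] ℂ with σ.comp (IsScalarTower.toAlgHom ℚ k K) = τ, σ x := by
  let _ : Algebra k ℂ := τ.toRingHom.toAlgebra
  have h : τ (Algebra.trace k K x) = ∑ σ : K →ₐ[k] ℂ, σ x := trace_eq_sum_embeddings ℂ
  rw [h]
  refine Finset.sum_bij (fun σ _ => σ.restrictScalars ℚ) ?_ ?_ ?_ ?_
  · intro σ _
    simp only [mem_filter, mem_univ, true_and]
    ext y
    exact σ.commutes y
  · intro σ _ σ' _ h
    ext y
    exact DFunLike.congr_fun h y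
  · intro σ hσ
    simp only [mem_filter, mem_univ, true_and] at hσ
    exact ⟨{ σ with commutes' := fun y => DFunLike.congr_fun hσ y }, mem_univ _, rfl⟩
  · intro σ _
    rfl

open Classical in
theorem hartley_trace {k K : Type*} [Field k] [NumberField k] [Field K] [NumberField K]
    [Algebra k K] (τ : k →ₐ[ℚ] ℂ) (x : K) :
    hartley τ (Algebra.trace k K x) =
      ∑ σ : K →ₐ[ℚ] ℂ with σ.comp (IsScalarTower.toAlgHom ℚ k K) = τ, hartley σ x := by
  rw [hartley_apply, sum_embeddings_over, Complex.re_sum, Complex.im_sum, ← sum_add_distrib]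
  rfl

theorem exists_embedding_over {k K : Type*} [Field k] [NumberField k] [Field K] [NumberField K]
    [Algebra k K] (τ : k →ₐ[ℚ] ℂ) :
    ∃ σ : K →ₐ[ℚ] ℂ, σ.comp (IsScalarTower.toAlgHom ℚ k K) = τ := by
  let _ : Algebra k ℂ := τ.toRingHom.toAlgebra
  let σ : K →ₐ[k] ℂ := IsAlgClosed.lift
  exact ⟨σ.restrictScalars ℚ, by ext y; exact σ.commutes y⟩

end HartleyForms

section RelativeMinkowski
open NumberField

/-- A number field has small algebraic integers of relative trace zero. -/
theorem exists_small_trace_zero (k K : Type*) [Field k] [NumberField k] [Field K] [NumberField K]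
    [Algebra k K] (s : ℝ) (hs : 0 < s)
    (h : |(discr K : ℝ)| < |(discr k : ℝ)| * s ^ (2 * (finrank ℚ K - finrank ℚ k))) :
    ∃ α : 𝓞 K, α ≠ 0 ∧ Algebra.trace k K (α : K) = 0 ∧
      ∀ σ : K →ₐ[ℚ] ℂ, ‖σ α‖ ≤ 2 * (finrank ℚ K * s) := by
  classical
  let ρ : (K →ₐ[ℚ] ℂ) → (k →ₐ[ℚ] ℂ) := fun σ => σ.comp (IsScalarTower.toAlgHom ℚ k K)
  choose sec hsec using fun τ : k →ₐ[ℚ] ℂ => exists_embedding_over (K := K) τ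
  have hρ : ∀ τ, ρ (sec τ) = τ := hsec
  let κ := {σ : K →ₐ[ℚ] ℂ // σ ≠ sec (ρ σ)}
  let e : (k →ₐ[ℚ] ℂ) ⊕ κ ≃ (K →ₐ[ℚ] ℂ) := Equiv.ofBijective (Sum.elim sec Subtype.val) (by
    constructor
    · rintro (a | a) (b | b) hab
      · have := congrArg ρ hab
        simp only [Sum.elim_inl, hρ] at this
        rw [this]
      · simp only [Sum.elim_inl, Sum.elim_inr] at hab
        exact absurd (by rw [← hab, hρ]) b.2
      · simp only [Sum.elim_inl, Sum.elim_inr] at hab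
        exact absurd (by rw [hab, hρ]) a.2
      · exact congrArg Sum.inr (Subtype.ext hab)
    · intro σ
      by_cases hσ : σ = sec (ρ σ)
      · exact ⟨Sum.inl (ρ σ), hσ.symm⟩
      · exact ⟨Sum.inr ⟨σ, hσ⟩, rfl⟩)
  have hcardK : Fintype.card (K →ₐ[ℚ] ℂ) = finrank ℚ K := AlgHom.card ℚ K ℂ
  have hcardk : Fintype.card (k →ₐ[ℚ] ℂ) = finrank ℚ k := AlgHom.card ℚ k ℂ
  have hcard : finrank ℚ k + Fintype.card κ = finrank ℚ K := by
    rw [← hcardK, ← hcardk, ← card_sum]; exact Fintype.card_congr e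
  have hbK : Fintype.card (Module.Free.ChooseBasisIndex ℤ (𝓞 K)) =
      Fintype.card ((k →ₐ[ℚ] ℂ) ⊕ κ) := by
    rw [← Module.finrank_eq_card_chooseBasisIndex, RingOfIntegers.rank, card_sum, hcardk,
      hcard]
  have hbk : Fintype.card (Module.Free.ChooseBasisIndex ℤ (𝓞 k)) =
      Fintype.card (k →ₐ[ℚ] ℂ) := by
    rw [← Module.finrank_eq_card_chooseBasisIndex, RingOfIntegers.rank, hcardk]
  let ω := (RingOfIntegers.basis K).reindex (equivOfCardEq hbK)
  let η := (RingOfIntegers.basis k).reindex (equivOfCardEq hbk)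
  let U : Matrix ((k →ₐ[ℚ] ℂ) ⊕ κ) ((k →ₐ[ℚ] ℂ) ⊕ κ) ℝ :=
    Matrix.of fun i j => hartley (e i) (ω j : K)
  let F : Matrix (k →ₐ[ℚ] ℂ) (k →ₐ[ℚ] ℂ) ℝ := Matrix.of fun i j => hartley i (η j : k)
  have hU : |(discr K : ℝ)| = U.det ^ 2 := abs_discr_eq_det_hartley_sq ω e
  have hF : |(discr k : ℝ)| = F.det ^ 2 := abs_discr_eq_det_hartley_sq η (Equiv.refl _)
  let tr := Algebra.intTrace (𝓞 k) (𝓞 K)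
  have htr : ∀ x : 𝓞 K, ((tr x : 𝓞 k) : k) = Algebra.trace k K (x : K) := fun x =>
    Algebra.algebraMap_intTrace _
  let N : Matrix ((k →ₐ[ℚ] ℂ) ⊕ κ) ((k →ₐ[ℚ] ℂ) ⊕ κ) ℝ :=
    Matrix.of fun i j => Sum.elim (fun τ => ((η.repr (tr (ω j)) τ : ℤ) : ℝ)) (fun σ => U (Sum.inr σ) j) i
  let Q : Matrix (k →ₐ[ℚ] ℂ) κ ℝ := Matrix.of fun τ σ => if ρ σ.1 = τ then 1 else 0
  have hsum : ∀ (τ : k →ₐ[ℚ] ℂ) (x : K), hartley τ (Algebra.trace k K x) =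
      hartley (sec τ) x + ∑ σ : κ, if ρ σ.1 = τ then hartley σ.1 x else 0 := by
    intro τ x
    rw [hartley_trace, Finset.sum_filter, ← e.sum_comp, sum_sum_type]
    congr 1
    have : ∀ a : k →ₐ[ℚ] ℂ, (e (Sum.inl a)).comp (IsScalarTower.toAlgHom ℚ k K) = a := hρ
    simp only [this, sum_ite_eq', mem_univ, if_true]
    rfl
  have hmat : fromBlocks F 0 0 1 * N = fromBlocks 1 Q 0 1 * U := by
    ext i j
    rcases i with τ | σ
    · simp only [Matrix.mul_apply, sum_sum_type, Matrix.fromBlocks_apply₁₁,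
        Matrix.fromBlocks_apply₁₂, Matrix.zero_apply, zero_mul, Finset.sum_const_zero, add_zero,
        Matrix.one_apply, ite_mul, one_mul, sum_ite_eq, mem_univ, if_true]
      have h1 := hsum τ (ω j : K)
      rw [← htr] at h1
      have h2 : ((tr (ω j) : 𝓞 k) : k) = ∑ τ', ((η.repr (tr (ω j)) τ' : ℤ) : k) * (η τ' : k) := by
        conv_lhs => rw [← η.sum_repr (tr (ω j))]
        simp [zsmul_eq_mul]
      have h3 : hartley τ ((tr (ω j) : 𝓞 k) : k) =
          ∑ τ', F τ τ' * ((η.repr (tr (ω j)) τ' : ℤ) : ℝ) := by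
        rw [h2, map_sum]
        refine sum_congr rfl fun τ' _ => ?_
        rw [← zsmul_eq_mul, map_zsmul, zsmul_eq_mul, mul_comm]; rfl
      rw [h3] at h1
      refine h1.trans ?_
      congr 1
      refine sum_congr rfl fun σ _ => ?_
      simp only [Q, Matrix.of_apply, ite_mul, one_mul, zero_mul]
      rfl
    · simp [Matrix.mul_apply, sum_sum_type, Matrix.one_apply, N]
  have hdet : F.det * N.det = U.det := by
    have := congrArg det hmat
    simpa [det_mul, Matrix.det_fromBlocks_zero₂₁] using this
  have hU0 : U.det ≠ 0 := by
    intro h0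
    rw [h0] at hU
    exact discr_ne_zero K (by simpa using hU)
  have hN0 : N.det ≠ 0 := fun h0 => hU0 (by rw [← hdet, h0, mul_zero])
  have hF0 : 0 < F.det ^ 2 := by
    have : F.det ≠ 0 := fun h0 => hU0 (by rw [← hdet, h0, zero_mul])
    positivity
  obtain ⟨x, hx0, hx⟩ := exists_int_vec_forms_lt N hN0 (Sum.elim (fun _ => 1) (fun _ => s))
    (by rintro (_ | _) <;> simp [hs]) (by
      rw [Fintype.prod_sum_type]
      simp only [Sum.elim_inl, Sum.elim_inr, Finset.prod_const_one, one_mul, prod_const,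
        card_univ]
      rw [show finrank ℚ K - finrank ℚ k = Fintype.card κ by omega, hU, hF, ← hdet,
        mul_pow] at h
      have := lt_of_mul_lt_mul_left h hF0.le
      rw [mul_comm 2, pow_mul] at this
      exact abs_lt_of_sq_lt_sq this (by positivity))
  let α : 𝓞 K := ∑ j, x j • ω j
  have hα : ω.repr α = Finsupp.equivFunOnFinite.symm x := by
    ext j
    exact congrFun (ω.repr_sum_self x) j
  have htrα : tr α = 0 := by
    apply η.repr.injective
    ext τ
    have h1 := hx (Sum.inl τ)
    have h2 : N.mulVec (fun j => (x j : ℝ)) (Sum.inl τ) = ((η.repr (tr α) τ : ℤ) : ℝ) := by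
      have : tr α = ∑ j, x j • tr (ω j) := by
        simp only [α, map_sum, map_zsmul]
      rw [this, map_sum, Finsupp.finsetSum_apply]
      push_cast
      refine sum_congr rfl fun j _ => ?_
      rw [map_zsmul, Finsupp.smul_apply, smul_eq_mul, Int.cast_mul, mul_comm]
      rfl
    rw [h2] at h1
    simp only [Sum.elim_inl] at h1
    have h4 : |η.repr (tr α) τ| < 1 := by exact_mod_cast h1
    simpa using Int.abs_lt_one_iff.1 h4
  have htr0 : Algebra.trace k K (α : K) = 0 := by rw [← htr, htrα]; simp
  have hsmall : ∀ σ : κ, |hartley σ.1 (α : K)| < s := by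
    intro σ
    have h1 := hx (Sum.inr σ)
    have h2 : N.mulVec (fun j => (x j : ℝ)) (Sum.inr σ) = hartley σ.1 (α : K) := by
      have : (α : K) = ∑ j, x j • (ω j : K) := by simp [α]
      rw [this, map_sum]
      simp only [mulVec, dotProduct, N, Matrix.of_apply, Sum.elim_inr, U]
      refine sum_congr rfl fun j _ => ?_
      rw [map_zsmul, zsmul_eq_mul, mul_comm]; rfl
    rwa [h2] at h1
  have hn1 : (1 : ℝ) ≤ finrank ℚ K := by
    exact_mod_cast finrank_pos
  have hall : ∀ σ : K →ₐ[ℚ] ℂ, |hartley σ (α : K)| ≤ finrank ℚ K * s := by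
    intro σ
    obtain ⟨i, rfl⟩ := e.surjective σ
    rcases i with τ | σ
    · have h1 := hsum τ (α : K)
      rw [htr0, map_zero] at h1
      have h2 : hartley (sec τ) (α : K) = -∑ σ : κ, if ρ σ.1 = τ then hartley σ.1 (α : K) else 0 := by
        linarith
      change |hartley (sec τ) (α : K)| ≤ _
      rw [h2, abs_neg]
      refine (abs_sum_le_sum_abs _ _).trans ?_
      refine (sum_le_card_nsmul _ _ s fun σ _ => ?_).trans ?_
      · split_ifs
        · exact (hsmall σ).le
        · simpa using hs.le
      · rw [nsmul_eq_mul, card_univ]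
        have : (Fintype.card κ : ℝ) ≤ finrank ℚ K := by
          exact_mod_cast (by omega : Fintype.card κ ≤ finrank ℚ K)
        gcongr
    · refine (hsmall σ).le.trans ?_
      nlinarith
  refine ⟨α, ?_, htr0, norm_le_of_abs_hartley_le hall⟩
  intro h0
  apply hx0
  rw [h0, map_zero] at hα
  ext j
  exact (DFunLike.congr_fun hα j).symm

end RelativeMinkowski

section BoxCount
open NumberField

theorem eq_zero_of_forall_norm_lt_one {k : Type*} [Field k] [NumberField k] (c : 𝓞 k)
    (h : ∀ τ : k →ₐ[ℚ] ℂ, ‖τ c‖ < 1) : c = 0 := by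
  classical
  by_contra hc
  have h1 := Algebra.norm_eq_prod_embeddings ℚ ℂ (c : k)
  have h2 : ‖algebraMap ℚ ℂ (Algebra.norm ℚ (c : k))‖ < 1 := by
    rw [h1, norm_prod]
    obtain ⟨τ₀⟩ : Nonempty (k →ₐ[ℚ] ℂ) := ⟨IsAlgClosed.lift⟩
    rw [← mul_prod_erase _ _ (mem_univ τ₀)]
    exact (mul_le_of_le_one_right (norm_nonneg _) (Finset.prod_le_one (fun _ _ => norm_nonneg _)
      fun τ _ => (h τ).le)).trans_lt (h τ₀)
  rw [← Algebra.coe_norm_int] at h2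
  have h3 : |Algebra.norm ℤ c| < 1 := by
    have : ‖((Algebra.norm ℤ c : ℤ) : ℂ)‖ < 1 := by simpa using h2
    rw [Complex.norm_intCast] at this
    exact_mod_cast this
  exact hc (Algebra.norm_eq_zero_iff.1 (Int.abs_lt_one_iff.1 h3))

/-- Counting algebraic integers whose conjugates are bounded. -/
theorem card_integers_le {k : Type*} [Field k] [NumberField k] (Y : ℝ) (hY : 1 ≤ Y)
    (S : Finset (𝓞 k)) (hS : ∀ c ∈ S, ∀ τ : k →ₐ[ℚ] ℂ, ‖τ c‖ ≤ Y) :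
    (S.card : ℝ) ≤ (7 * Y) ^ finrank ℚ k := by
  classical
  let g : 𝓞 k → ((k →ₐ[ℚ] ℂ) → ℤ) := fun c τ => ⌊hartley τ (c : k)⌋
  have hg : InjOn g S := by
    intro c _ c' _ hcc
    rw [← sub_eq_zero]
    apply eq_zero_of_forall_norm_lt_one
    have : ∀ τ : k →ₐ[ℚ] ℂ, |hartley τ ((c - c' : 𝓞 k) : k)| < 1 := by
      intro τ
      rw [show ((c - c' : 𝓞 k) : k) = (c : k) - c' from rfl, map_sub]
      exact Int.abs_sub_lt_one_of_floor_eq_floor (congrFun hcc τ)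
    exact norm_le_one_of_abs_hartley_lt this
  have hmaps : Set.MapsTo g S
      (piFinset fun _ : k →ₐ[ℚ] ℂ => Icc ⌊-(2 * Y)⌋ ⌊2 * Y⌋ : Finset _) := by
    intro c hc
    simp only [mem_coe, mem_piFinset, mem_Icc, g]
    intro τ
    have h1 := (Complex.abs_re_le_norm (τ c)).trans (hS c hc τ)
    have h2 := (Complex.abs_im_le_norm (τ c)).trans (hS c hc τ)
    rw [abs_le] at h1 h2
    rw [hartley_apply]
    exact ⟨Int.floor_le_floor (by linarith [h1.1, h2.1]), Int.floor_le_floor (by linarith [h1.2, h2.2])⟩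
  have hcard := card_le_card_of_injOn g hmaps hg
  rw [card_piFinset, prod_const, card_univ, AlgHom.card ℚ k ℂ,
    card_Icc] at hcard
  calc (S.card : ℝ) ≤ (((⌊2 * Y⌋ + 1 - ⌊-(2 * Y)⌋).toNat ^ finrank ℚ k : ℕ) : ℝ) := by
        exact_mod_cast hcard
    _ ≤ _ := by
        push_cast
        refine pow_le_pow_left₀ (by positivity) ?_ _
        have h1 := Int.floor_le (2 * Y)
        have h2 := Int.sub_one_lt_floor (-(2 * Y))
        have h3 : ((⌊2 * Y⌋ + 1 - ⌊-(2 * Y)⌋).toNat : ℤ) = ⌊2 * Y⌋ + 1 - ⌊-(2 * Y)⌋ := by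
          refine Int.toNat_of_nonneg ?_
          have : ⌊-(2 * Y)⌋ ≤ ⌊2 * Y⌋ := Int.floor_le_floor (by linarith)
          omega
        have h4 : ((⌊2 * Y⌋ + 1 - ⌊-(2 * Y)⌋).toNat : ℝ) = ⌊2 * Y⌋ + 1 - ⌊-(2 * Y)⌋ := by
          exact_mod_cast h3
        rw [h4]
        linarith

/-- Partial summation in dyadic form. -/
theorem sum_rpow_neg_le {ι : Type*} (β ε C : ℝ) (hβ : 0 ≤ β) (hε : 0 < ε) (hC : 0 ≤ C)
    (S : Finset ι) (δ : ι → ℕ) (hδ : ∀ i ∈ S, 1 ≤ δ i)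
    (hcount : ∀ D : ℕ, 1 ≤ D → (((S.filter fun i => δ i ≤ D).card : ℕ) : ℝ) ≤ C * (D : ℝ) ^ β) :
    ∑ i ∈ S, (δ i : ℝ) ^ (-(β + ε)) ≤ C * 2 ^ β * (1 - (2 : ℝ) ^ (-ε))⁻¹ := by
  classical
  set r : ℝ := (2 : ℝ) ^ (-ε) with hr
  have hr0 : 0 < r := by positivity
  have hr1 : r < 1 := Real.rpow_lt_one_of_one_lt_of_neg (by norm_num) (by linarith)
  set J := S.image fun i => Nat.log 2 (δ i)
  have hfib : ∀ j ∈ J, ∑ i ∈ S with Nat.log 2 (δ i) = j, (δ i : ℝ) ^ (-(β + ε)) ≤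
      C * 2 ^ β * r ^ j := by
    intro j _
    have h1 : ∀ i ∈ S.filter (fun i => Nat.log 2 (δ i) = j),
        (δ i : ℝ) ^ (-(β + ε)) ≤ ((2 : ℝ) ^ j) ^ (-(β + ε)) := by
      intro i hi
      simp only [mem_filter] at hi
      refine Real.rpow_le_rpow_of_nonpos (by positivity) ?_ (by linarith)
      have := Nat.pow_log_le_self 2 (x := δ i) (by have := hδ i hi.1; omega)
      rw [hi.2] at this
      exact_mod_cast this
    refine (sum_le_card_nsmul _ _ _ h1).trans ?_
    rw [nsmul_eq_mul]
    have h2 : ((S.filter (fun i => Nat.log 2 (δ i) = j)).card : ℝ) ≤ C * ((2 : ℝ) ^ (j + 1)) ^ β := by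
      refine le_trans ?_ ((hcount (2 ^ (j + 1)) Nat.one_le_two_pow).trans (by push_cast; rfl))
      gcongr with i _ hi
      intro hi'
      have := Nat.lt_pow_succ_log_self (b := 2) (by norm_num) (δ i)
      rw [hi'] at this
      exact this.le
    refine (mul_le_mul_of_nonneg_right h2 (by positivity)).trans (le_of_eq ?_)
    rw [hr, ← rpow_natCast, ← rpow_natCast, ← rpow_natCast, ← rpow_mul two_pos.le,
      ← rpow_mul two_pos.le, ← rpow_mul two_pos.le, mul_assoc, mul_assoc,
      ← rpow_add two_pos, ← rpow_add two_pos]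
    congr 2
    push_cast; ring
  rw [← Finset.sum_fiberwise_of_maps_to (t := J) (g := fun i => Nat.log 2 (δ i))
    (fun i hi => mem_image_of_mem _ hi)]
  refine (sum_le_sum hfib).trans ?_
  rw [← mul_sum]
  refine mul_le_mul_of_nonneg_left ?_ (by positivity)
  rw [← tsum_geometric_of_lt_one hr0.le hr1]
  exact (summable_geometric_of_lt_one hr0.le hr1).sum_le_tsum _ fun _ _ => by positivity

end BoxCount

section RelativeCount
open NumberField

theorem fieldDiscr_eq (K : IntermediateField ℚ Qbar) [NumberField K] : fieldDiscr K = discr K := by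
  rw [fieldDiscr, dif_pos (inferInstance : FiniteDimensional ℚ K)]

instance isAlgebraic_Qbar : Algebra.IsAlgebraic ℚ Qbar := AlgebraicClosure.isAlgebraic ℚ

instance isAlgebraic_intermediateField_Qbar (k : IntermediateField ℚ Qbar) :
    Algebra.IsAlgebraic k Qbar := Algebra.IsAlgebraic.tower_top (K := ℚ) k

theorem norm_coeff_minpoly_le (k : IntermediateField ℚ Qbar) (α : Qbar) {B : ℝ}
    (hB : ∀ σ : Qbar →ₐ[ℚ] ℂ, ‖σ α‖ ≤ B) (τ : k →ₐ[ℚ] ℂ) (i : ℕ) :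
    ‖τ ((minpoly k α).coeff i)‖ ≤
      B ^ ((minpoly k α).natDegree - i) * (minpoly k α).natDegree.choose i := by
  have : IsAlgClosure k Qbar := ⟨inferInstance, inferInstance⟩
  have := IsAlgClosure.normal k Qbar
  have hα : IsIntegral k α := Algebra.IsIntegral.isIntegral α
  let _ : Algebra k ℂ := τ.toRingHom.toAlgebra
  let σ : Qbar →ₐ[k] ℂ := IsAlgClosed.lift
  have hστ : (τ : k →+* ℂ) = (σ : Qbar →+* ℂ).comp (algebraMap k Qbar) :=
    RingHom.ext fun y => (σ.commutes y).symm
  have hs := splits ((minpoly k α).map (algebraMap k Qbar))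
  have h := coeff_le_of_roots_le (p := minpoly k α) (f := (τ : k →+* ℂ)) (B := B) i
    (minpoly.monic hα) (splits _) (by
      rw [hστ, ← Polynomial.map_map, hs.roots_map]
      intro z hz
      obtain ⟨β, hβ, rfl⟩ := mem_map.1 hz
      have h0 : aeval β (minpoly k α) = 0 := by
        rw [aeval_def, eval₂_eq_eval_map]
        exact (mem_roots'.1 hβ).2
      obtain ⟨g, rfl⟩ := minpoly.exists_algEquiv_of_root' (Algebra.IsAlgebraic.isAlgebraic α) h0
      exact hB ((σ.comp (g : Qbar →ₐ[k] Qbar)).restrictScalars ℚ))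
  rwa [coeff_map] at h

/-- Counting simple extensions of a number field by generators of bounded height and trace zero. -/
theorem card_simple_extensions_le (k : IntermediateField ℚ Qbar) [NumberField k] (l : ℕ) (hl : 2 ≤ l)
    (B : ℝ) (hB : 1 ≤ B) (S : Finset (IntermediateField ℚ Qbar))
    (hS : ∀ K ∈ S, ∃ α : Qbar, IsIntegral ℤ α ∧
      (adjoin k {α}).restrictScalars ℚ = K ∧ (minpoly k α).natDegree = l ∧
      (minpoly k α).nextCoeff = 0 ∧ ∀ σ : Qbar →ₐ[ℚ] ℂ, ‖σ α‖ ≤ B) :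
    (S.card : ℝ) ≤ l * ∏ i ∈ range (l - 1), (7 * (2 ^ l * B ^ (l - i))) ^ finrank ℚ k := by
  classical
  choose! α hint hadj hdeg hnext hbd using hS
  have hcoef : ∀ K ∈ S, ∀ i, IsIntegral ℤ ((minpoly k (α K)).coeff i) := by
    intro K hK i
    have h1 := minpoly.isIntegrallyClosed_eq_field_fractions' k ((hint K hK).tower_top (A := 𝓞 k))
    rw [h1, coeff_map]
    exact RingOfIntegers.isIntegral_coe _
  have hex : ∀ (K : IntermediateField ℚ Qbar) (i : Fin (l - 1)), ∃ x : 𝓞 k, K ∈ S →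
      (x : k) = (minpoly k (α K)).coeff i := fun K i => by
    by_cases hK : K ∈ S
    · obtain ⟨x, hx⟩ := IsIntegralClosure.isIntegral_iff (A := 𝓞 k).1 (hcoef K hK i)
      exact ⟨x, fun _ => hx⟩
    · exact ⟨0, fun h => absurd h hK⟩
  choose c hc' using hex
  have hc : ∀ K ∈ S, ∀ i, (c K i : k) = (minpoly k (α K)).coeff i := fun K hK i => hc' K i hK
  have hmin : ∀ K ∈ S, ∀ K' ∈ S, c K = c K' → minpoly k (α K) = minpoly k (α K') := by
    intro K hK K' hK' hcc
    have hm := minpoly.monic ((hint K hK).tower_top (A := k))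
    have hm' := minpoly.monic ((hint K' hK').tower_top (A := k))
    ext i : 1
    rcases lt_trichotomy i (l - 1) with hi | hi | hi
    · rw [← hc K hK ⟨i, hi⟩, ← hc K' hK' ⟨i, hi⟩, hcc]
    · have e := hnext K hK
      have e' := hnext K' hK'
      rw [nextCoeff_of_natDegree_pos (by rw [hdeg K hK]; omega), hdeg K hK] at e
      rw [nextCoeff_of_natDegree_pos (by rw [hdeg K' hK']; omega), hdeg K' hK'] at e'
      rw [hi, e, e']
    · rcases eq_or_lt_of_le (show l ≤ i by omega) with rfl | hi'
      · have e := hm.coeff_natDegree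
        have e' := hm'.coeff_natDegree
        rw [hdeg K hK] at e
        rw [hdeg K' hK'] at e'
        rw [e, e']
      · rw [coeff_eq_zero_of_natDegree_lt (by rw [hdeg K hK]; exact hi'),
          coeff_eq_zero_of_natDegree_lt (by rw [hdeg K' hK']; exact hi')]
  have h1 : S.card ≤ l * (S.image c).card := by
    refine card_le_mul_card_image S l fun b hb => ?_
    obtain ⟨K₀, hK₀, rfl⟩ := mem_image.1 hb
    have hm := minpoly.monic ((hint K₀ hK₀).tower_top (A := k))
    calc _ ≤ ((minpoly k (α K₀)).aroots Qbar).toFinset.card := by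
          refine card_le_card_of_injOn α (fun K hK => ?_) fun K hK K' hK' hαα => ?_
          · obtain ⟨hK, hcK⟩ := mem_filter.1 hK
            rw [mem_coe, mem_toFinset, mem_aroots]
            refine ⟨hm.ne_zero, ?_⟩
            rw [← hmin K hK K₀ hK₀ hcK]
            exact minpoly.aeval _ _
          · rw [← hadj K (mem_filter.1 hK).1, ← hadj K' (mem_filter.1 hK').1, hαα]
      _ ≤ Multiset.card ((minpoly k (α K₀)).aroots Qbar) := toFinset_card_le _
      _ ≤ l := by
        refine (card_roots' _).trans (natDegree_map_le.trans (hdeg K₀ hK₀).le)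
  have h2 : (S.image c).card ≤ ∏ i : Fin (l - 1), (S.image fun K => c K i).card := by
    rw [← card_piFinset]
    refine card_le_card fun b hb => ?_
    obtain ⟨K, hK, rfl⟩ := mem_image.1 hb
    exact mem_piFinset.2 fun i => mem_image_of_mem _ hK
  have h3 : ∀ i : Fin (l - 1), ((S.image fun K => c K i).card : ℝ) ≤
      (7 * (2 ^ l * B ^ (l - i))) ^ finrank ℚ k := by
    intro i
    refine card_integers_le _ (one_le_mul_of_one_le_of_one_le (one_le_pow₀ (by norm_num))
      (one_le_pow₀ hB)) _ fun x hx τ => ?_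
    obtain ⟨K, hK, rfl⟩ := mem_image.1 hx
    rw [hc K hK i]
    refine (norm_coeff_minpoly_le k (α K) (hbd K hK) τ i).trans ?_
    rw [hdeg K hK, mul_comm]
    refine mul_le_mul_of_nonneg_right ?_ (by positivity)
    exact_mod_cast Nat.choose_le_two_pow _ _
  calc (S.card : ℝ) ≤ l * ∏ i : Fin (l - 1), ((S.image fun K => c K i).card : ℝ) := by
        exact_mod_cast h1.trans (Nat.mul_le_mul_left _ h2)
    _ ≤ l * ∏ i : Fin (l - 1), (7 * (2 ^ l * B ^ (l - i))) ^ finrank ℚ k := by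
        gcongr with i _
        exact h3 i
    _ = _ := by rw [Finset.prod_range]

end RelativeCount

section Covers
open NumberField

theorem exists_generator_of_covBy (k K : IntermediateField ℚ Qbar) [NumberField k] [NumberField K]
    (hkK : k ⋖ K) (s : ℝ) (hs : 0 < s)
    (h : |(discr K : ℝ)| < |(discr k : ℝ)| * s ^ (2 * (finrank ℚ K - finrank ℚ k))) :
    ∃ α : Qbar, IsIntegral ℤ α ∧ (adjoin k {α}).restrictScalars ℚ = K ∧
      finrank ℚ k * (minpoly k α).natDegree = finrank ℚ K ∧
      (minpoly k α).nextCoeff = 0 ∧ ∀ σ : Qbar →ₐ[ℚ] ℂ, ‖σ α‖ ≤ 2 * (finrank ℚ K * s) := by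
  let _ : Algebra k K := (inclusion hkK.le).toAlgebra
  have : IsScalarTower k K Qbar := IsScalarTower.of_algebraMap_eq fun x => rfl
  have : IsScalarTower ℚ k K := IsScalarTower.of_algebraMap_eq fun x => rfl
  obtain ⟨α, h0, htr, hbd⟩ := exists_small_trace_zero k K s hs h
  have hfin : FiniteDimensional k K := FiniteDimensional.right ℚ k K
  have hαk : ((α : K) : Qbar) ∉ k := fun hmem => by
    have e : (α : K) = algebraMap k K ⟨_, hmem⟩ := Subtype.ext rfl
    rw [e, Algebra.trace_algebraMap, smul_eq_zero] at htr
    rcases htr with h1 | h1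
    · exact absurd h1 finrank_pos.ne'
    · rw [h1, map_zero] at e
      exact h0 (RingOfIntegers.ext e)
  have hadj : (adjoin k {((α : K) : Qbar)}).restrictScalars ℚ = K := by
    have hle : (adjoin k {((α : K) : Qbar)}).restrictScalars ℚ ≤ K := by
      have : adjoin k {((α : K) : Qbar)} ≤
          extendScalars hkK.le := by
        rw [adjoin_simple_le_iff]
        exact (α : K).2
      exact this
    have hge : k ≤ (adjoin k {((α : K) : Qbar)}).restrictScalars ℚ := fun x hx =>
      (adjoin k {((α : K) : Qbar)}).algebraMap_mem ⟨x, hx⟩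
    rcases hkK.eq_or_eq hge hle with h1 | h1
    · refine absurd ?_ hαk
      rw [← h1]
      exact mem_adjoin_simple_self k _
    · exact h1
  have hmin : minpoly k ((α : K) : Qbar) = minpoly k (α : K) :=
    minpoly.algebraMap_eq (algebraMap K Qbar).injective (α : K)
  refine ⟨(α : K), α.isIntegral_coe.algebraMap, hadj, ?_, ?_, fun σ => ?_⟩
  · have hi : IsIntegral k ((α : K) : Qbar) := Algebra.IsIntegral.isIntegral _
    rw [← adjoin.finrank hi]
    have := finrank_mul_finrank ℚ k (adjoin k {((α : K) : Qbar)})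
    rw [this]
    conv_rhs => rw [← hadj]
    rfl
  · rw [hmin]
    have := _root_.trace_eq_finrank_mul_minpoly_nextCoeff k (α : K)
    rw [htr, eq_comm, mul_eq_zero, neg_eq_zero] at this
    refine this.resolve_left ?_
    have : FiniteDimensional (adjoin k {(α : K)}) K := IntermediateField.finiteDimensional_right _
    exact_mod_cast finrank_pos.ne'
  · exact hbd (σ.comp K.val)

theorem discr_pow_le_of_le (k K : IntermediateField ℚ Qbar) [NumberField k] [NumberField K]
    (hkK : k ≤ K) : |(discr k : ℝ)| ≤ |(discr K : ℝ)| := by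
  let _ : Algebra k K := (inclusion hkK).toAlgebra
  have h := discr_dvd_discr k K
  have := Int.le_of_dvd (abs_pos.2 (discr_ne_zero K)) ((abs_dvd_abs _ _).2 h)
  exact_mod_cast this

theorem one_le_abs_discr (K : Type*) [Field K] [NumberField K] : (1 : ℝ) ≤ |(discr K : ℝ)| := by
  exact_mod_cast one_le_abs (discr_ne_zero K)

/-- Counting the minimal overfields of given degree of a number field. -/
theorem card_covers_le (m l : ℕ) (hm : 1 ≤ m) (hl : 2 ≤ l) : ∃ C : ℝ, 0 < C ∧
    ∀ (k : IntermediateField ℚ Qbar) [NumberField k], finrank ℚ k = m →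
    ∀ (X : ℝ), 0 ≤ X → ∀ S : Finset (IntermediateField ℚ Qbar),
      (∀ K ∈ S, k ⋖ K ∧ finrank ℚ K = m * l ∧ |(fieldDiscr K : ℝ)| ≤ X) →
      (S.card : ℝ) ≤ C * (X / |(discr k : ℝ)|) ^ (((l : ℝ) + 2) / 4) := by
  refine ⟨l * ((7 * 2 ^ l) ^ m) ^ (l - 1) * ((2 * (m * l : ℝ)) ^ ((((l : ℝ) + 2) / 2) * (m * (l - 1))) * 2 ^ (((l : ℝ) + 2) / 4)),
    by positivity, fun k _ hk X hX S hS => ?_⟩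
  rcases S.eq_empty_or_nonempty with rfl | ⟨K₀, hK₀⟩
  · have := one_le_abs_discr k
    simp only [card_empty, cast_zero]
    positivity
  have hnf : ∀ K ∈ S, NumberField K := fun K hK => by
    have : FiniteDimensional ℚ K := of_finrank_pos
      ((hS K hK).2.1 ▸ Nat.mul_pos hm (by omega))
    exact ⟨⟩
  have hd := one_le_abs_discr k
  have hkX : |(discr k : ℝ)| ≤ X := by
    have := hnf K₀ hK₀
    obtain ⟨h1, -, h3⟩ := hS K₀ hK₀
    rw [fieldDiscr_eq] at h3
    exact (discr_pow_le_of_le k K₀ h1.le).trans h3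
  set Q : ℝ := X / |(discr k : ℝ)| with hQ
  have hQ1 : 1 ≤ Q := by rw [hQ, one_le_div (by positivity)]; exact hkX
  have hnm : m * l - m = m * (l - 1) := by rw [Nat.mul_sub, mul_one]
  have hl1 : 0 < m * (l - 1) := Nat.mul_pos hm (by omega)
  set e : ℝ := 1 / (2 * (m * (l - 1) : ℕ)) with he
  set s : ℝ := (2 * Q) ^ e with hsdef
  have hs1 : 1 ≤ s := one_le_rpow (by linarith) (by positivity)
  have hB : 1 ≤ 2 * ((m * l : ℕ) * s) := by
    have : (1 : ℝ) ≤ (m * l : ℕ) := by exact_mod_cast Nat.mul_pos hm (by omega)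
    nlinarith
  have hcast : ((l - 1 : ℕ) : ℝ) = l - 1 := by rw [cast_sub (by omega)]; simp
  have hspow : s ^ (2 * (m * (l - 1))) = 2 * Q := by
    rw [hsdef, ← rpow_natCast, ← rpow_mul (by positivity), he]
    have : 1 / (2 * ((m * (l - 1) : ℕ) : ℝ)) * ((2 * (m * (l - 1)) : ℕ) : ℝ) = 1 := by
      have : ((m * (l - 1) : ℕ) : ℝ) ≠ 0 := by exact_mod_cast hl1.ne'
      rw [cast_mul 2]
      rw [cast_ofNat]
      field_simp
    rw [this, rpow_one]
  have h := card_simple_extensions_le k l hl _ hB S fun K hK => by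
    have := hnf K hK
    obtain ⟨h1, h2, h3⟩ := hS K hK
    rw [fieldDiscr_eq] at h3
    obtain ⟨α, ha, hb, hc, hd', he'⟩ := exists_generator_of_covBy k K h1 s (by linarith) (by
      rw [h2, hk, hnm, hspow, hQ]
      have : |(discr k : ℝ)| * (2 * (X / |(discr k : ℝ)|)) = 2 * X := by field_simp
      rw [this]; linarith)
    refine ⟨α, ha, hb, ?_, hd', ?_⟩
    · rw [h2, hk] at hc
      exact Nat.eq_of_mul_eq_mul_left hm hc
    · rw [h2] at he'; exact he'
  refine h.trans (le_of_eq ?_)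
  rw [hk]
  have hsum : ∑ i ∈ range (l - 1), ((l - i : ℕ) : ℝ) = ((l : ℝ) + 2) * (l - 1) / 2 := by
    obtain ⟨q, rfl⟩ : ∃ q, l = q + 2 := ⟨l - 2, by omega⟩
    rw [show q + 2 - 1 = q + 1 by omega, ← Finset.sum_range_reflect]
    have : ∀ j ∈ range (q + 1), ((q + 2 - (q + 1 - 1 - j) : ℕ) : ℝ) = (j : ℝ) + 2 := by
      intro j hj
      rw [mem_range] at hj
      rw [show q + 2 - (q + 1 - 1 - j) = j + 2 by omega]; push_cast; ring
    rw [sum_congr rfl this]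
    clear * -
    induction q with
    | zero => norm_num
    | succ q ih => rw [sum_range_succ, ih]; push_cast; ring
  have hBpos : 0 < 2 * (((m * l : ℕ) : ℝ) * s) := by linarith
  have hprod : ∏ i ∈ range (l - 1), (7 * (2 ^ l * (2 * (((m * l : ℕ) : ℝ) * s)) ^ (l - i))) ^ m
      = ((7 * 2 ^ l) ^ m) ^ (l - 1) * (2 * (((m * l : ℕ) : ℝ) * s)) ^ ((((l : ℝ) + 2) / 2) * (m * (l - 1))) := by
    have : (((l : ℝ) + 2) / 2) * (m * (l - 1)) = (∑ i ∈ range (l - 1), ((l - i : ℕ) : ℝ)) * m := by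
      rw [hsum]; ring
    rw [this, rpow_mul hBpos.le, rpow_natCast, Real.rpow_sum_of_pos hBpos]
    simp_rw [rpow_natCast]
    rw [prod_pow, ← pow_mul, Nat.mul_comm m (l - 1), pow_mul, ← mul_pow]
    congr 1
    simp_rw [← mul_assoc]
    rw [prod_mul_distrib, prod_const, card_range]
  rw [hprod, show 2 * (((m * l : ℕ) : ℝ) * s) = (2 * (m * l : ℝ)) * s by push_cast; ring,
    mul_rpow (by positivity) (by linarith)]
  have hsp : s ^ ((((l : ℝ) + 2) / 2) * (m * (l - 1))) = 2 ^ (((l : ℝ) + 2) / 4) * Q ^ (((l : ℝ) + 2) / 4) := by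
    rw [← mul_rpow (by norm_num) (by linarith), hsdef, ← rpow_mul (by positivity), he]
    congr 1
    push_cast
    rw [hcast]
    have h1 : (m : ℝ) ≠ 0 := by positivity
    have h2 : (l : ℝ) - 1 ≠ 0 := by rw [← hcast]; exact_mod_cast (by omega : l - 1 ≠ 0)
    field_simp
    ring
  rw [hsp]
  ring

end Covers

section FieldInduction
open NumberField

theorem exists_covBy_of_lt (k₀ K : IntermediateField ℚ Qbar) [FiniteDimensional ℚ K] (h : k₀ < K) :
    ∃ k, k₀ ≤ k ∧ k ⋖ K := by
  obtain ⟨k, ⟨h1, h2⟩, hmax⟩ := WellFounded.has_min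
    (measure fun k : IntermediateField ℚ Qbar => finrank ℚ K - finrank ℚ k).wf
    {k | k₀ ≤ k ∧ k < K} ⟨k₀, le_rfl, h⟩
  refine ⟨k, h1, h2, fun k' hk hk' => ?_⟩
  have hfin : FiniteDimensional ℚ k' := by
    let _ : Algebra k' K := (inclusion hk'.le).toAlgebra
    exact FiniteDimensional.of_injective (inclusion hk'.le).toLinearMap
      (inclusion hk'.le).injective
  refine hmax k' ⟨h1.trans hk.le, hk'⟩ ?_
  change finrank ℚ K - finrank ℚ k' < finrank ℚ K - finrank ℚ k
  have a1 : finrank ℚ k < finrank ℚ k' := by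
    by_contra hh
    exact hk.ne (eq_of_le_of_finrank_le hk.le (by omega))
  have a2 : finrank ℚ k' < finrank ℚ K := by
    by_contra hh
    exact hk'.ne (eq_of_le_of_finrank_le hk'.le (by omega))
  omega

/-- The number of fields of degree `m * l` with a maximal subfield of degree `m`, in terms of the
number of fields of degree `m`. -/
theorem card_fields_over_le (m l : ℕ) (hm : 1 ≤ m) (hl : 2 ≤ l) (β ε : ℝ) (hε : 0 < ε) (hβ : 0 ≤ β)
    (hlβ : ((l : ℝ) + 2) / 4 ≤ β) (C₀ : ℝ) (hC₀ : 0 ≤ C₀)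
    (hP : ∀ D : ℕ, 1 ≤ D → ∀ S : Finset (IntermediateField ℚ Qbar),
      (∀ K ∈ S, finrank ℚ K = m ∧ |(fieldDiscr K : ℝ)| ≤ D) → (S.card : ℝ) ≤ C₀ * (D : ℝ) ^ β) :
    ∃ C : ℝ, 0 ≤ C ∧ ∀ D : ℕ, 1 ≤ D → ∀ S : Finset (IntermediateField ℚ Qbar),
      (∀ K ∈ S, finrank ℚ K = m * l ∧ |(fieldDiscr K : ℝ)| ≤ D ∧
        ∃ k, k ⋖ K ∧ finrank ℚ k = m) → (S.card : ℝ) ≤ C * (D : ℝ) ^ (β + ε) := by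
  classical
  obtain ⟨C₁, hC₁, hcov⟩ := card_covers_le m l hm hl
  refine ⟨C₁ * (C₀ * 2 ^ β * (1 - 2 ^ (-ε))⁻¹), ?_, fun D hD S hS => ?_⟩
  · have : (2 : ℝ) ^ (-ε) ≤ 1 := Real.rpow_le_one_of_one_le_of_nonpos (by norm_num) (by linarith)
    have : 0 ≤ (1 - (2 : ℝ) ^ (-ε))⁻¹ := inv_nonneg.2 (by linarith)
    positivity
  choose! f hf using fun K hK => (hS K hK).2.2
  have hD1 : (1 : ℝ) ≤ D := by exact_mod_cast hD
  have hfk : ∀ k ∈ S.image f, finrank ℚ k = m ∧ 1 ≤ (fieldDiscr k).natAbs ∧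
      ((fieldDiscr k).natAbs : ℝ) ≤ D ∧
      ((S.filter fun K => f K = k).card : ℝ) ≤
        C₁ * ((D : ℝ) / (fieldDiscr k).natAbs) ^ (((l : ℝ) + 2) / 4) := by
    intro k hk
    obtain ⟨K, hK, rfl⟩ := mem_image.1 hk
    obtain ⟨h1, h2⟩ := hf K hK
    have : FiniteDimensional ℚ (f K) := of_finrank_pos (by omega)
    have : NumberField (f K) := ⟨⟩
    have : FiniteDimensional ℚ K := of_finrank_pos
      ((hS K hK).1 ▸ Nat.mul_pos hm (by omega))
    have : NumberField K := ⟨⟩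
    have e : ((fieldDiscr (f K)).natAbs : ℝ) = |(discr (f K) : ℝ)| := by
      rw [fieldDiscr_eq, Nat.cast_natAbs, cast_abs]
    refine ⟨h2, ?_, ?_, ?_⟩
    · have := one_le_abs_discr (f K)
      rw [← e] at this
      exact_mod_cast this
    · rw [e]
      refine (discr_pow_le_of_le _ K h1.le).trans ?_
      have := (hS K hK).2.1
      rwa [fieldDiscr_eq] at this
    · rw [e]
      refine hcov (f K) h2 D (by positivity) _ fun K' hK' => ?_
      obtain ⟨hK', hfK⟩ := mem_filter.1 hK'
      exact ⟨hfK ▸ (hf K' hK').1, (hS K' hK').1, (hS K' hK').2.1⟩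
  have hsum := sum_rpow_neg_le (ι := IntermediateField ℚ Qbar) β ε C₀ hβ hε hC₀ (S.image f)
    (fun k => (fieldDiscr k).natAbs) (fun k hk => (hfk k hk).2.1) (fun E hE => by
      refine hP E hE _ fun k hk => ?_
      obtain ⟨hk, hkE⟩ := mem_filter.1 hk
      refine ⟨(hfk k hk).1, ?_⟩
      rw [← cast_abs, ← Nat.cast_natAbs]
      exact_mod_cast hkE)
  have hcard : S.card = ∑ k ∈ S.image f, (S.filter fun K => f K = k).card :=
    card_eq_sum_card_image f S
  rw [hcard]
  push_cast
  calc ∑ k ∈ S.image f, ((S.filter fun K => f K = k).card : ℝ)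
      ≤ ∑ k ∈ S.image f, C₁ * ((D : ℝ) ^ (β + ε) * ((fieldDiscr k).natAbs : ℝ) ^ (-(β + ε))) := by
        refine sum_le_sum fun k hk => (hfk k hk).2.2.2.trans ?_
        obtain ⟨-, h1, h2, -⟩ := hfk k hk
        have h1' : (1 : ℝ) ≤ (fieldDiscr k).natAbs := by exact_mod_cast h1
        gcongr
        rw [Real.rpow_neg (by linarith), ← div_eq_mul_inv, ← Real.div_rpow (by linarith) (by linarith)]
        refine rpow_le_rpow_of_exponent_le ?_ (by linarith)
        rwa [one_le_div (by linarith)]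
    _ = C₁ * (D : ℝ) ^ (β + ε) * ∑ k ∈ S.image f, ((fieldDiscr k).natAbs : ℝ) ^ (-(β + ε)) := by
        rw [mul_sum]
        exact sum_congr rfl fun _ _ => by ring
    _ ≤ C₁ * (D : ℝ) ^ (β + ε) * (C₀ * 2 ^ β * (1 - 2 ^ (-ε))⁻¹) := by gcongr
    _ = _ := by ring

/-- Summing `card_fields_over_le` over a range of possible degrees of a maximal subfield. -/
theorem card_fields_divisors_le (n : ℕ) (hn : 1 ≤ n) (A : Finset ℕ) (hA : ∀ m ∈ A, 1 ≤ m ∧ m < n)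
    (q : ℝ) (hq : ∀ m ∈ A, (m : ℝ) ≤ q ∧ ∀ l, m * l = n → (l : ℝ) ≤ q) (hq0 : 0 ≤ q) (ε : ℝ) (hε : 0 < ε)
    (hP : ∀ m ∈ A, ∀ ε : ℝ, 0 < ε → ∃ C : ℝ, 0 ≤ C ∧ ∀ D : ℕ, 1 ≤ D →
      ∀ S : Finset (IntermediateField ℚ Qbar),
      (∀ K ∈ S, finrank ℚ K = m ∧ |(fieldDiscr K : ℝ)| ≤ D) →
        (S.card : ℝ) ≤ C * (D : ℝ) ^ (((m : ℝ) + 2) / 4 + ε)) :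
    ∃ C : ℝ, 0 ≤ C ∧ ∀ D : ℕ, 1 ≤ D → ∀ S : Finset (IntermediateField ℚ Qbar),
      (∀ K ∈ S, finrank ℚ K = n ∧ |(fieldDiscr K : ℝ)| ≤ D ∧
        ∃ k, k ⋖ K ∧ finrank ℚ k ∈ A) → (S.card : ℝ) ≤ C * (D : ℝ) ^ ((q + 2) / 4 + ε) := by
  classical
  have key : ∀ m : ℕ, ∃ C : ℝ, 0 ≤ C ∧ (m ∈ A → ∀ D : ℕ, 1 ≤ D →
      ∀ S : Finset (IntermediateField ℚ Qbar),
      (∀ K ∈ S, finrank ℚ K = n ∧ |(fieldDiscr K : ℝ)| ≤ D ∧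
        ∃ k, k ⋖ K ∧ finrank ℚ k = m) → (S.card : ℝ) ≤ C * (D : ℝ) ^ ((q + 2) / 4 + ε)) := by
    intro m
    by_cases hmA : m ∈ A ∧ m ∣ n
    · obtain ⟨hmA, l, rfl⟩ := hmA
      obtain ⟨hm, hmn⟩ := hA m hmA
      obtain ⟨hq1, hq2⟩ := hq m hmA
      have hl2 : 2 ≤ l := by by_contra hh; interval_cases l <;> omega
      obtain ⟨C₀, hC₀, hP₀⟩ := hP m hmA (ε / 2) (by linarith)
      have hql := hq2 l rfl
      obtain ⟨C, hC, h⟩ := card_fields_over_le m l hm hl2 ((q + 2) / 4 + ε / 2) (ε / 2) (by linarith)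
        (by linarith) (by linarith) C₀ hC₀ fun D hD S hS => (hP₀ D hD S hS).trans (by
          gcongr
          exact_mod_cast hD)
      refine ⟨C, hC, fun _ D hD S hS => (h D hD S hS).trans_eq ?_⟩
      rw [show (q + 2) / 4 + ε / 2 + ε / 2 = (q + 2) / 4 + ε by ring]
    · refine ⟨0, le_rfl, fun hm D hD S hS => ?_⟩
      rcases S.eq_empty_or_nonempty with rfl | ⟨K, hK⟩
      · simp
      · obtain ⟨h1, -, k, hk, rfl⟩ := hS K hK
        refine absurd ⟨hm, ?_⟩ hmA
        let _ : Algebra k K := (inclusion hk.le).toAlgebra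
        have : IsScalarTower ℚ k K := IsScalarTower.of_algebraMap_eq fun x => rfl
        exact ⟨_, h1 ▸ (finrank_mul_finrank ℚ k K).symm⟩
  choose C hC h using key
  refine ⟨∑ m ∈ A, C m, sum_nonneg fun m _ => hC m, fun D hD S hS => ?_⟩
  choose! f hf using fun K hK => (hS K hK).2.2
  have hcard := Finset.card_eq_sum_card_fiberwise (s := S) (t := A) (f := fun K => finrank ℚ (f K))
    fun K hK => (hf K hK).2
  rw [hcard, sum_mul]
  push_cast
  refine sum_le_sum fun m hm => h m hm D hD _ fun K hK => ?_
  obtain ⟨hK, hfK⟩ := mem_filter.1 hK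
  exact ⟨(hS K hK).1, (hS K hK).2.1, f K, (hf K hK).1, hfK⟩

/-- Schmidt's bound for the number of number fields of given degree and bounded discriminant. -/
theorem card_fields_le (m : ℕ) (hm : 1 ≤ m) (ε : ℝ) (hε : 0 < ε) :
    ∃ C : ℝ, 0 ≤ C ∧ ∀ D : ℕ, 1 ≤ D → ∀ S : Finset (IntermediateField ℚ Qbar),
      (∀ K ∈ S, finrank ℚ K = m ∧ |(fieldDiscr K : ℝ)| ≤ D) →
        (S.card : ℝ) ≤ C * (D : ℝ) ^ (((m : ℝ) + 2) / 4 + ε) := by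
  induction m using Nat.strong_induction_on generalizing ε with
  | _ m ih =>
    rcases hm.eq_or_lt with rfl | hm2
    · refine ⟨1, by norm_num, fun D hD S hS => ?_⟩
      have h1 : S.card ≤ 1 := by
        rw [Finset.card_le_one]
        intro K hK K' hK'
        rw [IntermediateField.finrank_eq_one_iff.1 (hS K hK).1,
          IntermediateField.finrank_eq_one_iff.1 (hS K' hK').1]
      rw [one_mul]
      refine le_trans (by exact_mod_cast h1) (one_le_rpow (by exact_mod_cast hD) ?_)
      positivity
    · obtain ⟨C, hC, h⟩ := card_fields_divisors_le m hm (Ico 1 m) (by simp) m (fun k hk => by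
          rw [mem_Ico] at hk
          refine ⟨by exact_mod_cast hk.2.le, fun l hl => ?_⟩
          have : l ≤ m := by nlinarith
          exact_mod_cast this) (by positivity) ε hε fun k hk ε hε => by
            rw [mem_Ico] at hk
            exact ih k hk.2 hk.1 ε hε
      refine ⟨C, hC, fun D hD S hS => h D hD S fun K hK => ⟨(hS K hK).1, (hS K hK).2, ?_⟩⟩
      have h1 := (hS K hK).1
      have : FiniteDimensional ℚ K := of_finrank_pos (by omega)
      have hlt : (⊥ : IntermediateField ℚ Qbar) < K := bot_lt_iff_ne_bot.2 fun hh => by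
        rw [IntermediateField.finrank_eq_one_iff.2 hh] at h1
        omega
      obtain ⟨k, -, hk⟩ := exists_covBy_of_lt ⊥ K hlt
      have : FiniteDimensional ℚ k := FiniteDimensional.of_injective
        (inclusion hk.le).toLinearMap (inclusion hk.le).injective
      refine ⟨k, hk, mem_Ico.2 ⟨finrank_pos, ?_⟩⟩
      by_contra hh
      exact hk.lt.ne (eq_of_le_of_finrank_le hk.le (by omega))

/-- The number of number fields with a nontrivial proper subfield. -/
theorem card_imprimitive_fields_le (n : ℕ) (hn : 1 ≤ n) (ε : ℝ) (hε : 0 < ε) :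
    ∃ C : ℝ, 0 ≤ C ∧ ∀ D : ℕ, 1 ≤ D → ∀ S : Finset (IntermediateField ℚ Qbar),
      (∀ K ∈ S, finrank ℚ K = n ∧ |(fieldDiscr K : ℝ)| ≤ D ∧ ∃ k, k ≠ ⊥ ∧ k < K) →
        (S.card : ℝ) ≤ C * (D : ℝ) ^ (((n : ℝ) + 4) / 8 + ε) := by
  obtain ⟨C, hC, h⟩ := card_fields_divisors_le n hn ((Ico 2 n).filter (2 * · ≤ n))
    (fun m hm => by simp at hm; omega) (n / 2) (fun m hm => by
      simp only [mem_filter, mem_Ico] at hm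
      refine ⟨?_, fun l hl => ?_⟩
      · have : (2 * m : ℝ) ≤ n := by exact_mod_cast hm.2
        linarith
      · have : 2 * l ≤ n := by nlinarith
        have : (2 * l : ℝ) ≤ n := by exact_mod_cast this
        linarith) (by positivity) ε hε fun m hm ε hε => by
          simp only [mem_filter, mem_Ico] at hm
          exact card_fields_le m (by omega) ε hε
  refine ⟨C, hC, fun D hD S hS => (h D hD S fun K hK => ⟨(hS K hK).1, (hS K hK).2.1, ?_⟩).trans_eq ?_⟩
  · obtain ⟨h1, -, k₀, hk₀, hlt⟩ := hS K hK
    have : FiniteDimensional ℚ K := of_finrank_pos (by omega)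
    obtain ⟨k, hk0, hk⟩ := exists_covBy_of_lt k₀ K hlt
    have : FiniteDimensional ℚ k := FiniteDimensional.of_injective
      (inclusion hk.le).toLinearMap (inclusion hk.le).injective
    let _ : Algebra k K := (inclusion hk.le).toAlgebra
    have : IsScalarTower ℚ k K := IsScalarTower.of_algebraMap_eq fun x => rfl
    have hmul := finrank_mul_finrank ℚ k K
    have hne1 : finrank ℚ k ≠ 1 := fun hh => hk₀ (by
      rw [IntermediateField.finrank_eq_one_iff] at hh
      exact le_bot_iff.1 (hh ▸ hk0))
    have hpos : 0 < finrank ℚ k := finrank_pos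
    have hltn : finrank ℚ k < n := by
      by_contra hh
      exact hk.lt.ne (eq_of_le_of_finrank_le hk.le (by omega))
    have hl : 2 ≤ finrank k K := by
      rw [h1] at hmul
      by_contra hh
      have : finrank k K = 0 ∨ finrank k K = 1 := by omega
      rcases this with h0 | h0 <;> rw [h0] at hmul <;> omega
    refine ⟨k, hk, mem_filter.2 ⟨mem_Ico.2 ⟨by omega, hltn⟩, ?_⟩⟩
    rw [← h1, ← hmul]
    nlinarith
  · rw [show ((n : ℝ) / 2 + 2) / 4 = (n + 4) / 8 by ring]

end FieldInduction

section RootData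
open NumberField

theorem exists_int_of_fixed (x : Qbar) (hx : IsIntegral ℤ x) (h : ∀ g : Qbar ≃ₐ[ℚ] Qbar, g x = x) :
    ∃ z : ℤ, (z : Qbar) = x := by
  have : IsAlgClosure ℚ Qbar := ⟨inferInstance, inferInstance⟩
  have := IsAlgClosure.isGalois ℚ Qbar
  obtain ⟨q, rfl⟩ := IntermediateField.mem_bot.1 ((InfiniteGalois.mem_bot_iff_fixed x).2 h)
  rw [isIntegral_algebraMap_iff (algebraMap ℚ Qbar).injective] at hx
  obtain ⟨z, rfl⟩ := IsIntegrallyClosed.isIntegral_iff.1 hx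
  exact ⟨z, by simp⟩

/-- A primitive field has a small generator, whose conjugates are permuted by the Galois group. -/
theorem exists_root_data {n : ℕ} {G : Subgroup (Perm (Fin n))} (hn : 2 ≤ n)
    (K : IntermediateField ℚ Qbar) [NumberField K] (hK : finrank ℚ K = n)
    (hG : HasGalGroup n K G) (hprim : ∀ k, k < K → k = ⊥) {s : ℝ} (hs : 0 < s)
    (hlt : |(discr K : ℝ)| < s ^ (2 * (n - 1))) :
    ∃ r : Fin n → Qbar, Injective r ∧ (∃ i, adjoin ℚ {r i} = K) ∧
      (∃ α : 𝓞 K, ∀ i, ∃ ι : K →ₐ[ℚ] Qbar, r i = ι α) ∧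
      (∀ g : Qbar ≃ₐ[ℚ] Qbar, ∃ τ ∈ G, ∀ i, g (r i) = r (τ i)) ∧ ∑ i, r i = 0 ∧
      ∀ (σ : Qbar →ₐ[ℚ] ℂ) (i), ‖σ (r i)‖ ≤ 2 * (n * s) := by
  obtain ⟨α, h0, htr, hbd⟩ := exists_small_trace_zero ℚ K s hs (by
    rw [hK, Module.finrank_self, discr_rat]
    simpa using hlt)
  obtain ⟨e, he⟩ := hG
  let v : K →ₐ[ℚ] Qbar := K.val
  have hadj : adjoin ℚ {((α : K) : Qbar)} = K := by
    have hle : adjoin ℚ {((α : K) : Qbar)} ≤ K := by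
      rw [adjoin_simple_le_iff]
      exact (α : K).2
    refine hle.eq_or_lt.resolve_right fun hlt => ?_
    have hbot := hprim _ hlt
    have hmem : ((α : K) : Qbar) ∈ (⊥ : IntermediateField ℚ Qbar) :=
      hbot ▸ mem_adjoin_simple_self ℚ _
    obtain ⟨q, hq⟩ := IntermediateField.mem_bot.1 hmem
    have hq' : (α : K) = algebraMap ℚ K q := Subtype.ext hq.symm
    rw [hq', Algebra.trace_algebraMap, hK, smul_eq_zero] at htr
    rcases htr with h1 | h1
    · omega
    · rw [h1, map_zero] at hq'
      exact h0 (RingOfIntegers.ext hq')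
  have hpol : ∀ x : K, ∃ p : ℚ[X], x = aeval (α : K) p := fun x => by
    have hx : (x : Qbar) ∈ (adjoin ℚ {((α : K) : Qbar)}).toSubalgebra := by
      rw [hadj]; exact x.2
    rw [IntermediateField.adjoin_simple_toSubalgebra_of_isAlgebraic
      (Algebra.IsAlgebraic.isAlgebraic _), Algebra.adjoin_singleton_eq_range_aeval] at hx
    obtain ⟨p, hp⟩ := hx
    exact ⟨p, Subtype.ext (hp.symm.trans (aeval_algHom_apply K.val (α : K) p))⟩
  refine ⟨fun i => e.symm i (α : K), fun i j hij => ?_, ⟨e v, by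
    change adjoin ℚ {e.symm (e v) (α : K)} = K
    rw [Equiv.symm_apply_apply]
    exact hadj⟩,
    ⟨α, fun i => ⟨e.symm i, rfl⟩⟩, fun g => ⟨Equiv.permCongr e (galAct K g), (he _).2 ⟨g, rfl⟩, fun i => ?_⟩,
    ?_, fun σ i => ?_⟩
  · have : e.symm i = e.symm j := AlgHom.ext fun x => by
      obtain ⟨p, rfl⟩ := hpol x
      rw [← aeval_algHom_apply, ← aeval_algHom_apply]
      exact congrArg (aeval · p) hij
    exact e.symm.injective this
  · simp [galAct]
  · have h1 := trace_eq_sum_embeddings (K := ℚ) (L := K) Qbar (x := (α : K))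
    rw [htr, map_zero] at h1
    rw [h1, ← Equiv.sum_comp e.symm (fun σ : K →ₐ[ℚ] Qbar => σ (α : K))]
  · have := hbd (σ.comp (e.symm i))
    rwa [hK] at this

theorem exists_coeff_data {n : ℕ} (r : Fin n → Qbar) (hint : ∀ i, IsIntegral ℤ (r i))
    (hperm : ∀ g : Qbar ≃ₐ[ℚ] Qbar, ∃ τ : Perm (Fin n), ∀ i, g (r i) = r (τ i)) {B : ℝ}
    (hB : 0 ≤ B) (hbd : ∀ (σ : Qbar →ₐ[ℚ] ℂ) (i), ‖σ (r i)‖ ≤ B) {H : ℕ} (hH : 2 ^ n * B ≤ H) :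
    ∃ a : Fin n → ℤ, (coeffVec n (∏ j, (X - C (r j))) = fun i => (a i : Qbar)) ∧
      ∀ i, |a i| ≤ (H : ℤ) ^ (n - (i : ℕ)) := by
  have hfix : ∀ i : Fin n, ∃ z : ℤ, (z : Qbar) = coeffVec n (∏ j, (X - C (r j))) i := by
    intro i
    refine exists_int_of_fixed _ ?_ fun g => ?_
    · have : (∏ j, (X - C (r j))) =
          (∏ j, (X - C (⟨r j, hint j⟩ : integralClosure ℤ Qbar))).map (algebraMap _ Qbar) := by
        rw [Polynomial.map_prod]
        refine prod_congr rfl fun j _ => ?_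
        rw [Polynomial.map_sub, map_X, map_C]
        rfl
      rw [this, coeffVec, coeff_map]
      exact Subtype.property (Polynomial.coeff
        (∏ j, (X - C (⟨r j, hint j⟩ : integralClosure ℤ Qbar))) i)
    · obtain ⟨τ, hτ⟩ := hperm g
      have := congrFun (coeffVec_map (n := n) (g : Qbar →+* Qbar) (∏ j, (X - C (r j)))) i
      refine (this : g _ = _).trans ?_
      rw [Polynomial.map_prod]
      congr 1
      rw [← Equiv.prod_comp τ fun j => X - C (r j)]
      refine prod_congr rfl fun j _ => ?_
      rw [Polynomial.map_sub, map_X, map_C]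
      exact congrArg _ (congrArg C (hτ j))
  choose a ha using hfix
  refine ⟨a, funext fun i => (ha i).symm, fun i => ?_⟩
  have σ : Qbar →ₐ[ℚ] ℂ := IsAlgClosed.lift
  have hm : (∏ j, (X - C (r j))).Monic := monic_prod_of_monic _ _ fun j _ => monic_X_sub_C _
  have h := coeff_le_of_roots_le (p := ∏ j, (X - C (r j))) (f := (σ : Qbar →+* ℂ)) (B := B) i hm
    (splits _) (by
      intro z hz
      rw [Polynomial.map_prod] at hz
      simp only [Polynomial.map_sub, map_X, map_C] at hz
      have hz' := (mem_roots'.1 hz).2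
      rw [IsRoot.def, eval_prod, prod_eq_zero_iff] at hz'
      obtain ⟨j, -, hj⟩ := hz'
      rw [eval_sub, eval_X, eval_C, sub_eq_zero] at hj
      exact hj ▸ hbd σ j)
  have hd : (∏ j, (X - C (r j))).natDegree = n := by simp
  rw [hd, coeff_map] at h
  have e : (σ : Qbar →+* ℂ) ((∏ j, (X - C (r j))).coeff i) = (a i : ℂ) := by
    rw [← map_intCast (σ : Qbar →+* ℂ)]
    exact congrArg _ (ha i).symm
  rw [e, Complex.norm_intCast] at h
  have h2 : (|a i| : ℝ) ≤ (H : ℝ) ^ (n - (i : ℕ)) := by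
    refine h.trans ((le_trans ?_ (pow_le_pow_left₀ (by positivity) hH _)))
    rw [mul_pow, mul_comm]
    gcongr
    calc ((n.choose i : ℕ) : ℝ) ≤ 2 ^ n := by exact_mod_cast Nat.choose_le_two_pow _ _
      _ ≤ (2 ^ n) ^ (n - (i : ℕ)) := le_self_pow₀ (one_le_pow₀ (by norm_num)) (by omega)
  exact_mod_cast h2

theorem coeffVec_sub_one_eq_zero {n : ℕ} (hn : 0 < n) (r : Fin n → Qbar) (h : ∑ i, r i = 0) (i : Fin n)
    (hi : (i : ℕ) = n - 1) : coeffVec n (∏ j, (X - C (r j))) i = 0 := by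
  have h1 := prod_X_sub_C_nextCoeff (s := univ) r
  rw [nextCoeff_of_natDegree_pos (by simpa using hn), h, neg_zero] at h1
  rw [coeffVec, hi]
  simpa using h1

theorem eq_of_coeffVec_eq {n : ℕ} {S : Type*} [Field S] {r r' : Fin n → S}
    (h : coeffVec n (∏ j, (X - C (r j))) = coeffVec n (∏ j, (X - C (r' j)))) :
    ∏ j, (X - C (r j)) = ∏ j, (X - C (r' j)) := by
  have hm (r : Fin n → S) : (∏ j, (X - C (r j))).Monic := monic_prod_of_monic _ _ fun j _ => monic_X_sub_C _
  have hd (r : Fin n → S) : (∏ j, (X - C (r j))).natDegree = n := by simp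
  ext k
  rcases lt_trichotomy k n with hk | rfl | hk
  · exact congrFun h ⟨k, hk⟩
  · have h1 := (hm r).coeff_natDegree
    have h2 := (hm r').coeff_natDegree
    rw [hd] at h1 h2
    rw [h1, h2]
  · rw [coeff_eq_zero_of_natDegree_lt (by rwa [hd]), coeff_eq_zero_of_natDegree_lt (by rwa [hd])]

/-- The number of fields generated by a root of one of the given polynomials. -/
theorem card_fields_le_card_coeff {n : ℕ} (S : Finset (IntermediateField ℚ Qbar))
    (T : Finset (Fin n → ℤ))
    (h : ∀ K ∈ S, ∃ r : Fin n → Qbar, (∃ i, adjoin ℚ {r i} = K) ∧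
      ∃ a ∈ T, coeffVec n (∏ j, (X - C (r j))) = fun i => (a i : Qbar)) :
    S.card ≤ n * T.card := by
  classical
  choose! r hi a ha hr using h
  calc S.card ≤ n * (S.image a).card := by
        refine card_le_mul_card_image S n fun b hb => ?_
        obtain ⟨K₀, hK₀, rfl⟩ := mem_image.1 hb
        calc _ ≤ (univ.image fun j => adjoin ℚ {r K₀ j}).card := by
              refine card_le_card fun K hK => ?_
              obtain ⟨hK, hKa⟩ := mem_filter.1 hK
              have hc : coeffVec n (∏ j, (X - C (r K j))) = coeffVec n (∏ j, (X - C (r K₀ j))) := by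
                rw [hr K hK, hr K₀ hK₀, hKa]
              have hpoly : ∏ j, (X - C (r K j)) = ∏ j, (X - C (r K₀ j)) := by
                exact eq_of_coeffVec_eq hc
              obtain ⟨i, hi⟩ := hi K hK
              have hroot : (∏ j, (X - C (r K₀ j))).eval (r K i) = 0 := by
                rw [← hpoly, eval_prod]
                exact prod_eq_zero (mem_univ i) (by simp)
              rw [eval_prod, prod_eq_zero_iff] at hroot
              obtain ⟨j, -, hj⟩ := hroot
              rw [eval_sub, eval_X, eval_C, sub_eq_zero] at hj
              exact mem_image.2 ⟨j, mem_univ _, by rw [← hj, hi]⟩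
          _ ≤ n := card_image_le.trans (by simp)
    _ ≤ n * T.card := by
        refine Nat.mul_le_mul_left _ (card_le_card fun b hb => ?_)
        obtain ⟨K, hK, rfl⟩ := mem_image.1 hb
        exact ha K hK

end RootData

section PrimitiveCount
open NumberField

theorem exists_int_intEval_eq {n : ℕ} {G : Subgroup (Perm (Fin n))} (r : Fin n → Qbar)
    (hint : ∀ i, IsIntegral ℤ (r i))
    (hperm : ∀ g : Qbar ≃ₐ[ℚ] Qbar, ∃ τ ∈ G, ∀ i, g (r i) = r (τ i)) (p : MvPolynomial (Fin n) ℤ)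
    (hp : ∀ τ ∈ G, rename τ p = p) : ∃ z : ℤ, intEval r p = z := by
  obtain ⟨z, hz⟩ := exists_int_of_fixed (intEval r p) (by
    have := congrArg (fun φ : MvPolynomial (Fin n) ℤ →+* Qbar => φ p)
      (comp_intEval (algebraMap (integralClosure ℤ Qbar) Qbar) fun j => ⟨r j, hint j⟩)
    have h2 : intEval r p = algebraMap (integralClosure ℤ Qbar) Qbar
      (intEval (fun j => ⟨r j, hint j⟩) p) := this.symm
    rw [h2]
    exact Subtype.property (intEval (fun j => (⟨r j, hint j⟩ : integralClosure ℤ Qbar)) p)) fun g => by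
      obtain ⟨τ, hτ, hg⟩ := hperm g
      have h1 : g (intEval r p) = intEval (fun i => g (r i)) p :=
        congrArg (fun φ : MvPolynomial (Fin n) ℤ →+* Qbar => φ p) (comp_intEval (g : Qbar →+* Qbar) r)
      rw [h1]
      simp only [hg]
      conv_rhs => rw [← hp τ hτ]
      exact (eval₂Hom_rename _ _ _ p).symm
  exact ⟨z, hz.symm⟩

theorem exists_int_det_vandermonde_eq {n : ℕ} {G : Subgroup (Perm (Fin n))}
    (halt : G ≤ alternatingGroup (Fin n)) (r : Fin n → Qbar) (hint : ∀ i, IsIntegral ℤ (r i))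
    (hperm : ∀ g : Qbar ≃ₐ[ℚ] Qbar, ∃ τ ∈ G, ∀ i, g (r i) = r (τ i)) :
    ∃ y : ℤ, (vandermonde r).det = y := by
  have hmap : ∀ {S : Type} [CommRing S] (φ : MvPolynomial (Fin n) ℤ →+* S),
      φ (vandermonde (MvPolynomial.X : Fin n → MvPolynomial (Fin n) ℤ)).det =
        (vandermonde fun i => φ (MvPolynomial.X i)).det := by
    intro S _ φ
    rw [RingHom.map_det]
    congr 1
    ext i j
    simp [vandermonde]
  obtain ⟨z, hz⟩ := exists_int_intEval_eq (G := G) r hint hperm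
    (vandermonde (MvPolynomial.X : Fin n → MvPolynomial (Fin n) ℤ)).det fun τ hτ => by
      have h1 := hmap (rename τ : MvPolynomial (Fin n) ℤ →ₐ[ℤ] _).toRingHom
      have h2 := det_permute τ (vandermonde (MvPolynomial.X : Fin n → MvPolynomial (Fin n) ℤ))
      rw [Perm.mem_alternatingGroup.1 (halt hτ)] at h2
      refine h1.trans (Eq.trans ?_ (h2.trans (by simp)))
      congr 1
      ext i j
      simp [vandermonde]
  refine ⟨z, hz ▸ ?_⟩
  rw [hmap]
  simp [intEval]

/-- The exponents of the coefficients other than those of `X ^ (n - 1)`, `X` and `1`. -/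
theorem two_mul_sum_weights (n : ℕ) (hn : 3 ≤ n) :
    2 * ∑ i : Fin n, (if (i : ℕ) < 2 ∨ (i : ℕ) = n - 1 then 0 else n - (i : ℕ)) = n * (n - 3) := by
  obtain ⟨q, rfl⟩ : ∃ q, n = q + 3 := ⟨n - 3, by omega⟩
  rw [Fin.sum_univ_eq_sum_range (fun i => if i < 2 ∨ i = q + 3 - 1 then 0 else q + 3 - i),
    sum_range_succ, sum_range_succ', sum_range_succ']
  have : ∀ i ∈ range q, (if i + 1 + 1 < 2 ∨ i + 1 + 1 = q + 3 - 1 then 0 else q + 3 - (i + 1 + 1))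
      = q + 1 - i := fun i hi => by
    rw [mem_range] at hi
    rw [if_neg (by omega)]
    omega
  rw [sum_congr rfl this]
  simp only [zero_add, Nat.one_lt_ofNat, true_or, if_true, add_zero, Nat.zero_lt_two]
  rw [if_pos (by omega), add_zero]
  have h : ∀ q : ℕ, 2 * ∑ i ∈ range q, (q + 1 - i) = q * (q + 3) := by
    intro q
    induction q with
    | zero => simp
    | succ q ih =>
      rw [sum_range_succ', mul_add]
      simp only [Nat.add_sub_add_right]
      rw [ih]
      simp only [Nat.sub_zero]
      ring
  rw [h]
  simp only [Nat.add_sub_cancel]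
  ring

theorem card_coeff_vectors_le (n : ℕ) (hn : 3 ≤ n) (H : ℕ) (hH : 1 ≤ H) (T : Finset (Fin n → ℤ))
    (hbd : ∀ a ∈ T, ∀ i, |a i| ≤ (H : ℤ) ^ (n - (i : ℕ)))
    (htop : ∀ a ∈ T, ∀ i : Fin n, (i : ℕ) = n - 1 → a i = 0) (M : ℝ)
    (hfib : ∀ A : Fin n → ℤ, (∀ i, |A i| ≤ (H : ℤ) ^ (n - (i : ℕ))) → ∀ S : Finset (ℤ × ℤ),
      (∀ x ∈ S, (fun i : Fin n => if (i : ℕ) = 0 then x.2 else if (i : ℕ) = 1 then x.1 else A i) ∈ T) →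
      (S.card : ℝ) ≤ M) :
    (T.card : ℝ) ≤ 3 ^ n * (H : ℝ) ^ ((n : ℝ) * (n - 3) / 2) * M := by
  classical
  have hM : 0 ≤ M := by simpa using hfib 0 (fun i => by simp) ∅ (by simp)
  set mask : (Fin n → ℤ) → Fin n → ℤ := fun a i => if (i : ℕ) < 2 then 0 else a i with hmask
  set w : Fin n → ℕ := fun i => if (i : ℕ) < 2 ∨ (i : ℕ) = n - 1 then 0 else n - (i : ℕ) with hw
  have hHZ : (1 : ℤ) ≤ H := by exact_mod_cast hH
  have himg : ((T.image mask).card : ℝ) ≤ 3 ^ n * (H : ℝ) ^ (∑ i, w i) := by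
    have h1 : T.image mask ⊆ piFinset fun i : Fin n =>
        if (i : ℕ) < 2 ∨ (i : ℕ) = n - 1 then {0} else Icc (-(H : ℤ) ^ (n - (i : ℕ))) ((H : ℤ) ^ (n - (i : ℕ))) := by
      intro b hb
      obtain ⟨a, ha, rfl⟩ := mem_image.1 hb
      refine mem_piFinset.2 fun i => ?_
      split_ifs with h
      · rw [Finset.mem_singleton, hmask]
        rcases h with h | h
        · simp [h]
        · simp [htop a ha i h]
      · push Not at h
        simp only [hmask]
        rw [if_neg (by omega), mem_Icc, ← abs_le]
        exact hbd a ha i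
    have h2 := card_le_card h1
    rw [card_piFinset] at h2
    calc ((T.image mask).card : ℝ) ≤ ((∏ i : Fin n, 3 * H ^ w i : ℕ) : ℝ) := by
          refine cast_le.2 (h2.trans (prod_le_prod' fun i _ => ?_))
          simp only [hw]
          split_ifs with h
          · simp
          · rw [card_Icc]
            have := one_le_pow₀ hHZ (n := n - (i : ℕ))
            zify
            rw [Int.toNat_of_nonneg (by linarith)]
            linarith
      _ = _ := by
          push_cast
          rw [prod_mul_distrib, prod_const, card_univ, card_fin,
            prod_pow_eq_pow_sum]
  have hfibre : ∀ A ∈ T.image mask, ((T.filter fun a => mask a = A).card : ℝ) ≤ M := by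
    intro A hA
    obtain ⟨a₀, ha₀, rfl⟩ := mem_image.1 hA
    have hvec : ∀ a, mask a = mask a₀ → (fun i : Fin n => if (i : ℕ) = 0 then a ⟨0, by omega⟩ else
        if (i : ℕ) = 1 then a ⟨1, by omega⟩ else mask a₀ i) = a := by
      intro a ha
      funext i
      split_ifs with h0 h1
      · exact congrArg a (Fin.ext h0.symm)
      · exact congrArg a (Fin.ext h1.symm)
      · rw [← ha]
        simp only [hmask]
        rw [if_neg (by omega)]
    rw [← card_image_of_injOn (f := fun a : Fin n → ℤ => (a ⟨1, by omega⟩, a ⟨0, by omega⟩))]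
    · refine hfib (mask a₀) (fun i => ?_) _ fun x hx => ?_
      · simp only [hmask]
        split_ifs
        · simp
        · exact hbd a₀ ha₀ i
      · obtain ⟨a, ha, rfl⟩ := mem_image.1 hx
        obtain ⟨ha, hma⟩ := mem_filter.1 ha
        have := hvec a hma
        simp only
        rwa [this]
    · intro a ha b hb hab
      simp only [Prod.mk.injEq] at hab
      rw [← hvec a (mem_filter.1 ha).2, ← hvec b (mem_filter.1 hb).2, hab.1, hab.2]
  rw [card_eq_sum_card_image mask T]
  push_cast
  refine (sum_le_card_nsmul _ _ M hfibre).trans ?_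
  rw [nsmul_eq_mul]
  refine mul_le_mul_of_nonneg_right (himg.trans_eq ?_) hM
  congr 1
  rw [← rpow_natCast]
  congr 1
  have := two_mul_sum_weights n hn
  have h2 : ((2 * ∑ i, w i : ℕ) : ℝ) = ((n * (n - 3) : ℕ) : ℝ) := by exact_mod_cast this
  rw [cast_mul n, cast_sub hn, cast_mul 2] at h2
  rw [cast_ofNat] at h2
  rw [cast_ofNat] at h2
  linarith

/-- The height parameter attached to a bound for the discriminant. -/
theorem exists_height (n : ℕ) (hn : 3 ≤ n) (H₀ : ℕ) : ∃ C : ℝ, 1 ≤ C ∧ ∀ X : ℝ, 1 ≤ X →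
    ∃ (s : ℝ) (H : ℕ), 0 < s ∧ X < s ^ (2 * (n - 1)) ∧ H₀ ≤ H ∧ 1 ≤ H ∧ 2 ^ n * (2 * (n * s)) ≤ H ∧
      (H : ℝ) ≤ C * X ^ (1 / (2 * ((n : ℝ) - 1))) := by
  refine ⟨H₀ + (2 ^ n * (2 * (n * 2)) + 2), by
    have : (0 : ℝ) ≤ 2 ^ n * (2 * (n * 2)) := by positivity
    linarith [cast_nonneg (α := ℝ) H₀], fun X hX => ?_⟩
  have hn' : (3 : ℝ) ≤ n := by exact_mod_cast hn
  set e : ℝ := 1 / (2 * ((n : ℝ) - 1)) with he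
  have he0 : 0 < e := by rw [he]; exact div_pos one_pos (by linarith)
  have hXe : 1 ≤ X ^ e := one_le_rpow hX he0.le
  have hpow : (2 * X ^ e) ^ (2 * (n - 1)) = 2 ^ (2 * (n - 1)) * X := by
    rw [mul_pow, ← rpow_natCast (X ^ e), ← rpow_mul (by linarith), he]
    have : 1 / (2 * ((n : ℝ) - 1)) * ((2 * (n - 1) : ℕ) : ℝ) = 1 := by
      rw [cast_mul, cast_sub (by omega), cast_ofNat, Nat.cast_one]
      have : (n : ℝ) - 1 ≠ 0 := by linarith
      field_simp
    rw [this, rpow_one]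
  refine ⟨2 * X ^ e, H₀ + ⌈(2 ^ n * (2 * (n * (2 * X ^ e))) : ℝ)⌉₊ + 1, by positivity, ?_, by omega, by omega,
    ?_, ?_⟩
  · rw [hpow]
    have : (2 : ℝ) ^ 1 ≤ 2 ^ (2 * (n - 1)) := pow_le_pow_right₀ (by norm_num) (by omega)
    nlinarith
  · push_cast
    have := le_ceil (2 ^ n * (2 * (n * (2 * X ^ e))) : ℝ)
    linarith [cast_nonneg (α := ℝ) H₀]
  · push_cast
    have := (ceil_lt_add_one (a := (2 ^ n * (2 * (n * (2 * X ^ e))) : ℝ)) (by positivity)).le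
    have h1 : (H₀ : ℝ) ≤ H₀ * X ^ e := le_mul_of_one_le_right (by positivity) hXe
    linarith

theorem exists_vector_data {n : ℕ} {G : Subgroup (Perm (Fin n))} (hn : 2 ≤ n)
    (K : IntermediateField ℚ Qbar) [NumberField K] (hK : finrank ℚ K = n)
    (hG : HasGalGroup n K G) (hprim : ∀ k, k < K → k = ⊥) {s : ℝ} (hs : 0 < s)
    (hlt : |(discr K : ℝ)| < s ^ (2 * (n - 1))) {H : ℕ} (hH : 2 ^ n * (2 * (n * s)) ≤ H) :
    ∃ r : Fin n → Qbar, (∃ i, adjoin ℚ {r i} = K) ∧ Injective r ∧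
      (∀ i, IsIntegral ℤ (r i)) ∧ (∃ α : 𝓞 K, ∀ i, ∃ ι : K →ₐ[ℚ] Qbar, r i = ι α) ∧
      (∀ g : Qbar ≃ₐ[ℚ] Qbar, ∃ τ ∈ G, ∀ i, g (r i) = r (τ i)) ∧
      ∃ a : Fin n → ℤ, (coeffVec n (∏ j, (X - C (r j))) = fun i => (a i : Qbar)) ∧
        (∀ i, |a i| ≤ (H : ℤ) ^ (n - (i : ℕ))) ∧ ∀ i : Fin n, (i : ℕ) = n - 1 → a i = 0 := by
  obtain ⟨r, hinj, hadj, ⟨α, hα⟩, hperm, hsum, hbd⟩ := exists_root_data hn K hK hG hprim hs hlt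
  have hint : ∀ i, IsIntegral ℤ (r i) := fun i => by
    obtain ⟨ι, hι⟩ := hα i
    rw [hι]
    exact α.isIntegral_coe.map (ι.restrictScalars ℤ)
  obtain ⟨a, ha, hbd'⟩ := exists_coeff_data r hint
    (fun g => (hperm g).imp fun τ hτ => hτ.2) (by positivity) hbd hH
  refine ⟨r, hadj, hinj, hint, ⟨α, hα⟩, hperm, a, ha, hbd', fun i hi => ?_⟩
  have h1 : ((a i : ℤ) : Qbar) = 0 :=
    (congrFun ha i).symm.trans (coeffVec_sub_one_eq_zero (by omega) r hsum i hi)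
  exact_mod_cast h1

/-- Counting primitive fields with even Galois group of large index. -/
theorem card_primitive_fields_le (n : ℕ) (hn : 3 ≤ n) (G : Subgroup (Perm (Fin n)))
    (halt : G ≤ alternatingGroup (Fin n))
    (hshape : ∀ m : ℕ, Odd m → 0 < m → n ≠ m ^ 2 ∧ n ≠ m ^ 2 + 1)
    (hπ : √((n : ℝ) * (n - 1) / G.index) ≤ n / 2) (ε : ℝ) (hε : 0 < ε) :
    ∃ B : ℝ, 0 ≤ B ∧ ∀ D : ℝ, 1 ≤ D → ∀ S : Finset (IntermediateField ℚ Qbar),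
      (∀ K ∈ S, finrank ℚ K = n ∧ |(fieldDiscr K : ℝ)| ≤ D ∧ HasGalGroup n K G ∧
        ∀ k, k < K → k = ⊥) →
      (S.card : ℝ) ≤ B * D ^ (((n : ℝ) * (n - 3) / 2 + (√((n : ℝ) * (n - 1) / G.index) + n / 2))
        / (2 * ((n : ℝ) - 1)) + ε) := by
  classical
  obtain ⟨W, hW⟩ := card_family_le n hn G hshape hπ
  obtain ⟨c, H₀, hc⟩ := hW ε hε
  obtain ⟨B, hB, hX⟩ := exists_height n hn H₀
  set E := (n : ℝ) * (n - 3) / 2 + (√((n : ℝ) * (n - 1) / G.index) + n / 2 + ε) with hE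
  have hn' : (3 : ℝ) ≤ n := by exact_mod_cast hn
  have hE0 : 0 ≤ E := by
    have : 0 ≤ (n : ℝ) * (n - 3) := mul_nonneg (by linarith) (by linarith)
    positivity
  refine ⟨n * (3 ^ n * c) * B ^ E, by positivity, fun D hD S hS => ?_⟩
  obtain ⟨s, H, hs, hXs, hHH₀, hH1, hBH, hHX⟩ := hX D hD
  have hdata : ∀ K ∈ S, ∃ (r : Fin n → Qbar) (a : Fin n → ℤ),
      (∃ i, adjoin ℚ {r i} = K) ∧
      (coeffVec n (∏ j, (X - C (r j))) = fun i => (a i : Qbar)) ∧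
      (∀ i, |a i| ≤ (H : ℤ) ^ (n - (i : ℕ))) ∧ (∀ i : Fin n, (i : ℕ) = n - 1 → a i = 0) ∧
      Injective r ∧ (∃ z : ℤ, intEval r (resolventSeed n G W) = z) ∧
          ∃ y : ℤ, (vandermonde r).det = y := by
    intro K hK
    obtain ⟨h1, h2, h3, h4⟩ := hS K hK
    have : FiniteDimensional ℚ K := of_finrank_pos (by omega)
    have : NumberField K := ⟨⟩
    rw [fieldDiscr_eq] at h2
    obtain ⟨r, hadj, hinj, hint, -, hperm, a, ha, hbd, htop⟩ :=
      exists_vector_data (by omega) K h1 h3 h4 hs (h2.trans_lt hXs) hBH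
    exact ⟨r, a, hadj, ha, hbd, htop, hinj,
      exists_int_intEval_eq r hint hperm _ fun τ hτ => rename_resolventSeed W τ hτ,
      exists_int_det_vandermonde_eq halt r hint hperm⟩
  choose! r a hadj ha hbd htop hinj hz hy using hdata
  have h1 := card_fields_le_card_coeff (n := n) S (S.image a) fun K hK =>
    ⟨r K, hadj K hK, a K, mem_image_of_mem _ hK, ha K hK⟩
  have hforall : ∀ P : (Fin n → ℤ) → Prop, (∀ K ∈ S, P (a K)) → ∀ b ∈ S.image a, P b := by
    intro P hP b hb
    obtain ⟨K, hK, rfl⟩ := mem_image.1 hb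
    exact hP K hK
  have hHZ : (1 : ℤ) ≤ H := by exact_mod_cast hH1
  have h2 := card_coeff_vectors_le n hn H hH1 (S.image a) (hforall _ hbd) (hforall _ htop)
    (c * (H : ℝ) ^ (√((n : ℝ) * (n - 1) / G.index) + n / 2 + ε)) fun A hA R hR => by
      refine hc H hHH₀ A (fun i => (hA i).trans ?_) R fun x hx => ?_
      · have h3 := pow_le_pow_right₀ hHZ (show n - (i : ℕ) ≤ n by omega)
        have h4 := one_le_pow₀ hHZ (n := n)
        linarith
      · obtain ⟨K, hK, hKx⟩ := mem_image.1 (hR x hx)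
        have e0 := hbd K hK ⟨0, by omega⟩
        have e1 := hbd K hK ⟨1, by omega⟩
        have f0 : a K ⟨0, by omega⟩ = x.2 := by rw [hKx]; simp
        have f1 : a K ⟨1, by omega⟩ = x.1 := by rw [hKx]; simp
        rw [f0] at e0
        rw [f1] at e1
        refine ⟨e1, e0, r K, hinj K hK, ?_, hz K hK, hy K hK⟩
        rw [ha K hK]
        funext i
        rw [hKx]
  have hHR : (1 : ℝ) ≤ H := by exact_mod_cast hH1
  calc (S.card : ℝ) ≤ n * (S.image a).card := by exact_mod_cast h1
    _ ≤ n * (3 ^ n * (H : ℝ) ^ ((n : ℝ) * (n - 3) / 2) *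
        (c * (H : ℝ) ^ (√((n : ℝ) * (n - 1) / G.index) + n / 2 + ε))) := by gcongr
    _ = n * (3 ^ n * c) * (H : ℝ) ^ E := by
        have h3 : (H : ℝ) ^ E = (H : ℝ) ^ ((n : ℝ) * (n - 3) / 2) *
            (H : ℝ) ^ (√((n : ℝ) * (n - 1) / G.index) + n / 2 + ε) :=
          rpow_add (by linarith) _ _
        rw [h3]
        generalize (H : ℝ) ^ (√((n : ℝ) * (n - 1) / G.index) + n / 2 + ε) = u
        generalize (H : ℝ) ^ ((n : ℝ) * (n - 3) / 2) = v
        ring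
    _ ≤ n * (3 ^ n * c) * (B * D ^ (1 / (2 * ((n : ℝ) - 1)))) ^ E := by gcongr
    _ = n * (3 ^ n * c) * B ^ E * D ^ (E / (2 * ((n : ℝ) - 1))) := by
        rw [mul_rpow (by linarith) (by positivity), ← rpow_mul (by linarith), mul_assoc]
        rw [one_div_mul_eq_div]
        simp only [mul_assoc]
    _ ≤ _ := by
        refine mul_le_mul_of_nonneg_left (rpow_le_rpow_of_exponent_le hD ?_) (by positivity)
        have h3 : ε / (2 * ((n : ℝ) - 1)) ≤ ε := div_le_self hε.le (by linarith)
        have h4 : E / (2 * ((n : ℝ) - 1)) = ((n : ℝ) * (n - 3) / 2 +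
            (√((n : ℝ) * (n - 1) / G.index) + n / 2)) / (2 * ((n : ℝ) - 1)) + ε / (2 * ((n : ℝ) - 1)) := by
          rw [hE]; ring
        linarith

end PrimitiveCount

namespace MvPolynomial

theorem homogeneousComponent_mul_of_isHomogeneous {σ R : Type*} [CommRing R]
    {q : MvPolynomial σ R} {d : ℕ} (hq : q.IsHomogeneous d) (p : MvPolynomial σ R) (n : ℕ) :
    homogeneousComponent n (p * q) =
      if d ≤ n then homogeneousComponent (n - d) p * q else 0 := by
  let _ : GradedAlgebra (homogeneousSubmodule σ R) := MvPolynomial.gradedAlgebra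
  simp only [← decomposition.decompose'_apply]
  exact DirectSum.coe_decompose_mul_of_right_mem (homogeneousSubmodule σ R) (a := p) n
      ((mem_homogeneousSubmodule d q).2 hq)

/-- Homogeneous equations cutting out only the origin have boundedly many solutions on every
translate. -/
theorem exists_card_fibre_le {σ ι : Type*} [Fintype σ] [Fintype ι] (P : ι → MvPolynomial σ ℤ)
    (d : ι → ℕ) (hd : ∀ i, 1 ≤ d i) (hP : ∀ i, (P i).IsHomogeneous (d i)) (ν : ℤ)
    (h : ∀ l, C ν * X l ∈ (span (Set.range P)).radical) :
    ∃ c : ℕ, ∀ (κ : Type) [Field κ], (ν : κ) ≠ 0 → ∀ s : ι → κ, ∀ Z : Finset (σ → κ),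
      (∀ v ∈ Z, ∀ i, aeval v (P i) = s i) → Z.card ≤ c := by
  classical
  choose M hM using h
  set N := ∑ l, M l
  have hN (l : σ) : ∃ g : ι → MvPolynomial σ ℤ, (∀ i, 1 ≤ N → (g i).totalDegree + 1 ≤ N) ∧
      (1 ≤ N ∨ ∀ i, g i = 0) ∧ (C ν * X l) ^ N = ∑ i, g i * P i := by
    obtain ⟨g, hg⟩ := (Ideal.mem_span_range_iff_exists_fun).1 (Ideal.pow_mem_of_pow_mem _ (hM l)
      (single_le_sum (fun _ _ => Nat.zero_le _) (mem_univ l) : M l ≤ N))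
    refine ⟨fun i => if d i ≤ N then homogeneousComponent (N - d i) (g i) else 0, fun i h1 => ?_,
      ?_, ?_⟩
    · dsimp only
      split_ifs with hi
      · have := (homogeneousComponent_isHomogeneous (N - d i) (g i)).totalDegree_le
        have := hd i
        omega
      · simpa using h1
    · rcases Nat.eq_zero_or_pos N with h0 | h0
      · exact Or.inr fun i => if_neg (by have := hd i; omega)
      · exact Or.inl h0
    · have h1 : ((C ν * X l : MvPolynomial σ ℤ) ^ N).IsHomogeneous N := by
        simpa using! ((isHomogeneous_C σ ν).mul (isHomogeneous_X ℤ l)).pow N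
      rw [← homogeneousComponent_eq_self h1, ← hg, map_sum]
      refine sum_congr rfl fun i _ => ?_
      rw [homogeneousComponent_mul_of_isHomogeneous (hP i), ite_mul, zero_mul]
  choose g hgd hg0 hg using hN
  refine ⟨N ^ Fintype.card σ, fun κ _ hν s Z hZ => ?_⟩
  let T : (Z → κ) →ₗ[κ] ((σ → Fin N) → κ) :=
    LinearMap.pi fun e => ∑ z : Z, (∏ l, z.1 l ^ (e l : ℕ)) • LinearMap.proj z
  have hT : Injective T := by
    rw [← LinearMap.ker_eq_bot, LinearMap.ker_eq_bot']
    intro α hα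
    have key (D : ℕ) : ∀ q : MvPolynomial σ ℤ, q.totalDegree + 1 ≤ D →
        ∑ z : Z, α z * aeval z.1 q = 0 := by
      induction D with
      | zero => intro q hq; omega
      | succ D ih =>
        intro q hq
        have hmon (e : σ →₀ ℕ) (he : e.degree ≤ D) (x : ℤ) :
            ∑ z : Z, α z * aeval z.1 (monomial e x) = 0 := by
          by_cases hb : ∀ l, e l < N
          · have h1 := congr_fun hα fun l => ⟨e l, hb l⟩
            simp only [T, LinearMap.pi_apply, LinearMap.sum_apply, LinearMap.smul_apply,
              LinearMap.proj_apply, smul_eq_mul, Pi.zero_apply] at h1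
            rw [← mul_zero (x : κ), ← h1, mul_sum]
            refine sum_congr rfl fun z _ => ?_
            rw [aeval_monomial, Finsupp.prod_fintype _ _ (by simp)]
            simp
            ring
          · push Not at hb
            obtain ⟨l, hl⟩ := hb
            obtain ⟨e, rfl⟩ := exists_add_of_le (Finsupp.single_le_iff.2 hl)
            rw [map_add, Finsupp.degree_single] at he
            have h1 (z : Z) : (ν : κ) ^ N * (α z * aeval z.1
                (monomial (Finsupp.single l N + e) x)) =
                ∑ i, s i * (α z * aeval z.1 (g l i * monomial e x)) := by
              have h2 : C (ν ^ N) * monomial (Finsupp.single l N + e) x =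
                  ∑ i, g l i * P i * monomial e x := by
                rw [← sum_mul, ← hg, mul_pow, X_pow_eq_monomial, map_pow, mul_assoc,
                  monomial_mul, one_mul]
              have h3 := congr_arg (aeval z.1) h2
              simp only [map_mul, map_sum, algHom_C, hZ z.1 z.2] at h3
              rw [mul_left_comm]
              push_cast [algebraMap_int_eq, eq_intCast] at h3
              rw [h3, mul_sum]
              refine sum_congr rfl fun i _ => ?_
              rw [map_mul]
              ring
            refine (mul_eq_zero.1 (?_ : (ν : κ) ^ N * _ = 0)).resolve_left (pow_ne_zero _ hν)
            rw [mul_sum, sum_congr rfl fun z _ => h1 z, sum_comm]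
            refine sum_eq_zero fun i _ => ?_
            rw [← mul_sum]
            rcases hg0 l with h0 | h0
            · rw [ih _ ?_, mul_zero]
              have h4 := totalDegree_mul (g l i) (monomial e x)
              have h5 := totalDegree_monomial_le e x
              have h6 := hgd l i h0
              change _ ≤ e.degree at h5
              omega
            · simp [h0 i]
        conv_lhs => rw [q.as_sum]
        simp only [map_sum, mul_sum]
        rw [sum_comm]
        refine sum_eq_zero fun e he => hmon e ?_ _
        have := le_totalDegree he
        change e.degree ≤ _ at this
        omega
    have hli : LinearIndependent κ fun z : Z =>
        (((aeval z.1 : MvPolynomial σ ℤ →ₐ[ℤ] κ) : MvPolynomial σ ℤ →* κ) :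
          MvPolynomial σ ℤ → κ) := by
      refine (linearIndependent_monoidHom (MvPolynomial σ ℤ) κ).comp
        (fun z : Z => ((aeval z.1 : MvPolynomial σ ℤ →ₐ[ℤ] κ) : MvPolynomial σ ℤ →* κ))
        fun z w hzw => Subtype.ext <| _root_.funext fun l => ?_
      simpa using! DFunLike.congr_fun hzw (X l)
    refine _root_.funext (Fintype.linearIndependent_iff.1 hli α (_root_.funext fun q => ?_))
    simpa using! key _ q le_rfl
  simpa using LinearMap.finrank_le_finrank_of_injective hT

end MvPolynomial

/-- A vector with few distinct coordinates whose first elementary symmetric functions vanish is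
zero. -/
theorem eq_zero_of_card_image_le {n k : ℕ} {κ : Type*} [Field κ] [DecidableEq κ]
    (hn : (n.factorial : κ) ≠ 0) (u : Fin n → κ) (hu : (univ.image u).card ≤ k)
    (h : ∀ j, n - k ≤ j → j < n → (∏ i, (X - C (u i))).coeff j = 0) (l : Fin n) : u l = 0 := by
  set f := ∏ i, (X - C (u i)) with hf
  have hfm : f.Monic := monic_prod_X_sub_C u _
  have hfd : f.natDegree = n := by simp [hf, natDegree_prod_of_monic _ _ fun i _ => monic_X_sub_C (u i)]
  set m : κ → ℕ := fun x => (univ.filter fun i => u i = x).card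
  have hfp : f = ∏ x ∈ univ.image u, (X - C x) ^ m x :=
    Finset.prod_comp (fun x => X - C x) u
  set w := ∏ x ∈ univ.image u, (X - C x) ^ (m x - 1)
  have hcop : (↑(univ.image u) : Set κ).Pairwise
      (Function.onFun IsCoprime fun x => (X - C x : κ[X]) ^ (m x - 1)) := fun x _ y _ hxy =>
    (isCoprime_X_sub_C_of_isUnit_sub (sub_ne_zero.2 hxy).isUnit).pow
  have hdvd (x : κ) (hx : x ∈ univ.image u) : (X - C x) ^ m x ∣ f :=
    hfp ▸ Finset.dvd_prod_of_mem (fun x => (X - C x) ^ m x) hx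
  have hwg : w ∣ X * derivative f - C (n : κ) * f := dvd_sub
    (Dvd.dvd.mul_left (prod_dvd_of_coprime hcop fun x hx =>
      pow_sub_one_dvd_derivative_of_pow_dvd (hdvd x hx)) _)
    (Dvd.dvd.mul_left (prod_dvd_of_coprime hcop fun x hx =>
      (pow_dvd_pow _ (sub_le _ _)).trans (hdvd x hx)) _)
  have hwd : n ≤ w.natDegree + k := by
    have h1 : w.natDegree = ∑ x ∈ univ.image u, (m x - 1) := by
      rw [natDegree_prod_of_monic _ _ fun x _ => (monic_X_sub_C x).pow _]
      simp
    have h2 : n = ∑ x ∈ univ.image u, m x := by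
      simpa using card_eq_sum_card_image u univ
    have h3 : ∑ x ∈ univ.image u, m x ≤ ∑ x ∈ univ.image u, ((m x - 1) + 1) :=
      sum_le_sum fun x _ => by omega
    rw [sum_add_distrib, sum_const, smul_eq_mul, mul_one] at h3
    omega
  have hcoeff (j : ℕ) : (X * derivative f - C (n : κ) * f).coeff j = ((j : κ) - n) * f.coeff j := by
    cases j with
    | zero => simp
    | succ j =>
      simp only [coeff_sub, coeff_X_mul, coeff_derivative, coeff_C_mul]
      push_cast
      ring
  have hg : X * derivative f - C (n : κ) * f = 0 := by
    by_contra hg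
    have h1 := natDegree_le_of_dvd hwg hg
    refine hg (leadingCoeff_eq_zero.1 ?_)
    rw [leadingCoeff, hcoeff]
    rcases lt_trichotomy (X * derivative f - C (n : κ) * f).natDegree n with h2 | h2 | h2
    · rw [h _ (by omega) h2, mul_zero]
    · rw [h2, sub_self, zero_mul]
    · rw [coeff_eq_zero_of_natDegree_lt (by omega), mul_zero]
  have hX : f = X ^ n := by
    ext j
    rw [coeff_X_pow]
    rcases lt_trichotomy j n with h2 | h2 | h2
    · have h3 := hcoeff j
      rw [hg, coeff_zero, eq_comm, mul_eq_zero] at h3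
      rw [if_neg h2.ne]
      refine h3.resolve_left fun h4 => hn ?_
      obtain ⟨q, hq⟩ := Nat.dvd_factorial (Nat.sub_pos_of_lt h2) (sub_le n j)
      rw [hq, cast_mul, cast_sub h2.le, ← neg_sub, h4, neg_zero, zero_mul]
    · rw [if_pos h2, h2]
      conv_lhs => rw [← hfd]
      exact hfm
    · rw [if_neg h2.ne', coeff_eq_zero_of_natDegree_lt (by omega)]
  have h1 : f.eval (u l) = 0 := by
    rw [hf, eval_prod]
    exact prod_eq_zero (mem_univ l) (by simp)
  rw [hX, eval_pow, eval_X] at h1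
  exact eq_zero_of_pow_eq_zero h1

/-- There are boundedly many vectors with at most `k` distinct coordinates and prescribed first `k`
elementary symmetric functions. -/
theorem exists_card_prefix_fibre_le (n k : ℕ) (hk : k ≤ n) : ∃ c : ℕ, ∀ (κ : Type) [Field κ] [DecidableEq κ],
    (n.factorial : κ) ≠ 0 → ∀ b : ℕ → κ, ∀ Z : Finset (Fin n → κ),
      (∀ v ∈ Z, (univ.image v).card ≤ k ∧
        ∀ j, n - k ≤ j → j < n → (∏ i, (X - C (v i))).coeff j = b j) → Z.card ≤ c := by
  classical
  let P (φ : Fin n → Fin n) : Fin k ⊕ Fin n → MvPolynomial (Fin n) ℤ :=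
    Sum.elim (fun m => esymm (Fin n) ℤ (m + 1))
      fun i => MvPolynomial.X i - MvPolynomial.X (φ i)
  have hP (φ : Fin n → Fin n) (hφ : (univ.image φ).card ≤ k) : ∃ c : ℕ,
      ∀ (κ : Type) [Field κ], ((n.factorial : ℤ) : κ) ≠ 0 → ∀ s : Fin k ⊕ Fin n → κ,
      ∀ Z : Finset (Fin n → κ), (∀ v ∈ Z, ∀ i, MvPolynomial.aeval v (P φ i) = s i) → Z.card ≤ c := by
    refine MvPolynomial.exists_card_fibre_le (P φ) (Sum.elim (fun m => m + 1) fun _ => 1) ?_ ?_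
      (n.factorial : ℤ) fun l => ?_
    · rintro (m | i) <;> simp
    · rintro (m | i)
      · change (esymm (Fin n) ℤ (m + 1)).IsHomogeneous (m + 1)
        refine MvPolynomial.IsHomogeneous.sum (R := ℤ) _ _ _ fun t ht => ?_
        have := MvPolynomial.IsHomogeneous.prod t (fun i => (MvPolynomial.X i : MvPolynomial (Fin n) ℤ))
          (fun _ => 1) fun i _ => isHomogeneous_X _ _
        simpa [(Finset.mem_powersetCard.1 ht).2] using this
      · exact (isHomogeneous_X _ _).sub (isHomogeneous_X _ _)
    · rw [Ideal.radical_eq_sInf, Ideal.mem_sInf]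
      rintro 𝔭 ⟨hJ, hpr⟩
      let ψ : MvPolynomial (Fin n) ℤ →+* FractionRing (MvPolynomial (Fin n) ℤ ⧸ 𝔭) :=
        (algebraMap _ _).comp (Ideal.Quotient.mk 𝔭)
      have hψ (q) : ψ q = 0 ↔ q ∈ 𝔭 := by
        rw [← Ideal.Quotient.eq_zero_iff_mem]
        exact map_eq_zero_iff (algebraMap (MvPolynomial (Fin n) ℤ ⧸ 𝔭) (FractionRing
          (MvPolynomial (Fin n) ℤ ⧸ 𝔭))) (IsFractionRing.injective _ _)
      have hψP (i) : ψ (P φ i) = 0 := (hψ _).2 (hJ (Ideal.subset_span ⟨i, rfl⟩))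
      rw [← hψ, map_mul]
      by_cases h0 : (n.factorial : FractionRing (MvPolynomial (Fin n) ℤ ⧸ 𝔭)) = 0
      · rw [show ψ (MvPolynomial.C (n.factorial : ℤ)) = n.factorial by simp, h0, zero_mul]
      · rw [eq_zero_of_card_image_le h0 (fun i => ψ (MvPolynomial.X i)) (k := k) ?_ ?_ l, mul_zero]
        · refine le_trans ?_ hφ
          have : (fun i => ψ (MvPolynomial.X i)) = (fun i => ψ (MvPolynomial.X i)) ∘ φ := by
            funext i
            have := hψP (Sum.inr i)
            simp only [P, Sum.elim_inr, map_sub] at this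
            exact sub_eq_zero.1 this
          rw [this, ← image_image]
          exact card_image_le
        · intro j h1 h2
          have := hψP (Sum.inl ⟨n - j - 1, by omega⟩)
          simp only [P, Sum.elim_inl, show n - j - 1 + 1 = n - j by omega] at this
          rw [prod_X_sub_C_coeff_fin _ h2.le, Finset.esymm_map_val,
            show ∑ t ∈ univ.powersetCard (n - j), ∏ i ∈ t, ψ (MvPolynomial.X i) = 0 by
              rw [← this, esymm]
              simp only [map_sum, map_prod], mul_zero]
  choose c hc using hP
  refine ⟨∑ φ, if h : (univ.image φ).card ≤ k then c φ h else 0, fun κ _ _ hn b Z hZ => ?_⟩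
  have hsub : Z ⊆ univ.biUnion fun φ : Fin n → Fin n =>
      Z.filter fun v => (univ.image φ).card ≤ k ∧ v = v ∘ φ := fun v hv => by
    have h1 (i : Fin n) : v (Set.rangeSplitting v ⟨v i, i, rfl⟩) = v i := Set.apply_rangeSplitting v _
    rw [mem_biUnion]
    refine ⟨fun i => Set.rangeSplitting v ⟨v i, i, rfl⟩, mem_univ _, mem_filter.2 ⟨hv,
      le_trans (card_le_card_of_injOn v ?_ ?_) (hZ v hv).1, funext fun i => (h1 i).symm⟩⟩
    · intro x _
      simp
    · intro x hx y hy hxy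
      simp only [Finset.coe_image, Finset.coe_univ, Set.image_univ, Set.mem_range] at hx hy
      obtain ⟨⟨i, rfl⟩, j, rfl⟩ := And.intro hx hy
      rw [h1, h1] at hxy
      simp only [hxy]
  refine (card_le_card hsub).trans (Finset.card_biUnion_le.trans (sum_le_sum
    fun φ _ => ?_))
  split_ifs with hφ
  · refine hc φ hφ κ (by exact_mod_cast hn) (Sum.elim (fun m => if m + 1 ≤ n then
      (-1) ^ ((m : ℕ) + 1) * b (n - (m + 1)) else 0) 0) _ fun v hv i => ?_
    obtain ⟨h1, -, h2⟩ := mem_filter.1 hv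
    rcases i with m | i
    · have hm := m.2
      simp only [P, Sum.elim_inl, MvPolynomial.aeval_esymm_eq_multiset_esymm]
      rw [if_pos (by omega), ← (hZ v h1).2 _ (by omega) (by omega),
        prod_X_sub_C_coeff_fin _ (by omega), show n - (n - (m + 1)) = (m : ℕ) + 1 by omega,
        ← mul_assoc, ← mul_pow, neg_one_mul, neg_neg, one_pow, one_mul]
    · simp only [P, Sum.elim_inr, map_sub, MvPolynomial.aeval_X, Pi.zero_apply, sub_eq_zero]
      exact congr_fun h2 i
  · simp [hφ]

section Ramification
open NumberField

theorem factorial_mul_pow_mem_span_psum {σ : Type*} [Fintype σ] [DecidableEq σ] (i : σ) :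
    ((Fintype.card σ).factorial : MvPolynomial σ ℤ) * MvPolynomial.X i ^ Fintype.card σ ∈
      span (Set.range fun j : ℕ => psum σ ℤ (j + 1)) := by
  set J := span (Set.range fun j : ℕ => psum σ ℤ (j + 1))
  have h1 (j : ℕ) : (j : MvPolynomial σ ℤ) * esymm σ ℤ j ∈ J := by
    rw [MvPolynomial.mul_esymm_eq_sum]
    refine J.mul_mem_left _ (J.sum_mem fun a ha => J.mul_mem_left _ (Ideal.subset_span
      ⟨a.2 - 1, ?_⟩))
    simp only [mem_filter, Finset.HasAntidiagonal.mem_antidiagonal] at ha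
    dsimp only
    rw [show a.2 - 1 + 1 = a.2 by omega]
  have h2 := congr_arg (eval (-(MvPolynomial.X i : MvPolynomial σ ℤ)))
    (Multiset.prod_X_add_C_eq_sum_esymm
      (univ.val.map (MvPolynomial.X : σ → MvPolynomial σ ℤ)))
  rw [Multiset.map_map, Finset.prod_map_val, eval_prod, prod_eq_zero (mem_univ i)
    (by simp), card_map, card_val, card_univ, eval_finsetSum,
    sum_range_succ', Nat.sub_zero] at h2
  simp only [← MvPolynomial.esymm_eq_multiset_esymm, eval_mul, eval_C, eval_pow, eval_X,
    esymm_zero, one_mul] at h2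
  have h3 : ((Fintype.card σ).factorial : MvPolynomial σ ℤ) *
      (-MvPolynomial.X i) ^ Fintype.card σ ∈ J := by
    rw [(neg_eq_of_add_eq_zero_right h2.symm).symm, mul_neg, mul_sum]
    refine J.neg_mem (J.sum_mem fun j hj => ?_)
    obtain ⟨c, hc⟩ := Nat.dvd_factorial j.succ_pos (mem_range.1 hj)
    rw [hc, cast_mul, mul_comm (j.succ : MvPolynomial σ ℤ), mul_assoc, ← mul_assoc (j.succ : MvPolynomial σ ℤ)]
    exact J.mul_mem_left _ (J.mul_mem_right _ (h1 _))
  rw [neg_pow, mul_left_comm] at h3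
  simpa [← mul_assoc, ← mul_pow] using J.mul_mem_left ((-1) ^ Fintype.card σ) h3

theorem dvd_factorial_mul_pow {K : Type*} [Field K] [NumberField K] (x : 𝓞 K) (q : ℤ)
    (hq : q ≠ 0) (h : ∀ j, q ∣ Algebra.trace ℤ (𝓞 K) (x ^ (j + 1))) :
    (q : 𝓞 K) ∣ (finrank ℚ K).factorial * x ^ finrank ℚ K := by
  classical
  let v : (K →ₐ[ℚ] Qbar) → integralClosure ℤ Qbar := fun σ =>
    ⟨σ x, (RingOfIntegers.isIntegral_coe x).map (σ.restrictScalars ℤ)⟩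
  have hJ : span (Set.range fun j : ℕ => psum (K →ₐ[ℚ] Qbar) ℤ (j + 1)) ≤
      (span {(q : integralClosure ℤ Qbar)}).comap (MvPolynomial.aeval v).toRingHom := by
    rw [Ideal.span_le]
    rintro _ ⟨j, rfl⟩
    obtain ⟨c, hc⟩ := h j
    refine Ideal.mem_span_singleton.2 ⟨(c : integralClosure ℤ Qbar), Subtype.ext ?_⟩
    have h1 := trace_eq_sum_embeddings (K := ℚ) Qbar (x := (x ^ (j + 1) : K))
    have h2 := Algebra.coe_trace_int (x ^ (j + 1))
    rw [hc] at h2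
    push_cast at h2
    rw [← h2] at h1
    simpa [psum, v] using h1.symm
  let σ₀ : K →ₐ[ℚ] Qbar := IsAlgClosed.lift
  obtain ⟨w, hw⟩ := Ideal.mem_span_singleton.1 (hJ (factorial_mul_pow_mem_span_psum σ₀))
  have hw := congr_arg Subtype.val hw
  rw [AlgHom.card] at hw
  simp [v] at hw
  have hq' : (q : K) ≠ 0 := by exact_mod_cast hq
  have hy : IsIntegral ℤ ((finrank ℚ K).factorial * (x : K) ^ finrank ℚ K / q) := by
    rw [← isIntegral_algHom_iff (σ₀.restrictScalars ℤ) σ₀.toRingHom.injective]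
    convert! w.2 using 1
    simp only [AlgHom.coe_restrictScalars', map_div₀, map_mul, map_natCast, map_pow, map_intCast]
    rw [hw, mul_div_cancel_left₀ _ (by exact_mod_cast hq)]
  obtain ⟨y, hy⟩ := (IsIntegralClosure.isIntegral_iff (A := 𝓞 K)).1 hy
  refine ⟨y, RingOfIntegers.coe_injective ?_⟩
  push_cast
  change _ = ((q : ℤ) : K) * algebraMap (𝓞 K) K y
  rw [hy, mul_div_cancel₀ _ hq']

end Ramification

section Ramification
open NumberField

theorem isCoprime_of_not_dvd {B : Type*} [CommRing B] [IsDedekindDomain B] {P Q : Ideal B} (hP : Prime P)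
    (h : ¬ P ∣ Q) : IsCoprime P Q := by
  have : P.IsPrime := isPrime_of_prime hP
  rw [Ideal.isCoprime_iff_sup_eq]
  refine (this.isMaximal hP.ne_zero).1.2 _ (lt_of_le_of_ne le_sup_left fun h1 => h ?_)
  rw [dvd_iff_le]
  exact le_sup_right.trans h1.ge

theorem not_pow_dvd_differentIdeal {K : Type*} [Field K] [NumberField K] {p k : ℕ} (hp : p.Prime)
    (hk : ¬ p ^ k ∣ (finrank ℚ K).factorial) {P Q : Ideal (𝓞 K)} (hP : Prime P) {e : ℕ}
    (he : e ≠ 0) (hPQ : span {(p : 𝓞 K)} = P ^ e * Q) (hQ : ¬ P ∣ Q) :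
    ¬ P ^ (e * k) ∣ differentIdeal ℤ (𝓞 K) := by
  intro h
  have hPQ' : P ^ (e * k) * Q ^ k = Ideal.map (algebraMap ℤ (𝓞 K)) (span {(p : ℤ) ^ k}) := by
    rw [Ideal.map_span, Set.image_singleton, pow_mul, ← mul_pow, ← hPQ, Ideal.span_singleton_pow]
    simp
  obtain ⟨y, hy, x, hx, hxy⟩ := Ideal.isCoprime_iff_exists.1 ((isCoprime_of_not_dvd hP hQ).pow_right (n := k))
  have hPp := isPrime_of_prime hP
  have hxP : x ∉ P := fun h1 => hPp.ne_top ((Ideal.eq_top_iff_one _).2 (hxy ▸ P.add_mem hy h1))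
  have h1 (j : ℕ) : (p ^ k : ℤ) ∣ Algebra.trace ℤ (𝓞 K) (x ^ (j + 1)) := by
    by_contra h2
    refine not_dvd_differentIdeal_of_intTrace_not_mem ℤ _ _ hPQ' (x ^ (j + 1))
      (Ideal.pow_mem_of_mem _ hx _ j.succ_pos) ?_ h
    rwa [Algebra.intTrace_eq_trace, Ideal.mem_span_singleton]
  have h2 := dvd_factorial_mul_pow x _ (pow_ne_zero k (by exact_mod_cast hp.ne_zero)) h1
  obtain ⟨v, m, hm, hv⟩ := Nat.exists_eq_pow_mul_and_not_dvd (Nat.factorial_ne_zero (finrank ℚ K)) p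
    hp.ne_one
  have hvk : v < k := by
    by_contra! h3
    exact hk (hv ▸ (pow_dvd_pow p h3).mul_right m)
  obtain ⟨u, rfl⟩ := Nat.exists_eq_add_of_lt hvk
  rw [hv] at h2
  push_cast at h2
  have h3 : (p : 𝓞 K) ∣ m * x ^ finrank ℚ K := by
    have hp0 : (p : 𝓞 K) ^ v ≠ 0 := pow_ne_zero _ (by exact_mod_cast hp.ne_zero)
    rw [mul_assoc, add_assoc, pow_add] at h2
    exact (dvd_pow_self _ u.succ_ne_zero).trans ((mul_dvd_mul_iff_left hp0).1 h2)
  have hpP : (p : 𝓞 K) ∈ P := by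
    rw [← Ideal.dvd_span_singleton, hPQ]
    exact (dvd_pow_self _ he).mul_right _
  have h4 := (hPp.mem_or_mem (P.mem_of_dvd h3 hpP)).resolve_right fun h5 => hxP (hPp.mem_of_pow_mem _ h5)
  have h6 : IsCoprime (p : 𝓞 K) m := by
    simpa using (Nat.isCoprime_iff_coprime.2 (hp.coprime_iff_not_dvd.2 hm)).map (castRingHom (𝓞 K))
  obtain ⟨a, b, hab⟩ := h6
  exact hPp.ne_top ((Ideal.eq_top_iff_one _).2 (hab ▸ P.add_mem (P.mul_mem_left _ hpP) (P.mul_mem_left _ h4)))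

theorem card_ringHom_add_le {K : Type*} [Field K] [NumberField K] {p k v m : ℕ} (hp : p.Prime)
    (hk : ¬ p ^ k ∣ (finrank ℚ K).factorial) (hv : (discr K).natAbs = p ^ v * m) (hm : ¬ p ∣ m)
    (κ : Type) [Field κ] [CharP κ p] (Z : Finset (𝓞 K →+* κ)) :
    v + Z.card ≤ finrank ℚ K * k := by
  set D := differentIdeal ℤ (𝓞 K)
  set I := (span {(p : 𝓞 K)}).radical
  have hp0 : (p : 𝓞 K) ≠ 0 := by exact_mod_cast hp.ne_zero
  have hpI : (p : 𝓞 K) ∈ I := Ideal.le_radical (Ideal.mem_span_singleton_self _)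
  have hD : D.absNorm = p ^ v * m := by rw [absNorm_differentIdeal K, hv]
  have hm0 : m ≠ 0 := by
    rintro rfl
    simp at hm
  have hD0 : D ≠ 0 := fun h => by
    rw [h] at hD
    simp [hp.ne_zero, hm0] at hD
  have hI0 : I ≠ 0 := fun h => hp0 (by simpa [h] using hpI)
  have hdvd : D * I ∣ span {((p ^ k * m : ℕ) : 𝓞 K)} := by
    rw [UniqueFactorizationMonoid.dvd_iff_emultiplicity_le (mul_ne_zero hD0 hI0)]
    intro P hP
    have hPp := isPrime_of_prime hP
    rw [emultiplicity_mul hP]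
    push_cast
    rw [← Ideal.span_singleton_mul_span_singleton, ← Ideal.span_singleton_pow]
    by_cases hPp' : P ∣ span {(p : 𝓞 K)}
    · have hfin : FiniteMultiplicity P (span {(p : 𝓞 K)}) :=
        FiniteMultiplicity.of_prime_left hP (by simpa using hp0)
      obtain ⟨Q, hQ, hQP⟩ := hfin.exists_eq_pow_mul_and_not_dvd
      set e := multiplicity P (span {(p : 𝓞 K)})
      have he : e ≠ 0 := fun h => by
        rw [h, pow_zero, one_mul] at hQ
        exact hQP (hQ ▸ hPp')
      have h1 : emultiplicity P D < (e * k : ℕ) :=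
        emultiplicity_lt_iff_not_dvd.2 (not_pow_dvd_differentIdeal hp hk hP he hQ hQP)
      have h2 : emultiplicity P I < (2 : ℕ) := by
        rw [emultiplicity_lt_iff_not_dvd]
        rintro ⟨J, hJ⟩
        have hle : P * J ≤ I := fun x hx => Ideal.radical_isRadical _ ⟨2, (?_ : x ^ 2 ∈ I)⟩
        · have h3 := dvd_iff_le.2 hle
          rw [hJ, sq, mul_assoc] at h3
          have hJ0 : P * J ≠ 0 := fun h4 => hI0 (by rw [hJ, sq, mul_assoc, h4, mul_zero])
          exact hP.not_isUnit (isUnit_of_dvd_one ((mul_dvd_mul_iff_right hJ0).1 (by rwa [one_mul])))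
        · rw [hJ]
          have h4 := Ideal.pow_mem_pow hx 2
          rw [mul_pow] at h4
          exact Ideal.mul_mono_right (Ideal.pow_le_self two_ne_zero) h4
      have h3 : ((e * k : ℕ) : ℕ∞) ≤
          emultiplicity P (span {(p : 𝓞 K)} ^ k * span {(m : 𝓞 K)}) := by
        refine le_emultiplicity_of_pow_dvd (Dvd.dvd.mul_right ?_ _)
        rw [pow_mul]
        exact pow_dvd_pow_of_dvd (hQ ▸ dvd_mul_right _ _) k
      refine le_trans ?_ h3
      obtain ⟨a, ha⟩ := ENat.ne_top_iff_exists.1 h1.ne_top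
      obtain ⟨b, hb⟩ := ENat.ne_top_iff_exists.1 h2.ne_top
      rw [← ha] at h1 ⊢
      rw [← hb] at h2 ⊢
      norm_cast at h1 h2 ⊢
      omega
    · have h1 : ¬ P ∣ I := fun h => hPp' (h.trans (dvd_iff_le.2 Ideal.le_radical))
      rw [emultiplicity_eq_zero.2 h1, add_zero]
      have h2 : D ∣ span {(p : 𝓞 K)} ^ v * span {(m : 𝓞 K)} := by
        rw [Ideal.span_singleton_pow, Ideal.span_singleton_mul_span_singleton, Ideal.dvd_span_singleton]
        have := Ideal.absNorm_mem D
        rw [hD] at this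
        exact_mod_cast this
      refine (emultiplicity_le_emultiplicity_of_dvd_right h2).trans ?_
      rw [emultiplicity_mul hP, emultiplicity_mul hP,
        emultiplicity_eq_zero.2 fun h => hPp' (hP.dvd_of_dvd_pow h), zero_add]
      exact le_add_self
  have hZ : p ^ Z.card ∣ I.absNorm := by
    rcases Z.eq_empty_or_nonempty with rfl | ⟨φ₀, -⟩
    · simp
    have hφ (φ : 𝓞 K →+* κ) (x) (hx : x ∈ I) : φ x = 0 := by
      have h1 : I ≤ RingHom.ker φ := ((RingHom.ker_isPrime φ).isRadical.radical_le_iff).2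
        ((Ideal.span_singleton_le_iff_mem _).2 (by simp [RingHom.mem_ker]))
      exact h1 hx
    have hI : Nontrivial (𝓞 K ⧸ I) := Ideal.Quotient.nontrivial_iff.2 fun h =>
      one_ne_zero ((map_one φ₀).symm.trans (hφ φ₀ 1 (h ▸ Submodule.mem_top)))
    have : Fact p.Prime := ⟨hp⟩
    have : CharP (𝓞 K ⧸ I) p := (CharP.charP_iff_prime_eq_zero hp).2
      (by simpa using Ideal.Quotient.eq_zero_iff_mem.2 hpI)
    let _ : Algebra (ZMod p) (𝓞 K ⧸ I) := ZMod.algebra _ p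
    let _ : Algebra (ZMod p) κ := ZMod.algebra _ p
    have : Finite (𝓞 K ⧸ I) := Ideal.finiteQuotientOfFreeOfNeBot I hI0
    let F (φ : Z) : (𝓞 K ⧸ I) →ₐ[ZMod p] κ :=
      { Ideal.Quotient.lift I φ.1 (hφ φ.1) with
        commutes' := fun r => RingHom.congr_fun (Subsingleton.elim
          ((Ideal.Quotient.lift I φ.1 (hφ φ.1)).comp (algebraMap (ZMod p) _)) (algebraMap _ κ)) r }
    have hF : Injective F := fun φ ψ h => Subtype.ext <| RingHom.ext fun x =>
      DFunLike.congr_fun h (Ideal.Quotient.mk I x)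
    have h1 := ((linearIndependent_algHom_toLinearMap (ZMod p) (𝓞 K ⧸ I) κ).comp F
      hF).fintype_card_le_finrank
    rw [card_coe, Module.finrank_linearMap_self] at h1
    rw [Ideal.absNorm_apply, Submodule.cardQuot_apply]
    have h2 := Module.natCard_eq_pow_finrank (K := ZMod p) (V := 𝓞 K ⧸ I)
    rw [Nat.card_zmod] at h2
    exact h2 ▸ pow_dvd_pow p h1
  have h1 := _root_.map_dvd Ideal.absNorm hdvd
  rw [map_mul, hD, Ideal.absNorm_span_natCast, RingOfIntegers.rank, mul_pow, ← pow_mul,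
    mul_comm k] at h1
  have h2 : p ^ (v + Z.card) ∣ p ^ (finrank ℚ K * k) * m ^ finrank ℚ K := by
    rw [pow_add]
    exact (mul_dvd_mul (dvd_mul_right _ _) hZ).trans h1
  have h3 := (Nat.Coprime.pow _ (finrank ℚ K) (hp.coprime_iff_not_dvd.2 hm)).dvd_of_dvd_mul_right h2
  exact (Nat.pow_dvd_pow_iff_le_right hp.one_lt).1 h3

end Ramification

section Residue
open NumberField

theorem exists_residue {p : ℕ} (hp : p.Prime) : ∃ (κ : Type) (_ : Field κ),
    CharP κ p ∧ Nonempty (integralClosure ℤ Qbar →+* κ) := by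
  obtain ⟨M, hM, hpM⟩ := exists_max_ideal_of_mem_nonunits (a := ((p : ℕ) : integralClosure ℤ Qbar)) (by
    rintro hu
    obtain ⟨y, hy⟩ := hu.exists_right_inv
    have h0 : (p : Qbar) ≠ 0 := by exact_mod_cast hp.ne_zero
    have h1 : (p : Qbar) * y = 1 := congrArg Subtype.val hy
    have h2 : algebraMap ℚ Qbar (p : ℚ)⁻¹ = y := by
      rw [map_inv₀, map_natCast]
      exact (eq_inv_of_mul_eq_one_right h1).symm
    have h3 : IsIntegral ℤ (algebraMap ℚ Qbar (p : ℚ)⁻¹) := h2 ▸ y.2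
    rw [isIntegral_algebraMap_iff (algebraMap ℚ Qbar).injective] at h3
    obtain ⟨z, hz⟩ := IsIntegrallyClosed.isIntegral_iff.1 h3
    have h4 : (z : ℚ) * p = 1 := by
      rw [show (z : ℚ) = (p : ℚ)⁻¹ from hz]
      exact inv_mul_cancel₀ (by exact_mod_cast hp.ne_zero)
    have h5 : z * p = 1 := by exact_mod_cast h4
    have := Int.isUnit_iff.1 (IsUnit.of_mul_eq_one_right _ h5)
    have := hp.two_le
    omega)
  refine ⟨_ ⧸ M, Ideal.Quotient.field M, (CharP.charP_iff_prime_eq_zero hp).2 ?_,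
    ⟨Ideal.Quotient.mk M⟩⟩
  rw [← map_natCast (Ideal.Quotient.mk M)]
  exact Ideal.Quotient.eq_zero_iff_mem.2 hpM

theorem exists_roots_mod {n p : ℕ} (K : IntermediateField ℚ Qbar) [NumberField K]
    (hK : finrank ℚ K = n) (hp : p.Prime) (hpn : n < p) {κ : Type} [Field κ] [CharP κ p]
    [DecidableEq κ] (φ : integralClosure ℤ Qbar →+* κ) (r : Fin n → Qbar) (hint : ∀ i, IsIntegral ℤ (r i))
    (hr : ∃ α : 𝓞 K, ∀ i, ∃ ι : K →ₐ[ℚ] Qbar, r i = ι α) (a : Fin n → ℤ)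
    (ha : coeffVec n (∏ j, (X - C (r j))) = fun i => (a i : Qbar)) :
    ∃ v : Fin n → κ, (univ.image v).card + (discr K).natAbs.factorization p ≤ n ∧
      ∀ i : Fin n, (∏ j, (X - C (v j))).coeff i = (a i : κ) := by
  classical
  obtain ⟨α, hα⟩ := hr
  choose ι hι using hα
  let w : Fin n → integralClosure ℤ Qbar := fun i => ⟨r i, hint i⟩
  let ψ : Fin n → 𝓞 K →+* κ := fun i => φ.comp
    (((ι i : K →+* Qbar).comp (algebraMap (𝓞 K) K)).codRestrict (integralClosure ℤ Qbar).toSubring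
      fun x => map_isIntegral_int (ι i) x.isIntegral_coe)
  refine ⟨fun i => φ (w i), ?_, fun i => ?_⟩
  · have h0 : (discr K).natAbs ≠ 0 := Int.natAbs_ne_zero.2 (discr_ne_zero K)
    have h1 := card_ringHom_add_le (K := K) (k := 1) hp (by
      rw [hK, pow_one, hp.dvd_factorial]; omega)
      (Nat.ordProj_mul_ordCompl_eq_self (discr K).natAbs p).symm (Nat.not_dvd_ordCompl hp h0) κ
      (univ.image ψ)
    have h2 : (univ.image fun i => φ (w i)) ⊆ (univ.image ψ).image fun f => f α := by
      intro x hx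
      obtain ⟨i, -, rfl⟩ := mem_image.1 hx
      refine mem_image.2 ⟨ψ i, mem_image_of_mem _ (mem_univ i), ?_⟩
      exact congrArg φ (Subtype.ext (hι i).symm)
    have h3 := (card_le_card h2).trans card_image_le
    rw [hK] at h1
    omega
  · have h1 : (∏ j, (X - C (w j))).coeff i = (a i : integralClosure ℤ Qbar) := by
      refine Subtype.ext ?_
      have h2 := congrFun (coeffVec_map (n := n) (algebraMap (integralClosure ℤ Qbar) Qbar)
        (∏ j, (X - C (w j)))) i
      refine (h2 : algebraMap _ _ _ = _).trans ?_
      rw [Polynomial.map_prod]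
      simp only [Polynomial.map_sub, map_X, map_C]
      exact (congrFun ha i).trans (by simp)
    have h2 := congrFun (coeffVec_map (n := n) φ (∏ j, (X - C (w j)))) i
    rw [Polynomial.map_prod] at h2
    simp only [Polynomial.map_sub, map_X, map_C, coeffVec] at h2
    rw [← h2, h1, map_intCast]

theorem exists_sq_eq_discr {n : ℕ} {G : Subgroup (Perm (Fin n))} (halt : G ≤ alternatingGroup (Fin n))
    (K : IntermediateField ℚ Qbar) [NumberField K] (hG : HasGalGroup n K G) :
    ∃ z : ℤ, discr K = z ^ 2 := by
  classical
  obtain ⟨e, he⟩ := hG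
  have hc : Fintype.card (Module.Free.ChooseBasisIndex ℤ (𝓞 K)) = Fintype.card (K →ₐ[ℚ] Qbar) := by
    rw [AlgHom.card, ← Module.finrank_eq_card_chooseBasisIndex, RingOfIntegers.rank]
  let f := (equivOfCardEq hc).trans e
  let b := (integralBasis K).reindex f
  have hd := Algebra.discr_eq_det_embeddingsMatrixReindex_pow_two ℚ Qbar b e.symm
  set N := Algebra.embeddingsMatrixReindex ℚ Qbar b e.symm with hN
  obtain ⟨z, hz⟩ := exists_int_of_fixed N.det (by
    refine IsIntegral.det fun i j => ?_
    have : b i = algebraMap (𝓞 K) K (RingOfIntegers.basis K (f.symm i)) := by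
      simp [b, integralBasis_apply]
    change IsIntegral ℤ (e.symm j (b i))
    rw [this]
    exact map_isIntegral_int (e.symm j) (RingOfIntegers.isIntegral_coe _)) fun g => by
      have h1 := halt ((he _).2 ⟨g, rfl⟩)
      have h2 := Matrix.det_permute' (Equiv.permCongr e (galAct K g)) N
      rw [Perm.mem_alternatingGroup.1 h1] at h2
      refine ((g : Qbar →+* Qbar).map_det N).trans (Eq.trans ?_ (h2.trans (by simp)))
      congr 1
      ext i j
      change g (e.symm j (b i)) = e.symm (Equiv.permCongr e (galAct K g) j) (b i)
      simp [galAct]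
  refine ⟨z, ?_⟩
  rw [← hz] at hd
  have h1 : Algebra.discr ℚ b = discr K := by
    rw [coe_discr, ← Algebra.discr_reindex ℚ (integralBasis K) f, ← Module.Basis.coe_reindex]
  rw [h1, eq_ratCast, Rat.cast_intCast] at hd
  exact_mod_cast hd

end Residue

theorem card_le_prod_layers {n : ℕ} (T : Finset (Fin n → ℤ)) (W : ℕ → ℝ) (hW : ∀ i, 0 ≤ W i)
    (h : ∀ i : Fin n, ∀ T' ⊆ T, (∀ a ∈ T', ∀ a' ∈ T', ∀ j > i, a j = a' j) →
      ((T'.image fun a => a i).card : ℝ) ≤ W i) : (T.card : ℝ) ≤ ∏ i ∈ range n, W i := by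
  suffices ∀ m ≤ n, ∀ T' ⊆ T, (∀ a ∈ T', ∀ a' ∈ T', ∀ j : Fin n, m ≤ j → a j = a' j) →
      (T'.card : ℝ) ≤ ∏ i ∈ range m, W i from
    this n le_rfl T subset_rfl fun _ _ _ _ j hj => absurd hj (by omega)
  intro m
  induction m with
  | zero =>
    intro _ T' _ hT'
    have : T'.card ≤ 1 := Finset.card_le_one.2 fun a ha a' ha' =>
      funext fun j => hT' a ha a' ha' j (Nat.zero_le _)
    simpa using this
  | succ m ih =>
    intro hm T' hT' hag
    have h1 := h ⟨m, hm⟩ T' hT' fun a ha a' ha' j hj => hag a ha a' ha' j hj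
    rw [card_eq_sum_card_image (fun a => a ⟨m, hm⟩) T', cast_sum, Finset.prod_range_succ]
    refine (sum_le_card_nsmul _ _ (∏ i ∈ range m, W i) fun x _ => ?_).trans ?_
    · refine ih (by omega) _ ((filter_subset _ _).trans hT') fun a ha a' ha' j hj => ?_
      rw [mem_filter] at ha ha'
      rcases eq_or_lt_of_le hj with hj | hj
      · rw [show j = ⟨m, hm⟩ from Fin.ext hj.symm, ha.2, ha'.2]
      · exact hag a ha.1 a' ha'.1 j hj
    · rw [nsmul_eq_mul, mul_comm]
      exact mul_le_mul_of_nonneg_left h1 (prod_nonneg fun i _ => hW i)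

theorem card_le_of_modEq {C N : ℕ} (hC : 0 < C) (hCN : C ≤ N) (S : Finset ℤ) (hN : ∀ x ∈ S, |x| ≤ N)
    (h : ∀ x ∈ S, ∀ y ∈ S, (C : ℤ) ∣ x - y) : S.card ≤ 4 * (N / C) := by
  have hC' : (0 : ℤ) < C := by exact_mod_cast hC
  have h1 : S.card ≤ (Icc (-(N : ℤ) / C) (N / C)).card :=
    card_le_card_of_injOn (· / (C : ℤ)) (fun x hx => by
      have := abs_le.1 (hN x hx)
      exact mem_coe.2 (mem_Icc.2
        ⟨Int.ediv_le_ediv hC' this.1, Int.ediv_le_ediv hC' this.2⟩)) fun x hx y hy hxy => by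
      have h3 : x % C = y % C := ModEq.symm ((Int.modEq_iff_dvd).2 (h x hx y hy))
      rw [← Int.mul_ediv_add_emod x C, ← Int.mul_ediv_add_emod y C, h3]
      rw [show x / (C : ℤ) = y / C from hxy]
  have h2 : 1 ≤ N / C := (Nat.one_le_div_iff hC).2 hCN
  have h3 : -((N / C : ℕ) : ℤ) - 1 ≤ -(N : ℤ) / C := by
    rw [Int.le_ediv_iff_mul_le hC']
    have : N < C * (N / C + 1) := Nat.lt_mul_div_succ N hC
    zify at this ⊢
    nlinarith
  rw [card_Icc] at h1
  have h4 : ((N / C : ℕ) : ℤ) = (N : ℤ) / C := by simp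
  omega

theorem card_layer_le {n c N : ℕ} (i : Fin n)
    (hc : ∀ (κ : Type) [Field κ] [DecidableEq κ], (n.factorial : κ) ≠ 0 → ∀ b : ℕ → κ,
      ∀ Z : Finset (Fin n → κ), (∀ v ∈ Z, (univ.image v).card ≤ n - 1 - i ∧
        ∀ j, n - (n - 1 - i) ≤ j → j < n → (∏ i, (X - C (v i))).coeff j = b j) → Z.card ≤ c)
    (T : Finset (Fin n → ℤ)) (I : Finset ℕ) (hI : ∀ p ∈ I, p.Prime ∧ n < p ∧
      ∃ (κ : Type) (_ : Field κ) (_ : DecidableEq κ), CharP κ p ∧ ∀ a ∈ T, ∃ v : Fin n → κ,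
        (univ.image v).card ≤ n - 1 - i ∧
        ∀ j : Fin n, (∏ l, (X - C (v l))).coeff j = (a j : κ))
    (hT : ∀ a ∈ T, ∀ a' ∈ T, ∀ j > i, a j = a' j) (hN : ∀ a ∈ T, |a i| ≤ N) (hI' : ∏ p ∈ I, p ≤ N) :
    ((T.image fun a => a i).card : ℝ) ≤ 4 * N / (∏ p ∈ I, p : ℕ) * c ^ I.card := by
  classical
  rcases T.eq_empty_or_nonempty with rfl | ⟨a₀, ha₀⟩
  · simp only [Finset.image_empty, card_empty, cast_zero]
    positivity
  have hC : 0 < ∏ p ∈ I, p := prod_pos fun p hp => (hI p hp).1.pos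
  have h1 := card_le_of_cells (β := fun p => ZMod p) (T.image fun a => a i) I (fun p x => (x : ZMod p))
    c (4 * (N / ∏ p ∈ I, p)) (fun p hp => by
      obtain ⟨hpp, hnp, κ, _, _, _, hv⟩ := hI p hp
      choose! v hv1 hv2 using hv
      rw [← Finset.card_image_of_injective _ (ZMod.castHom_injective (n := p) κ)]
      refine le_trans (card_le_card (t := (T.image v).image fun u =>
        (∏ l, (X - C (u l))).coeff i) ?_) (card_image_le.trans
        (hc κ ?_ (fun j => if hj : j < n then (a₀ ⟨j, hj⟩ : κ) else 0) (T.image v) ?_))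
      · intro x hx
        simp only [mem_image] at hx
        obtain ⟨_, ⟨_, ⟨a, ha, rfl⟩, rfl⟩, rfl⟩ := hx
        rw [map_intCast]
        exact mem_image.2 ⟨v a, mem_image_of_mem _ ha, hv2 a ha i⟩
      · rw [Ne, CharP.cast_eq_zero_iff κ p, hpp.dvd_factorial]
        omega
      · intro u hu
        obtain ⟨a, ha, rfl⟩ := mem_image.1 hu
        refine ⟨hv1 a ha, fun j hj hjn => ?_⟩
        rw [dif_pos hjn, hv2 a ha ⟨j, hjn⟩, hT a ha a₀ ha₀ ⟨j, hjn⟩ (Fin.lt_def.2 (by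
          have := i.2; simp only; omega))])
    fun S' hS' hcong => card_le_of_modEq hC hI' S' (fun x hx => by
      obtain ⟨a, ha, rfl⟩ := mem_image.1 (hS' hx)
      exact hN a ha) fun x hx y hy => by
        rw [Nat.cast_prod]
        refine prod_dvd_of_coprime (fun p hp q hq hpq => ?_) fun p hp => ?_
        · exact Nat.isCoprime_iff_coprime.2 ((Nat.coprime_primes (hI p hp).1 (hI q hq).1).2 hpq)
        · rw [← ZMod.intCast_zmod_eq_zero_iff_dvd, Int.cast_sub, sub_eq_zero]
          exact hcong p hp x hx y hy
  calc ((T.image fun a => a i).card : ℝ) ≤ (4 * (N / ∏ p ∈ I, p) : ℕ) * (c : ℝ) ^ I.card := by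
        exact_mod_cast h1
    _ ≤ _ := by
        gcongr
        rw [cast_mul, mul_div_assoc]
        gcongr
        · norm_num
        · exact Nat.cast_div_le

theorem pow_card_primeFactors_le (c : ℕ) (ε : ℝ) (hε : 0 < ε) : ∃ C : ℝ, 0 ≤ C ∧ ∀ Y : ℕ, Y ≠ 0 →
    ((c + 1 : ℕ) : ℝ) ^ Y.primeFactors.card ≤ C * (Y : ℝ) ^ ε := by
  set P := ⌈((c + 1 : ℕ) : ℝ) ^ ε⁻¹⌉₊ with hP
  refine ⟨((c + 1 : ℕ) : ℝ) ^ P, by positivity, fun Y hY => ?_⟩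
  have hd : ∏ p ∈ Y.primeFactors with ¬ p < P, p ∣ Y :=
    (Finset.prod_dvd_prod_of_subset _ _ _ (filter_subset _ _)).trans (Nat.prod_primeFactors_dvd Y)
  have hc : (1 : ℝ) ≤ (c + 1 : ℕ) := by simp
  rw [← Finset.card_filter_add_card_filter_not (s := Y.primeFactors) (· < P), pow_add]
  refine mul_le_mul (pow_le_pow_right₀ hc ?_) ?_ (by positivity) (by positivity)
  · refine (card_le_card (t := range P) fun p hp => ?_).trans (card_range P).le
    exact mem_range.2 (mem_filter.1 hp).2
  · refine le_trans ?_ (rpow_le_rpow (cast_nonneg _)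
      (cast_le.2 (le_of_dvd (Nat.pos_of_ne_zero hY) hd)) hε.le)
    rw [Nat.cast_prod, ← Real.finsetProd_rpow _ _ fun i _ => cast_nonneg _, ← prod_const]
    refine Finset.prod_le_prod (fun _ _ => by positivity) fun p hp => ?_
    have h1 : ((c + 1 : ℕ) : ℝ) ^ ε⁻¹ ≤ p := (le_ceil _).trans
      (cast_le.2 (not_lt.1 (mem_filter.1 hp).2))
    have h2 := rpow_le_rpow (by positivity) h1 hε.le
    rwa [← rpow_mul (by positivity), inv_mul_cancel₀ hε.ne', rpow_one] at h2

theorem exists_card_vectors_le (m : ℕ) (hm : 2 ≤ m) : ∃ c M : ℕ, ∀ (Y H : ℕ) (T : Finset (Fin (m + 1) → ℤ)),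
    Y ≠ 0 → IsSquare Y → Y ≤ H ^ (2 * m) → (∀ p, p.Prime → Y.factorization p ≤ (m + 1) ^ 2) →
    (∀ p, p.Prime → m + 1 < p → ∃ (κ : Type) (_ : Field κ) (_ : DecidableEq κ), CharP κ p ∧
      ∀ a ∈ T, ∃ v : Fin (m + 1) → κ, (univ.image v).card + Y.factorization p ≤ m + 1 ∧
        ∀ j : Fin (m + 1), (∏ l, (X - C (v l))).coeff j = (a j : κ)) →
    (∀ a ∈ T, ∀ i, |a i| ≤ (H : ℤ) ^ (m + 1 - (i : ℕ))) →
    (∀ a ∈ T, ∀ i : Fin (m + 1), (i : ℕ) = m → a i = 0) →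
    (T.card : ℝ) ≤ M * (((c + 1 : ℕ) : ℝ) ^ Y.primeFactors.card) ^ m *
      (H : ℝ) ^ (∑ i ∈ range m, (m + 1 - i)) / Y := by
  classical
  choose c₀ hc₀ using fun k : Fin (m + 1) => exists_card_prefix_fibre_le (m + 1) k k.2.le
  refine ⟨∑ k, c₀ k, 4 ^ m * ((m + 1) ^ (m + 1) ^ 2) ^ (m + 2), fun Y H T hY hsq hYH hv hT hbd htop => ?_⟩
  set c := ∑ k, c₀ k
  rcases T.eq_empty_or_nonempty with rfl | ⟨a₀, ha₀⟩
  · rw [card_empty, cast_zero]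
    positivity
  let I : ℕ → Finset ℕ := fun i => {p ∈ Y.primeFactors | m + 1 < p ∧ i < Y.factorization p}
  have hIp : ∀ {i p}, p ∈ I i → p.Prime ∧ m + 1 < p ∧ i < Y.factorization p := fun h =>
    ⟨Nat.prime_of_mem_primeFactors (mem_filter.1 h).1, (mem_filter.1 h).2⟩
  have hCpos : ∀ i, 0 < ∏ p ∈ I i, p := fun i => prod_pos fun p hp => (hIp hp).1.pos
  have hYprod : ∏ p ∈ Y.primeFactors, p ^ Y.factorization p = Y := Nat.prod_factorization_pow_eq_self hY
  have hC : ∀ i < m, ∏ p ∈ I i, p ≤ H ^ (m + 1 - i) := by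
    intro i hi
    set e := max 2 (i + 1) with he
    have h1 : (∏ p ∈ I i, p) ^ e ∣ Y := by
      rw [← prod_pow]
      conv_rhs => rw [← hYprod]
      refine (Finset.prod_dvd_prod_of_dvd _ (fun p => p ^ Y.factorization p) fun p hp =>
        pow_dvd_pow p ?_).trans (Finset.prod_dvd_prod_of_subset _ _ _ (filter_subset _ _))
      obtain ⟨y, rfl⟩ := hsq
      have hy : y ≠ 0 := fun h => hY (by simp [h])
      have h2 := (hIp hp).2.2
      rw [Nat.factorization_mul hy hy, Finsupp.add_apply] at h2 ⊢
      omega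
    have h2 : 2 * m ≤ (m + 1 - i) * e := by
      rcases Nat.eq_zero_or_pos i with rfl | h0
      · simp [he]; omega
      · obtain ⟨s, rfl⟩ := Nat.exists_eq_add_of_le h0
        obtain ⟨t, rfl⟩ := Nat.exists_eq_add_of_lt hi
        rw [he, max_eq_right (by omega), show 1 + s + t + 1 + 1 - (1 + s) = t + 2 by omega]
        nlinarith
    have hH : 0 < H := Nat.pos_of_ne_zero fun h => hY (by
      rw [h, zero_pow (by omega)] at hYH; omega)
    refine le_of_not_gt fun h3 => ?_
    have h4 := Nat.pow_lt_pow_left h3 (show e ≠ 0 by omega)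
    rw [← pow_mul] at h4
    have h5 := le_of_dvd (Nat.pos_of_ne_zero hY) h1
    have h6 := Nat.pow_le_pow_right hH h2
    omega
  have hvp : ∀ p ∈ Y.primeFactors, m + 1 < p → Y.factorization p ≤ m := fun p hp hpm => by
    obtain ⟨κ, _, _, _, h⟩ := hT p (Nat.prime_of_mem_primeFactors hp) hpm
    obtain ⟨v, h1, -⟩ := h a₀ ha₀
    have : 0 < (univ.image v).card := Finset.card_pos.2 (Finset.univ_nonempty.image v)
    omega
  have hYC : Y ≤ ((m + 1) ^ (m + 1) ^ 2) ^ (m + 2) * ∏ i ∈ range m, ∏ p ∈ I i, p := by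
    conv_lhs => rw [← hYprod, ← Finset.prod_filter_not_mul_prod_filter Y.primeFactors (m + 1 < ·)]
    refine Nat.mul_le_mul ?_ ?_
    · refine (prod_le_pow_card _ _ ((m + 1) ^ (m + 1) ^ 2) fun p hp => ?_).trans
        (Nat.pow_le_pow_right (by positivity) ?_)
      · have h1 := (mem_filter.1 hp).2
        exact (Nat.pow_le_pow_left (not_lt.1 h1) _).trans (Nat.pow_le_pow_right (by omega)
          (hv p (Nat.prime_of_mem_primeFactors (mem_filter.1 hp).1)))
      · refine (card_le_card (t := range (m + 2)) fun p hp => ?_).trans (card_range _).le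
        have h1 := (mem_filter.1 hp).2
        exact mem_range.2 (by omega)
    · simp only [I, ← Finset.filter_filter]
      simp only [fun i => prod_filter (s := {p ∈ Y.primeFactors | m + 1 < p})
        (fun p => i < Y.factorization p) fun p => p]
      rw [Finset.prod_comm]
      refine (prod_congr rfl fun p hp => ?_).le
      rw [mem_filter] at hp
      rw [← prod_filter, prod_const]
      congr 1
      have h1 := hvp p hp.1 hp.2
      rw [show ({i ∈ range m | i < Y.factorization p}) = range (Y.factorization p) by
        ext i; simp only [mem_filter, mem_range]; omega, card_range]
  set w : ℝ := ((c + 1 : ℕ) : ℝ) ^ Y.primeFactors.card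
  have h1 := card_le_prod_layers T
    (fun i => if i < m then 4 * ((H ^ (m + 1 - i) : ℕ) : ℝ) / (∏ p ∈ I i, p : ℕ) * w else 1)
    (fun i => by split_ifs <;> positivity) fun i T' hT' hag => by
      by_cases hi : (i : ℕ) < m
      · rw [if_pos hi]
        refine (card_layer_le (N := H ^ (m + 1 - i)) i (hc₀ ⟨m - i, by omega⟩) T' (I i) (fun p hp => ?_) hag
          (fun a ha => ?_) (hC i hi)).trans ?_
        · obtain ⟨hp1, hp2, hp3⟩ := hIp hp
          obtain ⟨κ, iF, iD, iC, h⟩ := hT p hp1 hp2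
          refine ⟨hp1, hp2, κ, iF, iD, iC, fun a ha => ?_⟩
          obtain ⟨v, h1, h2⟩ := h a (hT' ha)
          exact ⟨v, by omega, h2⟩
        · exact_mod_cast hbd a (hT' ha) i
        · refine mul_le_mul_of_nonneg_left ?_ (by positivity)
          refine (pow_le_pow_left₀ (cast_nonneg _) (cast_le.2 ?_) _).trans
            (pow_le_pow_right₀ (by simp) (card_le_card (filter_subset _ _)))
          exact (single_le_sum (fun _ _ => Nat.zero_le _) (mem_univ _)).trans (Nat.le_succ c)
      · rw [if_neg hi]
        have : (T'.image fun a => a i).card ≤ 1 := Finset.card_le_one.2 fun x hx y hy => by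
          obtain ⟨a, ha, rfl⟩ := mem_image.1 hx
          obtain ⟨b, hb, rfl⟩ := mem_image.1 hy
          rw [htop a (hT' ha) i (by omega), htop b (hT' hb) i (by omega)]
        exact_mod_cast this
  rw [Finset.prod_range_succ, if_neg (lt_irrefl m), mul_one] at h1
  refine h1.trans ?_
  rw [prod_congr rfl fun i hi => if_pos (mem_range.1 hi), prod_mul_distrib,
    prod_const, card_range, Finset.prod_div_distrib, prod_mul_distrib,
    prod_const, card_range]
  simp only [Nat.cast_pow]
  rw [prod_pow_eq_pow_sum]
  have hP : 0 < ∏ i ∈ range m, ((∏ p ∈ I i, p : ℕ) : ℝ) :=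
    prod_pos fun i _ => cast_pos.2 (hCpos i)
  have hYR : (Y : ℝ) ≤ ((m + 1 : ℝ) ^ (m + 1) ^ 2) ^ (m + 2) * ∏ i ∈ range m, ((∏ p ∈ I i, p : ℕ) : ℝ) := by
    exact_mod_cast hYC
  have hY0 : (0 : ℝ) < Y := cast_pos.2 (Nat.pos_of_ne_zero hY)
  rw [div_mul_eq_mul_div, div_le_div_iff₀ hP hY0]
  calc _ ≤ 4 ^ m * (H : ℝ) ^ (∑ i ∈ range m, (m + 1 - i)) * w ^ m * _ :=
        mul_le_mul_of_nonneg_left hYR (by positivity)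
    _ = _ := by push_cast; ring

section PrimitiveSquare
open NumberField

theorem card_fields_of_discr_le (m : ℕ) (hm : 2 ≤ m) (G : Subgroup (Perm (Fin (m + 1))))
    (halt : G ≤ alternatingGroup (Fin (m + 1))) (ε : ℝ) (hε : 0 < ε) :
    ∃ B : ℝ, 0 ≤ B ∧ ∀ Y : ℕ, Y ≠ 0 → ∀ S : Finset (IntermediateField ℚ Qbar),
      (∀ K ∈ S, finrank ℚ K = m + 1 ∧ (fieldDiscr K).natAbs = Y ∧ HasGalGroup (m + 1) K G ∧
        ∀ k, k < K → k = ⊥) → (S.card : ℝ) ≤ B * (Y : ℝ) ^ (((m : ℝ) + 3) / 4 - 1 + ε) := by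
  classical
  obtain ⟨c, M, hcM⟩ := exists_card_vectors_le m hm
  have hm0 : (0 : ℝ) < m := by exact_mod_cast (by omega : 0 < m)
  obtain ⟨C₁, hC₁, hω⟩ := pow_card_primeFactors_le c (ε / m) (by positivity)
  obtain ⟨C₂, hC₂, hX⟩ := exists_height (m + 1) (by omega) 1
  set e := ∑ i ∈ range m, (m + 1 - i) with he
  have hes : ∀ k ≤ m, 2 * ∑ i ∈ range k, ((m : ℝ) + 1 - i) = k * (2 * m + 3 - k) := fun k _ => by
    induction k with
    | zero => simp
    | succ k ih => rw [sum_range_succ, mul_add, ih (by omega)]; push_cast; ring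
  have hes' : (e : ℝ) = m * (m + 3) / 2 := by
    have h1 := hes m le_rfl
    rw [he, cast_sum, sum_congr rfl fun i hi => by
      rw [cast_sub (by have := mem_range.1 hi; omega)]]
    push_cast
    linarith
  refine ⟨(m + 1) * (M * C₁ ^ m * C₂ ^ e), by positivity, fun Y hY S hS => ?_⟩
  have hY1 : (1 : ℝ) ≤ Y := by exact_mod_cast Nat.one_le_iff_ne_zero.2 hY
  obtain ⟨s, H, hs, hYs, -, hH1, hBH, hHY⟩ := hX Y hY1
  rcases S.eq_empty_or_nonempty with rfl | ⟨K₀, hK₀⟩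
  · rw [card_empty, cast_zero]
    positivity
  have hNF : ∀ K ∈ S, NumberField K := fun K hK => by
    have : FiniteDimensional ℚ K := of_finrank_pos (by rw [(hS K hK).1]; omega)
    exact ⟨⟩
  have hdata : ∀ K ∈ S, ∃ (r : Fin (m + 1) → Qbar) (a : Fin (m + 1) → ℤ),
      (∃ i, adjoin ℚ {r i} = K) ∧
      (coeffVec (m + 1) (∏ j, (X - C (r j))) = fun i => (a i : Qbar)) ∧
      (∀ i, |a i| ≤ (H : ℤ) ^ (m + 1 - (i : ℕ))) ∧ (∀ i : Fin (m + 1), (i : ℕ) = m → a i = 0) ∧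
      ∀ (p : ℕ) (κ : Type) [Field κ] [CharP κ p] [DecidableEq κ], p.Prime → m + 1 < p →
        ∀ φ : integralClosure ℤ Qbar →+* κ,
        ∃ v : Fin (m + 1) → κ, (univ.image v).card + Y.factorization p ≤ m + 1 ∧
          ∀ j : Fin (m + 1), (∏ l, (X - C (v l))).coeff j = (a j : κ) := by
    intro K hK
    have := hNF K hK
    obtain ⟨h1, h2, h3, h4⟩ := hS K hK
    rw [fieldDiscr_eq] at h2
    obtain ⟨r, hadj, -, hint, hα, -, a, ha, hbd, htop⟩ :=
      exists_vector_data (by omega) K h1 h3 h4 hs (by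
        rw [← cast_abs, abs_eq_natAbs, h2]
        exact_mod_cast hYs) hBH
    exact ⟨r, a, hadj, ha, hbd, htop, fun p κ _ _ _ hp hpm φ =>
      h2 ▸ exists_roots_mod K h1 hp hpm φ r hint hα a ha⟩
  choose! r a hadj ha hbd htop hv using hdata
  have hforall : ∀ P : (Fin (m + 1) → ℤ) → Prop, (∀ K ∈ S, P (a K)) → ∀ b ∈ S.image a, P b := by
    intro P hP b hb
    obtain ⟨K, hK, rfl⟩ := mem_image.1 hb
    exact hP K hK
  have h1 := card_fields_le_card_coeff (n := m + 1) S (S.image a) fun K hK =>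
    ⟨r K, hadj K hK, a K, mem_image_of_mem _ hK, ha K hK⟩
  obtain ⟨h01, h02, h03, -⟩ := hS K₀ hK₀
  have := hNF K₀ hK₀
  rw [fieldDiscr_eq] at h02
  have hsH : s ≤ H := by
    have h3 : s ≤ ((m + 1 : ℕ) : ℝ) * s := le_mul_of_one_le_left hs.le (by simp)
    have h4 : (1 : ℝ) ≤ 2 ^ (m + 1) := one_le_pow₀ one_le_two
    nlinarith
  have h2 := hcM Y H (S.image a) hY
    (by
      obtain ⟨z, hz⟩ := exists_sq_eq_discr halt K₀ h03
      exact ⟨z.natAbs, by rw [← h02, hz, Int.natAbs_pow, sq]⟩)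
    (by
      have h3 := hYs.le.trans (pow_le_pow_left₀ hs.le hsH _)
      exact_mod_cast h3)
    (fun p hp => by
      have : Fact p.Prime := ⟨hp⟩
      have h3 := card_ringHom_add_le (K := K₀) (k := m + 1) hp (by
        rw [h01]
        intro h4
        have h5 := (padicValNat_dvd_iff_le (Nat.factorial_ne_zero _)).1 h4
        exact absurd (padicValNat_factorial_lt_of_ne_zero p (Nat.succ_ne_zero m)) (not_lt.2 h5))
        (Nat.ordProj_mul_ordCompl_eq_self (discr K₀).natAbs p).symm
        (Nat.not_dvd_ordCompl hp (h02 ▸ hY)) (AlgebraicClosure (ZMod p)) ∅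
      rw [h02, h01] at h3
      simpa [sq] using h3)
    (fun p hp hpm => by
      obtain ⟨κ, iF, iC, ⟨φ⟩⟩ := exists_residue hp
      exact ⟨κ, iF, Classical.decEq κ, iC, hforall _ fun K hK => hv K hK p κ hp hpm φ⟩)
    (hforall _ hbd) (hforall _ htop)
  have hHR : (H : ℝ) ^ e ≤ C₂ ^ e * (Y : ℝ) ^ (((m : ℝ) + 3) / 4) := by
    refine (pow_le_pow_left₀ (cast_nonneg _) hHY _).trans_eq ?_
    rw [mul_pow, ← Real.rpow_mul_natCast (cast_nonneg _), hes']
    congr 2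
    push_cast
    rw [add_sub_cancel_right]
    field_simp
    norm_num
  have hwR : (((c + 1 : ℕ) : ℝ) ^ Y.primeFactors.card) ^ m ≤ C₁ ^ m * (Y : ℝ) ^ ε := by
    refine (pow_le_pow_left₀ (by positivity) (hω Y hY) _).trans_eq ?_
    rw [mul_pow, ← Real.rpow_mul_natCast (cast_nonneg _), div_mul_cancel₀ _ hm0.ne']
  have hsplit : (Y : ℝ) ^ (((m : ℝ) + 3) / 4 - 1 + ε) = (Y : ℝ) ^ (((m : ℝ) + 3) / 4) * (Y : ℝ) ^ ε / Y := by
    rw [rpow_add (by linarith), Real.rpow_sub_one (by linarith)]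
    ring
  calc (S.card : ℝ) ≤ (m + 1) * (S.image a).card := by exact_mod_cast h1
    _ ≤ (m + 1) * (M * (C₁ ^ m * (Y : ℝ) ^ ε) * (C₂ ^ e * (Y : ℝ) ^ (((m : ℝ) + 3) / 4)) / Y) := by
        refine mul_le_mul_of_nonneg_left (h2.trans ?_) (by positivity)
        gcongr
    _ = _ := by
        rw [hsplit]
        ring

theorem card_primitive_fields_le_of_le_alternatingGroup (n : ℕ) (hn : 3 ≤ n) (G : Subgroup (Perm (Fin n)))
    (halt : G ≤ alternatingGroup (Fin n)) (ε : ℝ) (hε : 0 < ε) :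
    ∃ B : ℝ, 0 ≤ B ∧ ∀ D : ℝ, 1 ≤ D → ∀ S : Finset (IntermediateField ℚ Qbar),
      (∀ K ∈ S, finrank ℚ K = n ∧ |(fieldDiscr K : ℝ)| ≤ D ∧ HasGalGroup n K G ∧
        ∀ k, k < K → k = ⊥) → (S.card : ℝ) ≤ B * D ^ (((n : ℝ) + 2) / 4 - 1 / 2 + ε) := by
  classical
  obtain ⟨m, rfl⟩ : ∃ m, n = m + 1 := ⟨n - 1, by omega⟩
  obtain ⟨B, hB, h⟩ := card_fields_of_discr_le m (by omega) G halt ε hε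
  have hm : (2 : ℝ) ≤ m := by exact_mod_cast (by omega : 2 ≤ m)
  refine ⟨2 * B, by positivity, fun D hD S hS => ?_⟩
  set E := ((m : ℝ) + 3) / 4 - 1 + ε
  have hE : 0 ≤ E := by simp only [E]; linarith
  have hroot : ∀ K ∈ S, ∃ z : ℕ, z ≠ 0 ∧ (fieldDiscr K).natAbs = z ^ 2 := fun K hK => by
    obtain ⟨h1, -, h3, -⟩ := hS K hK
    have : FiniteDimensional ℚ K := of_finrank_pos (by omega)
    have : NumberField K := ⟨⟩
    obtain ⟨z, hz⟩ := exists_sq_eq_discr halt K h3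
    refine ⟨z.natAbs, fun h0 => discr_ne_zero K ?_, by rw [fieldDiscr_eq, hz, Int.natAbs_pow]⟩
    rw [hz, Int.natAbs_eq_zero.1 h0, zero_pow two_ne_zero]
  choose! z hz hzK using hroot
  have hzD : ∀ K ∈ S, (((z K) ^ 2 : ℕ) : ℝ) ≤ D := fun K hK => by
    rw [← hzK K hK, Nat.cast_natAbs, cast_abs]
    exact (hS K hK).2.1
  have h1 : S.card = ∑ b ∈ S.image z, {K ∈ S | z K = b}.card := card_eq_sum_card_image _ _
  have h2 : ((S.image z).card : ℝ) ≤ 2 * √D := by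
    have h3 : (S.image z).card ≤ ⌊√D⌋₊ + 1 := by
      refine (card_le_card (t := range (⌊√D⌋₊ + 1)) fun b hb => ?_).trans (card_range _).le
      obtain ⟨K, hK, rfl⟩ := mem_image.1 hb
      rw [mem_range, Nat.lt_succ_iff]
      refine Nat.le_floor (Real.le_sqrt_of_sq_le ?_)
      exact_mod_cast hzD K hK
    have h4 : ((S.image z).card : ℝ) ≤ ⌊√D⌋₊ + 1 := by exact_mod_cast h3
    have h5 := Nat.floor_le (sqrt_nonneg D)
    have h6 : 1 ≤ √D := Real.one_le_sqrt.2 hD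
    linarith
  have h3 : (S.card : ℝ) ≤ ∑ b ∈ S.image z, B * D ^ E := by
    rw [h1, cast_sum]
    refine sum_le_sum fun b hb => ?_
    obtain ⟨K, hK, rfl⟩ := mem_image.1 hb
    refine (h ((z K) ^ 2) (pow_ne_zero _ (hz K hK)) _ fun L hL => ?_).trans ?_
    · obtain ⟨hL1, hL2⟩ := mem_filter.1 hL
      obtain ⟨g1, -, g3, g4⟩ := hS L hL1
      exact ⟨g1, by rw [hzK L hL1, hL2], g3, g4⟩
    · exact mul_le_mul_of_nonneg_left (rpow_le_rpow (cast_nonneg _) (hzD K hK) hE) hB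
  rw [sum_const, nsmul_eq_mul] at h3
  refine h3.trans ((mul_le_mul_of_nonneg_right h2 (by positivity)).trans_eq ?_)
  rw [show (((m + 1 : ℕ) : ℝ) + 2) / 4 - 1 / 2 + ε = 1 / 2 + E by simp only [E]; push_cast; ring,
    rpow_add (by linarith) (1 / 2) E, Real.sqrt_eq_rpow]
  ring

end PrimitiveSquare

theorem card_le_of_transitive {n : ℕ} (hn : 0 < n) {G : Subgroup (Perm (Fin n))} (h : IsTransitiveSub G) :
    n ≤ Nat.card G := by
  refine (Nat.card_fin n).ge.trans (Nat.card_le_card_of_surjective (fun σ : G => (σ : Perm (Fin n)) ⟨0, hn⟩) fun y => by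
    obtain ⟨σ, hσ, hy⟩ := h ⟨0, hn⟩ y
    exact ⟨⟨σ, hσ⟩, hy⟩)

theorem natCard_le_of_finset_le {α : Type*} {p : α → Prop} {b : ℝ} (hb : 0 ≤ b)
    (h : ∀ S : Finset α, (∀ x ∈ S, p x) → (S.card : ℝ) ≤ b) : (Nat.card {x // p x} : ℝ) ≤ b := by
  rcases finite_or_infinite {x // p x} with hf | hi
  · have := ofFinite {x // p x}
    rw [Nat.card_eq_fintype_card, ← card_univ, ← Finset.card_map (Function.Embedding.subtype p)]
    refine h _ fun x hx => ?_
    obtain ⟨y, -, rfl⟩ := Finset.mem_map.1 hx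
    exact y.2
  · simpa using hb

theorem exponent_eq {n d : ℝ} (hn : 6 ≤ n) (hd : 0 < d) :
    (n * (n - 3) / 2 + (√(n * (n - 1) / d) + n / 2)) / (2 * (n - 1)) =
      (n + 2) / 4 - 1 - 1 / (2 * n - 2) + √(n / (4 * (n - 1) * d)) + n / (4 * n - 4) := by
  have h1 : n - 1 ≠ 0 := by linarith
  have h2 : √(n * (n - 1) / d) = 2 * (n - 1) * √(n / (4 * (n - 1) * d)) := by
    rw [← sqrt_sq (show 0 ≤ 2 * (n - 1) by linarith), ← sqrt_mul (sq_nonneg _)]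
    congr 1
    field_simp
    ring
  rw [h2, show 2 * n - 2 = 2 * (n - 1) by ring, show 4 * n - 4 = 4 * (n - 1) by ring]
  field_simp
  ring

theorem exponent_ge {n : ℝ} (hn : 6 ≤ n) : n / 4 ≤
    (n + 2) / 4 - 1 - 1 / (2 * n - 2) + √(n / (4 * (n - 1) * 2)) + n / (4 * n - 4) := by
  have h1 : 0 < n - 1 := by linarith
  have h2 : n / (4 * (n - 1)) ≤ √(n / (4 * (n - 1) * 2)) := Real.le_sqrt_of_sq_le (by
    rw [div_pow, div_le_div_iff₀ (by positivity) (by positivity)]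
    nlinarith [mul_pos (mul_pos h1 h1) (by linarith : 0 < n), mul_pos h1 (by linarith : 0 < n)])
  have h3 : n / 4 = (n + 2) / 4 - 1 - 1 / (2 * n - 2) + n / (4 * (n - 1)) + n / (4 * n - 4) := by
    rw [show 2 * n - 2 = 2 * (n - 1) by ring, show 4 * n - 4 = 4 * (n - 1) by ring]
    field_simp
    ring
  linarith

theorem imprimitive_exponent_le {n : ℕ} (hn : 6 ≤ n) {G : Subgroup (Perm (Fin n))}
    (h : IsTransitiveSub G) : ((n : ℝ) + 4) / 8 ≤ (n + 2) / 4 - 1 - 1 / (2 * n - 2) +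
      √((n : ℝ) / (4 * (n - 1) * G.index)) + n / (4 * n - 4) := by
  have hn' : (6 : ℝ) ≤ n := by exact_mod_cast hn
  have h1 : (0 : ℝ) < n - 1 := by linarith
  have h2 : ((n : ℝ) + 2) / 4 - 1 - 1 / (2 * n - 2) + n / (4 * n - 4) =
      (n - 2) / 4 + (n - 2) / (4 * (n - 1)) := by
    rw [show (2 : ℝ) * n - 2 = 2 * (n - 1) by ring, show (4 : ℝ) * n - 4 = 4 * (n - 1) by ring]
    field_simp
    ring
  have h3 : 0 ≤ ((n : ℝ) - 2) / (4 * (n - 1)) := div_nonneg (by linarith) (by linarith)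
  have h4 := sqrt_nonneg ((n : ℝ) / (4 * (n - 1) * G.index))
  obtain rfl | rfl | h8 : n = 6 ∨ n = 7 ∨ 8 ≤ n := by omega
  · have h5 : (1 / 20 : ℝ) ≤ √(((6 : ℕ) : ℝ) / (4 * ((6 : ℕ) - 1) * G.index)) := by
      have h6 := card_le_of_transitive (by norm_num) h
      have h7 := G.index_mul_card
      rw [Nat.card_perm, Nat.card_fin, show Nat.factorial 6 = 720 by decide] at h7
      have h9 : G.index ≤ 120 := by nlinarith
      have h10 : (0 : ℝ) < G.index := cast_pos.2 (Nat.pos_of_ne_zero fun h => by simp [h] at h7)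
      have h11 : (G.index : ℝ) ≤ 120 := by exact_mod_cast h9
      refine Real.le_sqrt_of_sq_le ?_
      rw [le_div_iff₀ (by push_cast; linarith)]
      push_cast
      linarith
    push_cast at *
    linarith
  · push_cast at *
    linarith
  · have : (8 : ℝ) ≤ n := by exact_mod_cast h8
    linarith

theorem even_index {n : ℕ} (hn : 2 ≤ n) {G : Subgroup (Perm (Fin n))} (h : G ≤ alternatingGroup (Fin n)) :
    2 ∣ G.index := by
  have : Nontrivial (Fin n) := Fin.nontrivial_iff_two_le.2 hn
  rw [← alternatingGroup.index_eq_two (α := Fin n)]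
  exact Subgroup.index_dvd_of_le h

theorem enumerative_galois_even (n : ℕ) (hn : 6 ≤ n)
    (G : Subgroup (Perm (Fin n)))
    (htrans : IsTransitiveSub G) (hproper : G ≠ ⊤)
    (halt : G ≤ alternatingGroup (Fin n))
    (hshape : ∀ m : ℕ, Odd m → 0 < m → n ≠ m ^ 2 ∧ n ≠ m ^ 2 + 1)
    (ε : ℝ) (hε : 0 < ε) :
    ∃ c : ℝ, 0 < c ∧ ∀ X : ℝ, 2 ≤ X →
      (FnG n X G : ℝ) ≤
        c * X ^ (((n : ℝ) + 2) / 4 - 1 - 1 / (2 * (n : ℝ) - 2)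
          + sqrt ((n : ℝ) / (4 * ((n : ℝ) - 1) * (G.index : ℝ)))
          + (n : ℝ) / (4 * (n : ℝ) - 4) + ε) := by
  classical
  have hn' : (6 : ℝ) ≤ n := by exact_mod_cast hn
  have h2d := even_index (by omega) halt
  have hd0 : G.index ≠ 0 := Subgroup.index_ne_zero_of_finite
  set E := ((n : ℝ) + 2) / 4 - 1 - 1 / (2 * (n : ℝ) - 2)
        + sqrt ((n : ℝ) / (4 * ((n : ℝ) - 1) * (G.index : ℝ)))
        + (n : ℝ) / (4 * (n : ℝ) - 4) with hE
  obtain ⟨B, hB, hprim⟩ : ∃ B : ℝ, 0 ≤ B ∧ ∀ D : ℝ, 1 ≤ D → ∀ S : Finset (IntermediateField ℚ Qbar),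
      (∀ K ∈ S, finrank ℚ K = n ∧ |(fieldDiscr K : ℝ)| ≤ D ∧ HasGalGroup n K G ∧
        ∀ k, k < K → k = ⊥) → (S.card : ℝ) ≤ B * D ^ (E + ε) := by
    obtain hd | hd : G.index = 2 ∨ 4 ≤ G.index := by omega
    · obtain ⟨B, hB, h⟩ := card_primitive_fields_le_of_le_alternatingGroup n (by omega) G halt ε hε
      refine ⟨B, hB, fun D hD S hS => (h D hD S hS).trans (mul_le_mul_of_nonneg_left
        (rpow_le_rpow_of_exponent_le hD ?_) hB)⟩
      have := exponent_ge hn'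
      rw [hE, hd]
      push_cast
      linarith
    · have hd4 : (4 : ℝ) ≤ G.index := by exact_mod_cast hd
      rw [← exponent_eq hn' (by linarith)] at hE
      rw [hE]
      refine card_primitive_fields_le n (by omega) G halt hshape (Real.sqrt_le_iff.2 ⟨by positivity, ?_⟩) ε hε
      rw [div_le_iff₀ (by linarith)]
      nlinarith
  obtain ⟨C, hC, himp⟩ := card_imprimitive_fields_le n (by omega) ε hε
  have hE0 : ((n : ℝ) + 4) / 8 ≤ E := imprimitive_exponent_le hn htrans
  refine ⟨C * 2 ^ (E + ε) + B + 1, by positivity, fun X hX => natCard_le_of_finset_le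
    (by positivity) fun S hS => ?_⟩
  have h1 := hprim X (by linarith) {K ∈ S | ∀ k, k < K → k = ⊥} fun K hK =>
    ⟨(hS K (mem_filter.1 hK).1).1, (hS K (mem_filter.1 hK).1).2.1,
      (hS K (mem_filter.1 hK).1).2.2, (mem_filter.1 hK).2⟩
  have h2 := himp ⌈X⌉₊ (Nat.one_le_ceil_iff.2 (by linarith)) {K ∈ S | ¬ ∀ k, k < K → k = ⊥} fun K hK => by
    obtain ⟨hK1, hK2⟩ := mem_filter.1 hK
    push Not at hK2
    obtain ⟨k, hk, hk'⟩ := hK2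
    exact ⟨(hS K hK1).1, (hS K hK1).2.1.trans (le_ceil X), k, hk', hk⟩
  have h3 : ((⌈X⌉₊ : ℕ) : ℝ) ^ (((n : ℝ) + 4) / 8 + ε) ≤ 2 ^ (E + ε) * X ^ (E + ε) := by
    have h4 := (ceil_lt_add_one (show 0 ≤ X by linarith)).le
    rw [← mul_rpow zero_le_two (by linarith)]
    refine (rpow_le_rpow (cast_nonneg _) (show ((⌈X⌉₊ : ℕ) : ℝ) ≤ 2 * X by linarith)
      (by positivity)).trans (rpow_le_rpow_of_exponent_le (by linarith) (by linarith))
  have h4 := mul_le_mul_of_nonneg_left h3 hC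
  have h5 : (0 : ℝ) ≤ X ^ (E + ε) := by positivity
  rw [← Finset.card_filter_add_card_filter_not (s := S) (fun K => ∀ k, k < K → k = ⊥), Nat.cast_add]
  linarith
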